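/- Let F|K be an algebraic function field and P a place of F|K such that the value group v_PF is archimedean ordered (rank 1), and let ζ₁,…,ζ_m ∈ 𝓞_F. Then there exist a finite extension 𝓕 of F with an extension of P and a finite purely inseparable extension 𝓚 of K inside 𝓕 such that (𝓕|𝓚,P) is uniformizable with respect to ζ₁,…,ζ_m, and such that 𝓕 is obtained from the compositum F.𝓚 by at most two successive Galois extensions; that is, there is an intermediate field L with F.𝓚 ⊆ L ⊆ 𝓕, L|F.𝓚 Galois and 𝓕|L Galois. -/

import Mathlib

namespace LocalUnif

variable {F : Type*} [Field F]

def InMax (O : ValuationSubring F) (x : F) : Prop := x = 0 ∨ x⁻¹ ∉ O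

def IsVUnit (O : ValuationSubring F) (x : F) : Prop := x ≠ 0 ∧ x ∈ O ∧ x⁻¹ ∈ O

def TrivialOn (O : ValuationSubring F) (K : Subfield F) : Prop :=
  ∀ x ∈ K, x ∈ O ∧ x⁻¹ ∈ O

def ResidueEq (O : ValuationSubring F) (K : Subfield F) : Prop :=
  ∀ x ∈ O, ∃ c ∈ K, InMax O (x - c)

def ResidueAlgebraic (O : ValuationSubring F) (K : Subfield F) : Prop :=
  ∀ x ∈ O, ∃ p : Polynomial F, p ≠ 0 ∧ (∀ i, p.coeff i ∈ K) ∧ InMax O (Polynomial.eval x p)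

def ValIndepMod (O : ValuationSubring F) (K : Subfield F) {ρ : ℕ} (x : Fin ρ → F) : Prop :=
  (∀ i, x i ≠ 0) ∧
  ∀ e : Fin ρ → ℤ, (∃ c ∈ K, c ≠ 0 ∧ IsVUnit O ((∏ i, x i ^ e i) / c)) → e = 0

def ResIndep (O : ValuationSubring F) (K : Subfield F) {τ : ℕ} (y : Fin τ → F) : Prop :=
  (∀ i, y i ∈ O) ∧
  ∀ p : MvPolynomial (Fin τ) F, (∀ m, p.coeff m ∈ K ∧ p.coeff m ∈ O) →
    (∃ m, IsVUnit O (p.coeff m)) → ¬ InMax O (MvPolynomial.eval y p)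

def RatRankEq (O : ValuationSubring F) (K : Subfield F) (ρ : ℕ) : Prop :=
  (∃ x : Fin ρ → F, ValIndepMod O K x) ∧ ∀ x : Fin (ρ + 1) → F, ¬ ValIndepMod O K x

def ResTrdegEq (O : ValuationSubring F) (K : Subfield F) (τ : ℕ) : Prop :=
  (∃ y : Fin τ → F, ResIndep O K y) ∧ ∀ y : Fin (τ + 1) → F, ¬ ResIndep O K y

def TrdegEq (K : Subfield F) (d : ℕ) : Prop :=
  ∃ t : Fin d → F, IsTranscendenceBasis ↥K t

def IsAbhyankar (O : ValuationSubring F) (K : Subfield F) : Prop :=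
  ∃ d ρ τ : ℕ, d = ρ + τ ∧ TrdegEq K d ∧ RatRankEq O K ρ ∧ ResTrdegEq O K τ

def RankOne (O : ValuationSubring F) : Prop :=
  ∀ a b : F, a ≠ 0 → InMax O a → b ≠ 0 → InMax O b → ∃ n : ℕ, a ^ n / b ∈ O

def RankAtLeast (O : ValuationSubring F) (r : ℕ) : Prop :=
  ∃ a : Fin r → F, (∀ i, a i ≠ 0 ∧ InMax O (a i)) ∧
    ∀ i j : Fin r, i < j → ∀ n : ℕ, a i ^ n / a j ∉ O

def RankEq (O : ValuationSubring F) (r : ℕ) : Prop :=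
  RankAtLeast O r ∧ ¬ RankAtLeast O (r + 1)

def IsDiscrete (O : ValuationSubring F) : Prop :=
  ∃ π : F, π ≠ 0 ∧ InMax O π ∧ ∀ x : F, x ≠ 0 → ∃ n : ℤ, IsVUnit O (x / π ^ n)

def IsFunctionField (K : Subfield F) : Prop :=
  (∃ S : Finset F, IntermediateField.adjoin ↥K (S : Set F) = ⊤) ∧
  ∃ x : F, Transcendental ↥K x

def UnifData (𝓛 𝓚 : Subfield F) (O : ValuationSubring F) {s n : ℕ}
    (t : Fin s → F) (η : Fin n → F) : Prop :=
  (∀ i, t i ∈ 𝓛 ∧ t i ∈ O) ∧ (∀ i, η i ∈ 𝓛 ∧ η i ∈ O) ∧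
  AlgebraicIndependent ↥𝓚 t ∧
  (∀ z ∈ 𝓛, IsAlgebraic ↥(IntermediateField.adjoin ↥𝓚 (Set.range t)) z) ∧
  Subfield.closure ((𝓚 : Set F) ∪ Set.range t ∪ Set.range η) = 𝓛 ∧
  ∃ f : Fin n → MvPolynomial (Fin n) F,
    (∀ i m, (f i).coeff m ∈
      Subring.closure ((↑(𝓚.toSubring ⊓ O.toSubring) : Set F) ∪ Set.range t)) ∧
    (∀ i j : Fin n, (i : ℕ) < (j : ℕ) → MvPolynomial.degreeOf j (f i) = 0) ∧
    (∀ i, MvPolynomial.eval η (f i) = 0) ∧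
    IsVUnit O (Matrix.det (Matrix.of fun i j : Fin n =>
      MvPolynomial.eval η (MvPolynomial.pderiv j (f i))))

def UnifWrt (𝓛 𝓚 : Subfield F) (O : ValuationSubring F) {m : ℕ} (ζ : Fin m → F) : Prop :=
  ∃ (s n : ℕ) (t : Fin s → F) (η : Fin n → F),
    UnifData 𝓛 𝓚 O t η ∧ ∃ σ : Fin m → Fin n, ∀ k, η (σ k) = ζ k

def UnifIn (𝓛 𝓚 : Subfield F) (O : ValuationSubring F) : Prop :=
  ∀ (m : ℕ) (ζ : Fin m → F), (∀ k, ζ k ∈ 𝓛 ∧ ζ k ∈ O) → UnifWrt 𝓛 𝓚 O ζ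

section Defectless

variable {K L : Type*} [Field K] [Field L]

def ValClassIndep (φ : K →+* L) (OL : ValuationSubring L) {e : ℕ} (a : Fin e → L) : Prop :=
  (∀ i, a i ≠ 0) ∧ ∀ i j : Fin e, i ≠ j →
    ¬ ∃ c : K, c ≠ 0 ∧ IsVUnit OL (a i / (a j * φ c))

def RamIdxEq (φ : K →+* L) (OL : ValuationSubring L) (e : ℕ) : Prop :=
  (∃ a : Fin e → L, ValClassIndep φ OL a) ∧ ∀ a : Fin (e + 1) → L, ¬ ValClassIndep φ OL a

def ResLinIndep (φ : K →+* L) (OK : ValuationSubring K) (OL : ValuationSubring L)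
    {f : ℕ} (b : Fin f → L) : Prop :=
  (∀ i, b i ∈ OL) ∧ ∀ c : Fin f → K, (∀ i, c i ∈ OK) → (∃ i, ¬ InMax OK (c i)) →
    ¬ InMax OL (∑ i, φ (c i) * b i)

def InertiaDegEq (φ : K →+* L) (OK : ValuationSubring K) (OL : ValuationSubring L)
    (f : ℕ) : Prop :=
  (∃ b : Fin f → L, ResLinIndep φ OK OL b) ∧ ∀ b : Fin (f + 1) → L, ¬ ResLinIndep φ OK OL b

end Defectless

def IsDefectless (K : Type*) [Field K] (OK : ValuationSubring K) : Prop :=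
  ∀ L : IntermediateField K (AlgebraicClosure K), FiniteDimensional K ↥L →
    ∃ (g : ℕ) (Os : Fin g → ValuationSubring ↥L) (e f : Fin g → ℕ),
      Function.Injective Os ∧
      (∀ O' : ValuationSubring ↥L, O'.comap (algebraMap K ↥L) = OK ↔ ∃ i, O' = Os i) ∧
      (∀ i, RamIdxEq (algebraMap K ↥L) (Os i) (e i)) ∧
      (∀ i, InertiaDegEq (algebraMap K ↥L) OK (Os i) (f i)) ∧
      Module.finrank K ↥L = ∑ i, e i * f i

def IsSeparableExt (𝓚 𝓛 : Subfield F) : Prop :=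
  ∀ S : Finset F, ↑S ⊆ (𝓛 : Set F) →
    ∃ (d : ℕ) (u : Fin d → F), (∀ i, u i ∈ 𝓛) ∧ AlgebraicIndependent ↥𝓚 u ∧
      ∀ x ∈ Subfield.closure ((𝓚 : Set F) ∪ ↑S),
        IsSeparable ↥(IntermediateField.adjoin ↥𝓚 (Set.range u)) x

noncomputable def resEmb (O : ValuationSubring F) (K : Subfield F) (h : ∀ x ∈ K, x ∈ O) :
    ↥K →+* IsLocalRing.ResidueField ↥O :=
  (IsLocalRing.residue ↥O).comp
    { toFun := fun x => (⟨x.1, h x.1 x.2⟩ : ↥O)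
      map_one' := rfl
      map_mul' := fun _ _ => rfl
      map_zero' := rfl
      map_add' := fun _ _ => rfl }

end LocalUnif

namespace LU
open Polynomial
open Set (range union_subset subset_union_left range_subset_iff image_union subset_union_right union_subset_union_left InjOn iUnion₂_subset subset_biUnion_of_mem mem_range_self union_subset_union_right Iio Subset)
open IntermediateField (adjoin mem_bot adjoin_le_iff fixedField mem_adjoin_simple_self)
open Finset (mem_image mem_filter univ mem_range mem_union mem_union_left mem_union_right mem_univ sum_congr add_sum_erase coe_image card_image_le sum_sub_distrib induction_on prod_congr mem_insert_of_mem exists_max_image prod_ne_zero_iff mem_image_of_mem sum_range_succ' mem_insert ne_of_mem_erase mem_of_mem_erase card_union_le mem_coe sum_add_distrib mem_insert_self coe_insert nonempty_iff_ne_empty coe_biUnion prod_mul_distrib mem_biUnion coe_union sum_insert mul_sum)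
open Function (update)
open Subfield (closure_le inclusion le_topologicalClosure add_mem mul_mem isClosed_topologicalClosure)
open Module (finrank)
open UniformSpace (Completion)
open Submodule (span span_le subset_span)
open Nat (lt_succ_self lt_pow_self)
open Sum (elim inr inl)
open IsUltrametricDist (norm_natCast_le_one)
open RingHom (map_field_closure)
open AbsoluteValue (trivial_apply)
open ZMod (castHom)

abbrev Tr {C : Type*} [NormedField C] (k : Subfield C) : Prop := ∀ c ∈ k, c ≠ 0 → ‖c‖ = 1


section um
variable {C : Type*} [NormedField C] [IsUltrametricDist C]

theorem um_le {a b : C} {r : ℝ} (ha : ‖a‖ ≤ r) (hb : ‖b‖ ≤ r) : ‖a + b‖ ≤ r :=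
  (IsUltrametricDist.norm_add_le_max a b).trans (max_le ha hb)
theorem um_lt {a b : C} {r : ℝ} (ha : ‖a‖ < r) (hb : ‖b‖ < r) : ‖a + b‖ < r :=
  (IsUltrametricDist.norm_add_le_max a b).trans_lt (max_lt ha hb)
theorem um_sub_le {a b : C} {r : ℝ} (ha : ‖a‖ ≤ r) (hb : ‖b‖ ≤ r) : ‖a - b‖ ≤ r := by
  rw [sub_eq_add_neg]; exact um_le ha (by rwa [norm_neg])
theorem um_eq {a b : C} (h : ‖b‖ < ‖a‖) : ‖a + b‖ = ‖a‖ := by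
  rw [IsUltrametricDist.norm_add_eq_max_of_norm_ne_norm h.ne', max_eq_left h.le]
theorem um_eq_of_sub {a b : C} (h : ‖a - b‖ < ‖a‖) : ‖b‖ = ‖a‖ := by
  have := um_eq (a := a) (b := -(a - b)) (by rwa [norm_neg])
  rw [← this]; congr 1; ring
theorem um_eq_of_sub' {a b : C} (h : ‖a - b‖ < ‖b‖) : ‖a‖ = ‖b‖ :=
  um_eq_of_sub (by rwa [norm_sub_rev])
theorem um_sum_le {ι : Type*} {s : Finset ι} {f : ι → C} {r : ℝ} (h0 : 0 ≤ r)
    (h : ∀ i ∈ s, ‖f i‖ ≤ r) : ‖∑ i ∈ s, f i‖ ≤ r :=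
  IsUltrametricDist.norm_sum_le_of_forall_le_of_nonneg h0 h
theorem um_sum_lt {ι : Type*} {s : Finset ι} {f : ι → C} {r : ℝ} (h0 : 0 < r)
    (h : ∀ i ∈ s, ‖f i‖ < r) : ‖∑ i ∈ s, f i‖ < r := by
  classical
  induction s using induction_on with
  | empty => simpa
  | insert a s ha ih =>
    rw [sum_insert ha]
    exact um_lt (h _ (by simp)) (ih fun i hi => h i (by simp [hi]))

end um

section PG
variable {M : Type*} [NontriviallyNormedField M] [CompleteSpace M] [IsUltrametricDist M]

theorem exists_res_aux {A : Type*} [NormedField A] [IsUltrametricDist A] [NormedAlgebra M A]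
    (k1 : Subfield M) (hk : IsAlgClosed k1)
    (hres : ∀ a : M, ‖a‖ ≤ 1 → ∃ c ∈ k1, ‖a - c‖ < 1) (g : M[X]) (hg : g.Monic)
    (hg1 : ∀ i, ‖g.coeff i‖ ≤ 1) (hd : g.natDegree ≠ 0) (w : A) (hw : aeval w g = 0) (hw1 : ‖w‖ ≤ 1) :
    ∃ c ∈ k1, ‖w - algebraMap M A c‖ < 1 := by
  choose c hc hcl using fun i => hres (g.coeff i) (hg1 i)
  let q : k1[X] := X ^ g.natDegree + ∑ i ∈ Finset.range g.natDegree, C (⟨c i, hc i⟩ : k1) * X ^ i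
  have hqm : q.Monic := by
    apply monic_X_pow_add
    refine (degree_sum_le _ _).trans_lt ?_
    rw [Finset.sup_lt_iff (WithBot.bot_lt_coe _)]
    intro i hi
    exact (degree_C_mul_X_pow_le _ _).trans_lt (by exact_mod_cast mem_range.1 hi)
  have hqs : q.Splits := IsAlgClosed.splits q
  have h1 : aeval w q = (q.roots.map fun r : k1 => w - algebraMap M A r).prod := by
    conv_lhs => rw [hqs.eq_prod_roots_of_monic hqm]
    rw [map_multiset_prod, Multiset.map_map]
    congr 1
    apply Multiset.map_congr rfl
    intro r _
    simp [IsScalarTower.algebraMap_apply k1 M A]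
    rfl
  have h2 : ‖aeval w q‖ < 1 := by
    have : aeval w q = ∑ i ∈ Finset.range g.natDegree, algebraMap M A (c i - g.coeff i) * w ^ i := by
      rw [← sub_zero (aeval w q), ← hw]
      conv_lhs => rw [hg.as_sum]
      simp only [q, map_add, map_pow, aeval_X, map_sum, map_mul, aeval_C, add_sub_add_left_eq_sub,
        ← sum_sub_distrib]
      apply sum_congr rfl
      intro i _
      rw [IsScalarTower.algebraMap_apply k1 M A, map_sub, sub_mul]
      rfl
    rw [this]
    apply um_sum_lt one_pos
    intro i _
    rw [norm_mul, norm_pow, norm_algebraMap', norm_sub_rev]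
    exact (mul_le_of_le_one_right (norm_nonneg _) (pow_le_one₀ (norm_nonneg _) hw1)).trans_lt (hcl i)
  by_contra! hcon
  rw [h1] at h2
  have : ∀ s : Multiset k1, 1 ≤ ‖(s.map fun r : k1 => w - algebraMap M A r).prod‖ := by
    intro s
    induction s using Multiset.induction_on with
    | empty => simp
    | cons a s ih =>
      rw [Multiset.map_cons, Multiset.prod_cons, norm_mul]
      exact one_le_mul_of_one_le_of_one_le (hcon a a.2) ih
  exact absurd h2 (not_lt.2 (this _))

theorem prime_to_p (k1 : Subfield M) (hk : IsAlgClosed k1) (htriv : Tr k1)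
    (hres : ∀ a : M, ‖a‖ ≤ 1 → ∃ c ∈ k1, ‖a - c‖ < 1)
    (hdiv : ∀ n : ℕ, (n : M) ≠ 0 → ∀ a : M, a ≠ 0 → ∃ b : M, ‖b‖ ^ n = ‖a‖)
    {E : Type*} [Field E] [Algebra M E] [FiniteDimensional M E] [Algebra.IsSeparable M E]
    (hn : (finrank M E : M) ≠ 0) (u : E) : u ∈ (algebraMap M E).range := by
  set n := finrank M E with hndef
  have hn0 : n ≠ 0 := by rintro h; rw [h] at hn; simp at hn
  by_contra hu
  set v := u - algebraMap M E (Algebra.trace M E u / n) with hv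
  have hv0 : v ≠ 0 := by
    intro h; exact hu ⟨_, (sub_eq_zero.1 h).symm⟩
  have htr : Algebra.trace M E v = 0 := by
    rw [hv, map_sub, Algebra.trace_algebraMap, nsmul_eq_mul, ← hndef]; field_simp; ring
  obtain ⟨a, ha⟩ := hdiv n hn (Algebra.norm M v) (by simpa [Algebra.norm_eq_zero_iff] using hv0)
  have ha0 : a ≠ 0 := by
    rintro rfl
    rw [norm_zero, zero_pow hn0, eq_comm, norm_eq_zero, Algebra.norm_eq_zero_iff] at ha
    exact hv0 ha
  let A := AlgebraicClosure M
  letI : NormedField A := spectralNorm.normedField M A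
  letI : NormedAlgebra M A := spectralNorm.normedAlgebra M A
  haveI : IsUltrametricDist A := IsUltrametricDist.of_normedAlgebra M
  have hiso : ∀ (w : E) (σ τ : E →ₐ[M] A), ‖σ w‖ = ‖τ w‖ := by
    intro w σ τ
    change spectralNorm M A _ = spectralNorm M A _
    unfold spectralNorm
    rw [minpoly.algHom_eq σ σ.injective, minpoly.algHom_eq τ τ.injective]
  set w := v * algebraMap M E a⁻¹ with hw
  have htr' : Algebra.trace M E w = 0 := by
    rw [hw, mul_comm, ← Algebra.smul_def, map_smul, htr, smul_zero]
  obtain ⟨ι⟩ : Nonempty (E →ₐ[M] A) := ⟨IsAlgClosed.lift⟩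
  have hnorm : ‖ι w‖ = 1 := by
    have h1 := congrArg norm (Algebra.norm_eq_prod_embeddings M A w)
    rw [norm_algebraMap', norm_prod, prod_congr rfl (fun σ _ => hiso w σ ι)] at h1
    rw [Finset.prod_const, Finset.card_univ, AlgHom.card, ← hndef, hw, map_mul,
      Algebra.norm_algebraMap, norm_mul, norm_pow, ← ha, ← hndef, ← mul_pow, ← norm_mul,
      mul_inv_cancel₀ ha0, norm_one, one_pow, eq_comm] at h1
    exact (pow_eq_one_iff_of_nonneg (norm_nonneg _) hn0).1 h1
  have hint : IsIntegral M (ι w) := Algebra.IsIntegral.isIntegral _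
  obtain ⟨c, hc, hcw⟩ := exists_res_aux k1 hk hres (minpoly M (ι w)) (minpoly.monic hint)
    ((spectralValue_le_one_iff (minpoly.monic hint)).1 hnorm.le)
    (minpoly.natDegree_pos hint).ne' (ι w) (minpoly.aeval _ _) hnorm.le
  have hcw' : ∀ σ : E →ₐ[M] A, ‖σ w - algebraMap M A c‖ < 1 := by
    intro σ
    have := hiso (w - algebraMap M E c) σ ι
    rw [map_sub, map_sub, AlgHom.commutes, AlgHom.commutes] at this
    rwa [this]
  have hsum : ‖∑ σ : E →ₐ[M] A, (σ w - algebraMap M A c)‖ < 1 := um_sum_lt one_pos fun σ _ => hcw' σ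
  rw [sum_sub_distrib, ← trace_eq_sum_embeddings A, htr', map_zero, Finset.sum_const,
    Finset.card_univ, AlgHom.card, zero_sub, norm_neg, nsmul_eq_mul, ← hndef,
    ← map_natCast (algebraMap M A), ← map_mul, norm_algebraMap'] at hsum
  have hc0 : c = 0 := by
    by_contra hc0
    exact absurd (htriv _ (k1.mul_mem (natCast_mem k1 n) hc) (mul_ne_zero hn hc0)) hsum.ne
  rw [hc0, map_zero, sub_zero, hnorm] at hcw
  exact lt_irrefl _ hcw

theorem artin_schreier {M E : Type*} [Field M] [Field E] [Algebra M E] [FiniteDimensional M E]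
    [IsGalois M E] (p : ℕ) [Fact p.Prime] [CharP M p]
    (φ : Gal(E/M) →* Multiplicative (ZMod p)) :
    ∃ z : E, ∀ τ : Gal(E/M), τ z = z + algebraMap M E ((castHom dvd_rfl M) (φ τ).toAdd) := by
  obtain ⟨w, hw⟩ := Algebra.trace_surjective M E 1
  let ψ : Gal(E/M) → M := fun τ => (castHom dvd_rfl M) (φ τ).toAdd
  have hψ : ∀ σ τ, ψ (σ * τ) = ψ σ + ψ τ := fun σ τ => by simp [ψ]
  refine ⟨- ∑ σ : Gal(E/M), algebraMap M E (ψ σ) * σ w, fun τ => ?_⟩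
  change _ = _ + algebraMap M E (ψ τ)
  have h1 : ∑ σ : Gal(E/M), σ w = 1 := by
    rw [← trace_eq_sum_automorphisms, hw, map_one]
  have h2 : ∑ σ : Gal(E/M), algebraMap M E (ψ σ) * σ w
      = ∑ σ : Gal(E/M), algebraMap M E (ψ (τ * σ)) * (τ * σ) w :=
    (Fintype.sum_equiv (Equiv.mulLeft τ) _ _ fun σ => rfl).symm
  have h3 : ∑ σ : Gal(E/M), (τ * σ) w = 1 := by
    rw [← h1]; exact Fintype.sum_equiv (Equiv.mulLeft τ) _ _ fun σ => rfl
  conv_rhs => rw [h2]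
  simp only [map_neg, map_sum, map_mul, AlgEquiv.commutes, hψ, map_add, add_mul,
    sum_add_distrib, ← mul_sum, h3, AlgEquiv.mul_apply]
  have h4 : ∑ σ : Gal(E/M), τ (σ w) = 1 := h3
  rw [h4]; ring

theorem PG (k1 : Subfield M) (hk : IsAlgClosed k1) (htriv : Tr k1)
    (hres : ∀ a : M, ‖a‖ ≤ 1 → ∃ c ∈ k1, ‖a - c‖ < 1)
    (hdiv : ∀ n : ℕ, (n : M) ≠ 0 → ∀ a : M, a ≠ 0 → ∃ b : M, ‖b‖ ^ n = ‖a‖)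
    (p : ℕ) [ExpChar M p]
    {E : Type*} [Field E] [Algebra M E] [FiniteDimensional M E] [Algebra.IsSeparable M E]
    (hne : ∃ u : E, u ∉ (algebraMap M E).range) :
    p.Prime ∧ ∃ z : E, z ∉ (algebraMap M E).range ∧ z ^ p - z ∈ (algebraMap M E).range := by
  obtain ⟨u, hu⟩ := hne
  have hpp : p.Prime := by
    rcases ‹ExpChar M p› with _ | ⟨hp⟩
    · exact absurd (prime_to_p k1 hk htriv hres hdiv (by exact_mod_cast Module.finrank_pos.ne') u) hu
    · exact hp
  refine ⟨hpp, ?_⟩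
  haveI : Fact p.Prime := ⟨hpp⟩
  haveI : CharP M p := by
    rcases ‹ExpChar M p› with _ | ⟨hp⟩
    · exact absurd hpp Nat.not_prime_one
    · assumption
  let N := IntermediateField.normalClosure M E (AlgebraicClosure E)
  haveI : Algebra.IsSeparable M N := by
    haveI : ∀ f : E →ₐ[M] AlgebraicClosure E, Algebra.IsSeparable M f.fieldRange := fun f =>
      Algebra.IsSeparable.of_algHom M E (AlgEquiv.ofInjectiveField f).symm.toAlgHom
    exact IntermediateField.isSeparable_iSup M (AlgebraicClosure E)
  haveI : IsGalois M N := ⟨⟩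
  let G := Gal(N/M)
  have hGp : IsPGroup p G := by
    obtain ⟨P⟩ : Nonempty (Sylow p G) := inferInstance
    let E' := fixedField (P : Subgroup G)
    have hE' : (finrank M E' : M) ≠ 0 := by
      rw [IntermediateField.finrank_eq_fixingSubgroup_index,
        IntermediateField.fixingSubgroup_fixedField, Ne, CharP.cast_eq_zero_iff M p]
      exact P.not_dvd_index
    have h1 : E' = ⊥ := by
      rw [eq_bot_iff]
      intro x hx
      obtain ⟨y, hy⟩ := prime_to_p k1 hk htriv hres hdiv hE' (⟨x, hx⟩ : E')
      exact ⟨y, congrArg Subtype.val hy⟩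
    have h2 : (P : Subgroup G) = ⊤ := by
      rw [← IntermediateField.fixingSubgroup_fixedField (P : Subgroup G)]
      change E'.fixingSubgroup = ⊤
      rw [h1, IntermediateField.fixingSubgroup_bot]
    have := P.isPGroup'
    rw [h2] at this
    exact this.of_equiv Subgroup.topEquiv
  let ι : E →ₐ[M] N := IsScalarTower.toAlgHom M E N
  let H : Subgroup G := ι.fieldRange.fixingSubgroup
  have hHT : H ≠ ⊤ := by
    intro h
    have : ι u ∈ fixedField H := by
      rw [IsGalois.fixedField_fixingSubgroup]; exact ⟨u, rfl⟩
    rw [h, IsGalois.fixedField_top, mem_bot] at this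
    obtain ⟨y, hy⟩ := this
    exact hu ⟨y, ι.injective ((ι.commutes y).trans hy)⟩
  obtain ⟨n, hn⟩ := hGp.exists_card_eq
  obtain ⟨m, hm⟩ := (hGp.to_subgroup H).exists_card_eq
  have hmn : m < n := by
    by_contra! h
    apply hHT
    apply Subgroup.eq_top_of_card_eq
    apply le_antisymm (Subgroup.card_le_card_group H)
    rw [hn, hm]; exact Nat.pow_le_pow_right hpp.pos h
  obtain ⟨n, rfl⟩ : ∃ l, n = l + 1 := ⟨n - 1, by omega⟩
  obtain ⟨H1, hH1, hle⟩ := Sylow.exists_subgroup_card_pow_prime_le p (n := m) (m := n)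
    (by rw [hn]; exact pow_dvd_pow _ (by omega)) H hm (by omega)
  have hidx : H1.index = p := by
    have := H1.card_mul_index
    rw [hH1, hn, pow_succ] at this
    exact Nat.eq_of_mul_eq_mul_left (pow_pos hpp.pos _) this
  haveI : H1.Normal := Subgroup.normal_of_index_eq_minFac_card (by
    rw [hidx, hn, Nat.pow_minFac (by omega), hpp.minFac_eq])
  have hcard : Nat.card (G ⧸ H1) = p := hidx
  have hcyc : IsCyclic (G ⧸ H1) := isCyclic_of_prime_card hcard
  obtain ⟨e⟩ : Nonempty (Multiplicative (ZMod p) ≃* (G ⧸ H1)) := by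
    have := zmodCyclicMulEquiv hcyc
    rw [hcard] at this
    exact ⟨this⟩
  let φ : G →* Multiplicative (ZMod p) := e.symm.toMonoidHom.comp (QuotientGroup.mk' H1)
  obtain ⟨z, hz⟩ := artin_schreier (M := M) (E := N) p φ
  have hφ : ∀ τ ∈ H, φ τ = 1 := by
    intro τ hτ
    change e.symm ((τ : G) : G ⧸ H1) = 1
    rw [(QuotientGroup.eq_one_iff τ).2 (hle hτ), map_one]
  obtain ⟨τ, hτ⟩ : ∃ τ, φ τ ≠ 1 := by
    by_contra! h
    have : H1 = ⊤ := by
      rw [eq_top_iff]; intro τ _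
      have h1 : e.symm ((τ : G) : G ⧸ H1) = 1 := h τ
      rw [map_eq_one_iff e.symm e.symm.injective] at h1
      exact (QuotientGroup.eq_one_iff τ).1 h1
    rw [this, Subgroup.index_top] at hidx
    exact hpp.one_lt.ne hidx
  haveI : CharP N p := charP_of_injective_algebraMap (algebraMap M N).injective p
  haveI : CharP E p := charP_of_injective_algebraMap (algebraMap M E).injective p
  have hzE : z ∈ ι.fieldRange := by
    rw [← IsGalois.fixedField_fixingSubgroup ι.fieldRange]
    intro τ
    have := hz τ.1
    rw [hφ τ.1 τ.2] at this
    change τ.1 z = z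
    simpa using this
  obtain ⟨z', rfl⟩ := hzE
  refine ⟨z', ?_, ?_⟩
  · rintro ⟨y, rfl⟩
    have := hz τ
    have h0 : (ι : E →+* N) (algebraMap M E y) = algebraMap M N y := ι.commutes y
    have h0' : ι.toRingHom (algebraMap M E y) = algebraMap M N y := ι.commutes y
    rw [h0', AlgEquiv.commutes, left_eq_add, map_eq_zero, map_eq_zero] at this
    exact hτ this
  · have : ι (z' ^ p - z') ∈ fixedField (⊤ : Subgroup G) := by
      intro τ
      have h1 : τ.1 (ι z') = _ := hz τ.1
      change τ.1 (ι (z' ^ p - z')) = ι (z' ^ p - z')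
      rw [map_sub, map_pow, map_sub, map_pow, h1]
      change (ι z' + _) ^ p - (ι z' + _) = _
      rw [add_pow_char, ← map_pow (algebraMap M N), ← map_pow (castHom dvd_rfl M), ZMod.pow_card]
      ring
    rw [IsGalois.fixedField_top, mem_bot] at this
    obtain ⟨y, hy⟩ := this
    exact ⟨y, ι.injective ((ι.commutes y).trans hy)⟩

end PG


section PG'
variable {C : Type*} [NontriviallyNormedField C] [CompleteSpace C] [IsUltrametricDist C]


theorem PG' (M : Subfield C) (hM : IsClosed (M : Set C)) (hnt : ∃ a ∈ M, 1 < ‖a‖)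
    (k1 : Subfield C) (hk : IsAlgClosed k1) (hkM : k1 ≤ M) (htriv : Tr k1)
    (hres : ∀ a : C, ‖a‖ ≤ 1 → ∃ c ∈ k1, ‖a - c‖ < 1)
    (hdiv : ∀ n : ℕ, (n : C) ≠ 0 → ∀ a ∈ M, a ≠ 0 → ∃ b ∈ M, ‖b‖ ^ n = ‖a‖)
    (p : ℕ) [ExpChar C p] (α : C) (hα : IsSeparable M α) (hαM : α ∉ M) :
    p.Prime ∧ ∃ z ∈ adjoin M {α}, z ∉ M ∧ z ^ p - z ∈ M := by
  letI : NontriviallyNormedField M := { (inferInstance : NormedField M) with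
    non_trivial := by obtain ⟨a, ha, h⟩ := hnt; exact ⟨⟨a, ha⟩, h⟩ }
  haveI : CompleteSpace M := hM.completeSpace_coe
  haveI : IsUltrametricDist M := ⟨fun x y z => IsUltrametricDist.dist_triangle_max (x : C) y z⟩
  haveI : ExpChar M p := (algebraMap M C).expChar (algebraMap M C).injective p
  haveI : Algebra.IsSeparable M (adjoin M {α}) :=
    (IntermediateField.isSeparable_adjoin_simple_iff_isSeparable M C).2 hα
  haveI : FiniteDimensional M (adjoin M {α}) :=
    adjoin.finiteDimensional hα.isIntegral
  have hk' : IsAlgClosed (k1.comap M.subtype) := by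
    have e : k1 ≃+* k1.comap M.subtype :=
      { toFun := fun x => ⟨⟨x, hkM x.2⟩, x.2⟩
        invFun := fun x => ⟨x.1.1, x.2⟩
        left_inv := fun _ => rfl
        right_inv := fun _ => rfl
        map_mul' := fun _ _ => rfl
        map_add' := fun _ _ => rfl }
    exact IsAlgClosed.of_ringEquiv _ _ e
  obtain ⟨hp, z, hz, hz'⟩ := PG (M := M) (k1.comap M.subtype) hk'
    (fun c hc h0 => htriv c hc (by simpa using h0))
    (fun a ha => by
      obtain ⟨c, hc, h⟩ := hres a ha
      exact ⟨⟨c, hkM hc⟩, hc, h⟩)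
    (fun n hn a ha => by
      obtain ⟨b, hb, h⟩ := hdiv n (by exact_mod_cast fun h => hn (Subtype.ext (by simpa using h))) a a.2 (by simpa using ha)
      exact ⟨⟨b, hb⟩, h⟩) p (E := adjoin M {α})
    ⟨⟨α, mem_adjoin_simple_self M α⟩, by
      rintro ⟨y, hy⟩
      apply hαM
      have : (y : C) = α := congrArg Subtype.val hy
      rw [← this]; exact y.2⟩
  refine ⟨hp, z, z.2, fun h => hz ⟨⟨z, h⟩, rfl⟩, ?_⟩
  obtain ⟨y, hy⟩ := hz'
  have : (y : C) = (z : C) ^ p - z := congrArg Subtype.val hy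
  rw [← this]; exact y.2

theorem contr (S : Set C) (g : C → C) (y : C) (r θ ε : ℝ) (h0 : (0 : C) ∈ S) (hy : ‖y‖ ≤ r)
    (hθ0 : 0 ≤ θ) (hθ : θ < 1) (hε : 0 < ε) (hεr : ε ≤ r) (hS : ∀ Y ∈ S, g Y ∈ S)
    (hg : ∀ Y, ‖Y‖ ≤ r → ‖g Y - y‖ ≤ max (θ * ‖Y - y‖) ε) : ∃ Y ∈ S, ‖Y - y‖ ≤ ε := by
  have key : ∀ n : ℕ, ∃ Y ∈ S, ‖Y‖ ≤ r ∧ ‖Y - y‖ ≤ max (θ ^ n * r) ε := by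
    intro n
    induction n with
    | zero => exact ⟨0, h0, by simpa using (norm_nonneg y).trans hy, by simp [hy]⟩
    | succ n ih =>
      obtain ⟨Y, hYS, hYr, hY⟩ := ih
      have hr : 0 ≤ r := (norm_nonneg y).trans hy
      have h1 : ‖g Y - y‖ ≤ max (θ ^ (n + 1) * r) ε := by
        refine (hg Y hYr).trans (max_le ?_ (le_max_right _ _))
        rcases le_max_iff.1 hY with h | h
        · exact le_max_of_le_left (by rw [pow_succ' θ, mul_assoc]; gcongr)
        · exact le_max_of_le_right ((mul_le_of_le_one_left (norm_nonneg _) hθ.le).trans h)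
      refine ⟨g Y, hS Y hYS, ?_, h1⟩
      have : g Y = (g Y - y) + y := by ring
      rw [this]
      refine um_le (h1.trans (max_le ?_ hεr)) hy
      exact mul_le_of_le_one_left hr (pow_le_one₀ hθ0 hθ.le)
  obtain ⟨n, hn⟩ : ∃ n : ℕ, θ ^ n * r < ε := by
    have : Filter.Tendsto (fun n : ℕ => θ ^ n * r) Filter.atTop (nhds (0 * r)) :=
      (tendsto_pow_atTop_nhds_zero_of_lt_one hθ0 hθ).mul_const r
    rw [zero_mul] at this
    exact (this.eventually (gt_mem_nhds hε)).exists
  obtain ⟨Y, hYS, _, hY⟩ := key n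
  exact ⟨Y, hYS, hY.trans (max_le hn.le le_rfl)⟩

theorem as_small (M : Subfield C) (hM : IsClosed (M : Set C)) (p : ℕ) (hp : p.Prime) [CharP C p]
    (e : C) (he : e ∈ M) (he1 : ‖e‖ < 1) : ∃ w ∈ M, w ^ p - w = e := by
  haveI : Fact p.Prime := ⟨hp⟩
  have hs : Summable fun n : ℕ => e ^ p ^ n := by
    refine Summable.of_norm_bounded (summable_geometric_of_lt_one (norm_nonneg e) he1) fun n => ?_
    rw [norm_pow]
    exact pow_le_pow_of_le_one (norm_nonneg _) he1.le (lt_pow_self hp.one_lt).le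
  refine ⟨-∑' n : ℕ, e ^ p ^ n, ?_, ?_⟩
  · refine M.neg_mem ?_
    exact hM.mem_of_tendsto hs.hasSum.tendsto_sum_nat
      (Filter.Eventually.of_forall fun n => M.sum_mem fun i _ => M.pow_mem he _)
  · have h1 : (∑' n : ℕ, e ^ p ^ n) = e + ∑' n : ℕ, e ^ p ^ (n + 1) := by
      rw [hs.tsum_eq_zero_add]; simp
    have h2 : (∑' n : ℕ, e ^ p ^ n) ^ p = ∑' n : ℕ, e ^ p ^ (n + 1) := by
      have := hs.map_tsum (frobenius C p) (continuous_pow p)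
      rw [← frobenius_def, this]
      simp only [frobenius_def]
      congr 1; ext n; rw [← pow_mul, pow_succ]
    rcases hp.eq_two_or_odd' with rfl | hodd
    · rw [neg_pow_two, h2]
      conv_lhs => rw [h1]
      have := CharTwo.two_eq_zero (R := C)
      linear_combination (∑' n : ℕ, e ^ 2 ^ (n + 1)) * this
    · rw [hodd.neg_pow, h2, h1]; ring

theorem as_unique (M : Subfield C) (p : ℕ) (hp : p.Prime) [CharP C p] (z w : C) (hw : w ∈ M)
    (h : z ^ p - z = w ^ p - w) : z ∈ M := by
  haveI : Fact p.Prime := ⟨hp⟩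
  have h1 : (z - w) ^ p = z - w := by rw [sub_pow_char]; linear_combination h
  have : z - w ∈ (⊥ : Subfield C) := by
    rwa [Subfield.mem_bot_iff_pow_eq_self C p]
  have h2 := M.add_mem ((bot_le : ⊥ ≤ M) this) hw
  simpa using h2

end PG'


section Imm
variable {C : Type*} [NormedField C] [IsUltrametricDist C]

structure ImmBase (k1 L : Subfield C) : Prop where
  k1ac : IsAlgClosed k1
  le : k1 ≤ L
  ac : IsAlgClosed L
  triv : Tr k1
  res : ∀ a : C, ‖a‖ ≤ 1 → ∃ c ∈ k1, ‖a - c‖ < 1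
  val : ∀ a : C, ∃ l ∈ L, ‖l‖ = ‖a‖

def near (L : Subfield C) (x : C) : Filter L where
  sets := {s | ∃ c0 : L, ∀ c : L, ‖x - c‖ ≤ ‖x - c0‖ → c ∈ s}
  univ_sets := ⟨0, fun _ _ => trivial⟩
  sets_of_superset := by
    rintro s t ⟨c0, h⟩ hst; exact ⟨c0, fun c hc => hst (h c hc)⟩
  inter_sets := by
    rintro s t ⟨c0, h0⟩ ⟨c1, h1⟩
    rcases le_total ‖x - c0‖ ‖x - c1‖ with h | h
    · exact ⟨c0, fun c hc => ⟨h0 c hc, h1 c (hc.trans h)⟩⟩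
    · exact ⟨c1, fun c hc => ⟨h0 c (hc.trans h), h1 c hc⟩⟩

instance (L : Subfield C) (x : C) : (near L x).NeBot := by
  refine ⟨fun h => ?_⟩
  have : (∅ : Set L) ∈ near L x := by rw [h]; trivial
  obtain ⟨c0, h0⟩ := this
  exact h0 c0 le_rfl

variable {k1 L : Subfield C}

theorem ImmBase.nc (h : ImmBase k1 L) (x c : C) (hc : c ∈ L) (hx : x ≠ c) :
    ∃ c' ∈ L, ‖x - c'‖ < ‖x - c‖ := by
  obtain ⟨l, hl, hln⟩ := h.val (x - c)
  have hxc : 0 < ‖x - c‖ := norm_pos_iff.2 (sub_ne_zero.2 hx)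
  have hl0 : l ≠ 0 := by rintro rfl; rw [norm_zero] at hln; exact hxc.ne hln
  obtain ⟨a, ha, hac⟩ := h.res ((x - c) / l) (by rw [norm_div, hln, div_self hxc.ne'])
  refine ⟨c + a * l, L.add_mem hc (L.mul_mem (h.le ha) hl), ?_⟩
  have : x - (c + a * l) = ((x - c) / l - a) * l := by field_simp; ring
  rw [this, norm_mul, hln]
  exact mul_lt_of_lt_one_left hxc hac

theorem ImmBase.near_lt (h : ImmBase k1 L) {x : C} (hx : x ∉ L) (r : L) :
    ∀ᶠ c : L in near L x, ‖x - c‖ < ‖x - r‖ := by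
  obtain ⟨c', hc', hlt⟩ := h.nc x r r.2 (by rintro rfl; exact hx r.2)
  exact ⟨⟨c', hc'⟩, fun c hc => hc.trans_lt hlt⟩

def Dom (ρ : ℝ) (g : L[X]) : Prop := ∀ i, i ≠ 0 → ‖(g.coeff i : C)‖ * ρ ^ i < ‖(g.coeff 0 : C)‖

theorem Dom.mul {ρ : ℝ} (hρ : 0 < ρ) {g f : L[X]} (hg : Dom ρ g) (hf : Dom ρ f) : Dom ρ (g * f) := by
  have hg0 : 0 < ‖(g.coeff 0 : C)‖ := (by positivity : 0 ≤ ‖(g.coeff 1 : C)‖ * ρ ^ 1).trans_lt (hg 1 one_ne_zero)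
  have hf0 : 0 < ‖(f.coeff 0 : C)‖ := (by positivity : 0 ≤ ‖(f.coeff 1 : C)‖ * ρ ^ 1).trans_lt (hf 1 one_ne_zero)
  intro i hi
  rw [mul_coeff_zero, coeff_mul]
  push_cast
  rw [← lt_div_iff₀ (by positivity)]
  apply um_sum_lt (div_pos (by rw [norm_mul]; positivity) (by positivity))
  rintro ⟨a, b⟩ hab
  have hab := Finset.HasAntidiagonal.mem_antidiagonal.1 hab
  simp only at hab ⊢
  rw [lt_div_iff₀ (by positivity), ← hab, pow_add, norm_mul, norm_mul]
  have e : ‖(g.coeff a : C)‖ * ‖(f.coeff b : C)‖ * (ρ ^ a * ρ ^ b)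
    = (‖(g.coeff a : C)‖ * ρ ^ a) * (‖(f.coeff b : C)‖ * ρ ^ b) := by ring
  rw [e]
  rcases eq_or_ne a 0 with rfl | ha
  · have hb : b ≠ 0 := by rintro rfl; exact hi (by omega)
    rw [pow_zero, mul_one]
    exact mul_lt_mul_of_pos_left (hf b hb) hg0
  · have h2 : ‖(f.coeff b : C)‖ * ρ ^ b ≤ ‖(f.coeff 0 : C)‖ := by
      rcases eq_or_ne b 0 with rfl | hb
      · simp
      · exact (hf b hb).le
    exact (mul_le_mul_of_nonneg_left h2 (by positivity)).trans_lt (mul_lt_mul_of_pos_right (hg a ha) hf0)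

theorem ImmBase.kaplansky (h : ImmBase k1 L) {x : C} (hx : x ∉ L) (g : L[X]) (hg : g ≠ 0) :
    ∀ᶠ c : L in near L x, ‖((g.eval c : L) : C)‖ = ‖aeval x g‖ ∧ Dom ‖x - c‖ (taylor c g) := by
  haveI := h.ac
  have hs : g.Splits := IsAlgClosed.splits g
  have key : ∀ s : Multiset L, ∀ᶠ c : L in near L x,
      ‖(((s.map fun a => X - Polynomial.C a).prod.eval c : L) : C)‖
        = ‖aeval x (s.map fun a => X - Polynomial.C a).prod‖ ∧
      Dom ‖x - c‖ (taylor c (s.map fun a => X - Polynomial.C a).prod) := by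
    intro s
    induction s using Multiset.induction_on with
    | empty =>
      refine Filter.Eventually.of_forall fun c => ?_
      simp only [Multiset.map_zero, Multiset.prod_zero, eval_one, map_one, taylor_one]
      refine ⟨by simp, fun i hi => ?_⟩
      simp [coeff_one, hi]
    | cons r s ih =>
      filter_upwards [ih, h.near_lt hx r] with c ⟨h1, h2⟩ h3
      have hρ : 0 < ‖x - c‖ := norm_pos_iff.2 (sub_ne_zero.2 (by rintro rfl; exact hx c.2))
      have h4 : ‖((c - r : L) : C)‖ = ‖x - r‖ := by
        have := um_eq (a := x - (r : C)) (b := -(x - c)) (by rwa [norm_neg])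
        rw [← this]; push_cast; congr 1; ring
      rw [Multiset.map_cons, Multiset.prod_cons]
      constructor
      · rw [eval_mul, map_mul, norm_mul, ← h1]
        push_cast
        rw [norm_mul]
        congr 1
        rw [eval_sub, eval_X, eval_C, h4, map_sub, aeval_X, aeval_C]
        rfl
      · rw [taylor_mul]
        refine Dom.mul hρ ?_ h2
        have e : taylor c (X - Polynomial.C r) = X + Polynomial.C (c - r) := by
          simp [taylor_apply]; ring
        rw [e]
        intro i hi
        rcases eq_or_ne i 1 with rfl | hi1
        · simp only [coeff_add, coeff_X_one, coeff_C_ne_zero one_ne_zero, coeff_X_zero, coeff_C_zero,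
            zero_add, add_zero]
          rw [h4]; simpa using h3
        · simp only [coeff_add, coeff_X_of_ne_one hi1, coeff_C_ne_zero hi, coeff_X_zero, coeff_C_zero,
            zero_add]
          rw [h4]; simpa using (norm_nonneg _).trans_lt h3
  have hl : g.leadingCoeff ≠ 0 := leadingCoeff_ne_zero.2 hg
  have hl' : 0 < ‖(g.leadingCoeff : C)‖ := norm_pos_iff.2 (by simpa using hl)
  filter_upwards [key g.roots] with c ⟨h1, h2⟩
  rw [hs.eq_prod_roots]
  constructor
  · rw [eval_mul, map_mul, norm_mul, ← h1, eval_C, aeval_C]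
    push_cast
    rw [norm_mul]; rfl
  · intro i hi
    have := h2 i hi
    rw [taylor_mul, taylor_C, coeff_C_mul, coeff_C_mul]
    push_cast
    rw [norm_mul, norm_mul, mul_assoc]
    exact mul_lt_mul_of_pos_left this hl'

theorem ImmBase.near_norm (h : ImmBase k1 L) {x : C} (hx : x ∉ L) (g : L[X]) :
    ∀ᶠ c : L in near L x, ‖((g.eval c : L) : C)‖ = ‖aeval x g‖ := by
  rcases eq_or_ne g 0 with rfl | hg
  · simp
  · exact (h.kaplansky hx g hg).mono fun c hc => hc.1

def cl (L : Subfield C) (x : C) : Subfield C := (Subfield.closure ((L : Set C) ∪ {x})).topologicalClosure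

theorem cl_closed (L : Subfield C) (x : C) : IsClosed (cl L x : Set C) :=
  isClosed_topologicalClosure _
theorem le_cl (L : Subfield C) (x : C) : L ≤ cl L x := fun _ ha =>
  le_topologicalClosure _ (Subfield.subset_closure (Or.inl ha))
theorem mem_cl (L : Subfield C) (x : C) : x ∈ cl L x :=
  le_topologicalClosure _ (Subfield.subset_closure (Or.inr rfl))
theorem cl_le {L M : Subfield C} {x : C} (hM : IsClosed (M : Set C)) (hL : L ≤ M) (hx : x ∈ M) :
    cl L x ≤ M :=
  Subfield.topologicalClosure_minimal _ (closure_le.2 (union_subset hL (by simpa using hx))) hM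

theorem aeval_mem_cl (L : Subfield C) (x : C) (G : L[X]) : aeval x G ∈ cl L x := by
  rw [aeval_eq_sum_range]
  refine Subfield.sum_mem _ fun i _ => ?_
  rw [Algebra.smul_def]
  exact mul_mem _ (le_cl L x (G.coeff i).2) (Subfield.pow_mem _ (mem_cl L x) i)

theorem ImmBase.approx (h : ImmBase k1 L) {x : C} (hx : x ∉ L) (f : C) (hf : f ∈ cl L x) {ε : ℝ}
    (hε : 0 < ε) : ∃ G : L[X], ‖f - aeval x G‖ < ε := by
  haveI := h.ac
  let A : Subring C := (aeval x : L[X] →ₐ[L] C).range.toSubring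
  let A' := A.topologicalClosure
  have hA' : IsClosed (A' : Set C) := Subring.isClosed_topologicalClosure _
  have hAA : A ≤ A' := Subring.le_topologicalClosure _
  have hL : ∀ a ∈ L, a ∈ A' := fun a ha => hAA ⟨Polynomial.C ⟨a, ha⟩, by simp; rfl⟩
  have hxA : x ∈ A' := hAA ⟨X, by simp⟩
  have hinv1 : ∀ r : L, (x - r)⁻¹ ∈ A' := by
    intro r
    obtain ⟨c', hc', hlt⟩ := h.nc x r r.2 (by rintro rfl; exact hx r.2)
    have h1 : ‖c' - (r : C)‖ = ‖x - r‖ := by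
      have := um_eq (a := x - (r : C)) (b := -(x - c')) (by rwa [norm_neg])
      rw [← this]; congr 1; ring
    have h2 : c' - (r : C) ≠ 0 := by
      rw [← norm_pos_iff, h1]; exact (norm_nonneg _).trans_lt hlt
    have hq : ‖(c' - x) / (c' - r)‖ < 1 := by
      rw [norm_div, h1, norm_sub_rev, div_lt_one (h1 ▸ norm_pos_iff.2 h2)]; exact hlt
    have h3 : (x - r)⁻¹ = (c' - (r : C))⁻¹ * ∑' n : ℕ, ((c' - x) / (c' - r)) ^ n := by
      rw [tsum_geometric_of_norm_lt_one hq, ← mul_inv]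
      congr 1; field_simp; ring
    rw [h3]
    have h4 : (c' - (r : C))⁻¹ ∈ L := L.inv_mem (L.sub_mem hc' r.2)
    refine A'.mul_mem (hL _ h4) ?_
    refine hA'.mem_of_tendsto (summable_geometric_of_norm_lt_one hq).hasSum.tendsto_sum_nat
      (Filter.Eventually.of_forall fun n => A'.sum_mem fun i _ => A'.pow_mem ?_ _)
    rw [div_eq_mul_inv]
    exact A'.mul_mem (A'.sub_mem (hL _ hc') hxA) (hL _ h4)
  have hinv2 : ∀ g : L[X], (aeval x g)⁻¹ ∈ A' := by
    intro g
    rw [(IsAlgClosed.splits g).eq_prod_roots, map_mul, mul_inv, aeval_C]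
    refine A'.mul_mem (hL _ (L.inv_mem g.leadingCoeff.2)) ?_
    generalize g.roots = s
    induction s using Multiset.induction_on with
    | empty => simp [A'.one_mem]
    | cons r s ih =>
      rw [Multiset.map_cons, Multiset.prod_cons, map_mul, mul_inv]
      refine A'.mul_mem ?_ ih
      rw [map_sub, aeval_X, aeval_C]
      exact hinv1 r
  have hsub : (Subfield.closure ((L : Set C) ∪ {x}) : Set C) ⊆ A' := by
    let Q : Subfield C := (adjoin L {x}).toSubfield
    have : Subfield.closure ((L : Set C) ∪ {x}) ≤ Q := by
      rw [closure_le]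
      rintro a (ha | rfl)
      · exact (adjoin L {x}).algebraMap_mem ⟨a, ha⟩
      · exact mem_adjoin_simple_self L a
    intro a ha
    obtain ⟨r, s, rfl⟩ := (IntermediateField.mem_adjoin_simple_iff L a).1 (this ha)
    rw [div_eq_mul_inv]
    exact A'.mul_mem (hAA ⟨r, rfl⟩) (hinv2 s)
  have hfA : f ∈ closure (A : Set C) := closure_minimal hsub hA' hf
  obtain ⟨b, ⟨G, rfl⟩, hb⟩ := Metric.mem_closure_iff.1 hfA ε hε
  exact ⟨G, by rwa [dist_eq_norm] at hb⟩

end Imm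


section BB
variable {L : Type*} [Field L] (p : ℕ) [hp : Fact p.Prime] [CharP L p] [PerfectRing L p]

noncomputable def rt (k : ℕ) : L ≃+* L := (iterateFrobeniusEquiv L p k).symm

theorem rt_pow (k : ℕ) (a : L) : (rt p k a) ^ p ^ k = a := by
  rw [← iterateFrobeniusEquiv_def]; exact (iterateFrobeniusEquiv L p k).apply_symm_apply a

theorem rt_succ (k : ℕ) (a : L) : rt p (k + 1) (a ^ p) = rt p k a := by
  apply (iterateFrobeniusEquiv L p (k+1)).injective
  rw [iterateFrobeniusEquiv_def, iterateFrobeniusEquiv_def, rt_pow, pow_succ, pow_mul, rt_pow]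

noncomputable def bb (K i : ℕ) (H : L[X]) : L := ∑ k ∈ Finset.range K, rt p k (H.coeff (i * p ^ k))

theorem bb_add (K i : ℕ) (H G : L[X]) : bb p K i (H + G) = bb p K i H + bb p K i G := by
  simp [bb, sum_add_distrib]
theorem bb_sub (K i : ℕ) (H G : L[X]) : bb p K i (H - G) = bb p K i H - bb p K i G := by
  simp [bb, sum_sub_distrib]

theorem bb_inv (K i : ℕ) (hi : ¬ p ∣ i) (W : L[X]) (hW : W.natDegree < p ^ K) :
    bb p (K + 1) i (W ^ p) = bb p (K + 1) i W := by
  have hc : ∀ n, (W ^ p).coeff n = if p ∣ n then W.coeff (n / p) ^ p else 0 := by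
    intro n
    rw [← map_frobenius_expand, coeff_map, coeff_expand hp.out.pos]
    split_ifs <;> simp [frobenius_def, hp.out.ne_zero]
  have hi0 : 1 ≤ i := by by_contra h; exact hi (by simp [show i = 0 by omega])
  unfold bb
  rw [sum_range_succ']
  conv_rhs => rw [Finset.sum_range_succ]
  rw [coeff_eq_zero_of_natDegree_lt (n := i * p ^ K) (hW.trans_le (Nat.le_mul_of_pos_left _ hi0))]
  have : (W ^ p).coeff (i * p ^ 0) = 0 := by rw [hc, if_neg (by simpa using hi)]
  rw [this, map_zero, map_zero]
  congr 1
  refine sum_congr rfl fun k _ => ?_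
  rw [hc, if_pos (by rw [pow_succ, ← mul_assoc]; exact dvd_mul_left _ _), rt_succ]
  congr 2
  rw [pow_succ, ← mul_assoc, Nat.mul_div_cancel _ hp.out.pos]

theorem bb_red (K i : ℕ) (R : L[X]) (hR : ∀ m, p ∣ m → R.coeff m = 0) :
    bb p (K + 1) i R = R.coeff i := by
  unfold bb
  rw [sum_range_succ', Finset.sum_eq_zero]
  · simp only [pow_zero, mul_one, zero_add]
    have := rt_pow p 0 (R.coeff i)
    simpa using this
  · intro k _
    rw [hR _ (by rw [pow_succ, ← mul_assoc]; exact dvd_mul_left _ _), map_zero]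

theorem bb_poly (K i : ℕ) (G : L[X]) : ∃ Q : L[X], ∀ c, (bb p K i (taylor c G)) ^ p ^ K = Q.eval c := by
  refine ⟨∑ k ∈ Finset.range K, (hasseDeriv (i * p ^ k) G) ^ p ^ (K - k), fun c => ?_⟩
  rw [bb, sum_pow_char_pow, eval_finsetSum]
  refine sum_congr rfl fun k hk => ?_
  have hk := mem_range.1 hk
  rw [eval_pow, ← taylor_coeff]
  conv_lhs => rw [show K = k + (K - k) by omega, pow_add, pow_mul, rt_pow]

theorem dec_mono (has : ∀ a : L, ∃ w : L, w ^ p - w = a) (n : ℕ) : ∀ a : L, ∃ W R : L[X],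
    monomial n a = R + (W ^ p - W) ∧ W.natDegree ≤ n ∧ R.natDegree ≤ n ∧ ∀ m, p ∣ m → R.coeff m = 0 := by
  induction n using Nat.strong_induction_on with
  | _ n ih =>
    intro a
    rcases Nat.eq_zero_or_pos n with rfl | hn
    · obtain ⟨w, hw⟩ := has a
      exact ⟨Polynomial.C w, 0, by simp [← hw], by simp, by simp, by simp⟩
    by_cases hd : p ∣ n
    · obtain ⟨n', rfl⟩ := hd
      have hlt : n' < p * n' := by
        have := hp.out.two_le
        have h0 : 0 < n' := Nat.pos_of_mul_pos_left hn
        nlinarith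
      obtain ⟨W, R, e, h1, h2, h3⟩ := ih n' hlt (rt p 1 a)
      refine ⟨W + monomial n' (rt p 1 a), R, ?_, ?_, h2.trans hlt.le, h3⟩
      · rw [add_pow_char, monomial_pow]
        have := rt_pow p 1 a
        rw [pow_one] at this
        rw [this, mul_comm n' p]
        linear_combination e
      · exact (natDegree_add_le _ _).trans (max_le (h1.trans hlt.le) ((natDegree_monomial_le _).trans hlt.le))
    · refine ⟨0, monomial n a, by simp [hp.out.ne_zero], by simp, natDegree_monomial_le _, fun m hm => ?_⟩
      rw [coeff_monomial, if_neg]; rintro rfl; exact hd hm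

theorem dec0 (has : ∀ a : L, ∃ w : L, w ^ p - w = a) (H : L[X]) : ∃ W R : L[X],
    H = R + (W ^ p - W) ∧ W.natDegree ≤ H.natDegree ∧ R.natDegree ≤ H.natDegree ∧
      ∀ m, p ∣ m → R.coeff m = 0 := by
  choose W R e h1 h2 h3 using fun n => dec_mono p has n (H.coeff n)
  refine ⟨∑ n ∈ Finset.range (H.natDegree + 1), W n, ∑ n ∈ Finset.range (H.natDegree + 1), R n, ?_, ?_, ?_, ?_⟩
  · rw [sum_pow_char, ← sum_sub_distrib, ← sum_add_distrib]
    conv_lhs => rw [H.as_sum_range]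
    exact sum_congr rfl fun n _ => e n
  · exact natDegree_sum_le_of_forall_le _ _ fun n hn => (h1 n).trans (by have := mem_range.1 hn; omega)
  · exact natDegree_sum_le_of_forall_le _ _ fun n hn => (h2 n).trans (by have := mem_range.1 hn; omega)
  · intro m hm
    rw [finset_sum_coeff]
    exact Finset.sum_eq_zero fun n _ => h3 n m hm

end BB

theorem exists_nu {ι : Type*} (s : Finset ι) (f : ι → ℝ) (μ : ℝ) (hμ : 0 < μ) (h : ∀ j ∈ s, f j < μ) :
    ∃ ν, 0 ≤ ν ∧ ν < μ ∧ ∀ j ∈ s, f j ≤ ν := by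
  classical
  induction s using induction_on with
  | empty => exact ⟨0, le_rfl, hμ, by simp⟩
  | insert a s _ ih =>
    obtain ⟨ν, h0, h1, h2⟩ := ih fun j hj => h j (mem_insert_of_mem hj)
    refine ⟨max ν (f a), le_max_of_le_left h0, max_lt h1 (h a (mem_insert_self _ _)), fun j hj => ?_⟩
    rcases mem_insert.1 hj with rfl | hj
    · exact le_max_right _ _
    · exact le_max_of_le_left (h2 j hj)


section ASStep
variable {C : Type*} [NontriviallyNormedField C] [CompleteSpace C] [IsUltrametricDist C]
variable {k1 L : Subfield C}

theorem pow_sub_pow_le {y Y : C} {ρ : ℝ} (hy : ‖y‖ ≤ ρ) (hY : ‖Y‖ ≤ ρ) (j : ℕ) (hj : j ≠ 0) :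
    ‖Y ^ j - y ^ j‖ * ρ ≤ ρ ^ j * ‖Y - y‖ := by
  have hρ := (norm_nonneg _).trans hy
  rw [← (Commute.all Y y).geom_sum₂_mul, norm_mul]
  obtain ⟨j, rfl⟩ := Nat.exists_eq_succ_of_ne_zero hj
  have : ‖∑ i ∈ Finset.range (j+1), Y ^ i * y ^ (j + 1 - 1 - i)‖ ≤ ρ ^ j := by
    refine um_sum_le (by positivity) fun i hi => ?_
    have hi := mem_range.1 hi
    rw [norm_mul, norm_pow, norm_pow]
    calc ‖Y‖ ^ i * ‖y‖ ^ (j + 1 - 1 - i) ≤ ρ ^ i * ρ ^ (j + 1 - 1 - i) := by gcongr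
      _ = ρ ^ j := by rw [← pow_add]; congr 1; omega
  rw [Nat.succ_eq_add_one, pow_succ]
  calc _ ≤ ρ ^ j * ‖Y - y‖ * ρ := by gcongr
    _ = _ := by ring

theorem natCast_norm_le (n : ℕ) : ‖(n : C)‖ ≤ 1 := norm_natCast_le_one C n

theorem natCast_norm_eq (p : ℕ) [hp : Fact p.Prime] [CharP C p] (n : ℕ) (hn : ¬ p ∣ n) : ‖(n : C)‖ = 1 := by
  have hc : n.Coprime p := (Nat.Prime.coprime_iff_not_dvd hp.out).2 hn |>.symm
  obtain ⟨a, ha⟩ : ∃ a : ℕ, (a : C) * n = 1 := by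
    obtain ⟨a, -, ha⟩ := Nat.exists_mul_mod_eq_one_of_coprime hc hp.out.one_lt
    refine ⟨a, ?_⟩
    have : ((n * a : ℕ) : C) = ((1 : ℕ) : C) := by
      rw [CharP.natCast_eq_natCast C p]; exact ha.trans (Nat.mod_eq_of_lt hp.out.one_lt).symm
    push_cast at this; rw [mul_comm]; exact this
  refine le_antisymm (natCast_norm_le n) ?_
  have h1 : ‖(a : C)‖ * ‖(n : C)‖ = 1 := by rw [← norm_mul, ha, norm_one]
  have := natCast_norm_le (C := C) a
  nlinarith [norm_nonneg (n : C)]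

theorem aeval_taylor_sub {x : C} (c : L) (G : L[X]) : aeval (x - c) (taylor c G) = aeval x G := by
  rw [taylor_apply, aeval_comp]; simp
  congr 2
  exact sub_add_cancel x (c : C)

theorem aeval_sum' (R : L[X]) (N : ℕ) (hR : R.natDegree < N) (y : C) :
    aeval y R = ∑ j ∈ Finset.range N, (R.coeff j : C) * y ^ j := by
  rw [aeval_eq_sum_range' hR]; rfl

theorem bb_one_norm (p : ℕ) [hp : Fact p.Prime] [CharP C p] [CharP L p] [PerfectRing L p]
    (R : L[X]) (N K : ℕ) (hR : R.natDegree < N)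
    (h : L) (ρ μ : ℝ) (hρ : 0 < ρ) (hh : ‖(h : C)‖ = ρ) (hμ : 1 < μ) (J : ℕ) (hJp : ¬ p ∣ J)
    (hJ : ‖(R.coeff J : C)‖ * ρ ^ J = μ) (hlt : ∀ j, j ≠ J → ‖(R.coeff j : C)‖ * ρ ^ j < μ) :
    ‖((bb p (K + 1) 1 (taylor h R) : L) : C)‖ * ρ = μ := by
  have hJ1 : J ≠ 0 := by rintro rfl; exact hJp (dvd_zero _)
  have hle : ∀ j, ‖(R.coeff j : C)‖ * ρ ^ j ≤ μ := fun j => by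
    rcases eq_or_ne j J with rfl | hj
    · exact hJ.le
    · exact (hlt j hj).le
  have hco : ∀ n, ((taylor h R).coeff n : C) = ∑ j ∈ Finset.range N, (j.choose n : C) * (R.coeff j : C) * (h : C) ^ (j - n) := by
    intro n
    rw [taylor_coeff, hasseDeriv_apply, sum_over_range' _ (by simp) N hR, eval_finsetSum]
    push_cast
    refine sum_congr rfl fun j _ => ?_
    simp [eval_monomial]
  have hb : ∀ n, ‖((taylor h R).coeff n : C)‖ * ρ ^ n ≤ μ := by
    intro n
    rw [hco, ← le_div_iff₀ (by positivity)]
    refine um_sum_le (by positivity) fun j _ => ?_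
    rw [le_div_iff₀ (by positivity), norm_mul, norm_mul, norm_pow, hh]
    rcases lt_or_ge j n with hjn | hjn
    · rw [Nat.choose_eq_zero_of_lt hjn]; simp; positivity
    · calc _ ≤ 1 * ‖(R.coeff j : C)‖ * ρ ^ (j - n) * ρ ^ n := by gcongr; exact natCast_norm_le _
        _ = ‖(R.coeff j : C)‖ * ρ ^ j := by rw [one_mul, mul_assoc, ← pow_add]; congr 2; omega
        _ ≤ μ := hle j
  have h1 : ‖((taylor h R).coeff 1 : C)‖ * ρ = μ := by
    have hJN : J ∈ Finset.range N := by
      rw [mem_range]; by_contra hc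
      rw [coeff_eq_zero_of_natDegree_lt (by omega)] at hJ; simp at hJ; linarith
    have hterm : ∀ j : ℕ, ‖(j.choose 1 : C) * (R.coeff j : C) * (h : C) ^ (j - 1)‖ * ρ
        = ‖(j : C)‖ * (‖(R.coeff j : C)‖ * ρ ^ j) := by
      intro j
      rw [Nat.choose_one_right, norm_mul, norm_mul, norm_pow, hh]
      rcases Nat.eq_zero_or_pos j with rfl | hj
      · simp
      · rw [mul_assoc, ← pow_succ, Nat.sub_add_cancel hj, mul_assoc]
    have hJn := hterm J
    rw [natCast_norm_eq p J hJp, hJ, one_mul] at hJn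
    rw [hco, ← add_sum_erase _ _ hJN, um_eq, hJn]
    have hpos : 0 < ‖(J.choose 1 : C) * (R.coeff J : C) * (h : C) ^ (J - 1)‖ := by
      by_contra hc; rw [le_antisymm (not_lt.1 hc) (norm_nonneg _)] at hJn; linarith
    refine um_sum_lt hpos fun j hj => ?_
    refine lt_of_mul_lt_mul_right (a := ρ) ?_ hρ.le
    rw [hJn, hterm]
    calc _ ≤ 1 * (‖(R.coeff j : C)‖ * ρ ^ j) := by gcongr; exact natCast_norm_le _
      _ < μ := by rw [one_mul]; exact hlt j (ne_of_mem_erase hj)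
  unfold bb
  rw [sum_range_succ']
  push_cast
  rw [add_comm]
  have e0 : rt p 0 ((taylor h R).coeff (1 * p ^ 0)) = (taylor h R).coeff 1 := by
    simpa using rt_pow p 0 ((taylor h R).coeff 1)
  rw [e0, um_eq, h1]
  refine um_sum_lt (by by_contra hc; rw [le_antisymm (not_lt.1 hc) (norm_nonneg _)] at h1; linarith) fun k _ => ?_
  refine lt_of_mul_lt_mul_right (a := ρ) ?_ hρ.le
  rw [h1]
  refine lt_of_pow_lt_pow_left₀ (p ^ (k+1)) (by linarith) ?_
  have e1 := congrArg (fun t : L => ‖(t : C)‖) (rt_pow p (k+1) ((taylor h R).coeff (1 * p ^ (k + 1))))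
  push_cast at e1
  rw [norm_pow] at e1
  rw [mul_pow, e1, one_mul]
  refine (hb _).trans_lt ?_
  exact lt_self_pow₀ hμ (Nat.one_lt_pow (by omega) hp.out.one_lt)

theorem ImmBase.as_step (h : ImmBase k1 L) (p : ℕ) [hp : Fact p.Prime] [CharP C p] {x z : C} (hx : x ∉ L)
    (hz : z ∉ cl L x) (hzp : z ^ p - z ∈ cl L x) : ∃ z', z - z' ∈ cl L x ∧ x ∈ cl L z' := by
  haveI := h.ac
  haveI := h.k1ac
  haveI : CharP L p := (algebraMap L C).charP (algebraMap L C).injective p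
  haveI : PerfectRing L p := PerfectField.toPerfectRing p
  have hM := cl_closed L x
  have has : ∀ a : L, ∃ w : L, w ^ p - w = a := fun a => by
    have hd : (X ^ p + (-X - Polynomial.C a) : L[X]).degree = p := by
      rw [degree_add_eq_left_of_degree_lt, degree_X_pow]
      rw [degree_X_pow]
      exact (lt_of_le_of_lt (b := (1 : WithBot ℕ)) (by compute_degree) (by exact_mod_cast hp.out.one_lt))
    obtain ⟨w, hw⟩ := IsAlgClosed.exists_root (X ^ p + (-X - Polynomial.C a) : L[X]) (by
      rw [hd]; exact_mod_cast hp.out.ne_zero)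
    refine ⟨w, ?_⟩
    simp only [IsRoot.def, eval_add, eval_sub, eval_pow, eval_X, eval_C, eval_neg] at hw
    linear_combination hw
  obtain ⟨G, hG⟩ := h.approx hx _ hzp one_pos
  obtain ⟨w0, hw0, hw0e⟩ := as_small _ hM p hp.out _ (Subfield.sub_mem _ hzp (aeval_mem_cl L x G)) hG
  set N := G.natDegree + 1 with hN
  have hNp : G.natDegree < p ^ N := (lt_succ_self _).trans (lt_pow_self hp.out.one_lt)
  choose Q hQ using fun i => bb_poly p (N + 1) i G
  have hBn : ∀ i, ∀ᶠ c : L in near L x, ‖((bb p (N+1) i (taylor c G) : L) : C)‖ ^ p ^ (N+1) = ‖aeval x (Q i)‖ := by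
    intro i
    filter_upwards [h.near_norm hx (Q i)] with c hc
    rw [← hc, ← hQ]; push_cast; rw [norm_pow]
  have hB : ∀ i, ∃ β : ℝ, ∀ᶠ c : L in near L x, ‖((bb p (N+1) i (taylor c G) : L) : C)‖ = β := by
    intro i
    obtain ⟨c0, hc0⟩ := (hBn i).exists
    refine ⟨‖((bb p (N+1) i (taylor c0 G) : L) : C)‖, ?_⟩
    filter_upwards [hBn i] with c hc
    exact (pow_left_inj₀ (norm_nonneg _) (norm_nonneg _) (pow_ne_zero _ hp.out.ne_zero)).1 (hc.trans hc0.symm)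
  choose β hβ using hB
  have hβ0 : ∀ i, 0 ≤ β i := fun i => by
    obtain ⟨c, hc⟩ := (hβ i).exists; rw [← hc]; exact norm_nonneg _
  have hpos : ∀ c : L, 0 < ‖x - c‖ := fun c => norm_pos_iff.2 (sub_ne_zero.2 (by rintro rfl; exact hx c.2))
  have hdist : ∀ i j, i < j → ∀ᶠ c : L in near L x, β i * ‖x - c‖ ^ i = β j * ‖x - c‖ ^ j → β j = 0 := by
    intro i j hij
    by_cases hex : ∃ c1 : L, β i * ‖x - c1‖ ^ i = β j * ‖x - c1‖ ^ j
    · obtain ⟨c1, hc1⟩ := hex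
      filter_upwards [h.near_lt hx c1] with c hc he
      obtain ⟨d, rfl⟩ := Nat.exists_eq_add_of_lt hij
      by_contra hj0
      have e1 : ∀ c : L, β i * ‖x - c‖ ^ i = β (i + d + 1) * ‖x - c‖ ^ (i + d + 1) →
          β i = β (i+d+1) * ‖x - c‖ ^ (d+1) := fun c hc =>
        mul_right_cancel₀ (pow_ne_zero i (hpos c).ne') (by rw [hc]; ring)
      have e2 := (e1 c he).symm.trans (e1 c1 hc1)
      have e3 := (pow_left_inj₀ (norm_nonneg _) (norm_nonneg _) (by omega)).1 (mul_left_cancel₀ hj0 e2)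
      exact hc.ne e3
    · exact Filter.Eventually.of_forall fun c hc => (hex ⟨c, hc⟩).elim
  have ev1 : ∀ᶠ c : L in near L x, ∀ i ∈ Finset.range N, ‖((bb p (N+1) i (taylor c G) : L) : C)‖ = β i :=
    (Filter.eventually_all_finset _).2 fun i _ => hβ i
  have ev2 : ∀ᶠ c : L in near L x, ∀ i ∈ Finset.range N, ∀ j ∈ Finset.range N, i < j →
      β i * ‖x - c‖ ^ i = β j * ‖x - c‖ ^ j → β j = 0 := by
    refine (Filter.eventually_all_finset _).2 fun i _ => (Filter.eventually_all_finset _).2 fun j _ => ?_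
    by_cases hij : i < j
    · exact (hdist i j hij).mono fun c hc _ => hc
    · exact Filter.Eventually.of_forall fun c hc => (hij hc).elim
  obtain ⟨c, hc1, hc2⟩ := (ev1.and ev2).exists
  obtain ⟨W, R, hH, hWd, hRd, hR0⟩ := dec0 p has (taylor c G)
  rw [natDegree_taylor] at hWd hRd
  have hRN : R.natDegree < N := by omega
  set ρ := ‖x - c‖ with hρ
  have hρ0 : 0 < ρ := hpos c
  set y := x - (c : C) with hy
  have hym : y ∈ cl L x := Subfield.sub_mem _ (mem_cl L x) (le_cl L x c.2)
  have haev : ∀ H : L[X], aeval y H ∈ cl L x := fun H => by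
    rw [aeval_sum' H _ (lt_succ_self _)]
    exact Subfield.sum_mem _ fun i _ => mul_mem _ (le_cl L x (H.coeff i).2) (Subfield.pow_mem _ hym i)
  have hzR : z ^ p - z = aeval y R + ((w0 + aeval y W) ^ p - (w0 + aeval y W)) := by
    have e1 := congrArg (aeval y) hH
    rw [aeval_taylor_sub] at e1
    simp only [map_add, map_sub, map_pow] at e1
    rw [add_pow_char]
    linear_combination (-1) * hw0e + e1
  have hw1 : w0 + aeval y W ∈ cl L x := add_mem _ hw0 (haev W)
  set w := w0 + aeval y W
  have hbb : ∀ i, ¬ p ∣ i → bb p (N+1) i (taylor c G) = R.coeff i := by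
    intro i hi
    rw [hH, bb_add, bb_sub, bb_inv p N i hi W (hWd.trans_lt hNp), sub_self, add_zero, bb_red p N i R hR0]
  have hRn : ∀ i < N, R.coeff i = 0 ∨ (¬ p ∣ i ∧ ‖(R.coeff i : C)‖ = β i) := by
    intro i hi
    by_cases hd : p ∣ i
    · exact Or.inl (hR0 i hd)
    · refine Or.inr ⟨hd, ?_⟩; rw [← hc1 i (mem_range.2 hi), hbb i hd]
  have hRbig : ∀ i, N ≤ i → R.coeff i = 0 := fun i hi => coeff_eq_zero_of_natDegree_lt (by omega)
  by_cases hall : ∀ j, ‖(R.coeff j : C)‖ * ρ ^ j ≤ 1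
  · exfalso
    have h1 : ‖aeval y R‖ ≤ 1 := by
      rw [aeval_sum' R N hRN]
      exact um_sum_le zero_le_one fun j _ => by rw [norm_mul, norm_pow]; exact hall j
    obtain ⟨a, ha, ha1⟩ := h.res _ h1
    obtain ⟨v, hv⟩ := has ⟨a, h.le ha⟩
    have hv := congrArg (Subtype.val) hv
    push_cast at hv
    obtain ⟨w', hw', hw'e⟩ := as_small _ hM p hp.out _ (Subfield.sub_mem _ (haev R) (le_cl L x (h.le ha))) ha1
    refine hz (as_unique _ p hp.out z (w + v + w')
      (add_mem _ (add_mem _ hw1 (le_cl L x v.2)) hw') ?_)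
    rw [add_pow_char, add_pow_char]
    linear_combination hzR - hw'e - hv
  push Not at hall
  obtain ⟨j0, hj0⟩ := hall
  have hj0N : j0 < N := by by_contra hc; rw [hRbig j0 (by omega)] at hj0; simp at hj0; linarith
  obtain ⟨J, hJN, hJmax⟩ := exists_max_image (Finset.range N) (fun j => ‖(R.coeff j : C)‖ * ρ ^ j)
    ⟨j0, mem_range.2 hj0N⟩
  set μ := ‖(R.coeff J : C)‖ * ρ ^ J with hμ
  have hμ1 : 1 < μ := hj0.trans_le (hJmax j0 (mem_range.2 hj0N))
  have hRJ : R.coeff J ≠ 0 := by intro h0; rw [hμ, h0] at hμ1; simp at hμ1; linarith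
  have hJN' := mem_range.1 hJN
  obtain ⟨hJp, hJβ⟩ := (hRn J hJN').resolve_left hRJ
  have hstrict : ∀ j, j ≠ J → ‖(R.coeff j : C)‖ * ρ ^ j < μ := by
    intro j hj
    by_cases hjN : j < N
    · refine lt_of_le_of_ne (hJmax j (mem_range.2 hjN)) fun heq => ?_
      have hRj : R.coeff j ≠ 0 := by intro h0; rw [h0] at heq; simp at heq; linarith
      have hjβ := ((hRn j hjN).resolve_left hRj).2
      rw [hμ, hjβ, hJβ] at heq
      have n1 : β j ≠ 0 := by rw [← hjβ]; simpa using hRj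
      have n2 : β J ≠ 0 := by rw [← hJβ]; simpa using hRJ
      rcases lt_or_gt_of_ne hj with hl | hl
      · exact n2 (hc2 j (mem_range.2 hjN) J hJN hl heq)
      · exact n1 (hc2 J hJN j (mem_range.2 hjN) hl heq.symm)
    · rw [hRbig j (by omega)]; simp; linarith
  by_cases hJ1 : J = 1
  · subst hJ1
    refine ⟨z - w, by simpa using hw1, ?_⟩
    have hz' : (z - w) ^ p - (z - w) = aeval y R := by
      rw [sub_pow_char]; linear_combination hzR
    suffices y ∈ cl L (z - w) by
      have := add_mem _ this (le_cl L (z - w) c.2)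
      rwa [hy, sub_add_cancel] at this
    have hb1 : (R.coeff 1 : C) ≠ 0 := by simpa using hRJ
    obtain ⟨ν, hν0, hν1, hν⟩ := exists_nu ((Finset.range N).erase 1) (fun j => ‖(R.coeff j : C)‖ * ρ ^ j) μ (by linarith)
      fun j hj => hstrict j (ne_of_mem_erase hj)
    have hyz : aeval y R = R.coeff 1 * y + ∑ j ∈ (Finset.range N).erase 1, (R.coeff j : C) * y ^ j := by
      rw [aeval_sum' R N hRN, ← add_sum_erase _ _ hJN, pow_one]
    have hcl : y ∈ closure (cl L (z - w) : Set C) := by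
      rw [Metric.mem_closure_iff]
      intro ε hε
      obtain ⟨Y, hY, hYε⟩ : ∃ Y ∈ (cl L (z - w) : Set C), ‖Y - y‖ ≤ min (ε/2) ρ := by
        refine contr (cl L (z - w) : Set C) (fun Y => (R.coeff 1 : C)⁻¹ * ((z - w) ^ p - (z - w)
          - ∑ j ∈ (Finset.range N).erase 1, (R.coeff j : C) * Y ^ j)) y ρ (ν / μ) (min (ε/2) ρ) (Subfield.zero_mem _)
          le_rfl (by positivity) ((div_lt_one (by linarith)).2 hν1) (lt_min (by linarith) hρ0) (min_le_right _ _) ?_ ?_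
        · intro Y hY
          have hzm := mem_cl L (z - w)
          exact mul_mem _ (Subfield.inv_mem _ (le_cl L _ (R.coeff 1).2)) (Subfield.sub_mem _
            (Subfield.sub_mem _ (Subfield.pow_mem _ hzm _) hzm)
            (Subfield.sum_mem _ fun j _ => mul_mem _ (le_cl L _ (R.coeff j).2) (Subfield.pow_mem _ hY _)))
        · intro Y hY
          refine le_max_of_le_left ?_
          have e : (R.coeff 1 : C)⁻¹ * ((z - w) ^ p - (z - w)
            - ∑ j ∈ (Finset.range N).erase 1, (R.coeff j : C) * Y ^ j) - y
              = (R.coeff 1 : C)⁻¹ * ∑ j ∈ (Finset.range N).erase 1, (R.coeff j : C) * (y ^ j - Y ^ j) := by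
            rw [hz', hyz]; simp only [mul_sub, sum_sub_distrib]; field_simp; ring
          rw [e, norm_mul, norm_inv]
          rw [pow_one] at hμ
          have hb1' : 0 < ‖(R.coeff 1 : C)‖ := norm_pos_iff.2 hb1
          rw [inv_mul_le_iff₀ hb1']
          refine um_sum_le (by positivity) fun j hj => ?_
          rcases eq_or_ne j 0 with rfl | hj00
          · simp; positivity
          have h3 := pow_sub_pow_le (y := Y) (Y := y) hY le_rfl j hj00
          have h4 := hν j hj
          have h5 : ‖(R.coeff 1 : C)‖ * (ν / μ * ‖Y - y‖) = ν * ‖Y - y‖ / ρ := by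
            rw [hμ]; field_simp
          rw [h5, le_div_iff₀ hρ0, norm_mul, norm_sub_rev Y y]
          calc _ = ‖(R.coeff j : C)‖ * (‖y ^ j - Y ^ j‖ * ρ) := by ring
            _ ≤ ‖(R.coeff j : C)‖ * (ρ ^ j * ‖y - Y‖) := by gcongr
            _ = (‖(R.coeff j : C)‖ * ρ ^ j) * ‖y - Y‖ := by ring
            _ ≤ _ := by gcongr
      refine ⟨Y, hY, ?_⟩
      rw [dist_comm, dist_eq_norm]
      have := hYε.trans (min_le_left _ _); linarith
    exact (cl_closed L (z - w)).closure_subset hcl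
  · exfalso
    obtain ⟨c', hc'1, hc'2⟩ := (ev1.and (h.near_lt hx c)).exists
    have hh : ‖((c' - c : L) : C)‖ = ρ := by
      have := um_eq (a := x - (c : C)) (b := -(x - c')) (by rwa [norm_neg])
      rw [hρ, ← this]; push_cast; congr 1; ring
    have hJ0 : J ≠ 0 := by rintro rfl; exact hJp (dvd_zero _)
    have h1N : 1 < N := by omega
    have h1p : ¬ p ∣ 1 := fun hd => hp.out.one_lt.ne' (Nat.dvd_one.1 hd)
    have e := bb_one_norm p R N N hRN (c' - c) ρ μ hρ0 hh hμ1 J hJp rfl hstrict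
    have e2 : bb p (N+1) 1 (taylor c' G) = bb p (N+1) 1 (taylor (c' - c) R) := by
      have : taylor c' G = taylor (c' - c) R + ((taylor (c' - c) W) ^ p - taylor (c' - c) W) := by
        conv_lhs => rw [← sub_add_cancel c' c, ← taylor_taylor, hH]
        rw [map_add, map_sub, taylor_pow]
      rw [this, bb_add, bb_sub, bb_inv p N 1 h1p _ (by rw [natDegree_taylor]; exact hWd.trans_lt hNp), sub_self, add_zero]
    rw [← e2, hc'1 1 (mem_range.2 h1N)] at e
    have e3 := hc1 1 (mem_range.2 h1N)
    rw [hbb 1 h1p] at e3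
    have := hstrict 1 (Ne.symm hJ1)
    rw [e3, pow_one] at this
    exact this.ne e

end ASStep


section TImm
variable {C : Type*} [NontriviallyNormedField C] [CompleteSpace C] [IsUltrametricDist C]
variable {k1 L : Subfield C}

theorem ImmBase.nt (h : ImmBase k1 L) : ∃ a ∈ L, 1 < ‖a‖ := by
  obtain ⟨a, ha⟩ := NormedField.exists_one_lt_norm C
  obtain ⟨l, hl, e⟩ := h.val a
  exact ⟨l, hl, e ▸ ha⟩

theorem deg_lt {M E : Type*} [Field M] [Field E] [Algebra M E] {α z : E} (hα : IsIntegral M α)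
    (hz : z ∈ adjoin M {α}) (hzM : z ∉ (algebraMap M E).range) :
    (minpoly (adjoin M {z}) α).natDegree < (minpoly M α).natDegree := by
  have hzi : IsIntegral M z := by
    haveI := adjoin.finiteDimensional hα
    have := (IsIntegral.of_finite M (⟨z, hz⟩ : adjoin M {α}))
    exact this.map (IntermediateField.val _)
  have hα' : IsIntegral (adjoin M {z}) α := hα.tower_top
  rw [← adjoin.finrank hα, ← adjoin.finrank hα']
  have e : (adjoin (adjoin M {z}) {α}).restrictScalars M
      = adjoin M {α} := by
    rw [IntermediateField.adjoin_simple_adjoin_simple]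
    apply le_antisymm
    · rw [adjoin_le_iff]
      rintro a (rfl | rfl)
      · exact hz
      · exact mem_adjoin_simple_self M a
    · exact adjoin.mono _ _ _ (by simp)
  have e2 : finrank M (adjoin (adjoin M {z}) {α})
    = finrank M (adjoin M {α}) := by
    rw [← e]; rfl
  have e3 := Module.finrank_mul_finrank M (adjoin M {z})
    (adjoin (adjoin M {z}) {α})
  haveI := adjoin.finiteDimensional hα'
  have p1 : 0 < finrank (adjoin M {z}) (adjoin (adjoin M {z}) {α}) :=
    Module.finrank_pos
  have p2 : 1 < finrank M (adjoin M {z}) := by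
    rw [adjoin.finrank hzi]
    by_contra hc
    have h1 := minpoly.natDegree_pos hzi
    exact hzM (minpoly.natDegree_eq_one_iff.1 (by omega))
  rw [← e2, ← e3]
  exact lt_mul_of_one_lt_left p1 p2

theorem ImmBase.t_imm (h : ImmBase k1 L) (p : ℕ) [ExpChar C p] (n : ℕ) : ∀ {x : C}, x ∉ L → ∀ α : C,
    IsSeparable (cl L x) α → (minpoly (cl L x) α).natDegree = n →
    ∃ y, y ∉ L ∧ x ∈ cl L y ∧ α ∈ cl L y ∧
      ∀ N : Subfield C, IsClosed (N : Set C) → L ≤ N → x ∈ N → α ∈ N → y ∈ N := by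
  haveI := h.ac
  induction n using Nat.strong_induction_on with
  | _ n ih =>
    intro x hx α hα hn
    by_cases hαM : α ∈ cl L x
    · exact ⟨x, hx, mem_cl L x, hαM, fun N _ _ hN _ => hN⟩
    have hdiv : ∀ n : ℕ, (n : C) ≠ 0 → ∀ a ∈ cl L x, a ≠ 0 → ∃ b ∈ cl L x, ‖b‖ ^ n = ‖a‖ := by
      intro n hn0 a _ _
      obtain ⟨l, hl, e⟩ := h.val a
      obtain ⟨b, hb⟩ := IsAlgClosed.exists_pow_nat_eq (⟨l, hl⟩ : L) (n := n) (Nat.pos_of_ne_zero (by rintro rfl; simp at hn0))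
      refine ⟨b, le_cl L x b.2, ?_⟩
      rw [← norm_pow, ← e]; congr 1; exact congrArg Subtype.val hb
    obtain ⟨l0, hl0, hl01⟩ := h.nt
    obtain ⟨hp, z, hz, hzM, hzp⟩ := PG' (cl L x) (cl_closed L x) ⟨l0, le_cl L x hl0, hl01⟩ k1 h.k1ac
      (h.le.trans (le_cl L x)) h.triv h.res hdiv p α hα hαM
    haveI : Fact p.Prime := ⟨hp⟩
    haveI : CharP C p := by
      rcases ‹ExpChar C p› with _ | ⟨_⟩
      · exact (Nat.not_prime_one hp).elim
      · assumption
    obtain ⟨z', hzz, hxz⟩ := h.as_step p hx hzM hzp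
    have hle : cl L x ≤ cl L z' := cl_le (cl_closed L z') (le_cl L z') hxz
    have hzz' : z ∈ cl L z' := by
      have := add_mem _ (hle hzz) (mem_cl L z'); rwa [sub_add_cancel] at this
    have hz'L : z' ∉ L := fun hc => hzM (by
      have := add_mem _ hzz (le_cl L x hc); rwa [sub_add_cancel] at this)
    let E : IntermediateField (cl L x) C := adjoin (cl L x) {z}
    have hE : E.toSubfield ≤ cl L z' := by
      have : E ≤ Subfield.toIntermediateField (cl L z') (fun a => hle a.2) := by
        rw [adjoin_le_iff]; simpa using hzz'
      exact this
    letI : Algebra E (cl L z') := (inclusion hE).toAlgebra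
    haveI : IsScalarTower E (cl L z') C := IsScalarTower.of_algebraMap_eq fun _ => rfl
    have hαE : IsSeparable E α := hα.tower_top E
    have hαz : IsSeparable (cl L z') α := hαE.tower_top (cl L z')
    have hlt : (minpoly (cl L z') α).natDegree < n := by
      rw [← hn]
      refine lt_of_le_of_lt ?_ (deg_lt hα.isIntegral hz ?_)
      · have := minpoly.dvd_map_of_isScalarTower E (cl L z') α
        exact (natDegree_le_of_dvd this ((minpoly.monic hαE.isIntegral).map _).ne_zero).trans natDegree_map_le
      · rintro ⟨a, rfl⟩; exact hzM a.2
    obtain ⟨y, hy, hzy, hαy, hN⟩ := ih _ hlt hz'L α hαz rfl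
    have hzy' : cl L z' ≤ cl L y := cl_le (cl_closed L y) (le_cl L y) hzy
    refine ⟨y, hy, hzy' hxz, hαy, fun N hNc hLN hxN hαN => ?_⟩
    have hclN : cl L x ≤ N := cl_le hNc hLN hxN
    refine hN N hNc hLN ?_ hαN
    have hzN : z ∈ N := by
      have : adjoin (cl L x) {α} ≤ Subfield.toIntermediateField N (fun a => hclN a.2) := by
        rw [adjoin_le_iff]; simpa using hαN
      exact this hz
    have := N.sub_mem hzN (hclN hzz)
    rwa [sub_sub_cancel] at this

theorem ImmBase.pert (h : ImmBase k1 L) {y e : C} {γ : ℝ} (hγ : ∀ c ∈ L, γ ≤ ‖y - c‖)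
    (he : e ∈ cl L y) (heγ : ‖e‖ < γ) : y ∈ cl L (y + e) := by
  have hγ0 : 0 < γ := (norm_nonneg _).trans_lt heγ
  have hy : y ∉ L := fun hc => by have := hγ y hc; simp at this; linarith
  have hcl : y ∈ closure (cl L (y + e) : Set C) := by
    rw [Metric.mem_closure_iff]
    intro ε0 hε0
    obtain ⟨E, hE⟩ := h.approx hy e he (lt_min hε0 hγ0)
    set ε := ‖e - aeval y E‖ with hεd
    have hEy : ‖aeval y E‖ < γ := by
      have e1 : aeval y E = e + -(e - aeval y E) := by ring
      rw [e1]; exact um_lt heγ (by rw [norm_neg]; exact hE.trans_le (min_le_right _ _))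
    have hev : ∀ᶠ c : L in near L y, ‖((E.eval c : L) : C)‖ = ‖aeval y E‖ ∧
        ∀ i, ‖((taylor c E).coeff i : C)‖ * ‖y - c‖ ^ i ≤ ‖((taylor c E).coeff 0 : C)‖ := by
      rcases eq_or_ne E 0 with rfl | hE0
      · simp
      · filter_upwards [h.kaplansky hy E hE0] with c ⟨h1, h2⟩
        refine ⟨h1, fun i => ?_⟩
        rcases eq_or_ne i 0 with rfl | hi
        · simp
        · exact (h2 i hi).le
    obtain ⟨c, hc1, hc2⟩ := hev.exists
    set T := taylor c E with hT
    set ρ := ‖y - c‖ with hρ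
    have hρ0 : 0 < ρ := hγ0.trans_le (hγ c c.2)
    have ha0 : ‖(T.coeff 0 : C)‖ < ρ := by
      rw [hT, taylor_coeff_zero, hc1]; exact hEy.trans_le (hγ c c.2)
    have hεm : 0 < min ε0 γ := lt_min hε0 hγ0
    set δ := max ε (min (min ε0 γ / 2) (min ε0 γ / 2))
    have hδ0 : 0 < δ := lt_max_of_lt_right (by simp only [min_self]; linarith)
    have hδ1 : δ < min ε0 γ := max_lt hE (by simp only [min_self]; linarith)
    have hEt : aeval y E = (T.coeff 0 : C) + ∑ i ∈ Finset.range T.natDegree, (T.coeff (i+1) : C) * (y - c) ^ (i+1) := by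
      rw [← aeval_taylor_sub c E, aeval_sum' T _ (lt_succ_self _), sum_range_succ']
      simp [add_comm]
    obtain ⟨Y, hY, hYε⟩ : ∃ Y ∈ (cl L (y + e) : Set C), ‖Y - (y - c)‖ ≤ δ := by
      refine contr (cl L (y + e) : Set C) (fun Y => (y + e) - c - T.coeff 0 -
        ∑ i ∈ Finset.range T.natDegree, (T.coeff (i+1) : C) * Y ^ (i+1)) (y - c) ρ (‖(T.coeff 0 : C)‖ / ρ) δ
        (Subfield.zero_mem _) le_rfl (by positivity) ((div_lt_one hρ0).2 ha0) hδ0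
        (hδ1.le.trans ((min_le_right _ _).trans (hγ c c.2))) ?_ ?_
      · intro Y hY
        have hl := le_cl L (y + e)
        exact Subfield.sub_mem _ (Subfield.sub_mem _ (Subfield.sub_mem _ (mem_cl _ _) (hl c.2)) (hl (T.coeff 0).2))
          (Subfield.sum_mem _ fun j _ => mul_mem _ (hl (T.coeff _).2) (Subfield.pow_mem _ hY _))
      · intro Y hY
        have e1 : (y + e) - c - T.coeff 0 - ∑ i ∈ Finset.range T.natDegree, (T.coeff (i+1) : C) * Y ^ (i+1) - (y - c)
          = (e - aeval y E) + ∑ i ∈ Finset.range T.natDegree, (T.coeff (i+1) : C) * ((y - c) ^ (i+1) - Y ^ (i+1)) := by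
          rw [hEt]; simp only [mul_sub, sum_sub_distrib]; ring
        rw [e1]
        refine um_le ?_ ?_
        · exact le_max_of_le_right (le_max_left _ _)
        · refine le_max_of_le_left (um_sum_le (by positivity) fun j hj => ?_)
          have h3 := pow_sub_pow_le (y := Y) (Y := y - c) hY le_rfl (j+1) (by omega)
          rw [div_mul_eq_mul_div, le_div_iff₀ hρ0, norm_mul, norm_sub_rev Y]
          calc _ = ‖(T.coeff (j+1) : C)‖ * (‖(y - c) ^ (j+1) - Y ^ (j+1)‖ * ρ) := by ring
            _ ≤ ‖(T.coeff (j+1) : C)‖ * (ρ ^ (j+1) * ‖(y - c) - Y‖) := by gcongr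
            _ = (‖(T.coeff (j+1) : C)‖ * ρ ^ (j+1)) * ‖(y - c) - Y‖ := by ring
            _ ≤ _ := by gcongr; exact hc2 (j+1)
    refine ⟨Y + c, add_mem _ hY (le_cl L _ c.2), ?_⟩
    rw [dist_comm, dist_eq_norm, show Y + c - y = Y - (y - c) by ring]
    exact hYε.trans_lt (hδ1.trans_le (min_le_left _ _))
  exact (cl_closed L _).closure_subset hcl

theorem ImmBase.main (h : ImmBase k1 L) (p : ℕ) [ExpChar C p] {x : C} (hx : x ∉ L) (α : C)
    (hα : IsSeparable (cl L x) α) (N : Subfield C) (hLN : L ≤ N) (hxN : x ∈ N) (hαN : α ∈ N)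
    (hNm : ∀ M : Subfield C, L ≤ M → x ∈ M → α ∈ M → N ≤ M) :
    ∃ y0 ∈ N, ∃ δ : ℝ, 0 < δ ∧ ∀ y ∈ N, ‖y - y0‖ < δ → N ≤ cl L y := by
  obtain ⟨y, hy, hxy, hαy, hyN⟩ := h.t_imm p _ hx α hα rfl
  have hNy : N ≤ cl L y := hNm _ (le_cl L y) hxy hαy
  by_cases hγ : ∃ γ > 0, ∀ c ∈ L, γ ≤ ‖y - c‖
  · obtain ⟨γ, hγ0, hγ⟩ := hγ
    have hyc := hyN N.topologicalClosure (isClosed_topologicalClosure _)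
      (hLN.trans (le_topologicalClosure _)) (le_topologicalClosure _ hxN)
      (le_topologicalClosure _ hαN)
    obtain ⟨y0, hy0, hd⟩ := Metric.mem_closure_iff.1 hyc γ hγ0
    refine ⟨y0, hy0, γ, hγ0, fun y' hy' hyy => ?_⟩
    have h1 : ‖y' - y‖ < γ := by
      rw [show y' - y = (y' - y0) + -(y - y0) by ring]
      exact um_lt hyy (by rw [norm_neg, ← dist_eq_norm]; exact hd)
    have := h.pert hγ (Subfield.sub_mem _ (hNy hy') (mem_cl L y)) h1
    rw [add_sub_cancel] at this
    exact hNy.trans (cl_le (cl_closed L y') (le_cl L y') this)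
  · push Not at hγ
    refine ⟨x, hxN, 1, one_pos, fun y' _ _ => hNy.trans ?_⟩
    refine cl_le (cl_closed L y') (le_cl L y') ((cl_closed L y').closure_subset ?_)
    rw [Metric.mem_closure_iff]
    intro ε hε
    obtain ⟨c, hc, hlt⟩ := hγ ε hε
    exact ⟨c, le_cl L y' hc, by rwa [dist_eq_norm]⟩
end TImm


section Abh
variable {C : Type*} [NormedField C] [IsUltrametricDist C]

theorem sum_dom (S : Finset C) (hS : InjOn (fun a : C => ‖a‖) S) (h0 : ∀ s ∈ S, s ≠ 0) (hne : S.Nonempty) :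
    ∃ s ∈ S, ‖∑ a ∈ S, a‖ = ‖s‖ ∧ ∀ a ∈ S, a ≠ s → ‖a‖ < ‖s‖ := by
  classical
  obtain ⟨s, hs, hm⟩ := exists_max_image S (fun a => ‖a‖) hne
  have hlt : ∀ a ∈ S, a ≠ s → ‖a‖ < ‖s‖ := fun a ha hn => lt_of_le_of_ne (hm a ha) fun e => hn (hS ha hs e)
  refine ⟨s, hs, ?_, hlt⟩
  rw [← add_sum_erase _ _ hs, um_eq]
  exact um_sum_lt (norm_pos_iff.2 (h0 s hs)) fun a ha => hlt a (mem_of_mem_erase ha) (ne_of_mem_erase ha)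

theorem nf (Z : Set C) (hZ : ∀ a ∈ Z, ∀ b ∈ Z, ‖a‖ = ‖b‖ → a + b = 0 ∨ a + b ∈ Z) (a : C)
    (ha : a ∈ AddSubmonoid.closure Z) :
    ∃ S : Finset C, (∀ s ∈ S, s ∈ Z) ∧ InjOn (fun a : C => ‖a‖) S ∧ a = ∑ s ∈ S, s := by
  classical
  have ins : ∀ n, ∀ S : Finset C, S.card = n → (∀ s ∈ S, s ∈ Z) → InjOn (fun a : C => ‖a‖) S → ∀ z ∈ Z,
      ∃ S' : Finset C, (∀ s ∈ S', s ∈ Z) ∧ InjOn (fun a : C => ‖a‖) S' ∧ z + ∑ s ∈ S, s = ∑ s ∈ S', s := by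
    intro n
    induction n with
    | zero =>
      intro S hS _ _ z hz
      rw [Finset.card_eq_zero] at hS; subst hS
      exact ⟨{z}, by simpa using hz, by simp, by simp⟩
    | succ n ih =>
      intro S hS hSZ hi z hz
      by_cases hc : ∃ s ∈ S, ‖s‖ = ‖z‖
      · obtain ⟨s, hs, hsz⟩ := hc
        have hsub : InjOn (fun a : C => ‖a‖) (S.erase s : Finset C) := hi.mono (Finset.erase_subset _ _)
        have hZ' : ∀ a ∈ S.erase s, a ∈ Z := fun a ha => hSZ a (mem_of_mem_erase ha)
        rcases hZ z hz s (hSZ s hs) hsz.symm with h0 | h1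
        · exact ⟨S.erase s, hZ', hsub, by rw [← add_sum_erase _ _ hs, ← add_assoc, h0, zero_add]⟩
        · obtain ⟨S', h1, h2, h3⟩ := ih (S.erase s) (by rw [Finset.card_erase_of_mem hs]; omega) hZ' hsub _ h1
          exact ⟨S', h1, h2, by rw [← h3, ← add_sum_erase _ _ hs, ← add_assoc]⟩
      · push Not at hc
        have hzS : z ∉ S := fun h => hc z h rfl
        refine ⟨insert z S, ?_, ?_, by rw [sum_insert hzS]⟩
        · intro s hs; rcases mem_insert.1 hs with rfl | h
          · exact hz
          · exact hSZ s h
        · rw [coe_insert, Set.injOn_insert (by exact_mod_cast hzS)]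
          refine ⟨hi, ?_⟩
          rintro ⟨s, hs, e⟩; exact hc s hs e
  induction ha using AddSubmonoid.closure_induction_left with
  | zero => exact ⟨∅, by simp, by simp, by simp⟩
  | add_left z hz y _ ih =>
    obtain ⟨S, h1, h2, rfl⟩ := ih
    exact ins _ S rfl h1 h2 z hz

theorem nf_norm (Z : Set C) (h0 : ∀ a ∈ Z, a ≠ 0) (hZ : ∀ a ∈ Z, ∀ b ∈ Z, ‖a‖ = ‖b‖ → a + b = 0 ∨ a + b ∈ Z) (a : C)
    (ha : a ∈ AddSubmonoid.closure Z) (ha0 : a ≠ 0) : ∃ z ∈ Z, ‖a‖ = ‖z‖ := by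
  obtain ⟨S, h1, h2, rfl⟩ := nf Z hZ a ha
  obtain ⟨s, hs, e, -⟩ := sum_dom S h2 (fun s hs => h0 s (h1 s hs)) (by
    rw [nonempty_iff_ne_empty]; rintro rfl; simp at ha0)
  exact ⟨s, h1 s hs, e⟩

theorem norm_closure (A : Set C) (P : ℝ → Prop) (hA : ∀ a ∈ A, a ≠ 0 → P ‖a‖) (a : C) (ha : a ∈ closure A) (ha0 : a ≠ 0) :
    P ‖a‖ := by
  obtain ⟨b, hb, hd⟩ := Metric.mem_closure_iff.1 ha ‖a‖ (norm_pos_iff.2 ha0)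
  rw [dist_eq_norm] at hd
  have := um_eq_of_sub hd
  rw [← this]; exact hA b hb (by rw [← norm_pos_iff, this]; exact norm_pos_iff.2 ha0)

theorem ac_mem {E : Type*} [Field E] (k : Subfield E) [IsAlgClosed k] (s : E) (hi : IsIntegral k s) : s ∈ k := by
  obtain ⟨a, rfl⟩ := minpoly.mem_range_of_degree_eq_one k s (IsAlgClosed.degree_eq_one_of_irreducible k (minpoly.irreducible hi))
  exact a.2

theorem root_mem {E : Type*} [Field E] (k : Subfield E) [IsAlgClosed k] (n : ℕ) (hn : n ≠ 0) (s : E) (h : s ^ n ∈ k) : s ∈ k := by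
  refine ac_mem k s ⟨X ^ n - Polynomial.C ⟨s ^ n, h⟩, monic_X_pow_sub_C _ hn, ?_⟩
  simp; rw [sub_eq_zero]; rfl

structure Abh (K1 W N : Subfield C) (T : Set C) (p : ℕ) : Prop where
  k1ac : IsAlgClosed K1
  wac : IsAlgClosed W
  k1N : K1 ≤ N
  NW : N ≤ W
  triv : Tr K1
  res : ∀ a : C, ‖a‖ ≤ 1 → ∃ c ∈ K1, ‖a - c‖ < 1
  TN : ∀ t ∈ T, t ∈ N
  T0 : ∀ t ∈ T, t ≠ 0
  mul : ∀ t ∈ T, ∀ s ∈ T, t * s ∈ T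
  inv : ∀ t ∈ T, t⁻¹ ∈ T
  K1T : ∀ c ∈ K1, c ≠ 0 → c ∈ T
  T1 : ∀ t ∈ T, ‖t‖ = 1 → t ∈ K1
  val : ∀ a ∈ N, a ≠ 0 → ∃ t ∈ T, ‖t‖ = ‖a‖
  dis : p.Prime → ∀ t ∈ T, ‖t‖ ≠ 1 → ∃ k : ℕ, ¬ ∃ r ∈ T, ‖r‖ ^ p ^ k = ‖t‖
  nt : ∃ t ∈ T, 1 < ‖t‖

def TT (T : Set C) : Set C := {s | s ≠ 0 ∧ ∃ n : ℕ, (n : C) ≠ 0 ∧ s ^ n ∈ T}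

variable {K1 W N : Subfield C} {T : Set C} {p : ℕ}

namespace Abh

theorem pow (h : Abh K1 W N T p) {t : C} (ht : t ∈ T) (n : ℕ) : t ^ n ∈ T := by
  induction n with
  | zero => rw [pow_zero]; exact h.K1T 1 (Subfield.one_mem _) one_ne_zero
  | succ n ih => rw [pow_succ]; exact h.mul _ ih _ ht

theorem zpow (h : Abh K1 W N T p) {t : C} (ht : t ∈ T) (n : ℤ) : t ^ n ∈ T := by
  cases n with
  | ofNat n => simpa using h.pow ht n
  | negSucc n => rw [zpow_negSucc]; exact h.inv _ (h.pow ht _)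

theorem sub (h : Abh K1 W N T p) : T ⊆ TT T := fun t ht => ⟨h.T0 t ht, 1, by simp, by simpa using ht⟩

theorem mulT (h : Abh K1 W N T p) {s u : C} (hs : s ∈ TT T) (hu : u ∈ TT T) : s * u ∈ TT T := by
  obtain ⟨hs0, n, hn, hsn⟩ := hs
  obtain ⟨hu0, m, hm, hum⟩ := hu
  refine ⟨mul_ne_zero hs0 hu0, n * m, by push_cast; exact mul_ne_zero hn hm, ?_⟩
  rw [mul_pow]
  refine h.mul _ ?_ _ ?_
  · rw [pow_mul]; exact h.pow hsn m
  · rw [mul_comm n m, pow_mul]; exact h.pow hum n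

theorem invT (h : Abh K1 W N T p) {s : C} (hs : s ∈ TT T) : s⁻¹ ∈ TT T := by
  obtain ⟨hs0, n, hn, hsn⟩ := hs
  exact ⟨inv_ne_zero hs0, n, hn, by rw [inv_pow]; exact h.inv _ hsn⟩

theorem powT (h : Abh K1 W N T p) {s : C} (hs : s ∈ TT T) (n : ℕ) : s ^ n ∈ TT T := by
  obtain ⟨hs0, m, hm, hsn⟩ := hs
  exact ⟨pow_ne_zero _ hs0, m, hm, by rw [← pow_mul, mul_comm, pow_mul]; exact h.pow hsn _⟩

theorem T1T (h : Abh K1 W N T p) {s : C} (hs : s ∈ TT T) (h1 : ‖s‖ = 1) : s ∈ K1 := by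
  haveI := h.k1ac
  obtain ⟨hs0, n, hn, hsn⟩ := hs
  exact root_mem K1 n (by rintro rfl; simp at hn) s (h.T1 _ hsn (by rw [norm_pow, h1, one_pow]))

theorem eqn (h : Abh K1 W N T p) {s u : C} (hs : s ∈ TT T) (hu : u ∈ TT T) (he : ‖s‖ = ‖u‖) :
    ∃ c ∈ K1, c ≠ 0 ∧ s = c * u := by
  refine ⟨s * u⁻¹, h.T1T (h.mulT hs (h.invT hu)) ?_, mul_ne_zero hs.1 (inv_ne_zero hu.1), ?_⟩
  · rw [norm_mul, norm_inv, he, mul_inv_cancel₀ (norm_ne_zero_iff.2 hu.1)]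
  · rw [inv_mul_cancel_right₀ hu.1]

theorem rootT (h : Abh K1 W N T p) {s : C} (hs : s ∈ TT T) (n : ℕ) (hn : (n : C) ≠ 0) : ∃ u ∈ TT T, ‖u‖ ^ n = ‖s‖ := by
  haveI := h.wac
  have hn0 : n ≠ 0 := by rintro rfl; simp at hn
  obtain ⟨hs0, m, hm, hsm⟩ := hs
  have hsW : s ∈ W := root_mem W m (by rintro rfl; simp at hm) s (h.NW (h.TN _ hsm))
  obtain ⟨u, hu⟩ := IsAlgClosed.exists_pow_nat_eq (⟨s, hsW⟩ : W) (Nat.pos_of_ne_zero hn0)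
  have hu : (u : C) ^ n = s := congrArg Subtype.val hu
  refine ⟨u, ⟨?_, n * m, by push_cast; exact mul_ne_zero hn hm, ?_⟩, by rw [← norm_pow, hu]⟩
  · rintro h0; rw [h0, zero_pow hn0] at hu; exact hs0 hu.symm
  · rw [pow_mul, hu]; exact hsm

theorem mergeD (h : Abh K1 W N T p) (a : C) (ha : ∃ n ∈ N, n ≠ 0 ∧ ∃ s ∈ TT T, a = n * s) (b : C)
    (hb : ∃ n ∈ N, n ≠ 0 ∧ ∃ s ∈ TT T, b = n * s) (hab : ‖a‖ = ‖b‖) :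
    a + b = 0 ∨ ∃ n ∈ N, n ≠ 0 ∧ ∃ s ∈ TT T, a + b = n * s := by
  obtain ⟨n, hn, hn0, s, hs, rfl⟩ := ha
  obtain ⟨m, hm, hm0, u, hu, rfl⟩ := hb
  obtain ⟨t, ht, htn⟩ := h.val n hn hn0
  obtain ⟨t', ht', htn'⟩ := h.val m hm hm0
  obtain ⟨c, hc, hc0, e⟩ := h.eqn (h.mulT (h.sub ht') hu) (h.mulT (h.sub ht) hs) (by
    rw [norm_mul, norm_mul, htn, htn', ← norm_mul, ← norm_mul, hab])
  have hu' : u = t'⁻¹ * c * t * s := by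
    have := h.T0 t' ht'; field_simp; linear_combination e
  have hN : n + m * (t'⁻¹ * c * t) ∈ N := N.add_mem hn (N.mul_mem hm (N.mul_mem (N.mul_mem (N.inv_mem (h.TN _ ht'))
    (h.k1N hc)) (h.TN _ ht)))
  have e2 : n * s + m * u = (n + m * (t'⁻¹ * c * t)) * s := by rw [hu']; ring
  by_cases h0 : n + m * (t'⁻¹ * c * t) = 0
  · left; rw [e2, h0, zero_mul]
  · exact Or.inr ⟨_, hN, h0, s, hs, e2⟩

theorem mergeT (h : Abh K1 W N T p) (a : C) (ha : a ∈ TT T) (b : C) (hb : b ∈ TT T) (hab : ‖a‖ = ‖b‖) :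
    a + b = 0 ∨ (a + b ∈ TT T ∧ ‖a + b‖ = ‖a‖) := by
  obtain ⟨c, hc, hc0, rfl⟩ := h.eqn ha hb hab
  by_cases h0 : c + 1 = 0
  · left; rw [← add_one_mul, h0, zero_mul]
  · right
    have hc1 : c + 1 ∈ K1 := K1.add_mem hc K1.one_mem
    rw [← add_one_mul]
    refine ⟨h.mulT (h.sub (h.K1T _ hc1 h0)) hb, ?_⟩
    rw [norm_mul, norm_mul, h.triv _ hc1 h0, h.triv _ hc hc0]

theorem negT (h : Abh K1 W N T p) {s : C} (hs : s ∈ TT T) : -s ∈ TT T := by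
  rw [← neg_one_mul]
  exact h.mulT (h.sub (h.K1T _ (K1.neg_mem K1.one_mem) (by simp))) hs

end Abh

theorem ring_cl' (Z : Set C) (hm : ∀ a ∈ Z, ∀ b ∈ Z, a * b ∈ Z) (h1 : (1 : C) ∈ Z) (hn : ∀ a ∈ Z, -a ∈ Z) :
    (Subring.closure Z : Set C) = AddSubmonoid.closure Z := by
  let A : Subring C :=
    { AddSubmonoid.closure Z with
      one_mem' := AddSubmonoid.subset_closure h1
      mul_mem' := fun {a b} ha hb => by
        refine AddSubmonoid.closure_induction₂ (motive := fun a b _ _ => a * b ∈ AddSubmonoid.closure Z) ?_ ?_ ?_ ?_ ?_ ha hb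
        · exact fun x y hx hy => AddSubmonoid.subset_closure (hm x hx y hy)
        · intro x _; simp
        · intro x _; simp
        · intro x y z _ _ _ h1 h2; rw [add_mul]; exact add_mem h1 h2
        · intro x y z _ _ _ h1 h2; rw [mul_add]; exact add_mem h1 h2
      neg_mem' := fun {a} ha => by
        refine AddSubmonoid.closure_induction (motive := fun a _ => -a ∈ AddSubmonoid.closure Z) ?_ ?_ ?_ ha
        · exact fun x hx => AddSubmonoid.subset_closure (hn x hx)
        · simp
        · intro x y _ _ h1 h2; rw [neg_add]; exact add_mem h1 h2 }
  apply Subset.antisymm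
  · have : Subring.closure Z ≤ A := Subring.closure_le.2 AddSubmonoid.subset_closure
    exact this
  · intro a ha
    refine AddSubmonoid.closure_induction (motive := fun a _ => a ∈ Subring.closure Z) ?_ ?_ ?_ ha
    · exact fun x hx => Subring.subset_closure hx
    · exact Subring.zero_mem _
    · exact fun x y _ _ h1 h2 => Subring.add_mem _ h1 h2

def MM (T : Set C) : Subfield C := (Subfield.closure (TT T)).topologicalClosure

theorem MM_closed (T : Set C) : IsClosed (MM T : Set C) := isClosed_topologicalClosure _
theorem TT_MM (T : Set C) {s : C} (hs : s ∈ TT T) : s ∈ MM T :=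
  le_topologicalClosure _ (Subfield.subset_closure hs)

namespace Abh

theorem ring_cl (h : Abh K1 W N T p) : (Subring.closure (TT T) : Set C) = AddSubmonoid.closure (TT T) :=
  ring_cl' _ (fun a ha b hb => h.mulT ha hb) (h.sub (h.K1T 1 K1.one_mem one_ne_zero)) fun _ => h.negT

theorem dense (h : Abh K1 W N T p) : (MM T : Set C) ⊆ closure (AddSubmonoid.closure (TT T) : Set C) := by
  classical
  rw [← h.ring_cl]
  let A' := (Subring.closure (TT T)).topologicalClosure
  have hA' : IsClosed (A' : Set C) := Subring.isClosed_topologicalClosure _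
  have hAA : Subring.closure (TT T) ≤ A' := Subring.le_topologicalClosure _
  have hinv : ∀ z ∈ Subring.closure (TT T), z⁻¹ ∈ A' := by
    intro z hz
    have hz' : z ∈ AddSubmonoid.closure (TT T) := by
      have := h.ring_cl; rw [Set.ext_iff] at this; exact (this z).1 hz
    by_cases hz0 : z = 0
    · rw [hz0, inv_zero]; exact A'.zero_mem
    obtain ⟨S, h1, h2, e⟩ := nf (TT T) (fun a ha b hb hab => (h.mergeT a ha b hb hab).imp_right And.left) z hz'
    obtain ⟨s, hs, hn, hlt⟩ := sum_dom S h2 (fun s hs => (h1 s hs).1) (by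
      rw [nonempty_iff_ne_empty]; rintro rfl; simp at e; exact hz0 e)
    have hs0 := (h1 s hs).1
    have hsn := norm_pos_iff.2 hs0
    have hq : ‖1 - z / s‖ < 1 := by
      have : 1 - z / s = (-(∑ a ∈ S.erase s, a)) / s := by
        rw [e, ← add_sum_erase _ _ hs]; field_simp; ring
      rw [this, norm_div, norm_neg, div_lt_one hsn]
      exact um_sum_lt hsn fun a ha => hlt a (mem_of_mem_erase ha) (ne_of_mem_erase ha)
    have hsA : s⁻¹ ∈ A' := hAA (Subring.subset_closure (h.invT (h1 s hs)))
    have h3 : z⁻¹ = s⁻¹ * ∑' n : ℕ, (1 - z / s) ^ n := by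
      rw [tsum_geometric_of_norm_lt_one hq, ← mul_inv]
      congr 1; field_simp; ring
    rw [h3]
    refine A'.mul_mem hsA ?_
    refine hA'.mem_of_tendsto (summable_geometric_of_norm_lt_one hq).hasSum.tendsto_sum_nat
      (Filter.Eventually.of_forall fun n => A'.sum_mem fun i _ => A'.pow_mem ?_ _)
    rw [div_eq_mul_inv]
    exact A'.sub_mem A'.one_mem (A'.mul_mem (hAA hz) hsA)
  refine closure_minimal ?_ hA'
  intro a ha
  obtain ⟨y, hy, z, hz, rfl⟩ := Subfield.mem_closure_iff.1 ha
  rw [div_eq_mul_inv]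
  exact A'.mul_mem (hAA hy) (hinv z hz)

theorem normM (h : Abh K1 W N T p) {a : C} (ha : a ∈ MM T) (ha0 : a ≠ 0) : ∃ s ∈ TT T, ‖a‖ = ‖s‖ :=
  norm_closure _ (fun r => ∃ s ∈ TT T, r = ‖s‖) (fun a ha ha0 => nf_norm (TT T) (fun a ha => ha.1)
    (fun a ha b hb hab => (h.mergeT a ha b hb hab).imp_right And.left) a ha ha0) a (h.dense ha) ha0

end Abh
end Abh

section Abh
variable {C : Type*} [NontriviallyNormedField C] [CompleteSpace C] [IsUltrametricDist C]
variable {K1 W N : Subfield C} {T : Set C} {p : ℕ}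

theorem sep_up {E : Type*} [Field E] {A B : Subfield E} (hAB : A ≤ B) {b : E} (hb : IsSeparable A b) : IsSeparable B b := by
  letI : Algebra A B := (inclusion hAB).toAlgebra
  haveI : IsScalarTower A B E := .of_algebraMap_eq fun x => rfl
  exact IsSeparable.tower_top B hb

namespace Abh
theorem disT (h : Abh K1 W N T p) (hp : p.Prime) [CharP C p] {s : C} (hs : s ∈ TT T) (h1 : ‖s‖ ≠ 1) :
    ∃ k : ℕ, ¬ ∃ r ∈ TT T, ‖r‖ ^ p ^ k = ‖s‖ := by
  obtain ⟨hs0, n, hn, hsn⟩ := hs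
  have hn0 : n ≠ 0 := by rintro rfl; simp at hn
  obtain ⟨k, hk⟩ := h.dis hp _ hsn (by
    rw [norm_pow]; exact fun e => h1 ((pow_eq_one_iff_of_nonneg (norm_nonneg _) hn0).1 e))
  refine ⟨k, ?_⟩
  rintro ⟨r, ⟨hr0, m, hm, hrm⟩, hr⟩
  apply hk
  have hcop : IsCoprime (m : ℤ) ((p ^ k : ℕ) : ℤ) := by
    rw [Nat.isCoprime_iff_coprime]
    refine Nat.Coprime.pow_right _ (Nat.Coprime.symm ((Nat.Prime.coprime_iff_not_dvd hp).2 fun hd => hm ?_))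
    exact (CharP.cast_eq_zero_iff C p m).2 hd
  obtain ⟨a, b, hab⟩ := hcop
  refine ⟨(r ^ m) ^ ((n : ℤ) * a) * (s ^ n) ^ b, h.mul _ (h.zpow hrm _) _ (h.zpow hsn _), ?_⟩
  have hr' : ‖r‖ ≠ 0 := norm_ne_zero_iff.2 hr0
  simp only [norm_mul, norm_zpow, norm_pow, ← hr]
  rw [mul_pow]
  simp only [← zpow_natCast, ← zpow_mul]
  rw [← zpow_add₀ hr']
  congr 1
  linear_combination ((p ^ k : ℕ) : ℤ) * n * hab

def Z1 (T : Set C) (p : ℕ) : Set C := {r | r ∈ TT T ∧ 1 < ‖r‖ ∧ ¬ ∃ u ∈ TT T, ‖u‖ ^ p = ‖r‖}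

theorem redT (h : Abh K1 W N T p) (hp : p.Prime) [CharP C p] {s : C} (hs : s ∈ TT T) :
    ∃ r0, (r0 = 0 ∨ r0 ∈ Z1 T p) ∧ ∃ w ∈ MM T, s = r0 + (w ^ p - w) := by
  haveI := h.k1ac
  haveI : Fact p.Prime := ⟨hp⟩
  have big : ∀ k : ℕ, ∀ s ∈ TT T, 1 < ‖s‖ → (¬ ∃ r ∈ TT T, ‖r‖ ^ p ^ k = ‖s‖) →
      ∃ r0, (r0 = 0 ∨ r0 ∈ Z1 T p) ∧ ∃ w ∈ MM T, s = r0 + (w ^ p - w) := by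
    intro k
    induction k with
    | zero => intro s hs _ hn; exact absurd ⟨s, hs, by simp⟩ hn
    | succ k ih =>
      intro s hs h1 hn
      by_cases hz : ∃ u ∈ TT T, ‖u‖ ^ p = ‖s‖
      · obtain ⟨u, hu, e⟩ := hz
        obtain ⟨c, hc, hc0, e2⟩ := h.eqn hs (h.powT hu p) (by rw [norm_pow, e])
        obtain ⟨d, hd⟩ := IsAlgClosed.exists_pow_nat_eq (⟨c, hc⟩ : K1) hp.pos
        have hd : (d : C) ^ p = c := congrArg Subtype.val hd
        have hd0 : (d : C) ≠ 0 := by rintro h0; rw [h0, zero_pow hp.ne_zero] at hd; exact hc0 hd.symm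
        have hr : (d : C) * u ∈ TT T := h.mulT (h.sub (h.K1T _ d.2 hd0)) hu
        have hsr : s = ((d : C) * u) ^ p := by rw [mul_pow, hd, e2]
        obtain ⟨r0, hr0, w, hw, e3⟩ := ih _ hr (by
          by_contra hh; push Not at hh
          rw [hsr, norm_pow] at h1
          exact absurd h1 (not_lt.2 (pow_le_one₀ (norm_nonneg _) hh))) (by
          rintro ⟨r, hrT, er⟩
          exact hn ⟨r, hrT, by rw [pow_succ, pow_mul, er, hsr, norm_pow]⟩)
        refine ⟨r0, hr0, w + d * u, add_mem hw (TT_MM T hr), ?_⟩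
        rw [add_pow_char, ← hsr]
        linear_combination e3
      · exact ⟨s, Or.inr ⟨hs, h1, hz⟩, 0, zero_mem _, by simp [hp.ne_zero]⟩
  rcases lt_trichotomy ‖s‖ 1 with h1 | h1 | h1
  · obtain ⟨w, hw, e⟩ := as_small (MM T) (MM_closed T) p hp s (TT_MM T hs) h1
    exact ⟨0, Or.inl rfl, w, hw, by rw [e, zero_add]⟩
  · have hsK := h.T1T hs h1
    obtain ⟨w, hw⟩ := IsAlgClosed.exists_root (X ^ p - X - Polynomial.C (⟨s, hsK⟩ : K1)) (by
      have : (X ^ p - X - Polynomial.C (⟨s, hsK⟩ : K1)).natDegree = p := by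
        have := hp.one_lt
        rw [sub_sub, natDegree_sub_eq_left_of_natDegree_lt] <;> simp [natDegree_X_pow]; omega
      intro h0; rw [natDegree_eq_of_degree_eq_some h0] at this; exact hp.ne_zero this.symm)
    rw [IsRoot, eval_sub, eval_sub, eval_pow, eval_X, eval_C, sub_eq_zero] at hw
    have hw : (w : C) ^ p - w = s := congrArg Subtype.val hw
    refine ⟨0, Or.inl rfl, w, ?_, by rw [hw, zero_add]⟩
    by_cases hw0 : (w : C) = 0
    · rw [hw0]; exact zero_mem _
    · exact TT_MM T (h.sub (h.K1T _ w.2 hw0))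
  · obtain ⟨k, hk⟩ := h.disT hp hs h1.ne'
    exact big k s hs h1 hk

theorem redS (h : Abh K1 W N T p) (hp : p.Prime) [CharP C p] {g : C} (hg : g ∈ AddSubmonoid.closure (TT T)) :
    ∃ g' ∈ AddSubmonoid.closure (Z1 T p), ∃ w ∈ MM T, g = g' + (w ^ p - w) := by
  haveI : Fact p.Prime := ⟨hp⟩
  induction hg using AddSubmonoid.closure_induction with
  | mem s hs =>
    obtain ⟨r, hr, w, hw, e⟩ := h.redT hp hs
    refine ⟨r, ?_, w, hw, e⟩
    rcases hr with rfl | hr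
    · exact zero_mem _
    · exact AddSubmonoid.subset_closure hr
  | zero => exact ⟨0, zero_mem _, 0, zero_mem _, by simp [hp.ne_zero]⟩
  | add x y _ _ h1 h2 =>
    obtain ⟨r, hr, w, hw, rfl⟩ := h1
    obtain ⟨r', hr', w', hw', rfl⟩ := h2
    exact ⟨r + r', add_mem hr hr', w + w', add_mem hw hw', by rw [add_pow_char]; ring⟩

theorem normD (h : Abh K1 W N T p) {b : C} (hbN : b ∈ N) (hb : IsIntegral (MM T) b) {z : C}
    (hz : z ∈ adjoin (MM T) {b}) (hz0 : z ≠ 0) : ∃ u ∈ TT T, ‖z‖ = ‖u‖ := by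
  let Z : Set C := {a | ∃ n ∈ N, n ≠ 0 ∧ ∃ s ∈ TT T, a = n * s}
  have h1T : (1 : C) ∈ TT T := h.sub (h.K1T 1 K1.one_mem one_ne_zero)
  have hr := ring_cl' Z (by
    rintro _ ⟨n, hn, hn0, s, hs, rfl⟩ _ ⟨n', hn', hn0', s', hs', rfl⟩
    exact ⟨n * n', mul_mem hn hn', mul_ne_zero hn0 hn0', s * s', h.mulT hs hs', by ring⟩)
    ⟨1, one_mem _, one_ne_zero, 1, h1T, by simp⟩ (by
    rintro _ ⟨n, hn, hn0, s, hs, rfl⟩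
    exact ⟨-n, neg_mem hn, neg_ne_zero.2 hn0, s, hs, by ring⟩)
  let D := (Subring.closure Z).topologicalClosure
  have hD : Subring.closure Z ≤ D := Subring.le_topologicalClosure _
  have hMD : ∀ a ∈ MM T, a ∈ D := by
    intro a ha
    refine closure_minimal (t := (D : Set C)) ?_ (Subring.isClosed_topologicalClosure _) (h.dense ha)
    rw [← h.ring_cl]
    have : Subring.closure (TT T) ≤ D := Subring.closure_le.2 fun s hs => hD (Subring.subset_closure
      ⟨1, one_mem _, one_ne_zero, s, hs, by simp⟩)
    exact this
  have hbD : b ∈ D := by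
    by_cases hb0 : b = 0
    · rw [hb0]; exact zero_mem _
    · exact hD (Subring.subset_closure ⟨b, hbN, hb0, 1, h1T, by simp⟩)
  have hzD : z ∈ D := by
    rw [← IntermediateField.mem_toSubalgebra, IntermediateField.adjoin_simple_toSubalgebra_of_isAlgebraic hb.isAlgebraic] at hz
    induction hz using Algebra.adjoin_induction with
    | mem x hx => rw [Set.mem_singleton_iff.1 hx]; exact hbD
    | algebraMap r => exact hMD _ r.2
    | add x y _ _ h1 h2 => 
      by_cases hx : x = 0
      · by_cases hy : y = 0
        · rw [hx, hy, add_zero]; exact zero_mem _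
        · rw [hx, zero_add]; exact h2 hy
      · by_cases hy : y = 0
        · rw [hy, add_zero]; exact h1 hx
        · exact add_mem (h1 hx) (h2 hy)
    | mul x y _ _ h1 h2 => exact mul_mem (h1 (left_ne_zero_of_mul hz0)) (h2 (right_ne_zero_of_mul hz0))
  refine norm_closure (AddSubmonoid.closure Z : Set C) (fun r => ∃ u ∈ TT T, r = ‖u‖) ?_ z ?_ hz0
  · intro a ha ha0
    obtain ⟨_, ⟨n, hn, hn0, s, hs, rfl⟩, e⟩ := nf_norm Z (by
      rintro _ ⟨n, hn, hn0, s, hs, rfl⟩; exact mul_ne_zero hn0 hs.1) h.mergeD a ha ha0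
    obtain ⟨t, ht, et⟩ := h.val n hn hn0
    exact ⟨t * s, h.mulT (h.sub ht) hs, by rw [e, norm_mul, norm_mul, et]⟩
  · rw [← hr]; exact hzD

theorem memMM (h : Abh K1 W N T p) [ExpChar C p] {b : C} (hbN : b ∈ N) (hb : IsSeparable (Subfield.closure T) b) :
    b ∈ MM T := by
  have hTM : Subfield.closure T ≤ MM T := (Subfield.closure_mono h.sub).trans (le_topologicalClosure _)
  have hb' := sep_up hTM hb
  by_contra hbM
  obtain ⟨hp, z, hz, hzM, hf⟩ := PG' (MM T) (MM_closed T) (by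
    obtain ⟨t, ht, h1⟩ := h.nt; exact ⟨t, TT_MM T (h.sub ht), h1⟩) K1 h.k1ac (by
    intro c hc
    by_cases hc0 : c = 0
    · rw [hc0]; exact zero_mem _
    · exact TT_MM T (h.sub (h.K1T _ hc hc0))) h.triv h.res (by
    intro n hn a ha ha0
    obtain ⟨s, hs, e⟩ := h.normM ha ha0
    obtain ⟨u, hu, e2⟩ := h.rootT hs n hn
    exact ⟨u, TT_MM T hu, by rw [e2, e]⟩) p b hb' hbM
  haveI : Fact p.Prime := ⟨hp⟩
  haveI : CharP C p := by
    rcases ‹ExpChar C p› with _ | _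
    · exact absurd hp (by norm_num)
    · assumption
  obtain ⟨g, hg, hd⟩ := Metric.mem_closure_iff.1 (h.dense hf) 1 one_pos
  rw [dist_eq_norm] at hd
  have hgM : g ∈ MM T := by
    have : (AddSubmonoid.closure (TT T)) ≤ (MM T).toAddSubgroup.toAddSubmonoid := AddSubmonoid.closure_le.2 fun s hs => TT_MM T hs
    exact this hg
  obtain ⟨w1, hw1, e1⟩ := as_small (MM T) (MM_closed T) p hp _ (sub_mem hf hgM) hd
  obtain ⟨g', hg', w2, hw2, e2⟩ := h.redS hp hg
  have hw : w1 + w2 ∈ MM T := add_mem hw1 hw2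
  have e3 : (z - (w1 + w2)) ^ p - (z - (w1 + w2)) = g' := by
    rw [sub_pow_char, add_pow_char]; linear_combination (-1 : C) * e1 + e2
  by_cases hg0 : g' = 0
  · refine hzM ?_
    have := as_unique (MM T) p hp (z - (w1 + w2)) 0 (zero_mem _) (by rw [e3, hg0]; simp [hp.ne_zero])
    simpa using add_mem this hw
  · obtain ⟨r, ⟨hrT, hr1, hrn⟩, er⟩ := nf_norm (Z1 T p) (fun a ha => ha.1.1) (by
      intro a ha b hb hab
      rcases h.mergeT a ha.1 b hb.1 hab with h0 | ⟨h1, h2⟩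
      · exact Or.inl h0
      · exact Or.inr ⟨h1, by rw [h2]; exact ha.2.1, by rw [h2]; exact ha.2.2⟩) g' hg' hg0
    set z' := z - (w1 + w2) with hz'
    have hz1 : 1 < ‖z'‖ := by
      by_contra hh; push Not at hh
      rw [← er, ← e3] at hr1
      refine absurd hr1 (not_lt.2 (um_sub_le ?_ hh))
      rw [norm_pow]; exact pow_le_one₀ (norm_nonneg _) hh
    have hzp : ‖z'‖ ^ p = ‖r‖ := by
      rw [← er, ← e3, sub_eq_add_neg, um_eq, norm_pow]
      rw [norm_neg, norm_pow]
      exact lt_self_pow₀ hz1 hp.one_lt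
    have hzm : z' ∈ adjoin (MM T) {b} :=
      sub_mem hz ((adjoin (MM T) {b}).algebraMap_mem (⟨w1 + w2, hw⟩ : MM T))
    obtain ⟨u, hu, eu⟩ := h.normD hbN hb'.isIntegral hzm (by rw [← norm_pos_iff]; linarith)
    exact hrn ⟨u, hu, by rw [← eu, hzp]⟩

theorem main (h : Abh K1 W N T p) [ExpChar C p] {b : C} (hbN : b ∈ N) (hb : IsSeparable (Subfield.closure T) b) :
    b ∈ closure (AddSubmonoid.closure T : Set C) := by
  classical
  have hb' := h.dense (h.memMM hbN hb)
  rw [Metric.mem_closure_iff] at hb' ⊢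
  intro ε hε
  obtain ⟨g, hg, hd⟩ := hb' ε hε
  rw [dist_eq_norm] at hd
  obtain ⟨S, h1, h2, e⟩ := nf (TT T) (fun a ha b hb hab => (h.mergeT a ha b hb hab).imp_right And.left) g hg
  refine ⟨∑ s ∈ S with s ∈ T, s, sum_mem fun s hs => AddSubmonoid.subset_closure (mem_filter.1 hs).2, ?_⟩
  rw [dist_eq_norm]
  have hsp := Finset.sum_filter_add_sum_filter_not S (· ∈ T) (fun s => s)
  set g1 := ∑ s ∈ S with s ∈ T, s
  set S2 := S.filter (· ∉ T)
  rw [← hsp] at e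
  by_cases hne : S2 = ∅
  · rw [hne, Finset.sum_empty, add_zero] at e; rwa [← e]
  obtain ⟨s, hs, es, -⟩ := sum_dom S2 (h2.mono (by exact_mod_cast Finset.filter_subset _ _)) (fun s hs =>
    (h1 s (mem_filter.1 hs).1).1) (nonempty_iff_ne_empty.2 hne)
  have hs' := mem_filter.1 hs
  by_cases hb0 : b - g1 = 0
  · rw [hb0, norm_zero]; exact hε
  obtain ⟨t, ht, et⟩ := h.val (b - g1) (sub_mem hbN (sum_mem fun s hs => h.TN _ (mem_filter.1 hs).2)) hb0
  have hneq : ‖∑ s ∈ S2, s‖ ≠ ‖b - g1‖ := by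
    intro hh
    rw [es, ← et] at hh
    obtain ⟨c, hc, hc0, e4⟩ := h.eqn (h1 s hs'.1) (h.sub ht) hh
    exact hs'.2 (by rw [e4]; exact h.mul _ (h.K1T _ hc hc0) _ ht)
  refine lt_of_le_of_lt ?_ hd
  rw [e, ← sub_sub]
  generalize b - g1 = β at *
  rcases lt_or_gt_of_ne hneq with hl | hl
  · rw [sub_eq_add_neg, um_eq]; rwa [norm_neg]
  · rw [sub_eq_neg_add, um_eq, norm_neg]; exact hl.le
    rwa [norm_neg]
end Abh
end Abh

section Et
variable {U : Type*} [NormedField U] [IsUltrametricDist U]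

inductive Et (R G : Set U) : U → Prop
  | base {b : U} (hb : b ∈ R) : Et R G b
  | add {a b : U} (ha : Et R G a) (hb : Et R G b) : Et R G (a + b)
  | mul {a b : U} (ha : Et R G a) (hb : Et R G b) : Et R G (a * b)
  | root (g : U[X]) (η : U) (hg : ∀ i, Et R G (g.coeff i)) (hG : η ∈ G) (h1 : ‖η‖ ≤ 1) (h0 : g.eval η = 0)
      (hd : ‖g.derivative.eval η‖ = 1) : Et R G η

namespace Et
variable {R R' G G' : Set U} {a b : U}

theorem trans (hG : G ⊆ G') (h : ∀ r ∈ R, Et R' G' r) (hb : Et R G b) : Et R' G' b := by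
  induction hb with
  | base hb => exact h _ hb
  | add _ _ h1 h2 => exact h1.add h2
  | mul _ _ h1 h2 => exact h1.mul h2
  | root g η _ h2 h3 h4 h5 h6 => exact root g η h6 (hG h2) h3 h4 h5

theorem mono (hR : R ⊆ R') (hG : G ⊆ G') (hb : Et R G b) : Et R' G' b := trans hG (fun _ hr => base (hR hr)) hb

theorem le_one (h : ∀ r ∈ R, ‖r‖ ≤ 1) (hb : Et R G b) : ‖b‖ ≤ 1 := by
  induction hb with
  | base hb => exact h _ hb
  | add _ _ h1 h2 => exact um_le h1 h2
  | mul _ _ h1 h2 => rw [norm_mul]; exact mul_le_one₀ h1 (norm_nonneg _) h2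
  | root g η _ h2 h3 h4 h5 h6 => exact h3

theorem mem (D : Subfield U) (hR : R ⊆ D) (hG : G ⊆ D) (hb : Et R G b) : b ∈ D := by
  induction hb with
  | base hb => exact hR hb
  | add _ _ h1 h2 => exact add_mem h1 h2
  | mul _ _ h1 h2 => exact mul_mem h1 h2
  | root g η _ h2 h3 h4 h5 h6 => exact hG h2

theorem fin (hb : Et R G b) : ∃ R0 G0 : Finset U, (R0 : Set U) ⊆ insert 0 R ∧ (G0 : Set U) ⊆ G ∧ Et (R0 : Set U) G0 b := by
  classical
  induction hb with
  | @base b hb => exact ⟨{b}, ∅, by simpa using Or.inr hb, by simp, base (by simp)⟩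
  | add _ _ h1 h2 =>
    obtain ⟨R1, G1, a1, b1, e1⟩ := h1
    obtain ⟨R2, G2, a2, b2, e2⟩ := h2
    exact ⟨R1 ∪ R2, G1 ∪ G2, by simp [a1, a2], by simp [b1, b2], (e1.mono (by simp) (by simp)).add (e2.mono (by simp) (by simp))⟩
  | mul _ _ h1 h2 =>
    obtain ⟨R1, G1, a1, b1, e1⟩ := h1
    obtain ⟨R2, G2, a2, b2, e2⟩ := h2
    exact ⟨R1 ∪ R2, G1 ∪ G2, by simp [a1, a2], by simp [b1, b2], (e1.mono (by simp) (by simp)).mul (e2.mono (by simp) (by simp))⟩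
  | root g η _ h2 h3 h4 h5 h6 =>
    choose R1 G1 a1 b1 e1 using h6
    refine ⟨insert 0 (g.support.biUnion R1), insert η (g.support.biUnion G1), ?_, ?_, root g η ?_ (by simp) h3 h4 h5⟩
    · simp only [coe_insert, coe_biUnion]
      exact Set.insert_subset (Set.mem_insert _ _) (iUnion₂_subset fun i _ => a1 i)
    · simp only [coe_insert, coe_biUnion]
      exact Set.insert_subset h2 (iUnion₂_subset fun i _ => b1 i)
    · intro i
      by_cases hi : i ∈ g.support
      · refine (e1 i).mono ?_ ?_ <;> push_cast
        · exact (subset_biUnion_of_mem (u := fun i => (R1 i : Set U)) hi).trans (Set.subset_insert _ _)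
        · exact (subset_biUnion_of_mem (u := fun i => (G1 i : Set U)) hi).trans (Set.subset_insert _ _)
      · rw [notMem_support_iff.1 hi]; exact base (by simp)

theorem finM {B : Finset U} (hB : ∀ b ∈ B, Et R G b) :
    ∃ R0 G0 : Finset U, (R0 : Set U) ⊆ insert 0 R ∧ (G0 : Set U) ⊆ G ∧ ∀ b ∈ B, Et (R0 : Set U) G0 b := by
  classical
  choose! R1 G1 a1 b1 e1 using fun b hb => (hB b hb).fin
  refine ⟨B.biUnion R1, B.biUnion G1, ?_, ?_, fun b hb => (e1 b hb).mono ?_ ?_⟩ <;> push_cast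
  · exact iUnion₂_subset a1
  · exact iUnion₂_subset b1
  · exact subset_biUnion_of_mem (u := fun i => (R1 i : Set U)) hb
  · exact subset_biUnion_of_mem (u := fun i => (G1 i : Set U)) hb

theorem pow (h1 : (1 : U) ∈ R) (ha : Et R G a) (n : ℕ) : Et R G (a ^ n) := by
  induction n with
  | zero => rw [pow_zero]; exact base h1
  | succ n ih => rw [pow_succ]; exact ih.mul ha

theorem sum (h0 : (0 : U) ∈ R) {ι : Type*} (s : Finset ι) (f : ι → U) (h : ∀ i ∈ s, Et R G (f i)) : Et R G (∑ i ∈ s, f i) :=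
  Finset.sum_induction f (Et R G) (fun _ _ => add) (base h0) h

theorem inv (h0 : (0 : U) ∈ R) (hn : (-1 : U) ∈ R) (ha : Et R G a) (h1 : ‖a‖ = 1) (haG : a⁻¹ ∈ G) : Et R G a⁻¹ := by
  have ha0 : a ≠ 0 := by rintro rfl; simp at h1
  refine root (Polynomial.C a * X + Polynomial.C (-1)) a⁻¹ ?_ haG (by rw [norm_inv, h1, inv_one]) (by simp [ha0]) (by simpa using h1)
  intro i
  rw [coeff_add, coeff_C_mul, coeff_X, coeff_C]
  refine add ?_ ?_
  · split_ifs
    · simpa using ha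
    · simpa using base h0
  · split_ifs
    · exact base hn
    · exact base h0

end Et

theorem eval_le_one (g : U[X]) (hg : ∀ i, ‖g.coeff i‖ ≤ 1) (b : U) (hb : ‖b‖ ≤ 1) : ‖g.eval b‖ ≤ 1 := by
  rw [eval_eq_sum_range]
  refine um_sum_le zero_le_one fun i _ => ?_
  rw [norm_mul, norm_pow]
  exact mul_le_one₀ (hg i) (by positivity) (pow_le_one₀ (norm_nonneg _) hb)

theorem taylor_le_one (g : U[X]) (hg : ∀ i, ‖g.coeff i‖ ≤ 1) (e : U) (he : ‖e‖ ≤ 1) (j : ℕ) : ‖(taylor e g).coeff j‖ ≤ 1 := by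
  rw [taylor_coeff]
  refine eval_le_one _ (fun i => ?_) e he
  rw [hasseDeriv_coeff, norm_mul]
  refine mul_le_one₀ ?_ (norm_nonneg _) (hg _)
  exact norm_natCast_le_one U _

theorem newton (E : Subfield U) {G : Set U} (hG : (E : Set U) ⊆ G) (hGc : ∀ g ∈ G, ∀ e ∈ E, ∀ c ∈ E, (g - e) / c ∈ G)
    {b : U} (hbG : b ∈ G) (hb1 : ‖b‖ ≤ 1)
    (hs : IsSeparable E b) (hl : ∀ ε > 0, ∃ e ∈ E, ‖b - e‖ < ε) : Et {e | e ∈ E ∧ ‖e‖ ≤ 1} G b := by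
  obtain ⟨g, hg1, hg0, hgd⟩ : ∃ g : E[X], (∀ i, ‖((g.coeff i : E) : U)‖ ≤ 1) ∧ aeval b g = 0 ∧ aeval b (derivative g) ≠ 0 := by
    set m := minpoly E b
    have hm : m ≠ 0 := minpoly.ne_zero hs.isIntegral
    obtain ⟨i0, hi0, hmax⟩ := exists_max_image m.support (fun i => ‖((m.coeff i : E) : U)‖) (by simpa using hm)
    set a := m.coeff i0
    have ha : a ≠ 0 := mem_support_iff.1 hi0
    have ha' : ((a : E) : U) ≠ 0 := by simpa using ha
    refine ⟨Polynomial.C a⁻¹ * m, fun i => ?_, ?_, ?_⟩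
    · rw [coeff_C_mul]; push_cast
      rw [norm_mul, norm_inv, inv_mul_le_iff₀ (norm_pos_iff.2 ha'), mul_one]
      by_cases hi : i ∈ m.support
      · exact hmax i hi
      · rw [notMem_support_iff.1 hi]; simp
    · rw [map_mul, minpoly.aeval, mul_zero]
    · rw [derivative_C_mul, map_mul]
      refine mul_ne_zero (by simpa using ha) ?_
      exact hs.aeval_derivative_ne_zero (minpoly.aeval _ _)
  set gU : U[X] := g.map (algebraMap E U) with hgU
  have hgU1 : ∀ i, ‖gU.coeff i‖ ≤ 1 := fun i => by rw [hgU, coeff_map]; exact hg1 i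
  have hgb : gU.eval b = 0 := by rw [hgU, eval_map_algebraMap, hg0]
  have hgd' : gU.derivative.eval b ≠ 0 := by rw [hgU, derivative_map, eval_map_algebraMap]; exact hgd
  set δ := ‖gU.derivative.eval b‖ with hδ
  have hδ0 : 0 < δ := norm_pos_iff.2 hgd'
  have hd1 : ∀ i, ‖gU.derivative.coeff i‖ ≤ 1 := fun i => by
    rw [coeff_derivative, norm_mul]
    refine mul_le_one₀ (hgU1 _) (norm_nonneg _) ?_
    exact_mod_cast norm_natCast_le_one U (i + 1)
  have hδ1 : δ ≤ 1 := eval_le_one _ hd1 b hb1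
  obtain ⟨e, heE, he⟩ := hl δ hδ0
  have he1 : ‖e‖ ≤ 1 := by
    have : e = b - (b - e) := by ring
    rw [this]; exact um_sub_le hb1 (he.le.trans hδ1)
  have texp : ∀ q : U[X], (∀ i, ‖q.coeff i‖ ≤ 1) → ‖q.eval b - q.eval e‖ ≤ ‖b - e‖ := by
    intro q hq
    have h1 : q.eval b = (taylor e q).eval (b - e) := by rw [taylor_eval, sub_add_cancel]
    obtain ⟨r, hr⟩ : (X : U[X]) ∣ taylor e q - Polynomial.C (q.eval e) := by
      rw [X_dvd_iff]; simp
    have hr1 : ∀ i, ‖r.coeff i‖ ≤ 1 := fun i => by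
      have := congrArg (fun f => coeff f (i + 1)) hr
      simp only [coeff_sub, coeff_C_succ, sub_zero, coeff_X_mul] at this
      rw [← this]; exact taylor_le_one q hq e he1 _
    have h2 : q.eval b - q.eval e = (b - e) * r.eval (b - e) := by
      have := congrArg (eval (b - e)) hr
      simp only [eval_sub, eval_C, eval_mul, eval_X] at this
      rw [h1, this]
    rw [h2, norm_mul]
    exact mul_le_of_le_one_right (norm_nonneg _) (eval_le_one r hr1 _ (he.le.trans hδ1))
  set c := gU.derivative.eval e with hc
  have hcδ : ‖c‖ = δ := um_eq_of_sub (lt_of_le_of_lt (texp _ hd1) he)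
  have hc0 : c ≠ 0 := by rw [← norm_pos_iff, hcδ]; exact hδ0
  have hge : ‖gU.eval e‖ ≤ δ ^ 2 := by
    have h1 : gU.eval b = (taylor e gU).eval (b - e) := by rw [taylor_eval, sub_add_cancel]
    obtain ⟨r, hr⟩ : (X ^ 2 : U[X]) ∣ taylor e gU - (Polynomial.C (gU.eval e) + Polynomial.C c * X) := by
      rw [X_pow_dvd_iff]; intro d hd
      interval_cases d
      · simp
      · simp [hc, taylor_coeff_one]
    have hr1 : ∀ i, ‖r.coeff i‖ ≤ 1 := fun i => by
      have := congrArg (fun f => coeff f (i + 2)) hr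
      simp only [coeff_sub, coeff_add, coeff_X_pow_mul, coeff_C_mul, coeff_X, coeff_C] at this
      simp at this
      rw [← this]; exact taylor_le_one _ hgU1 e he1 _
    have h2 := congrArg (eval (b - e)) hr
    simp only [eval_sub, eval_add, eval_C, eval_mul, eval_X, eval_pow, ← h1, hgb] at h2
    have : gU.eval e = -(c * (b - e) + (b - e) ^ 2 * r.eval (b - e)) := by linear_combination -h2
    rw [this, norm_neg]
    refine um_le ?_ ?_
    · rw [norm_mul, hcδ, pow_two]; gcongr
    · rw [norm_mul, norm_pow]
      refine (mul_le_of_le_one_right (by positivity) (eval_le_one r hr1 _ (he.le.trans hδ1))).trans ?_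
      gcongr
  have hcE : c ∈ E := by
    have : c = ((((derivative g).eval ⟨e, heE⟩ : E)) : U) := by
      rw [hc, hgU, derivative_map]
      exact eval_map_apply (algebraMap E U) (⟨e, heE⟩ : E)
    rw [this]; exact Subtype.mem _
  have hZb : b = e + c * ((b - e) / c) := by field_simp; ring
  set Z := (b - e) / c
  have hZ1 : ‖Z‖ ≤ 1 := by rw [norm_div, hcδ, div_le_one hδ0]; exact he.le
  have hET : Et {e | e ∈ E ∧ ‖e‖ ≤ 1} G Z := by
    refine Et.root (Polynomial.C (c⁻¹ ^ 2) * (taylor e gU).comp (Polynomial.C c * X)) Z ?_ (hGc b hbG e heE c hcE) hZ1 ?_ ?_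
    · intro i
      refine Et.base ?_
      rw [coeff_C_mul, comp_C_mul_X_coeff]
      have ht : (taylor e gU).coeff i ∈ E := by
        have : taylor e gU = (taylor (⟨e, heE⟩ : E) g).map (algebraMap E U) := by
          rw [hgU, taylor_apply, taylor_apply, Polynomial.map_comp]; simp; rfl
        rw [this, coeff_map]; exact Subtype.mem _
      refine ⟨mul_mem (pow_mem (inv_mem hcE) _) (mul_mem ht (pow_mem hcE _)), ?_⟩
      rw [norm_mul, norm_mul, norm_pow, norm_pow, norm_inv, hcδ]
      rcases i with _ | _ | i
      · simp only [taylor_coeff_zero, pow_zero, mul_one]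
        rw [inv_pow, inv_mul_le_iff₀ (by positivity), mul_one]; exact hge
      · simp only [zero_add, taylor_coeff_one, pow_one]
        rw [← hc, hcδ]; field_simp; exact le_refl _
      · have := taylor_le_one gU hgU1 e he1 (i + 1 + 1)
        calc _ = ‖(taylor e gU).coeff (i + 1 + 1)‖ * δ ^ i := by field_simp; ring
          _ ≤ 1 := mul_le_one₀ this (by positivity) (pow_le_one₀ hδ0.le hδ1)
    · rw [eval_mul, eval_comp, taylor_eval]; simp only [eval_mul, eval_C, eval_X]
      rw [add_comm, ← hZb, hgb, mul_zero]
    · rw [derivative_C_mul, derivative_comp, eval_mul, eval_mul, eval_comp]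
      have : derivative (taylor e gU) = taylor e (derivative gU) := by
        rw [taylor_apply, taylor_apply, derivative_comp]; simp
      rw [this, taylor_eval]
      simp only [eval_mul, eval_C, eval_X, derivative_mul, derivative_C, derivative_X, zero_mul, zero_add, mul_one]
      rw [add_comm (c * Z), ← hZb, norm_mul, norm_mul, norm_pow, norm_inv, hcδ, ← hδ]
      field_simp
  rw [hZb]
  have hcb : c ∈ {e | e ∈ E ∧ ‖e‖ ≤ 1} := ⟨hcE, by rw [hcδ]; exact hδ1⟩
  have heb : e ∈ {e | e ∈ E ∧ ‖e‖ ≤ 1} := ⟨heE, he1⟩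
  exact (Et.base heb).add ((Et.base hcb).mul hET)
end Et

section Sep

theorem sep_iff {U : Type*} [Field U] (M : Subfield U) (b : U) :
    IsSeparable M b ↔ ∃ f : U[X], (∀ i, f.coeff i ∈ M) ∧ f.eval b = 0 ∧ f.derivative.eval b ≠ 0 := by
  constructor
  · intro h
    refine ⟨(minpoly M b).map (algebraMap M U), fun i => by rw [coeff_map]; exact Subtype.mem _, ?_, ?_⟩
    · rw [eval_map_algebraMap, minpoly.aeval]
    · rw [derivative_map, eval_map_algebraMap]; exact h.aeval_derivative_ne_zero (minpoly.aeval _ _)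
  · rintro ⟨f, hf, h0, hd⟩
    obtain ⟨g, rfl⟩ : ∃ g : M[X], g.map (algebraMap M U) = f := by
      have : f ∈ lifts (algebraMap M U) := by
        rw [lifts_iff_coeff_lifts]; intro i; exact ⟨⟨_, hf i⟩, rfl⟩
      exact this
    rw [eval_map_algebraMap] at h0
    rw [derivative_map, eval_map_algebraMap] at hd
    have hg : g ≠ 0 := by rintro rfl; simp at hd
    have hi : IsIntegral M b := (show IsAlgebraic M b from ⟨g, hg, h0⟩).isIntegral
    obtain ⟨q, rfl⟩ := minpoly.dvd M b h0
    rw [IsSeparable, separable_iff_derivative_ne_zero (minpoly.irreducible hi)]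
    intro h
    rw [derivative_mul, h, zero_mul, zero_add, map_mul, minpoly.aeval, zero_mul] at hd
    exact hd rfl

theorem sep_map {A B : Type*} [Field A] [Field B] (φ : A →+* B) {M : Subfield A} {M' : Subfield B}
    (hM : ∀ a ∈ M, φ a ∈ M') {b : A} (h : IsSeparable M b) : IsSeparable M' (φ b) := by
  rw [sep_iff] at h ⊢
  obtain ⟨f, hf, h0, hd⟩ := h
  refine ⟨f.map φ, fun i => by rw [coeff_map]; exact hM _ (hf i), ?_, ?_⟩
  · rw [eval_map_apply, h0, map_zero]
  · rw [derivative_map, eval_map_apply]; simpa using hd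

theorem sep_comap {A B : Type*} [Field A] [Field B] (φ : A →+* B) {M : Subfield A} {M' : Subfield B}
    (hM : ∀ a ∈ M', ∃ c ∈ M, φ c = a) {b : A} (h : IsSeparable M' (φ b)) : IsSeparable M b := by
  rw [sep_iff] at h ⊢
  obtain ⟨f, hf, h0, hd⟩ := h
  obtain ⟨g, rfl⟩ : ∃ g : A[X], g.map φ = f := by
    have : f ∈ lifts φ := by
      rw [lifts_iff_coeff_lifts]; intro i; obtain ⟨c, -, hc⟩ := hM _ (hf i); exact ⟨c, hc⟩
    exact this
  refine ⟨g, fun i => ?_, ?_, ?_⟩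
  · obtain ⟨c, hc, e⟩ := hM _ (hf i); rw [coeff_map] at e; rwa [← φ.injective e]
  · rw [eval_map_apply] at h0; exact φ.injective (h0.trans (map_zero φ).symm)
  · rw [derivative_map, eval_map_apply] at hd; exact fun h => hd (by rw [h, map_zero])

theorem greedy {N V : Type*} [Field N] [AddCommGroup V] [Module N V] {n : ℕ} (v w : Fin n → V) (c : Fin n → N)
    (hc : ∀ i, c i ≠ 0) (hv : span N (range v) = ⊤) :
    ∃ w' : Fin n → V, (∀ i, w' i = w i ∨ ∃ j, w' i = w i + c i • v j) ∧ span N (range w') = ⊤ := by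
  classical
  haveI : FiniteDimensional N V := ⟨by rw [← hv]; exact Submodule.fg_span (Set.finite_range v)⟩
  have hdim : finrank N V ≤ n := by
    have := finrank_range_le_card (R := N) v
    rw [Set.finrank, hv, finrank_top] at this; simpa using this
  let W (o : Fin n → Option (Fin n)) : Fin n → V := fun i => w i + (o i).elim 0 (fun j => c i • v j)
  obtain ⟨o, -, ho⟩ := exists_max_image univ
    (fun o => finrank N (span N (range (W o)))) ⟨fun _ => none, mem_univ _⟩
  refine ⟨W o, fun i => ?_, ?_⟩
  · cases h : o i with
    | none => left; simp [W, h]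
    | some j => right; exact ⟨j, by simp [W, h]⟩
  by_contra hne
  have hdep : ¬ LinearIndependent N (W o) := by
    intro hli
    refine hne (hli.span_eq_top_of_card_eq_finrank' ?_)
    have := hli.fintype_card_le_finrank
    simp only [Fintype.card_fin] at this ⊢; omega
  rw [linearIndependent_iff_notMem_span] at hdep
  push Not at hdep
  obtain ⟨i, hi⟩ := hdep
  set Wi := span N (W o '' (Set.univ \ {i})) with hWi
  have hspan : span N (range (W o)) = Wi := by
    refine le_antisymm (span_le.2 ?_) (Submodule.span_mono (Set.image_subset_range _ _))
    rintro _ ⟨k, rfl⟩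
    by_cases hk : k = i
    · rw [hk]; exact hi
    · exact subset_span ⟨k, ⟨trivial, hk⟩, rfl⟩
  have key : ∀ q : Option (Fin n), w i + q.elim 0 (fun j => c i • v j) ∈ Wi := by
    intro q
    by_contra hq
    have h1 : Wi < span N (range (W (update o i q))) := by
      refine lt_of_le_of_ne (span_le.2 ?_) ?_
      · rintro _ ⟨k, ⟨-, hk⟩, rfl⟩
        refine subset_span ⟨k, ?_⟩
        have hk : k ≠ i := hk
        simp [W, Function.update_of_ne hk]
      · intro h; apply hq; rw [h]; exact subset_span ⟨i, by simp [W]⟩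
    have h2 := Submodule.finrank_lt_finrank_of_lt h1
    rw [← hspan] at h2
    exact absurd h2 (not_lt.2 (ho _ (mem_univ _)))
  apply hne
  rw [hspan, eq_top_iff, ← hv, span_le]
  rintro _ ⟨j, rfl⟩
  have := Wi.sub_mem (key (some j)) (key none)
  simp only [Option.elim_some, Option.elim_none, add_zero, add_sub_cancel_left] at this
  exact (Submodule.smul_mem_iff _ (hc i)).1 this

open KaehlerDifferential in
theorem sep_of_span {K N : Type*} [Field K] [Field N] [Algebra K N] [Algebra.EssFiniteType K N] (B : Set N)
    (hB : span N (D K N '' B) = ⊤) : Algebra.IsSeparable (adjoin K B) N := by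
  set M := adjoin K B
  haveI : Algebra.EssFiniteType M N := Algebra.EssFiniteType.of_comp K M N
  rw [← Algebra.FormallyUnramified.iff_isSeparable]
  refine ⟨?_⟩
  have hm : KaehlerDifferential.map K M N N = 0 := by
    refine LinearMap.ext_on_range (v := fun b : B => D K N b) ?_ ?_
    · rw [← hB]; congr 1; ext; simp
    · rintro ⟨b, hb⟩
      have : D M N (algebraMap M N ⟨b, IntermediateField.subset_adjoin K B hb⟩) = 0 := Derivation.map_algebraMap _ _
      simpa using this
  have hs := KaehlerDifferential.map_surjective K M N
  rw [hm] at hs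
  exact ⟨fun a b => by obtain ⟨a, rfl⟩ := hs a; obtain ⟨b, rfl⟩ := hs b; rfl⟩

open KaehlerDifferential in
theorem span_of_sep {K N : Type*} [Field K] [Field N] [Algebra K N] (B : Set N)
    [Algebra.IsSeparable (adjoin K B) N] : span N (D K N '' B) = ⊤ := by
  rw [eq_top_iff, ← span_range_derivation, span_le]
  set Q := span N (D K N '' B)
  set d : Derivation K N (Ω[N⁄K] ⧸ Q) := (Q.mkQ).compDer (D K N) with hd
  have h1 : ∀ b, d b = 0 ↔ D K N b ∈ Q := fun b => by
    rw [hd]; simp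
  let M : IntermediateField K N :=
    { carrier := {b | d b = 0}
      mul_mem' := fun {a b} (ha : d a = 0) (hb : d b = 0) => by simp [ha, hb]
      add_mem' := fun {a b} (ha : d a = 0) (hb : d b = 0) => by simp [ha, hb]
      algebraMap_mem' := fun r => by simp
      inv_mem' := fun a (ha : d a = 0) => by simp [ha, Derivation.leibniz_inv] }
  have hM : adjoin K B ≤ M := by
    rw [adjoin_le_iff]
    intro b hb; exact (h1 b).2 (subset_span ⟨b, hb, rfl⟩)
  rintro _ ⟨b, rfl⟩
  refine (h1 b).1 ?_
  have hs := Algebra.IsSeparable.isSeparable (adjoin K B) b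
  set f := minpoly (adjoin K B) b
  have h2 : d (aeval b f) = aeval b (derivative f) • d b := by
    have hgen : ∀ g : (adjoin K B)[X], d (aeval b g) = aeval b (derivative g) • d b := by
      intro g
      induction g using Polynomial.induction_on' with
      | add p q hp hq => rw [map_add, map_add, hp, hq, derivative_add, map_add, add_smul]
      | monomial n a =>
        have ha : d (a : N) = 0 := hM a.2
        rw [aeval_monomial, Derivation.leibniz, derivative_monomial, aeval_monomial]
        simp only [IntermediateField.algebraMap_apply, ha, smul_zero, add_zero, Derivation.leibniz_pow]
        simp only [map_mul, map_natCast, ← Nat.cast_smul_eq_nsmul N, smul_smul, smul_eq_mul]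
        push_cast
        ring_nf
    exact hgen f
  rw [minpoly.aeval, map_zero] at h2
  exact (smul_eq_zero.1 h2.symm).resolve_left (hs.aeval_derivative_ne_zero (minpoly.aeval _ _))

open KaehlerDifferential in

theorem SEP {U : Type*} [Field U] (K1 N : Subfield U) (hKN : K1 ≤ N) (S0 : Finset U) (hN : N = Subfield.closure ((K1 : Set U) ∪ S0))
    {n : ℕ} (x w c : Fin n → U) (hx : ∀ i, x i ∈ N) (hw : ∀ i, w i ∈ N) (hc : ∀ i, c i ≠ 0)
    (hc' : ∀ i, c i ∈ K1 ∨ ∃ p : ℕ, ∃ m ∈ N, (p : U) = 0 ∧ c i = m ^ p)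
    (hs : ∀ b ∈ N, IsSeparable (Subfield.closure ((K1 : Set U) ∪ range x)) b) :
    ∃ π : Fin n → U, (∀ i, π i = w i ∨ ∃ j, π i = w i + c i * x j) ∧ (∀ i, π i ∈ N) ∧
      ∀ b ∈ N, IsSeparable (Subfield.closure ((K1 : Set U) ∪ range π)) b := by
  letI : Algebra K1 N := (inclusion hKN).toAlgebra
  have hcN : ∀ i, c i ∈ N := fun i => by
    rcases hc' i with h | ⟨p, m, hm, -, e⟩
    · exact hKN h
    · rw [e]; exact pow_mem hm p
  let x' : Fin n → N := fun i => ⟨x i, hx i⟩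
  let w' : Fin n → N := fun i => ⟨w i, hw i⟩
  let c' : Fin n → N := fun i => ⟨c i, hcN i⟩
  have hDc : ∀ i, D K1 N (c' i) = 0 := fun i => by
    rcases hc' i with h | ⟨p, m, hm, hp, e⟩
    · exact Derivation.map_algebraMap (D K1 N) (⟨c i, h⟩ : K1)
    · have : c' i = (⟨m, hm⟩ : N) ^ p := Subtype.ext e
      have hp' : (p : N) = 0 := Subtype.ext (by push_cast; exact hp)
      rw [this, Derivation.leibniz_pow, ← Nat.cast_smul_eq_nsmul N, hp', zero_smul]
  have adj : ∀ y : Fin n → N, ∀ a : U, a ∈ Subfield.closure ((K1 : Set U) ∪ range fun i => (y i : U)) ↔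
      ∃ b ∈ adjoin K1 (range y), (b : U) = a := by
    intro y a
    have : (adjoin K1 (range y)).toSubfield.map N.subtype
        = Subfield.closure ((K1 : Set U) ∪ range fun i => (y i : U)) := by
      rw [IntermediateField.adjoin_toSubfield, map_field_closure, image_union]
      congr 2
      · ext z; constructor
        · rintro ⟨_, ⟨r, rfl⟩, rfl⟩; exact r.2
        · intro hz; exact ⟨_, ⟨⟨z, hz⟩, rfl⟩, rfl⟩
      · rw [← Set.range_comp]; rfl
    rw [← this]; rfl
  haveI hess : Algebra.EssFiniteType K1 N := by
    classical
    have hS : ∀ s ∈ S0, s ∈ N := fun s hs => by rw [hN]; exact Subfield.subset_closure (Or.inr hs)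
    have : adjoin K1 ((fun s : S0 => (⟨s, hS s s.2⟩ : N)) '' Set.univ) = ⊤ := by
      rw [eq_top_iff]
      rintro ⟨b, hb⟩ -
      have h2 : N ≤ (adjoin K1 ((fun s : S0 => (⟨s, hS s s.2⟩ : N)) '' Set.univ)).toSubfield.map N.subtype := by
        conv_lhs => rw [hN]
        rw [closure_le]
        rintro z (hz | hz)
        · exact ⟨algebraMap K1 N ⟨z, hz⟩, IntermediateField.algebraMap_mem _ _, rfl⟩
        · exact ⟨⟨z, hS z hz⟩, IntermediateField.subset_adjoin _ _ ⟨⟨z, hz⟩, trivial, rfl⟩, rfl⟩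
      obtain ⟨b', hb', e⟩ := h2 hb
      have : b' = ⟨b, hb⟩ := Subtype.ext e
      rwa [← this]
    rw [← IntermediateField.fg_top_iff, ← this]
    refine ⟨(S0.attach.image fun s : S0 => (⟨(s : U), hS s s.2⟩ : N)), ?_⟩
    congr 1; rw [coe_image]; congr 1; ext; simp
  haveI : Algebra.IsSeparable (adjoin K1 (range x')) N := ⟨fun b =>
    sep_comap N.subtype (M := (adjoin K1 (range x')).toSubfield) (fun a ha => (adj x' a).1 ha) (hs b b.2)⟩
  have hsp := span_of_sep (K := K1) (N := N) (range x')
  rw [← Set.range_comp] at hsp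
  obtain ⟨v, hv, hvs⟩ := greedy (D K1 N ∘ x') (D K1 N ∘ w') c' (fun i h => hc i (congrArg Subtype.val h)) hsp
  choose! f hf using fun i (h : ¬ v i = (D K1 N ∘ w') i) => (hv i).resolve_left h
  classical
  let π : Fin n → N := fun i => if v i = (D K1 N ∘ w') i then w' i else w' i + c' i * x' (f i)
  have hπ : D K1 N ∘ π = v := by
    funext i
    simp only [Function.comp, π]
    split_ifs with h
    · exact h.symm
    · rw [hf i h, map_add, Derivation.leibniz, hDc, smul_zero, add_zero]; rfl
  refine ⟨fun i => π i, fun i => ?_, fun i => (π i).2, fun b hb => ?_⟩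
  · simp only [π]
    split_ifs with h
    · exact Or.inl rfl
    · exact Or.inr ⟨f i, rfl⟩
  · haveI := sep_of_span (K := K1) (N := N) (range π) (by rw [← Set.range_comp, hπ]; exact hvs)
    have h3 := Algebra.IsSeparable.isSeparable (adjoin K1 (range π)) (⟨b, hb⟩ : N)
    have h4 : ∀ a ∈ (adjoin K1 (range π)).toSubfield,
        N.subtype a ∈ Subfield.closure ((K1 : Set U) ∪ range fun i => (π i : U)) :=
      fun a ha => (adj π _).2 ⟨a, ha, rfl⟩
    have h5 := sep_map (b := (⟨b, hb⟩ : N)) N.subtype h4 h3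
    exact h5
end Sep

section Perron
variable {U : Type*} [NormedField U] {ι : Type*} [Fintype ι] [DecidableEq ι]

def Ind (π : ι → U) : Prop := (∀ i, π i ≠ 0 ∧ ‖π i‖ < 1) ∧ ∀ e : ι → ℤ, ∏ i, ‖π i‖ ^ e i = 1 → e = 0

theorem prod_upd {W : Type*} [Field W] (π : ι → W) (h0 : ∀ i, π i ≠ 0) {i j : ι} (hij : i ≠ j) (e : ι → ℤ) :
    ∏ k, (update π i (π i / π j)) k ^ (update e j (e j + e i)) k = ∏ k, π k ^ e k := by
  have h : ∀ k, (update π i (π i / π j)) k ^ (update e j (e j + e i)) k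
      = π k ^ e k * (if k = j then π j ^ e i else 1) * (if k = i then (π j ^ e i)⁻¹ else 1) := by
    intro k
    by_cases hk : k = j
    · subst hk; simp [hij.symm, zpow_add₀ (h0 k)]
    · by_cases hk' : k = i
      · subst hk'; simp [hk, div_eq_mul_inv, mul_zpow]
      · simp [hk, hk']
  simp only [h, prod_mul_distrib, Finset.prod_ite_eq', mem_univ, if_true]
  rw [mul_assoc, mul_inv_cancel₀ (zpow_ne_zero _ (h0 j)), mul_one]

theorem pstep {π : ι → U} (h : Ind π) {i j : ι} (hij : i ≠ j) (hlt : ‖π i‖ < ‖π j‖) :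
    ∃ π' : ι → U, Ind π' ∧ (∀ k, π' k ∈ Subfield.closure (range π)) ∧
      (∀ k, π k ∈ Submonoid.closure (range π')) ∧
      ∀ e : ι → ℤ, ∏ k, π k ^ e k = ∏ k, π' k ^ (update e j (e j + e i)) k := by
  have h0 := fun k => (h.1 k).1
  have hj : 0 < ‖π j‖ := norm_pos_iff.2 (h0 j)
  refine ⟨update π i (π i / π j), ⟨fun k => ?_, fun e he => ?_⟩, fun k => ?_, fun k => ?_, fun e => (prod_upd π h0 hij e).symm⟩
  · by_cases hk : k = i
    · subst hk; simp only [Function.update_self]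
      exact ⟨div_ne_zero (h0 _) (h0 _), by rwa [norm_div, div_lt_one hj]⟩
    · simpa [hk] using h.1 k
  · set e0 := update e j (e j - e i) with he0
    have e1 : update e0 j (e0 j + e0 i) = e := by
      funext k; by_cases hk : k = j
      · subst hk; simp [he0, hij]
      · simp [he0, hk]
    have e2 : (fun k => ‖update π i (π i / π j) k‖) = update (fun k => ‖π k‖) i (‖π i‖ / ‖π j‖) := by
      funext k; by_cases hk : k = i
      · subst hk; simp
      · simp [hk]
    have e3 := prod_upd (fun k => ‖π k‖) (fun k => norm_ne_zero_iff.2 (h0 k)) hij e0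
    rw [e1] at e3
    have e4 : e0 = 0 := h.2 e0 (by rw [← e3, ← he]; exact prod_congr rfl fun k _ => by rw [← congrFun e2 k])
    rw [← e1, e4]; simp
  · by_cases hk : k = i
    · subst hk; simp only [Function.update_self]
      exact div_mem (Subfield.subset_closure ⟨_, rfl⟩) (Subfield.subset_closure ⟨_, rfl⟩)
    · simp only [hk, Function.update_of_ne, ne_eq, not_false_eq_true]; exact Subfield.subset_closure ⟨_, rfl⟩
  · by_cases hk : k = i
    · subst hk
      have : π k = update π k (π k / π j) k * update π k (π k / π j) j := by
        simp [hij.symm, h0 j]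
      refine (congrArg (· ∈ Submonoid.closure (range (update π k (π k / π j)))) this).mpr ?_
      exact mul_mem (Submonoid.subset_closure (mem_range_self _)) (Submonoid.subset_closure (mem_range_self _))
    · exact Submonoid.subset_closure ⟨k, by simp [hk]⟩

theorem perron1 : ∀ (D c A B : ℕ) (π : ι → U) (e : ι → ℤ), A + B < D →
    (univ.filter fun k => e k = A ∨ e k = -B).card < c → Ind π → (∀ k, -(B : ℤ) ≤ e k ∧ e k ≤ A) →
    ‖∏ k, π k ^ e k‖ ≤ 1 → ∃ π' : ι → U, Ind π' ∧ (∀ k, π' k ∈ Subfield.closure (range π)) ∧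
      (∀ k, π k ∈ Submonoid.closure (range π')) ∧ ∏ k, π k ^ e k ∈ Submonoid.closure (range π') := by
  intro D
  induction D with
  | zero => intro c A B π e hD; omega
  | succ D IH =>
    intro c
    induction c with
    | zero => intro A B π e _ hc; omega
    | succ c IHc =>
      intro A B π e hD hc hπ he hm
      have self : (∀ k, 0 ≤ e k) → ∃ π' : ι → U, Ind π' ∧ (∀ k, π' k ∈ Subfield.closure (range π)) ∧
          (∀ k, π k ∈ Submonoid.closure (range π')) ∧ ∏ k, π k ^ e k ∈ Submonoid.closure (range π') := fun h =>
        ⟨π, hπ, fun k => Subfield.subset_closure ⟨k, rfl⟩, fun k => Submonoid.subset_closure ⟨k, rfl⟩,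
          prod_mem fun k _ => by
            obtain ⟨n, hn⟩ := Int.eq_ofNat_of_zero_le (h k)
            rw [hn, zpow_natCast]; exact pow_mem (Submonoid.subset_closure (mem_range_self k)) n⟩
      rcases Nat.eq_zero_or_pos B with rfl | hB0
      · exact self fun k => by simpa using (he k).1
      rcases Nat.eq_zero_or_pos A with rfl | hA0
      · have h1 : ∀ k, 1 ≤ ‖π k‖ ^ e k := fun k => by
          have h2 : e k = -((-e k).toNat : ℤ) := by have := (he k).2; push_cast at this; omega
          rw [h2, zpow_neg, zpow_natCast]
          exact (one_le_inv₀ (pow_pos (norm_pos_iff.2 (hπ.1 k).1) _)).2 (pow_le_one₀ (norm_nonneg _) (hπ.1 k).2.le)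
        rw [norm_prod] at hm
        simp only [norm_zpow] at hm
        have h3 := hπ.2 e (le_antisymm hm (by
          calc (1:ℝ) = ∏ k : ι, 1 := by simp
            _ ≤ _ := Finset.prod_le_prod (fun _ _ => zero_le_one) (fun k _ => h1 k)))
        exact self fun k => by rw [h3]; simp
      by_cases hA : ∃ i, e i = A
      swap
      · push Not at hA
        refine IH _ (A - 1) B π e (by omega) (lt_succ_self _) hπ (fun k => ⟨(he k).1, ?_⟩) hm
        have := (he k).2; have := hA k; omega
      by_cases hB : ∃ j, e j = -B
      swap
      · push Not at hB
        refine IH _ A (B - 1) π e (by omega) (lt_succ_self _) hπ (fun k => ⟨?_, (he k).2⟩) hm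
        have := (he k).1; have := hB k; omega
      obtain ⟨i, hi⟩ := hA
      obtain ⟨j, hj⟩ := hB
      have hij : i ≠ j := by rintro rfl; omega
      have hne : ‖π i‖ ≠ ‖π j‖ := fun h => by
        have h1 := hπ.2 (update (update 0 i 1) j (-1)) (by
          rw [Fintype.prod_eq_mul i j hij (fun k hk => by simp [hk.1, hk.2])]
          simp [hij, h, (hπ.1 j).1])
        have h2 := congrFun h1 j
        simp at h2
      have fin : ∀ k, (k = i ∨ k = j) → ∀ π' : ι → U, Ind π' → (∀ k, π' k ∈ Subfield.closure (range π)) →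
          (∀ k, π k ∈ Submonoid.closure (range π')) →
          ∏ k, π k ^ e k = ∏ l, π' l ^ (update e k ((A : ℤ) - B)) l →
          ∃ π' : ι → U, Ind π' ∧ (∀ k, π' k ∈ Subfield.closure (range π)) ∧
      (∀ k, π k ∈ Submonoid.closure (range π')) ∧ ∏ k, π k ^ e k ∈ Submonoid.closure (range π') := by
        intro k hk π' h1 h2 h3 h4
        obtain ⟨π'', g1, g2, g3, g4⟩ := IHc A B π' (update e k ((A : ℤ) - B)) hD (by
          refine lt_of_lt_of_le (Finset.card_lt_card ?_) (Nat.lt_succ_iff.1 hc)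
          refine Finset.ssubset_iff_subset_ne.2 ⟨fun l hl => ?_, fun h => ?_⟩
          · by_cases hlk : l = k
            · subst hlk; simp at hl; omega
            · simpa [hlk] using hl
          · have : k ∈ univ.filter fun k => e k = A ∨ e k = -B := by
              rcases hk with rfl | rfl <;> simp [hi, hj]
            rw [← h] at this; simp at this; omega) h1 (fun l => by
          by_cases hlk : l = k
          · subst hlk; simp
          · simpa [hlk] using he l) (by rw [← h4]; exact hm)
        refine ⟨π'', g1, fun l => ?_, fun l => ?_, by rw [h4]; exact g4⟩
        · exact (closure_le.2 (by rintro _ ⟨l, rfl⟩; exact h2 l)) (g2 l)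
        · exact (Submonoid.closure_le.2 (by rintro _ ⟨l, rfl⟩; exact g3 l)) (h3 l)
      rcases hne.lt_or_gt with hlt | hlt
      · obtain ⟨π', h1, h2, h3, h4⟩ := pstep hπ hij hlt
        exact fin j (Or.inr rfl) π' h1 h2 h3 (by rw [h4 e, hi, hj, neg_add_eq_sub])
      · obtain ⟨π', h1, h2, h3, h4⟩ := pstep hπ hij.symm hlt
        exact fin i (Or.inl rfl) π' h1 h2 h3 (by rw [h4 e, hi, hj, ← sub_eq_add_neg])

theorem zpow_sum_aux {W κ : Type*} [Field W] {a : W} (ha : a ≠ 0) (s : Finset κ) (f : κ → ℤ) :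
    a ^ (∑ k ∈ s, f k) = ∏ k ∈ s, a ^ f k := by
  classical
  induction s using induction_on with
  | empty => simp
  | insert i s hi ih => rw [sum_insert hi, Finset.prod_insert hi, zpow_add₀ ha, ih]

theorem perron {π : ι → U} (hπ : Ind π) (M : Finset U) : (∀ m ∈ M, ‖m‖ ≤ 1 ∧ ∃ e : ι → ℤ, m = ∏ k, π k ^ e k) →
    ∃ π' : ι → U, Ind π' ∧ (∀ k, π' k ∈ Subfield.closure (range π)) ∧
      (∀ k, π k ∈ Submonoid.closure (range π')) ∧ ∀ m ∈ M, m ∈ Submonoid.closure (range π') := by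
  classical
  induction M using induction_on with
  | empty => exact fun _ => ⟨π, hπ, fun k => Subfield.subset_closure ⟨k, rfl⟩, fun k => Submonoid.subset_closure ⟨k, rfl⟩, by simp⟩
  | insert m M _ ih =>
    intro hM
    obtain ⟨π', h1, h2, h3, h4⟩ := ih fun m hm => hM m (mem_insert_of_mem hm)
    obtain ⟨hm, e, rfl⟩ := hM m (mem_insert_self _ _)
    have hc : ∀ u ∈ Submonoid.closure (range π'), ∃ f : ι → ℤ, u = ∏ k, π' k ^ f k := by
      intro u hu
      induction hu using Submonoid.closure_induction with
      | mem u hu =>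
        obtain ⟨i, rfl⟩ := hu
        exact ⟨Pi.single i 1, by rw [Fintype.prod_eq_single i (fun k hk => by simp [hk])]; simp⟩
      | one => exact ⟨0, by simp⟩
      | mul a b _ _ ha hb =>
        obtain ⟨f, rfl⟩ := ha; obtain ⟨g, rfl⟩ := hb
        exact ⟨f + g, by rw [← prod_mul_distrib]; exact prod_congr rfl fun k _ => by rw [Pi.add_apply, zpow_add₀ (h1.1 k).1]⟩
    choose f hf using fun k => hc _ (h3 k)
    have he : ∏ k, π k ^ e k = ∏ l, π' l ^ (∑ k, f k l * e k) := by
      simp only [zpow_sum_aux (h1.1 _).1]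
      rw [Finset.prod_comm]
      refine prod_congr rfl fun k _ => ?_
      conv_lhs => rw [hf k, ← Finset.prod_zpow]
      exact prod_congr rfl fun l _ => by rw [zpow_mul]
    rw [he] at hm ⊢
    obtain ⟨N, hN⟩ : ∃ N : ℕ, ∀ l, -(N : ℤ) ≤ ∑ k, f k l * e k ∧ ∑ k, f k l * e k ≤ N := by
      refine ⟨∑ l, (∑ k, f k l * e k).natAbs, fun l => ?_⟩
      have := Finset.single_le_sum (f := fun l => (∑ k, f k l * e k).natAbs) (fun _ _ => Nat.zero_le _) (mem_univ l)
      omega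
    obtain ⟨π'', g1, g2, g3, g4⟩ := perron1 _ _ N N π' _ (lt_succ_self _) (lt_succ_self _) h1 hN hm
    have hle : Submonoid.closure (range π') ≤ Submonoid.closure (range π'') :=
      Submonoid.closure_le.2 (by rintro _ ⟨l, rfl⟩; exact g3 l)
    refine ⟨π'', g1, fun k => (closure_le.2 (by rintro _ ⟨l, rfl⟩; exact h2 l)) (g2 k), fun k => hle (h3 k), fun m hm => ?_⟩
    rcases mem_insert.1 hm with rfl | hm
    · exact g4
    · exact hle (h4 m hm)
end Perron

section Good

section Alg
variable {U : Type*} [Field U]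
def sc (E : Subfield U) : Subfield U := (separableClosure E U).toSubfield
theorem mem_sc {E : Subfield U} {b : U} : b ∈ sc E ↔ IsSeparable E b := mem_separableClosure_iff
def acl (E : Subfield U) : Subfield U := (algebraicClosure E U).toSubfield
theorem mem_acl {E : Subfield U} {b : U} : b ∈ acl E ↔ IsAlgebraic E b := mem_algebraicClosure_iff
theorem le_sc (E : Subfield U) : E ≤ sc E := fun a ha => mem_sc.2 (isSeparable_algebraMap (F := E) (⟨a, ha⟩ : E))
theorem sc_le (E : Subfield U) : sc E ≤ acl E := fun _ ha => mem_acl.2 (mem_sc.1 ha).isIntegral.isAlgebraic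
theorem le_acl (E : Subfield U) : E ≤ acl E := (le_sc E).trans (sc_le E)
theorem sc_mono {E E' : Subfield U} (h : E ≤ E') : sc E ≤ sc E' := fun _ ha => mem_sc.2 (sep_up h (mem_sc.1 ha))
theorem acl_ac [IsAlgClosed U] (E : Subfield U) : IsAlgClosed (acl E) :=
  (inferInstance : IsAlgClosure E (algebraicClosure E U)).isAlgClosed
theorem alg_up {A B : Subfield U} (hAB : A ≤ B) {b : U} (hb : IsAlgebraic A b) : IsAlgebraic B b := by
  letI : Algebra A B := (inclusion hAB).toAlgebra
  haveI : IsScalarTower A B U := .of_algebraMap_eq fun x => rfl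
  exact hb.tower_top B
theorem acl_mono {E E' : Subfield U} (h : E ≤ E') : acl E ≤ acl E' := fun _ ha => mem_acl.2 (alg_up h (mem_acl.1 ha))

def ad (A : Subfield U) (S : Set U) : Subfield U := Subfield.closure ((A : Set U) ∪ S)
theorem le_ad (A : Subfield U) (S : Set U) : A ≤ ad A S := fun _ h => Subfield.subset_closure (Or.inl h)
theorem sub_ad (A : Subfield U) (S : Set U) : S ⊆ ad A S := fun _ h => Subfield.subset_closure (Or.inr h)
theorem ad_le {A B : Subfield U} {S : Set U} (h : A ≤ B) (h' : S ⊆ B) : ad A S ≤ B :=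
  closure_le.2 (union_subset h h')
theorem ad_mono {A B : Subfield U} {S S' : Set U} (h : A ≤ B) (h' : S ⊆ S') : ad A S ≤ ad B S' :=
  ad_le (h.trans (le_ad _ _)) (h'.trans (sub_ad _ _))

theorem cl_fin (X : Set U) (G : Finset U) (hG : (G : Set U) ⊆ Subfield.closure X) :
    ∃ A : Finset U, (A : Set U) ⊆ X ∧ (G : Set U) ⊆ Subfield.closure (A : Set U) := by
  classical
  have h1 : ∀ g ∈ Subfield.closure X, ∃ A : Finset U, (A : Set U) ⊆ X ∧ g ∈ Subfield.closure (A : Set U) := by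
    intro g hg
    have two : ∀ A B : Finset U, (A : Set U) ⊆ X → (B : Set U) ⊆ X → ∃ D : Finset U, (D : Set U) ⊆ X ∧
        Subfield.closure (A : Set U) ≤ Subfield.closure (D : Set U) ∧ Subfield.closure (B : Set U) ≤ Subfield.closure (D : Set U) :=
      fun A B hA hB => ⟨A ∪ B, by simp [hA, hB], Subfield.closure_mono (by simp), Subfield.closure_mono (by simp)⟩
    induction hg using Subfield.closure_induction with
    | mem x hx => exact ⟨{x}, by simpa using hx, Subfield.subset_closure (by simp)⟩
    | one => exact ⟨∅, by simp, one_mem _⟩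
    | add x y _ _ hx hy =>
      obtain ⟨A, hA, ha⟩ := hx; obtain ⟨B, hB, hb⟩ := hy; obtain ⟨D, hD, h1, h2⟩ := two A B hA hB
      exact ⟨D, hD, add_mem (h1 ha) (h2 hb)⟩
    | mul x y _ _ hx hy =>
      obtain ⟨A, hA, ha⟩ := hx; obtain ⟨B, hB, hb⟩ := hy; obtain ⟨D, hD, h1, h2⟩ := two A B hA hB
      exact ⟨D, hD, mul_mem (h1 ha) (h2 hb)⟩
    | neg x _ hx => obtain ⟨A, hA, ha⟩ := hx; exact ⟨A, hA, neg_mem ha⟩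
    | inv x _ hx => obtain ⟨A, hA, ha⟩ := hx; exact ⟨A, hA, inv_mem ha⟩
  choose! A hA hg using fun g (hg : g ∈ G) => h1 g (hG hg)
  refine ⟨G.biUnion A, ?_, fun g hgG => Subfield.closure_mono ?_ (hg g hgG)⟩ <;> push_cast
  · exact iUnion₂_subset hA
  · exact subset_biUnion_of_mem (u := fun i => (A i : Set U)) hgG

theorem ad_fin (L : Subfield U) (S : Set U) (G : Finset U) (hG : (G : Set U) ⊆ ad L S) :
    ∃ A : Finset U, (A : Set U) ⊆ L ∧ (G : Set U) ⊆ Subfield.closure ((A : Set U) ∪ S) := by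
  classical
  obtain ⟨A, hA, h⟩ := cl_fin _ G hG
  refine ⟨A.filter (· ∈ L), fun a ha => (mem_filter.1 ha).2, h.trans (Subfield.closure_mono fun a ha => ?_)⟩
  rcases hA ha with h | h
  · exact Or.inl (by simpa using ⟨ha, h⟩)
  · exact Or.inr h


theorem stab (E : Subfield U) (A : Finset U) (hA : (A : Set U) ⊆ sc E) : ∃ S : Finset U, A ⊆ S ∧ (S : Set U) ⊆ sc E ∧
    (∀ σ : U ≃+* U, (∀ e ∈ E, σ e = e) → ∀ b ∈ S, σ b ∈ S) ∧ ∀ b ∈ S, b⁻¹ ∈ S := by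
  classical
  let S1 : Finset U := A.biUnion fun a => ((minpoly E a).map (algebraMap E U)).roots.toFinset
  have hne : ∀ a ∈ A, (minpoly E a).map (algebraMap E U) ≠ 0 := fun a ha =>
    (Polynomial.map_ne_zero_iff (algebraMap E U).injective).2 (minpoly.ne_zero (mem_sc.1 (hA ha)).isIntegral)
  have m1 : ∀ b, b ∈ S1 ↔ ∃ a ∈ A, aeval b (minpoly E a) = 0 := by
    intro b
    simp only [S1, mem_biUnion, Multiset.mem_toFinset]
    refine exists_congr fun a => and_congr_right fun ha => ?_
    rw [mem_roots (hne a ha), IsRoot, eval_map_algebraMap]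
  have s1 : (S1 : Set U) ⊆ sc E := by
    intro b hb
    obtain ⟨a, ha, h⟩ := (m1 b).1 hb
    refine mem_sc.2 ?_
    exact (show (minpoly E b).Separable from Polynomial.Separable.of_dvd (mem_sc.1 (hA ha)) (minpoly.dvd _ _ h))
  have st : ∀ σ : U ≃+* U, (∀ e ∈ E, σ e = e) → ∀ b ∈ S1, σ b ∈ S1 := by
    intro σ hσ b hb
    obtain ⟨a, ha, h⟩ := (m1 b).1 hb
    refine (m1 _).2 ⟨a, ha, ?_⟩
    rw [← eval_map_algebraMap] at h ⊢
    have e : ((minpoly E a).map (algebraMap E U)).map σ.toRingHom = (minpoly E a).map (algebraMap E U) := by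
      rw [Polynomial.map_map]; congr 1; ext e; exact hσ e e.2
    have h2 := congrArg σ h
    rw [map_zero] at h2
    rw [← h2]; nth_rewrite 1 [← e]
    exact eval_map_apply (p := (minpoly E a).map (algebraMap E U)) σ.toRingHom b
  refine ⟨S1 ∪ S1.image (·⁻¹), fun a ha => mem_union_left _ ((m1 a).2 ⟨a, ha, minpoly.aeval _ _⟩), ?_, ?_, ?_⟩
  · intro b hb
    rcases mem_union.1 hb with hb | hb
    · exact s1 hb
    · obtain ⟨c, hc, rfl⟩ := mem_image.1 hb; exact inv_mem (s1 hc)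
  · intro σ hσ b hb
    rcases mem_union.1 hb with hb | hb
    · exact mem_union_left _ (st σ hσ b hb)
    · obtain ⟨c, hc, rfl⟩ := mem_image.1 hb
      exact mem_union_right _ (mem_image.2 ⟨σ c, st σ hσ c hc, by rw [map_inv₀]⟩)
  · intro b hb
    rcases mem_union.1 hb with hb | hb
    · exact mem_union_right _ (mem_image.2 ⟨b, hb, rfl⟩)
    · obtain ⟨c, hc, rfl⟩ := mem_image.1 hb; simpa using Or.inl hc
end Alg

variable {U : Type*} [NormedField U] [IsUltrametricDist U]

def Good (k' E : Subfield U) (n : ℕ) : Prop := ∀ A : Finset U, (A : Set U) ⊆ sc E → ∃ S T : Finset U, A ⊆ S ∧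
  (S : Set U) ⊆ sc E ∧ (∀ σ : U ≃+* U, (∀ e ∈ E, σ e = e) → ∀ b ∈ S, σ b ∈ S) ∧ (∀ b ∈ S, b⁻¹ ∈ S) ∧ T.card ≤ n ∧
  (∀ t ∈ T, ‖t‖ ≤ 1 ∧ t ∈ ad k' S) ∧ ∀ b ∈ S, ‖b‖ ≤ 1 → Et ((k' : Set U) ∪ T) (ad k' S) b

def StepH (L E' : Subfield U) (X : Finset U) (d : ℕ) : Prop := ∀ S0 : Finset U, (S0 : Set U) ⊆ sc E' → X ⊆ S0 →
  ∃ τ : Finset U, τ.card ≤ d ∧ (∀ t ∈ τ, ‖t‖ ≤ 1 ∧ t ∈ ad L S0) ∧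
    ∀ b ∈ S0, ‖b‖ ≤ 1 → Et ({l | l ∈ L ∧ ‖l‖ ≤ 1} ∪ τ) (ad L S0) b

theorem Good.step {k' E E' : Subfield U} {n d : ℕ} {X : Finset U} (hk : k' ≤ E) (hE : E ≤ E') (hX : (X : Set U) ⊆ sc E') (h : Good k' E n)
    (hs : StepH (sc E) E' X d) : Good k' E' (n + d) := by
  classical
  intro A hA
  obtain ⟨S0, h1, h2, h3, h4⟩ := stab E' (A ∪ X) (by simp [hA, hX])
  obtain ⟨τ, hτ, hτ', hb⟩ := hs S0 h2 (Finset.subset_union_right.trans h1)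
  obtain ⟨R0, G0, hR, hG, he⟩ := Et.finM (B := S0.filter fun b => ‖b‖ ≤ 1) (fun b hb' => hb b (mem_filter.1 hb').1 (mem_filter.1 hb').2)
  obtain ⟨A', hA', hG'⟩ := ad_fin (sc E) S0 (G0 ∪ τ) (by
    push_cast; exact union_subset hG fun t ht => (hτ' t ht).2)
  obtain ⟨S', T', g1, g2, g3, g4, g5, g6, g7⟩ := h (A' ∪ R0.filter (· ∈ sc E)) (by
    push_cast; exact union_subset hA' fun t ht => (by simpa using ht : _ ∧ _).2)
  have hSS : ad k' (S' : Set U) ≤ ad k' ((S0 ∪ S' : Finset U) : Set U) := ad_mono le_rfl (by simp)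
  have hcl : Subfield.closure ((A' : Set U) ∪ S0) ≤ ad k' ((S0 ∪ S' : Finset U) : Set U) := by
    rw [closure_le]
    rintro a (ha | ha)
    · exact sub_ad _ _ (by simpa using Or.inr (g1 (mem_union_left _ ha)))
    · exact sub_ad _ _ (by simpa using Or.inl ha)
  refine ⟨S0 ∪ S', T' ∪ τ, fun a ha => mem_union_left _ (h1 (mem_union_left _ ha)), ?_, fun σ hσ b hb => ?_, fun b hb => ?_, ?_, ?_, ?_⟩
  · push_cast; exact union_subset h2 (g2.trans (sc_mono hE))
  · rcases mem_union.1 hb with hb | hb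
    · exact mem_union_left _ (h3 σ hσ b hb)
    · exact mem_union_right _ (g3 σ (fun e he => hσ e (hE he)) b hb)
  · rcases mem_union.1 hb with hb | hb
    · exact mem_union_left _ (h4 b hb)
    · exact mem_union_right _ (g4 b hb)
  · exact (card_union_le _ _).trans (add_le_add g5 hτ)
  · intro t ht
    rcases mem_union.1 ht with ht | ht
    · exact ⟨(g6 t ht).1, hSS (g6 t ht).2⟩
    · exact ⟨(hτ' t ht).1, hcl (hG' (by simp [ht]))⟩
  · intro b hb hb1
    have old : ∀ b ∈ S', ‖b‖ ≤ 1 → Et ((k' : Set U) ∪ (T' ∪ τ : Finset U)) (ad k' ((S0 ∪ S' : Finset U) : Set U)) b :=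
      fun b hb hb1 => (g7 b hb hb1).mono (union_subset_union_right _ (by simp)) hSS
    rcases mem_union.1 hb with hb | hb
    · refine (he b (mem_filter.2 ⟨hb, hb1⟩)).trans (fun g hg => hcl (hG' (by push_cast; exact Or.inl hg))) fun r hr => ?_
      rcases hR hr with rfl | ⟨hr', hr''⟩ | hr'
      · exact Et.base (Or.inl (zero_mem _))
      · exact old r (g1 (by simp [hr', (show r ∈ R0 from hr)])) hr''
      · exact Et.base (Or.inr (by simpa using Or.inr hr'))
    · exact old b hb hb1

theorem triv_int {k' : Subfield U} (ht : ∀ c ∈ k', c ≠ 0 → ‖c‖ = 1) {b : U} (hb : IsAlgebraic k' b) : ‖b‖ ≤ 1 := by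
  have hi := hb.isIntegral
  by_contra h
  push Not at h
  have hm := minpoly.monic hi
  have h0 := minpoly.aeval k' b
  rw [aeval_eq_sum_range, Finset.sum_range_succ, hm.coeff_natDegree, one_smul, add_comm] at h0
  set n := (minpoly k' b).natDegree
  refine absurd (eq_neg_of_add_eq_zero_left h0) fun e => ?_
  have h1 : ‖b ^ n‖ < ‖b ^ n‖ := by
    nth_rewrite 1 [e]
    rw [norm_neg]
    refine um_sum_lt (norm_pos_iff.2 (pow_ne_zero _ (by rintro rfl; simp at h; linarith))) fun i hi => ?_
    rw [Algebra.smul_def, norm_mul, norm_pow, norm_pow]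
    have : ‖algebraMap k' U ((minpoly k' b).coeff i)‖ ≤ 1 := by
      rcases eq_or_ne ((minpoly k' b).coeff i) 0 with h | h
      · rw [h]; simp
      · exact (ht _ ((minpoly k' b).coeff i).2 (by simpa using h)).le
    exact (mul_le_of_le_one_left (by positivity) this).trans_lt (pow_lt_pow_right₀ h (mem_range.1 hi))
  exact lt_irrefl _ h1

theorem triv_alg {k' : Subfield U} (ht : ∀ c ∈ k', c ≠ 0 → ‖c‖ = 1) : ∀ c ∈ acl k', c ≠ 0 → ‖c‖ = 1 := by
  intro c hc h0
  refine le_antisymm (triv_int ht (mem_acl.1 hc)) ?_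
  have := triv_int ht (mem_acl.1 (inv_mem hc))
  rwa [norm_inv, inv_le_one₀ (norm_pos_iff.2 h0)] at this

theorem Good.start {k' : Subfield U} (ht : ∀ c ∈ k', c ≠ 0 → ‖c‖ = 1) : Good k' k' 0 := by
  intro A hA
  obtain ⟨S, h1, h2, h3, h4⟩ := stab k' A hA
  refine ⟨S, ∅, h1, h2, h3, h4, by simp, by simp, fun b hb hb1 => ?_⟩
  have hs := mem_sc.1 (h2 hb)
  refine Et.root ((minpoly k' b).map (algebraMap k' U)) b (fun i => Et.base (Or.inl ?_)) (sub_ad _ _ hb) hb1 ?_ ?_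
  · rw [coeff_map]; exact ((minpoly k' b).coeff i).2
  · rw [eval_map_algebraMap, minpoly.aeval]
  · rw [derivative_map, eval_map_algebraMap]
    refine triv_alg ht _ ?_ (hs.aeval_derivative_ne_zero (minpoly.aeval _ _))
    exact mem_acl.2 (IsIntegral.of_mem_of_fg _ hs.isIntegral.fg_adjoin_singleton _ (aeval_mem_adjoin_singleton _ _)).isAlgebraic
end Good

section Imm
section Alg
variable {U : Type*} [Field U]
theorem sc_sc (E : Subfield U) : sc (sc E) ≤ sc E := by
  intro b hb
  have h : b ∈ separableClosure (separableClosure E U) U := mem_separableClosure_iff.2 (mem_sc.1 hb)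
  rw [separableClosure.separableClosure_eq_bot] at h
  obtain ⟨a, rfl⟩ := mem_bot.1 h
  exact a.2
theorem acl_acl (E : Subfield U) : acl (acl E) ≤ acl E := by
  intro b hb
  have h : b ∈ algebraicClosure (algebraicClosure E U) U := mem_algebraicClosure_iff.2 (mem_acl.1 hb)
  rw [algebraicClosure.algebraicClosure_eq_bot] at h
  obtain ⟨a, rfl⟩ := mem_bot.1 h
  exact a.2
theorem acl_trans {A B : Subfield U} (h : B ≤ acl A) : acl B ≤ acl A := (acl_mono h).trans (acl_acl A)

theorem adj_ad (M : Subfield U) (S : Set U) : (adjoin M S).toSubfield = ad M S := by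
  rw [IntermediateField.adjoin_toSubfield, ad]; congr 2
  ext z; exact ⟨by rintro ⟨r, rfl⟩; exact r.2, fun h => ⟨⟨z, h⟩, rfl⟩⟩

theorem prim (M : Subfield U) (S : Finset U) (hS : (S : Set U) ⊆ sc M) : ∃ α ∈ ad M S, ad M S = ad M {α} := by
  haveI : FiniteDimensional M (adjoin M (S : Set U)) :=
    IntermediateField.finiteDimensional_adjoin fun x hx => (mem_sc.1 (hS hx)).isIntegral
  haveI : Algebra.IsSeparable M (adjoin M (S : Set U)) :=
    (IntermediateField.isSeparable_adjoin_iff_isSeparable M U).2 fun x hx => mem_sc.1 (hS hx)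
  obtain ⟨α, hα⟩ := Field.exists_primitive_element M (adjoin M (S : Set U))
  have h := congrArg IntermediateField.lift hα
  rw [IntermediateField.lift_adjoin_simple, IntermediateField.lift_top] at h
  have h' := congrArg IntermediateField.toSubfield h
  rw [adj_ad, adj_ad] at h'
  exact ⟨α, by rw [← adj_ad]; exact α.2, h'.symm⟩

theorem ad_simple (L : Subfield U) (y r : U) (hr : r ∈ ad L {y}) (h0 : r ≠ 0) :
    ∃ g h : U[X], (∀ i, g.coeff i ∈ L) ∧ (∀ i, h.coeff i ∈ L) ∧ g.eval y ≠ 0 ∧ h.eval y ≠ 0 ∧ r = g.eval y / h.eval y := by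
  rw [← adj_ad] at hr
  obtain ⟨g, h, e⟩ := (IntermediateField.mem_adjoin_simple_iff L r).1 hr
  refine ⟨g.map (algebraMap L U), h.map (algebraMap L U), fun i => by rw [coeff_map]; exact (g.coeff i).2,
    fun i => by rw [coeff_map]; exact (h.coeff i).2, ?_, ?_, by rw [eval_map_algebraMap, eval_map_algebraMap, e]⟩ <;>
    rw [eval_map_algebraMap] <;> rintro h' <;> rw [h'] at e <;> simp at e <;> exact h0 e

theorem pow_sc (E : Subfield U) (q : ℕ) [ExpChar U q] {b : U} (hb : b ∈ acl E) : ∃ n, b ^ q ^ n ∈ sc E := by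
  haveI : ExpChar E q := RingHom.expChar (algebraMap E U) (algebraMap E U).injective q
  obtain ⟨g, hg, n, e⟩ := (minpoly.irreducible (mem_acl.1 hb).isIntegral).hasSeparableContraction q
  refine ⟨n, mem_sc.2 ?_⟩
  have : aeval (b ^ q ^ n) g = 0 := by rw [← expand_aeval, e, minpoly.aeval]
  exact Polynomial.Separable.of_dvd hg (minpoly.dvd _ _ this)
end Alg

variable {U : Type*} [NormedField U] [IsUltrametricDist U] [IsAlgClosed U]

theorem sc_dense (E : Subfield U) (q : ℕ) [ExpChar U q] (hϖ : ∃ ϖ ∈ E, ϖ ≠ 0 ∧ ‖ϖ‖ < 1) {a : U} (ha : a ∈ acl E) {ε : ℝ} (hε : 0 < ε) :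
    ∃ l ∈ sc E, ‖a - l‖ < ε := by
  obtain ⟨ϖ, hϖE, hϖ0, hϖ1⟩ := hϖ
  obtain ⟨n, hn⟩ := pow_sc E q ha
  rcases Nat.eq_zero_or_pos n with rfl | hnpos
  · exact ⟨a, by simpa using hn, by simpa using hε⟩
  rcases ‹ExpChar U q› with _ | hp
  · exact ⟨a, by simpa using hn, by simpa using hε⟩
  rename_i hq
  set Q := q ^ n with hQ
  have hQ1 : 1 < Q := Nat.one_lt_pow hnpos.ne' hp.one_lt
  haveI := Fact.mk hp
  have hQ0 : (Q : U) = 0 := by rw [hQ]; push_cast; rw [CharP.cast_eq_zero U q, zero_pow hnpos.ne']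
  obtain ⟨k, hk⟩ := exists_pow_lt_of_lt_one (y := ‖ϖ‖) (x := (min 1 ε) ^ Q / max ‖a‖ 1) (by positivity) hϖ1
  set e := ϖ ^ k
  have he0 : e ≠ 0 := pow_ne_zero _ hϖ0
  have he : ‖e‖ * max ‖a‖ 1 < (min 1 ε) ^ Q := by
    rw [norm_pow]; rwa [lt_div_iff₀ (by positivity)] at hk
  obtain ⟨b, hb⟩ := IsAlgClosed.exists_root (X ^ Q - (Polynomial.C e * X + Polynomial.C (a ^ Q)) : U[X]) (by
    rw [degree_sub_eq_left_of_degree_lt]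
    · rw [degree_X_pow]; exact_mod_cast (by omega : Q ≠ 0)
    · rw [degree_X_pow]; refine degree_linear_le.trans_lt ?_; exact_mod_cast hQ1)
  have hb' : b ^ Q - (e * b + a ^ Q) = 0 := by simpa [IsRoot] using hb
  refine ⟨b, ?_, ?_⟩
  · refine sc_sc E (mem_sc.2 ((sep_iff _ _).2 ⟨_, ?_, hb, ?_⟩))
    · intro i
      simp only [coeff_sub, coeff_add, coeff_X_pow, coeff_C_mul, coeff_X, coeff_C]
      have h1 : e ∈ sc E := le_sc E (pow_mem hϖE k)
      refine sub_mem (by split_ifs <;> simp) (add_mem (mul_mem h1 (by split_ifs <;> simp)) (by split_ifs; exacts [hn, zero_mem _]))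
    · rw [derivative_sub, derivative_X_pow, derivative_add, derivative_C_mul, derivative_X, derivative_C]; simp [hQ0, he0]
  · have h1 : (b - a) ^ Q = e * b := by
      rw [hQ, sub_pow_char_pow, ← hQ]; linear_combination hb'
    have h2 : ‖b - a‖ ^ Q = ‖e‖ * ‖b‖ := by rw [← norm_pow, h1, norm_mul]
    have hm0 : 0 < min 1 ε := by positivity
    have h3 : ‖b‖ ≤ max ‖a‖ ‖b - a‖ := by
      have := um_le (r := max ‖a‖ ‖b - a‖) (a := b - a) (b := a) (le_max_right _ _) (le_max_left _ _)
      rwa [sub_add_cancel] at this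
    rw [norm_sub_rev]
    refine lt_of_lt_of_le ?_ (min_le_right 1 ε)
    by_contra hlt
    push Not at hlt
    have h4 : ‖e‖ * max ‖a‖ 1 < ‖b - a‖ ^ Q := he.trans_le (pow_le_pow_left₀ hm0.le hlt Q)
    have h5 : ‖e‖ * max ‖a‖ 1 < ‖e‖ * max ‖a‖ ‖b - a‖ := h4.trans_le (by rw [h2]; gcongr)
    have h6 : max ‖a‖ 1 < max ‖a‖ ‖b - a‖ := lt_of_mul_lt_mul_left h5 (norm_nonneg _)
    have h7 : 1 < ‖b - a‖ := by
      rcases lt_max_iff.1 h6 with h | h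
      · exact absurd h (not_lt.2 (le_max_left _ _))
      · exact (le_max_right _ _).trans_lt h
    have h8 : ‖b‖ ≤ ‖b - a‖ := h3.trans (max_le (by
      rcases lt_max_iff.1 h6 with h | h
      · exact absurd h (not_lt.2 (le_max_left _ _))
      · exact ((le_max_left _ _).trans_lt h).le) le_rfl)
    have h9 : ‖e‖ < 1 := by
      have : ‖e‖ ≤ ‖e‖ * max ‖a‖ 1 := le_mul_of_one_le_right (norm_nonneg _) (le_max_right _ _)
      exact (this.trans_lt he).trans_le (pow_le_one₀ hm0.le (min_le_left _ _))
    have h10 : ‖b - a‖ ^ 1 ≤ ‖b - a‖ ^ Q := pow_le_pow_right₀ h7.le hQ1.le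
    rw [h2, pow_one] at h10
    nlinarith [norm_nonneg e, norm_nonneg b]


theorem dom_unit (L N : Subfield U) (hLN : L ≤ N) {y c d : U} (hy : y ∈ N) (hc : c ∈ L) (hd : d ∈ L) (hd0 : d ≠ 0)
    (hn : ‖(y - c) / d‖ ≤ 1) (g : U[X]) (hg : ∀ i, g.coeff i ∈ L)
    (hD : ∀ i, i ≠ 0 → ‖(taylor c g).coeff i‖ * ‖d‖ ^ i < ‖(taylor c g).coeff 0‖) :
    ∃ g0 ∈ L, g0 ≠ 0 ∧ ∃ u ∈ N, ‖u‖ = 1 ∧ Et ({l | l ∈ L ∧ ‖l‖ ≤ 1} ∪ {(y - c) / d}) N u ∧ g.eval y = g0 * u := by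
  set τ := (y - c) / d
  have hτ : τ ∈ N := div_mem (sub_mem hy (hLN hc)) (hLN hd)
  have hyτ : y - c = d * τ := by simp only [τ]; field_simp
  have hg00 : 0 < ‖(taylor c g).coeff 0‖ := (by positivity : 0 ≤ ‖(taylor c g).coeff 1‖ * ‖d‖ ^ 1).trans_lt (hD 1 one_ne_zero)
  have ht : ∀ i, (taylor c g).coeff i ∈ L := by
    intro i
    let g' : L[X] := ∑ j ∈ g.support, monomial j ⟨g.coeff j, hg j⟩
    have e : g = g'.map L.subtype := by
      simp only [g', Polynomial.map_sum, map_monomial]; exact as_sum_support g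
    rw [e, show c = L.subtype ⟨c, hc⟩ from rfl, ← map_taylor, coeff_map]
    exact Subtype.coe_prop _
  set g0 := (taylor c g).coeff 0
  have hg0 : g0 ≠ 0 := norm_pos_iff.1 hg00
  let u := ∑ i ∈ Finset.range ((taylor c g).natDegree + 1), ((taylor c g).coeff i * d ^ i / g0) * τ ^ i
  have e1 : g.eval y = g0 * u := by
    have : g.eval y = (taylor c g).eval (y - c) := by rw [taylor_eval]; congr 1; ring
    rw [this, eval_eq_sum_range, mul_sum]
    refine sum_congr rfl fun i _ => ?_
    rw [hyτ, mul_pow]; field_simp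
  have hco : ∀ i, i ≠ 0 → ‖(taylor c g).coeff i * d ^ i / g0‖ < 1 := fun i hi => by
    rw [norm_div, div_lt_one hg00, norm_mul, norm_pow]; exact hD i hi
  have h0 : ((taylor c g).coeff 0 * d ^ 0 / g0) * τ ^ 0 = 1 := by rw [pow_zero, pow_zero, mul_one, mul_one]; exact div_self hg0
  refine ⟨g0, ht 0, hg0, u, ?_, ?_, ?_, e1⟩
  · exact sum_mem fun i _ => mul_mem (hLN (div_mem (mul_mem (ht i) (pow_mem hd i)) (ht 0))) (pow_mem hτ i)
  · simp only [u]
    rw [sum_range_succ', h0, add_comm]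
    rw [um_eq, norm_one]
    rw [norm_one]
    refine um_sum_lt one_pos fun i _ => ?_
    rw [norm_mul, norm_pow]
    exact mul_lt_one_of_nonneg_of_lt_one_left (norm_nonneg _) (hco _ (by simp)) (pow_le_one₀ (norm_nonneg _) hn)
  · simp only [u]
    refine Et.sum (R := {l | l ∈ L ∧ ‖l‖ ≤ 1} ∪ {τ}) (Or.inl ⟨zero_mem _, by simp⟩) _ _ fun i _ => Et.mul (Et.base (Or.inl ⟨div_mem (mul_mem (ht i) (pow_mem hd i)) (ht 0), ?_⟩))
      (Et.pow (R := {l | l ∈ L ∧ ‖l‖ ≤ 1} ∪ {τ}) (Or.inl ⟨one_mem _, by simp⟩) (Et.base (Or.inr rfl)) i)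
    rcases eq_or_ne i 0 with rfl | hi
    · rw [pow_zero, mul_one, div_self hg0, norm_one]
    · exact (hco i hi).le

theorem ratl {K1 Lb L : Subfield U} (h : ImmBase K1 Lb) (hL : L ≤ Lb) (hdn : ∀ a ∈ Lb, ∀ ε > 0, ∃ l ∈ L, ‖a - l‖ < ε)
    {y : U} (hy : y ∉ Lb) (N : Subfield U) (hLN : L ≤ N) (hyN : y ∈ N) (R0 : Finset U) (hR : ∀ r ∈ R0, r ∈ ad L {y} ∧ ‖r‖ ≤ 1) :
    ∃ τ ∈ N, ‖τ‖ ≤ 1 ∧ ∀ r ∈ R0, Et ({l | l ∈ L ∧ ‖l‖ ≤ 1} ∪ {τ}) N r := by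
  have lift : ∀ g : U[X], (∀ i, g.coeff i ∈ L) → ∃ g' : Lb[X], g = g'.map Lb.subtype := fun g hg =>
    ⟨∑ j ∈ g.support, monomial j ⟨g.coeff j, hL (hg j)⟩, by
      simp only [Polynomial.map_sum, map_monomial]; exact as_sum_support g⟩
  have key : ∀ g : U[X], (∀ i, g.coeff i ∈ L) → g.eval y ≠ 0 → ∀ᶠ c : Lb in near Lb y,
      ∀ i, i ≠ 0 → ‖(taylor (c : U) g).coeff i‖ * ‖y - c‖ ^ i < ‖(taylor (c : U) g).coeff 0‖ := by
    intro g hg hgy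
    obtain ⟨g', rfl⟩ := lift g hg
    have : g' ≠ 0 := by rintro rfl; simp at hgy
    filter_upwards [h.kaplansky hy g' this] with c hc i hi
    have := hc.2 i hi
    rw [show (c : U) = Lb.subtype c from rfl, ← map_taylor, coeff_map, coeff_map]
    exact this
  have key2 : ∀ r ∈ R0, ∃ g h : U[X], (∀ i, g.coeff i ∈ L) ∧ (∀ i, h.coeff i ∈ L) ∧ (r ≠ 0 → g.eval y ≠ 0 ∧ h.eval y ≠ 0 ∧ r = g.eval y / h.eval y) := by
    intro r hr
    by_cases h0 : r = 0
    · exact ⟨0, 0, by simp, by simp, fun h => absurd h0 h⟩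
    · obtain ⟨g, h, h1, h2, h3⟩ := ad_simple L y r (hR r hr).1 h0
      exact ⟨g, h, h1, h2, fun _ => h3⟩
  choose! G H hG hH hGH using key2
  have ev : ∀ᶠ c : Lb in near Lb y, ∀ r ∈ R0, r ≠ 0 → (∀ i, i ≠ 0 → ‖(taylor (c : U) (G r)).coeff i‖ * ‖y - c‖ ^ i < ‖(taylor (c : U) (G r)).coeff 0‖) ∧
      (∀ i, i ≠ 0 → ‖(taylor (c : U) (H r)).coeff i‖ * ‖y - c‖ ^ i < ‖(taylor (c : U) (H r)).coeff 0‖) := by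
    rw [Filter.eventually_all_finset]
    intro r hr
    by_cases h0 : r = 0
    · exact Filter.Eventually.of_forall fun c h => absurd h0 h
    · exact ((key _ (hG r hr) (hGH r hr h0).1).and (key _ (hH r hr) (hGH r hr h0).2.1)).mono fun c hc _ => hc
  obtain ⟨c0, hc0⟩ := ev
  have hpos : ∀ c ∈ Lb, 0 < ‖y - c‖ := fun c hc => norm_pos_iff.2 (sub_ne_zero.2 (by rintro rfl; exact hy hc))
  obtain ⟨c, hcL, hc⟩ := hdn c0 c0.2 _ (hpos c0 c0.2)
  have hc' := hc0 ⟨c, hL hcL⟩ (by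
    have := um_le (a := y - c0) (b := c0 - c) le_rfl hc.le
    simpa using this)
  obtain ⟨l, hl, hln⟩ := h.val (y - c)
  obtain ⟨d, hdL, hd⟩ := hdn l hl ‖l‖ (by rw [hln]; exact hpos c (hL hcL))
  have hdn' : ‖d‖ = ‖y - c‖ := (um_eq_of_sub hd).trans hln
  have hd0 : d ≠ 0 := norm_pos_iff.1 (by rw [hdn']; exact hpos c (hL hcL))
  have hτ : ‖(y - c) / d‖ ≤ 1 := by rw [norm_div, hdn', div_self (hpos c (hL hcL)).ne']
  refine ⟨(y - c) / d, div_mem (sub_mem hyN (hLN hcL)) (hLN hdL), hτ, fun r hr => ?_⟩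
  by_cases h0 : r = 0
  · subst h0; exact Et.base (Or.inl ⟨zero_mem _, by simp⟩)
  obtain ⟨hgy, hhy, er⟩ := hGH r hr h0
  obtain ⟨g0, hg0, hg00, u, hu, hu1, hue, eg⟩ := dom_unit L N hLN hyN hcL hdL hd0 hτ (G r) (hG r hr) (by rw [hdn']; exact (hc' r hr h0).1)
  obtain ⟨k0, hk0, hk00, v, hv, hv1, hve, eh⟩ := dom_unit L N hLN hyN hcL hdL hd0 hτ (H r) (hH r hr) (by rw [hdn']; exact (hc' r hr h0).2)
  have e : r = (g0 / k0) * (u * v⁻¹) := by rw [er, eg, eh]; field_simp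
  rw [e]
  refine Et.mul (Et.base (Or.inl ⟨div_mem hg0 hk0, ?_⟩)) (hue.mul (Et.inv (Or.inl ⟨zero_mem _, by simp⟩) (Or.inl ⟨neg_mem (one_mem _), by simp⟩) hve hv1 (inv_mem hv)))
  have := (hR r hr).2
  rw [e, norm_mul, norm_mul, norm_inv, hu1, hv1] at this
  simpa using this


theorem dense_ad {L Lb : Subfield U} (hdn : ∀ a ∈ Lb, ∀ ε > 0, ∃ l ∈ L, ‖a - l‖ < ε) (S : Set U) {a : U} (ha : a ∈ ad Lb S) {ε : ℝ} (hε : 0 < ε) :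
    ∃ l ∈ ad L S, ‖a - l‖ < ε := by
  have h : ad Lb S ≤ (ad L S).topologicalClosure := ad_le (fun b hb => Metric.mem_closure_iff.2 fun ε hε => by
      obtain ⟨l, hl, h⟩ := hdn b hb ε hε
      exact ⟨l, le_ad _ _ hl, by rwa [dist_eq_norm]⟩) ((sub_ad L S).trans (le_topologicalClosure _))
  obtain ⟨l, hl, h⟩ := Metric.mem_closure_iff.1 (h ha) ε hε
  exact ⟨l, hl, by rwa [← dist_eq_norm]⟩

variable {C : Type*} [NontriviallyNormedField C] [CompleteSpace C] [IsUltrametricDist C] (ι : U →+* C)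

theorem map_mn {A B : Subfield U} (h : A ≤ B) : A.map ι ≤ B.map ι := by
  rintro _ ⟨a, ha, rfl⟩; exact ⟨a, h ha, rfl⟩
theorem map_ac (M : Subfield U) (h : IsAlgClosed M) : IsAlgClosed (M.map ι) :=
  haveI := h
  let e : M ≃+* M.map ι := M.toSubring.equivMapOfInjective ι ι.injective
  IsAlgClosed.of_exists_root _ fun P _ hP => by
    obtain ⟨z, hz⟩ := IsAlgClosed.exists_root (P.map e.symm.toRingHom) (by rw [degree_map]; exact (degree_pos_of_irreducible hP).ne')
    refine ⟨e z, ?_⟩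
    have := congrArg e hz
    rw [map_zero, show eval z (P.map e.symm.toRingHom) = e.symm (eval (e z) P) by
      conv_lhs => rw [← e.symm_apply_apply z]
      exact eval_map_apply (p := P) e.symm.toRingHom (e z), e.apply_symm_apply] at this
    exact this

theorem val_ap (hι : ∀ a, ‖ι a‖ = ‖a‖) (hd : ∀ c : C, ∀ ε > 0, ∃ a : U, ‖c - ι a‖ < ε) (c : C) : ∃ a : U, ‖a‖ = ‖c‖ := by
  rcases eq_or_ne c 0 with rfl | h0
  · exact ⟨0, by simp⟩
  obtain ⟨a, ha⟩ := hd c ‖c‖ (norm_pos_iff.2 h0)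
  exact ⟨a, by rw [← hι]; exact um_eq_of_sub ha⟩

theorem res_ap (hι : ∀ a, ‖ι a‖ = ‖a‖) (hd : ∀ c : C, ∀ ε > 0, ∃ a : U, ‖c - ι a‖ < ε) (K1 : Subfield U)
    (res : ∀ a : U, ‖a‖ ≤ 1 → ∃ c ∈ K1, ‖a - c‖ < 1) (a : C) (ha : ‖a‖ ≤ 1) : ∃ c ∈ K1.map ι, ‖a - c‖ < 1 := by
  obtain ⟨b, hb⟩ := hd a 1 one_pos
  obtain ⟨c, hc, h⟩ := res b (by
    rw [← hι]; have := um_sub_le (a := a) (b := a - ι b) ha hb.le; rwa [sub_sub_cancel] at this)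
  refine ⟨ι c, ⟨c, hc, rfl⟩, ?_⟩
  have := um_lt hb (b := ι b - ι c) (by rwa [← map_sub, hι])
  rwa [sub_add_sub_cancel] at this

theorem imm_step (p : ℕ) [ExpChar U p] (hι : ∀ a, ‖ι a‖ = ‖a‖) (hd : ∀ c : C, ∀ ε > 0, ∃ a : U, ‖c - ι a‖ < ε)
    (k' E : Subfield U) (hkE : k' ≤ E) (triv : ∀ c ∈ acl k', c ≠ 0 → ‖c‖ = 1) (res : ∀ a : U, ‖a‖ ≤ 1 → ∃ c ∈ acl k', ‖a - c‖ < 1)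
    (hϖ : ∃ ϖ ∈ E, ϖ ≠ 0 ∧ ‖ϖ‖ < 1) (val : ∀ a : U, ∃ l ∈ acl E, ‖l‖ = ‖a‖) (x : U) (hx : x ∉ acl E) : StepH (sc E) (ad E {x}) {x} 1 := by
  intro S0 hS0 hxS
  rw [Finset.singleton_subset_iff] at hxS
  have hU : ImmBase (acl k') (acl E) := ⟨acl_ac _, acl_mono hkE, acl_ac _, triv, res, val⟩
  have hC : ImmBase ((acl k').map ι) ((acl E).map ι) := by
    refine ⟨map_ac ι _ (acl_ac _), map_mn ι (acl_mono hkE), map_ac ι _ (acl_ac _), ?_, res_ap ι hι hd _ res, fun a => ?_⟩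
    · rintro _ ⟨c, hc, rfl⟩ h0; change ‖ι c‖ = 1; rw [hι]; exact triv c hc (by rintro rfl; exact h0 (map_zero ι))
    · obtain ⟨a', ha⟩ := val_ap ι hι hd a
      obtain ⟨l, hl, h⟩ := val a'
      exact ⟨ι l, ⟨l, hl, rfl⟩, by rw [hι, h, ha]⟩
  have hdn : ∀ a ∈ acl E, ∀ ε > 0, ∃ l ∈ sc E, ‖a - l‖ < ε := fun a ha ε hε => sc_dense E p hϖ ha hε
  set N := ad (sc E) (S0 : Set U) with hN
  set Nb := ad (acl E) (S0 : Set U) with hNb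
  have hxN : x ∈ N := sub_ad _ _ hxS
  have hSb : (S0 : Set U) ⊆ sc (ad (acl E) {x}) := hS0.trans (sc_mono (ad_mono (le_acl E) le_rfl))
  obtain ⟨α, hα, eα⟩ := prim (ad (acl E) {x}) S0 hSb
  have hαs : α ∈ sc (ad (acl E) {x}) := ad_le (le_sc _) hSb hα
  have hE1 : ad (ad (acl E) {x}) (S0 : Set U) = Nb := le_antisymm
    (ad_le (ad_mono le_rfl (by simpa using hxS)) (sub_ad _ _)) (ad_mono (le_ad _ _) le_rfl)
  haveI : ExpChar C p := expChar_of_injective_ringHom ι.injective p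
  obtain ⟨_, ⟨y0, hy0, rfl⟩, δ, hδ, hmain⟩ : ∃ y0 ∈ Nb.map ι, ∃ δ : ℝ, 0 < δ ∧ ∀ y ∈ Nb.map ι, ‖y - y0‖ < δ → Nb.map ι ≤ cl ((acl E).map ι) y := by
    refine hC.main p (x := ι x) ?_ (ι α) ?_ _ (map_mn ι (le_ad _ _)) ⟨x, sub_ad _ _ hxS, rfl⟩ ⟨α, hE1 ▸ hα, rfl⟩ ?_
    · rintro ⟨x', hx', e⟩; exact hx (ι.injective e ▸ hx')
    · refine sep_map (b := α) ι (M := ad (acl E) {x}) ?_ (mem_sc.1 hαs)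
      intro a ha
      have : ad (acl E) {x} ≤ (cl ((acl E).map ι) (ι x)).comap ι := ad_le (fun a ha => le_cl _ _ ⟨a, ha, rfl⟩) (by
        simpa using mem_cl _ _)
      exact this ha
    · intro M h1 h2 h3
      rw [Subfield.map_le_iff_le_comap, ← hE1, eα]
      exact ad_le (ad_le (fun a ha => h1 ⟨a, ha, rfl⟩) (by simpa using h2)) (by simpa using h3)
  obtain ⟨y', hy'N, hy'⟩ := dense_ad hdn S0 hy0 hδ
  obtain ⟨ϖ, hϖE, hϖ0, hϖ1⟩ := hϖ
  obtain ⟨k, hk⟩ := exists_pow_lt_of_lt_one (y := ‖ϖ‖) (x := δ / (‖x‖ + 1)) (by positivity) hϖ1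
  have hkx : ‖ϖ ^ k * x‖ < δ := by
    rw [norm_mul, norm_pow]; rw [lt_div_iff₀ (by positivity)] at hk; nlinarith [norm_nonneg x, pow_nonneg (norm_nonneg ϖ) k]
  obtain ⟨π, hπ, hπN, hsep⟩ : ∃ π : Fin 1 → U, (∀ i, π i = y' ∨ ∃ j : Fin 1, π i = y' + ϖ ^ k * x) ∧ (∀ i, π i ∈ N) ∧
      ∀ b ∈ N, IsSeparable (Subfield.closure ((sc E : Set U) ∪ range π)) b := by
    refine SEP (sc E) N (le_ad _ _) S0 rfl (fun _ => x) (fun _ => y') (fun _ => ϖ ^ k) (fun _ => hxN) (fun _ => hy'N)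
      (fun _ => pow_ne_zero _ hϖ0) (fun _ => Or.inl (le_sc E (pow_mem hϖE k))) fun b hb => ?_
    rw [Set.range_const]
    have : N ≤ sc (ad (sc E) {x}) := ad_le ((le_ad _ _).trans (le_sc _)) (hS0.trans (sc_mono (ad_mono (le_sc E) le_rfl)))
    exact mem_sc.1 (this hb)
  set y := π 0
  have hyy : ‖y - y0‖ < δ := by
    rcases hπ 0 with h | ⟨_, h⟩ <;> simp only [y] <;> rw [h]
    · rwa [norm_sub_rev]
    · rw [norm_sub_rev] at hy'
      have := um_lt hy' hkx
      rwa [show y' + ϖ ^ k * x - y0 = y' - y0 + ϖ ^ k * x by ring]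
  have hr : range π = {y} := by ext z; simp [y, Fin.exists_fin_one, eq_comm]
  have hNs : N ≤ sc (ad (sc E) {y}) := fun b hb => by
    refine mem_sc.2 ?_; have := hsep b hb; rwa [hr] at this
  have hNN : N ≤ Nb := ad_mono (sc_le E) le_rfl
  have hyb : y ∉ acl E := fun hy => hx (by
    have h1 : ad (sc E) {y} ≤ acl E := ad_le (sc_le E) (by simpa using hy)
    exact acl_trans h1 (sc_le _ (hNs hxN)))
  have hlim : ∀ b ∈ N, ∀ ε > 0, ∃ e ∈ ad (sc E) {y}, ‖b - e‖ < ε := by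
    intro b hb ε hε
    have h1 := hmain (ι y) ⟨y, hNN (hπN 0), rfl⟩ (by rw [← map_sub, hι]; exact hyy) ⟨b, hNN hb, rfl⟩
    obtain ⟨_, h2, h3⟩ := Metric.mem_closure_iff.1 h1 ε hε
    have h4 : Subfield.closure (((acl E).map ι : Set C) ∪ {ι y}) ≤ (ad (acl E) {y}).map ι := by
      rw [closure_le]
      rintro _ (⟨a, ha, rfl⟩ | rfl)
      · exact ⟨a, le_ad _ _ ha, rfl⟩
      · exact ⟨y, sub_ad _ _ rfl, rfl⟩
    obtain ⟨e, he, rfl⟩ := h4 h2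
    rw [dist_eq_norm] at h3
    change ‖ι b - ι e‖ < ε at h3
    rw [← map_sub, hι] at h3
    obtain ⟨l, hl, h5⟩ := dense_ad hdn {y} he hε
    exact ⟨l, hl, by have := um_lt h3 h5; rwa [sub_add_sub_cancel] at this⟩
  have hyN : ad (sc E) {y} ≤ N := ad_le (le_ad _ _) (by simpa using hπN 0)
  obtain ⟨R0, G0, hR, hG, he⟩ := Et.finM (B := S0.filter fun b => ‖b‖ ≤ 1) (R := {e | e ∈ ad (sc E) {y} ∧ ‖e‖ ≤ 1}) (G := N) (fun b hb' => by
    obtain ⟨hb, hb1⟩ := mem_filter.1 hb'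
    have hbN : b ∈ N := sub_ad _ _ hb
    exact newton _ hyN (fun g hg e he c hc => div_mem (sub_mem hg (hyN he)) (hyN hc)) hbN hb1 (mem_sc.1 (hNs hbN)) (hlim b hbN))
  obtain ⟨τ, hτN, hτ1, hτ⟩ := ratl hU (sc_le E) hdn hyb N (le_ad _ _) (hπN 0) R0 (fun r hr => by
    rcases hR hr with rfl | h
    · exact ⟨zero_mem _, by simp⟩
    · exact h)
  refine ⟨{τ}, by simp, by simpa using ⟨hτ1, hτN⟩, fun b hb hb1 => ?_⟩
  have := Et.trans hG hτ (he b (mem_filter.2 ⟨hb, hb1⟩))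
  rwa [Finset.coe_singleton]
end Imm

section Base
variable {U : Type*} [NormedField U] [IsUltrametricDist U] {ρ : ℕ}

def MT (K1 : Subfield U) (π : Fin ρ → U) : Set U := {t | ∃ c ∈ K1, c ≠ 0 ∧ ∃ e : Fin ρ → ℤ, t = c * ∏ i, π i ^ e i}

section MT
variable {K1 : Subfield U} {π : Fin ρ → U}
theorem MT.mul (h : Ind π) {s t : U} (hs : s ∈ MT K1 π) (ht : t ∈ MT K1 π) : s * t ∈ MT K1 π := by
  obtain ⟨c, hc, hc0, e, rfl⟩ := hs
  obtain ⟨d, hd, hd0, f, rfl⟩ := ht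
  refine ⟨c * d, mul_mem hc hd, mul_ne_zero hc0 hd0, e + f, ?_⟩
  simp only [Pi.add_apply, zpow_add₀ (h.1 _).1, prod_mul_distrib]; ring
theorem MT.inv {s : U} (hs : s ∈ MT K1 π) : s⁻¹ ∈ MT K1 π := by
  obtain ⟨c, hc, hc0, e, rfl⟩ := hs
  refine ⟨c⁻¹, inv_mem hc, inv_ne_zero hc0, -e, ?_⟩
  simp only [Pi.neg_apply, zpow_neg, Finset.prod_inv_distrib, mul_inv]
theorem MT.k1 {c : U} (hc : c ∈ K1) (h0 : c ≠ 0) : c ∈ MT K1 π := ⟨c, hc, h0, 0, by simp⟩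
theorem MT.pi (i : Fin ρ) : π i ∈ MT K1 π := ⟨1, one_mem _, one_ne_zero, Pi.single i 1, by
  rw [Finset.prod_eq_single i] <;> simp +contextual [Pi.single_apply]⟩
theorem MT.ne (h : Ind π) {s : U} (hs : s ∈ MT K1 π) : s ≠ 0 := by
  obtain ⟨c, hc, hc0, e, rfl⟩ := hs
  exact mul_ne_zero hc0 (prod_ne_zero_iff.2 fun i _ => zpow_ne_zero _ (h.1 i).1)
theorem MT.norm (ht : Tr K1) {c : U} (hc : c ∈ K1) (h0 : c ≠ 0) (e : Fin ρ → ℤ) :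
    ‖c * ∏ i, π i ^ e i‖ = ∏ i, ‖π i‖ ^ e i := by
  rw [norm_mul, ht c hc h0, one_mul, norm_prod]; simp only [norm_zpow]
theorem MT.one (ht : Tr K1) (h : Ind π) {s : U} (hs : s ∈ MT K1 π) (h1 : ‖s‖ = 1) : s ∈ K1 := by
  obtain ⟨c, hc, hc0, e, rfl⟩ := hs
  rw [MT.norm ht hc hc0] at h1
  rw [h.2 e h1]; simpa using hc
theorem MT.merge (ht : Tr K1) (h : Ind π) : ∀ a ∈ MT K1 π, ∀ b ∈ MT K1 π, ‖a‖ = ‖b‖ → a + b = 0 ∨ a + b ∈ MT K1 π := by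
  intro a ha b hb hab
  have hb0 := MT.ne h hb
  have h1 : a * b⁻¹ ∈ K1 := MT.one ht h (MT.mul h ha (MT.inv hb)) (by
    rw [norm_mul, norm_inv, hab, mul_inv_cancel₀ (norm_ne_zero_iff.2 hb0)])
  have e : a + b = (a * b⁻¹ + 1) * b := by field_simp
  by_cases h0 : a * b⁻¹ + 1 = 0
  · left; rw [e, h0, zero_mul]
  · right; rw [e]; exact MT.mul h (MT.k1 (add_mem h1 (one_mem _)) h0) hb
theorem MT.ad (h : Ind π) : Subfield.closure (MT K1 π) = ad K1 (range π) := by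
  refine le_antisymm (closure_le.2 ?_) (ad_le (fun c hc => ?_) ?_)
  · rintro _ ⟨c, hc, hc0, e, rfl⟩
    exact mul_mem (le_ad _ _ hc) (prod_mem fun i _ => zpow_mem (sub_ad _ _ (mem_range_self i)) _)
  · by_cases h0 : c = 0
    · subst h0; exact zero_mem _
    · exact Subfield.subset_closure (MT.k1 hc h0)
  · rintro _ ⟨i, rfl⟩; exact Subfield.subset_closure (MT.pi i)
theorem MT.sub (h : Ind π) : MT K1 π ⊆ LU.ad K1 (range π) := by rw [← MT.ad h]; exact Subfield.subset_closure

theorem MT.quot (ht : Tr K1) (h : Ind π) {a : U} (ha : a ∈ LU.ad K1 (range π)) (ha0 : a ≠ 0) :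
    ∃ s0 ∈ MT K1 π, ∃ S R : Finset U, (∀ s ∈ S, s ∈ MT K1 π ∧ ‖s‖ < 1) ∧ (∀ s ∈ R, s ∈ MT K1 π ∧ ‖s‖ < 1) ∧
      a = s0 * ((1 + ∑ s ∈ S, s) / (1 + ∑ s ∈ R, s)) := by
  classical
  have hone : (1 : U) ∈ MT K1 π := MT.k1 (one_mem _) one_ne_zero
  have rc := ring_cl' (MT K1 π) (fun a ha b hb => MT.mul h ha hb) hone (fun a ha => by
    rw [← neg_one_mul]; exact MT.mul h (MT.k1 (neg_mem (one_mem _)) (by simp)) ha)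
  have key : ∀ a ∈ Subring.closure (MT K1 π), a ≠ 0 → ∃ s0 ∈ MT K1 π, ∃ S : Finset U, (∀ s ∈ S, s ∈ MT K1 π ∧ ‖s‖ < 1) ∧
      a = s0 * (1 + ∑ s ∈ S, s) := by
    intro a ha ha0
    have ha' : a ∈ (Subring.closure (MT K1 π) : Set U) := ha
    rw [rc] at ha'
    obtain ⟨S, h1, h2, rfl⟩ := nf _ (MT.merge ht h) a ha'
    obtain ⟨s0, hs0, -, hlt⟩ := sum_dom S h2 (fun s hs => MT.ne h (h1 s hs)) (by
      rw [nonempty_iff_ne_empty]; rintro rfl; simp at ha0)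
    have h0 := MT.ne h (h1 s0 hs0)
    refine ⟨s0, h1 s0 hs0, (S.erase s0).image fun s => s * s0⁻¹, ?_, ?_⟩
    · intro s hs
      obtain ⟨t, ht', rfl⟩ := mem_image.1 hs
      refine ⟨MT.mul h (h1 t (mem_of_mem_erase ht')) (MT.inv (h1 s0 hs0)), ?_⟩
      rw [norm_mul, norm_inv, ← div_eq_mul_inv, div_lt_one (norm_pos_iff.2 h0)]
      exact hlt t (mem_of_mem_erase ht') (ne_of_mem_erase ht')
    · rw [Finset.sum_image (fun a _ b _ e => mul_right_cancel₀ (inv_ne_zero h0) e), ← Finset.sum_mul, mul_add, ← add_sum_erase _ _ hs0]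
      field_simp
  rw [← MT.ad h, Subfield.mem_closure_iff] at ha
  obtain ⟨y, hy, z, hz, rfl⟩ := ha
  obtain ⟨s0, hs0, S, hS, rfl⟩ := key y hy (by rintro rfl; simp at ha0)
  obtain ⟨r0, hr0, R, hR, rfl⟩ := key z hz (by rintro rfl; simp at ha0)
  refine ⟨s0 * r0⁻¹, MT.mul h hs0 (MT.inv hr0), S, R, hS, hR, ?_⟩
  rw [mul_div_mul_comm]; ring
theorem one_add_norm {S : Finset U} (hS : ∀ s ∈ S, ‖s‖ < 1) : ‖1 + ∑ s ∈ S, s‖ = 1 := by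
  rw [um_eq, norm_one]; rw [norm_one]; exact um_sum_lt one_pos hS
theorem MT.nrm (ht : Tr K1) (h : Ind π) {a : U} (ha : a ∈ LU.ad K1 (range π)) (ha0 : a ≠ 0) :
    ∃ e : Fin ρ → ℤ, ‖a‖ = ∏ i, ‖π i‖ ^ e i := by
  obtain ⟨_, ⟨c, hc, hc0, e, rfl⟩, S, R, hS, hR, rfl⟩ := MT.quot ht h ha ha0
  refine ⟨e, ?_⟩
  rw [norm_mul, MT.norm ht hc hc0, norm_div, one_add_norm fun s hs => (hS s hs).2, one_add_norm fun s hs => (hR s hs).2, div_one, mul_one]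
theorem MT.et (ht : Tr K1) (h : Ind π) {a : U} (ha : a ∈ LU.ad K1 (range π)) (ha1 : ‖a‖ ≤ 1) :
    ∃ M : Finset U, (∀ m ∈ M, m ∈ MT K1 π ∧ ‖m‖ ≤ 1) ∧ ∀ (R : Set U) (N : Subfield U), (K1 : Set U) ⊆ R →
      LU.ad K1 (range π) ≤ N → (∀ m ∈ M, Et R N m) → Et R N a := by
  classical
  by_cases ha0 : a = 0
  · exact ⟨∅, by simp, fun R N hR _ _ => Et.base (hR (by rw [ha0]; exact zero_mem K1))⟩
  obtain ⟨s0, hs0, S, R, hS, hR, rfl⟩ := MT.quot ht h ha ha0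
  have nS := one_add_norm fun s hs => (hS s hs).2
  have nR := one_add_norm fun s hs => (hR s hs).2
  rw [norm_mul, norm_div, nS, nR, div_one, mul_one] at ha1
  refine ⟨insert s0 (S ∪ R), ?_, fun R' N hR' hN hM => ?_⟩
  · intro m hm
    rcases mem_insert.1 hm with rfl | hm
    · exact ⟨hs0, ha1⟩
    · rcases mem_union.1 hm with hm | hm
      · exact ⟨(hS m hm).1, (hS m hm).2.le⟩
      · exact ⟨(hR m hm).1, (hR m hm).2.le⟩
  · have z : (0 : U) ∈ R' := hR' (zero_mem K1)
    have n1 : (-1 : U) ∈ R' := hR' (neg_mem (one_mem K1))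
    have o1 : Et R' N (1 : U) := Et.base (hR' (one_mem K1))
    rw [div_eq_mul_inv]
    refine Et.mul (hM _ (by simp)) (Et.mul (Et.add o1 (Et.sum z _ _ fun s hs => hM s (by simp [hs]))) (Et.inv z n1
      (Et.add o1 (Et.sum z _ _ fun s hs => hM s (by simp [hs]))) nR ?_))
    exact inv_mem (add_mem (one_mem _) (sum_mem fun s hs => hN (MT.sub h (hR s hs).1)))
end MT
end Base

section Base2
variable {U : Type*} [NormedField U] [IsUltrametricDist U] {ρ : ℕ}

theorem two_terms (f : U[X]) (hf : f ≠ 0) {a : U} (h : f.eval a = 0) (ha : a ≠ 0) : ∃ i j, i < j ∧ j ≤ f.natDegree ∧ f.coeff i ≠ 0 ∧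
    f.coeff j ≠ 0 ∧ ‖f.coeff i‖ * ‖a‖ ^ i = ‖f.coeff j‖ * ‖a‖ ^ j := by
  classical
  obtain ⟨i, hi, hm⟩ := exists_max_image f.support (fun i => ‖f.coeff i * a ^ i‖) (Polynomial.nonempty_support_iff.2 hf)
  by_contra hcon
  push Not at hcon
  have hi0 := mem_support_iff.1 hi
  have hlt : ∀ j ∈ f.support.erase i, ‖f.coeff j * a ^ j‖ < ‖f.coeff i * a ^ i‖ := fun j hj => by
    obtain ⟨hji, hj⟩ := Finset.mem_erase.1 hj
    refine lt_of_le_of_ne (hm j hj) fun e => ?_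
    rw [norm_mul, norm_mul, norm_pow, norm_pow] at e
    rcases lt_or_gt_of_ne hji with h' | h'
    · exact hcon j i h' (le_natDegree_of_mem_supp i hi) (mem_support_iff.1 hj) hi0 e
    · exact hcon i j h' (le_natDegree_of_mem_supp j hj) hi0 (mem_support_iff.1 hj) e.symm
  have hp : 0 < ‖f.coeff i * a ^ i‖ := norm_pos_iff.2 (mul_ne_zero hi0 (pow_ne_zero _ ha))
  rw [eval_eq_sum, Polynomial.sum, ← add_sum_erase _ _ hi] at h
  have := um_eq (um_sum_lt hp hlt)
  rw [h, norm_zero] at this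
  exact hp.ne this

theorem torsion {K1 : Subfield U} {x : Fin ρ → U} (ht : Tr K1) (h : Ind x) (f : U[X]) (hf : f ≠ 0)
    (hc : ∀ i, f.coeff i ∈ ad K1 (range x)) {a : U} (hfa : f.eval a = 0) (ha : a ≠ 0) :
    ∃ n, 0 < n ∧ n ≤ f.natDegree ∧ ∃ e : Fin ρ → ℤ, ‖a‖ ^ n = ∏ i, ‖x i‖ ^ e i := by
  obtain ⟨i, j, hij, hj, hi0, hj0, e⟩ := two_terms f hf hfa ha
  obtain ⟨v, hv⟩ := MT.nrm ht h (div_mem (hc i) (hc j)) (div_ne_zero hi0 hj0)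
  refine ⟨j - i, by omega, by omega, v, ?_⟩
  rw [← hv, norm_div, eq_div_iff (norm_ne_zero_iff.2 hj0)]
  have hai : ‖a‖ ^ i ≠ 0 := pow_ne_zero _ (norm_ne_zero_iff.2 ha)
  apply mul_right_cancel₀ hai
  rw [e, mul_assoc, mul_comm, mul_assoc, ← pow_add]; congr 2; omega

theorem uniform {K1 : Subfield U} {x : Fin ρ → U} (ht : Tr K1) (h : Ind x) (S0 : Finset U)
    (hS : (S0 : Set U) ⊆ acl (ad K1 (range x))) :
    ∃ m, 0 < m ∧ ∀ a ∈ ad K1 S0, a ≠ 0 → ∃ e : Fin ρ → ℤ, ‖a‖ ^ m = ∏ i, ‖x i‖ ^ e i := by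
  set E := ad K1 (range x)
  haveI : FiniteDimensional E (adjoin E (S0 : Set U)) :=
    IntermediateField.finiteDimensional_adjoin fun x hx => (mem_acl.1 (hS hx)).isIntegral
  refine ⟨(finrank E (adjoin E (S0 : Set U))).factorial, Nat.factorial_pos _, fun a ha ha0 => ?_⟩
  have haN : a ∈ adjoin E (S0 : Set U) := by
    change a ∈ (adjoin E (S0 : Set U)).toSubfield
    rw [adj_ad]; exact ad_mono (le_ad _ _) le_rfl ha
  let a' : adjoin E (S0 : Set U) := ⟨a, haN⟩
  have hi : IsIntegral E a' := IsIntegral.of_finite _ _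
  obtain ⟨n, hn, hnd, e, he⟩ := torsion ht h ((minpoly E a').map (algebraMap E U)) (map_ne_zero (minpoly.ne_zero hi))
    (fun i => by rw [coeff_map]; exact Subtype.coe_prop _) (a := a) (by
      rw [eval_map_algebraMap]
      have := congrArg (algebraMap _ U) (minpoly.aeval E a')
      rwa [map_zero, ← aeval_algebraMap_apply] at this) ha0
  rw [natDegree_map] at hnd
  obtain ⟨k, hk⟩ := Nat.dvd_factorial hn (hnd.trans (minpoly.natDegree_le a'))
  refine ⟨fun i => e i * k, ?_⟩
  rw [hk, pow_mul, he, ← Finset.prod_pow]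
  simp only [zpow_mul, zpow_natCast]

theorem vbasis {x : Fin ρ → U} (h : Ind x) (N : Subfield U) (hx : ∀ i, x i ∈ N) {m : ℕ} (hm : 0 < m)
    (hN : ∀ a ∈ N, a ≠ 0 → ∃ e : Fin ρ → ℤ, ‖a‖ ^ m = ∏ i, ‖x i‖ ^ e i) :
    ∃ w : Fin ρ → U, (∀ i, w i ∈ N) ∧ Ind w ∧ ∀ a ∈ N, a ≠ 0 → ∃ e : Fin ρ → ℤ, ‖a‖ = ∏ i, ‖w i‖ ^ e i := by
  have hx0 : ∀ i, ‖x i‖ ≠ 0 := fun i => norm_ne_zero_iff.2 (h.1 i).1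
  let φ : (Fin ρ → ℤ) → ℝ := fun e => ∏ i, ‖x i‖ ^ e i
  have φa : ∀ e f, φ (e + f) = φ e * φ f := fun e f => by
    simp only [φ, Pi.add_apply, zpow_add₀ (hx0 _), prod_mul_distrib]
  have φs : ∀ (c : ℤ) e, φ (c • e) = φ e ^ c := fun c e => by
    simp only [φ, Pi.smul_apply, smul_eq_mul, mul_comm c, zpow_mul, Finset.prod_zpow]
  have φ0 : ∀ e, 0 < φ e := fun e => Finset.prod_pos fun i _ => zpow_pos (norm_pos_iff.2 (h.1 i).1) _
  have φi : ∀ e, φ e = 1 → e = 0 := h.2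
  let M : Submodule ℤ (Fin ρ → ℤ) :=
    { carrier := {e | ∃ a ∈ N, a ≠ 0 ∧ ‖a‖ ^ m = φ e}
      zero_mem' := ⟨1, one_mem _, one_ne_zero, by simp [φ]⟩
      add_mem' := by
        rintro e f ⟨a, ha, ha0, h1⟩ ⟨b, hb, hb0, h2⟩
        exact ⟨a * b, mul_mem ha hb, mul_ne_zero ha0 hb0, by rw [φa, norm_mul, mul_pow, h1, h2]⟩
      smul_mem' := by
        rintro c e ⟨a, ha, ha0, h1⟩
        exact ⟨a ^ c, zpow_mem ha c, zpow_ne_zero c ha0, by rw [φs, ← h1, norm_zpow, ← zpow_natCast, ← zpow_natCast, zpow_comm]⟩ }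
  have fr : finrank ℤ M = ρ := by
    refine le_antisymm ((LinearMap.finrank_le_finrank_of_injective (f := M.subtype) M.injective_subtype).trans_eq (by simp)) ?_
    let ψ : (Fin ρ → ℤ) →ₗ[ℤ] M := LinearMap.codRestrict M ((m : ℤ) • LinearMap.id) fun e => ⟨∏ i, x i ^ e i, prod_mem fun i _ => zpow_mem (hx i) _,
      prod_ne_zero_iff.2 fun i _ => zpow_ne_zero _ (h.1 i).1, by
        rw [LinearMap.smul_apply, φs]; simp [φ]⟩
    have := LinearMap.finrank_le_finrank_of_injective (f := ψ) (fun a b e => by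
      have : (m : ℤ) • a = (m : ℤ) • b := congrArg Subtype.val e
      exact smul_right_injective _ (by exact_mod_cast hm.ne') this)
    simpa using this
  let B := Module.finBasisOfFinrankEq ℤ M fr
  have hB0 : ∀ i, ((B i : M) : Fin ρ → ℤ) ≠ 0 := fun i h => B.ne_zero i (Subtype.ext h)
  have ex : ∀ i, ∃ a ∈ N, a ≠ 0 ∧ ‖a‖ < 1 ∧ ∃ ε : ℤ, ε * ε = 1 ∧ ‖a‖ ^ m = φ (ε • (B i : Fin ρ → ℤ)) := by
    intro i
    obtain ⟨a, ha, ha0, h1⟩ := (B i).2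
    rcases lt_trichotomy ‖a‖ 1 with hl | hl | hl
    · exact ⟨a, ha, ha0, hl, 1, by simp, by simpa using h1⟩
    · exact absurd (φi _ (by rw [← h1, hl, one_pow])) (hB0 i)
    · exact ⟨a⁻¹, inv_mem ha, inv_ne_zero ha0, by rw [norm_inv]; exact inv_lt_one_of_one_lt₀ hl, -1, by simp, by
        rw [φs, ← h1]; simp⟩
  choose w hwN hw0 hw1 ε hε hw using ex
  have pw : ∀ e : Fin ρ → ℤ, (∏ i, ‖w i‖ ^ e i) ^ m = φ (∑ i, (e i * ε i) • (B i : Fin ρ → ℤ)) := by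
    intro e
    have φsum : ∀ (s : Finset (Fin ρ)) (g : Fin ρ → Fin ρ → ℤ), φ (∑ i ∈ s, g i) = ∏ i ∈ s, φ (g i) := by
      intro s g
      induction s using Finset.cons_induction with
      | empty => simp [φ]
      | cons a s _ ih => rw [Finset.sum_cons, Finset.prod_cons, φa, ih]
    rw [φsum, ← Finset.prod_pow]
    refine prod_congr rfl fun i _ => ?_
    rw [mul_smul, φs, ← hw, ← zpow_natCast, ← zpow_natCast, zpow_comm]
  have hw0' : ∀ e : Fin ρ → ℤ, 0 ≤ ∏ i, ‖w i‖ ^ e i := fun e => Finset.prod_nonneg fun i _ => zpow_nonneg (norm_nonneg _) _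
  refine ⟨w, hwN, ⟨fun i => ⟨hw0 i, hw1 i⟩, fun e he => ?_⟩, fun a ha ha0 => ?_⟩
  · have h1 := φi _ ((pw e).symm.trans (by rw [he, one_pow]))
    have h2 : ∑ i, (e i * ε i) • B i = 0 := Subtype.ext (by push_cast; exact h1)
    funext i
    have h3 := Fintype.linearIndependent_iff.1 B.linearIndependent _ h2 i
    have := congrArg (· * ε i) h3
    simpa [mul_assoc, hε] using this
  · obtain ⟨f, hf⟩ := hN a ha ha0
    let f' : M := ⟨f, a, ha, ha0, hf⟩
    refine ⟨fun i => B.repr f' i * ε i, ?_⟩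
    refine (pow_left_inj₀ (norm_nonneg _) (hw0' _) hm.ne').1 ?_
    rw [pw, hf]
    change φ f = _
    congr 1
    have := congrArg Subtype.val (B.sum_repr f')
    simp only [mul_assoc, hε, mul_one]
    rw [← show (f' : Fin ρ → ℤ) = f from rfl, ← this]; push_cast; rfl
end Base2

section Base
variable {U : Type*} [NormedField U] [IsUltrametricDist U] {ρ : ℕ} {K1 : Subfield U}

theorem alg_sc0 [CharZero U] (E : Subfield U) : acl E ≤ sc E := fun a ha => by
  have hi := (mem_acl.1 ha).isIntegral
  exact mem_sc.2 (PerfectField.separable_of_irreducible (minpoly.irreducible hi))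

theorem Ind.congr {x y : Fin ρ → U} (h : Ind x) (e : ∀ i, ‖y i‖ = ‖x i‖) : Ind y :=
  ⟨fun i => ⟨norm_ne_zero_iff.1 (by rw [e]; exact norm_ne_zero_iff.2 (h.1 i).1), by rw [e]; exact (h.1 i).2⟩,
    fun f hf => h.2 f (by simpa only [e] using hf)⟩

theorem base_pi (p : ℕ) [ExpChar U p] (ht : Tr K1) {x : Fin ρ → U} (h : Ind x) (S0 : Finset U)
    (hS : (S0 : Set U) ⊆ sc (ad K1 (range x))) (hx : ∀ i, x i ∈ S0) :
    ∃ π : Fin ρ → U, Ind π ∧ (∀ i, π i ∈ ad K1 S0) ∧ (∀ a ∈ ad K1 S0, a ≠ 0 → ∃ e : Fin ρ → ℤ, ‖a‖ = ∏ i, ‖π i‖ ^ e i) ∧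
      ad K1 S0 ≤ sc (ad K1 (range π)) := by
  set N := ad K1 S0
  have hxN : ∀ i, x i ∈ N := fun i => sub_ad _ _ (hx i)
  have hNs : N ≤ sc (ad K1 (range x)) := ad_le ((le_ad _ _).trans (le_sc _)) hS
  obtain ⟨m, hm, hu⟩ := uniform ht h S0 (hS.trans (sc_le _))
  obtain ⟨w, hwN, hw, hwv⟩ := vbasis h N hxN hm hu
  have key : ∃ x' c : Fin ρ → U, (∀ i, x' i ∈ N) ∧ (∀ i, c i ≠ 0) ∧ (∀ i, c i ∈ K1 ∨ ∃ p : ℕ, ∃ m ∈ N, (p : U) = 0 ∧ c i = m ^ p) ∧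
      (∀ b ∈ N, IsSeparable (Subfield.closure (K1 ∪ range x')) b) ∧ ∀ i j, ‖c i * x' j‖ < ‖w i‖ := by
    cases ‹ExpChar U p› with
    | zero =>
      have h1 : ∀ i j, ∀ᶠ k in Filter.atTop, ‖x j‖ ^ k < ‖w i‖ := fun i j =>
        (tendsto_pow_atTop_nhds_zero_of_lt_one (norm_nonneg _) (h.1 j).2).eventually_lt_const (norm_pos_iff.2 (hw.1 i).1)
      obtain ⟨k, hk, hk0⟩ := ((Filter.eventually_all.2 fun i => Filter.eventually_all.2 (h1 i)).and (Filter.eventually_gt_atTop 0)).exists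
      refine ⟨fun j => x j ^ k, fun _ => 1, fun i => pow_mem (hxN i) k, by simp, fun i => Or.inl (one_mem _), fun b hb => ?_, fun i j => ?_⟩
      · refine mem_sc.1 (alg_sc0 _ (acl_trans ?_ (sc_le _ (hNs hb))))
        refine ad_le ((le_ad _ _).trans (le_acl _)) ?_
        rintro _ ⟨j, rfl⟩
        exact mem_acl.2 (IsAlgebraic.of_pow hk0 (mem_acl.1 (le_acl _ (sub_ad _ _ ⟨j, rfl⟩))))
      · simpa using hk i j
    | prime hp =>
      refine ⟨x, fun i => w i ^ p, hxN, fun i => pow_ne_zero _ (hw.1 i).1, fun i => Or.inr ⟨p, w i, hwN i, by simp, rfl⟩,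
        fun b hb => mem_sc.1 (hNs hb), fun i j => ?_⟩
      rw [norm_mul, norm_pow]
      have := hw.1 i
      have h0 := norm_pos_iff.2 this.1
      have h2 : ‖w i‖ ^ p ≤ ‖w i‖ := pow_le_of_le_one h0.le this.2.le hp.ne_zero
      have h3 := (h.1 j).2
      have h4 : 0 < ‖w i‖ ^ p := by positivity
      nlinarith
  obtain ⟨x', c, hx', hc0, hc, hs, hsm⟩ := key
  obtain ⟨π, h1, h2, h3⟩ := SEP K1 N (le_ad _ _) S0 rfl x' w c hx' hwN hc0 hc hs
  have h4 : ∀ i, ‖π i‖ = ‖w i‖ := fun i => by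
    rcases h1 i with e | ⟨j, e⟩ <;> rw [e]
    exact um_eq (hsm i j)
  exact ⟨π, hw.congr h4, h2, by simpa only [h4] using hwv, fun b hb => mem_sc.2 (h3 b hb)⟩

theorem zpow_dis {π : Fin ρ → U} (h : Ind π) {p : ℕ} (hp : p.Prime) (e : Fin ρ → ℤ) (he : ∏ i, ‖π i‖ ^ e i ≠ 1) :
    ∃ k : ℕ, ∀ f : Fin ρ → ℤ, (∏ i, ‖π i‖ ^ f i) ^ p ^ k ≠ ∏ i, ‖π i‖ ^ e i := by
  obtain ⟨i, hi⟩ : ∃ i, e i ≠ 0 := by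
    by_contra hc; push Not at hc; exact he (by simp [hc])
  refine ⟨(e i).natAbs, fun f hf => ?_⟩
  have h0 : ∀ i, ‖π i‖ ≠ 0 := fun i => norm_ne_zero_iff.2 (h.1 i).1
  have h1 := congrFun (h.2 (fun j => f j * (p ^ (e i).natAbs : ℕ) - e j) (by
    simp only [zpow_sub₀ (h0 _), zpow_mul, zpow_natCast, Finset.prod_div_distrib, Finset.prod_pow]
    rw [hf, div_self (prod_ne_zero_iff.2 fun j _ => zpow_ne_zero _ (h0 j))])) i
  simp only [Pi.zero_apply] at h1
  have h2 : p ^ (e i).natAbs ∣ (e i).natAbs := by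
    rw [← Int.natCast_dvd]; exact ⟨f i, by linarith⟩
  have h3 := Nat.le_of_dvd (Int.natAbs_pos.2 hi) h2
  exact absurd h3 (not_le.2 (lt_pow_self hp.one_lt))

variable {C : Type*} [NontriviallyNormedField C] [CompleteSpace C] [IsUltrametricDist C] (ι : U →+* C)

theorem base_lim [IsAlgClosed U] (p : ℕ) [ExpChar U p] (hι : ∀ a, ‖ι a‖ = ‖a‖) (hd : ∀ c : C, ∀ ε > 0, ∃ a : U, ‖c - ι a‖ < ε)
    (hac : IsAlgClosed K1) (ht : Tr K1) (res : ∀ a : U, ‖a‖ ≤ 1 → ∃ c ∈ K1, ‖a - c‖ < 1)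
    {π : Fin ρ → U} (hρ : 0 < ρ) (h : Ind π) (N : Subfield U) (hKN : K1 ≤ N) (hπN : ∀ i, π i ∈ N)
    (hv : ∀ a ∈ N, a ≠ 0 → ∃ e : Fin ρ → ℤ, ‖a‖ = ∏ i, ‖π i‖ ^ e i) (hs : N ≤ sc (ad K1 (range π))) {b : U} (hb : b ∈ N)
    {ε : ℝ} (hε : 0 < ε) : ∃ e ∈ ad K1 (range π), ‖b - e‖ < ε := by
  have hMN : ad K1 (range π) ≤ N := ad_le hKN (by rintro _ ⟨i, rfl⟩; exact hπN i)
  have hA : Abh (K1.map ι) ι.fieldRange (N.map ι) (ι '' MT K1 π) p := by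
    refine ⟨map_ac ι _ hac, ?_, map_mn ι hKN, ?_, ?_, res_ap ι hι hd _ res, ?_, ?_, ?_, ?_, ?_, ?_, ?_, ?_, ?_⟩
    · have := map_ac ι ⊤ (IsAlgClosed.of_ringEquiv U _ Subfield.topEquiv.symm)
      rwa [← RingHom.fieldRange_eq_map] at this
    · rintro _ ⟨a, -, rfl⟩; exact ⟨a, rfl⟩
    · rintro _ ⟨c, hc, rfl⟩ h0; change ‖ι c‖ = 1; rw [hι]; exact ht c hc (by rintro rfl; exact h0 (map_zero ι))
    · rintro _ ⟨t, h1, rfl⟩; exact ⟨t, hMN (MT.sub h h1), rfl⟩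
    · rintro _ ⟨t, h1, rfl⟩ h0; exact MT.ne h h1 ((map_eq_zero ι).1 h0)
    · rintro _ ⟨t, h1, rfl⟩ _ ⟨s, h2, rfl⟩; exact ⟨t * s, MT.mul h h1 h2, map_mul _ _ _⟩
    · rintro _ ⟨t, h1, rfl⟩; exact ⟨t⁻¹, MT.inv h1, map_inv₀ _ _⟩
    · rintro _ ⟨c, hc, rfl⟩ h0; exact ⟨c, MT.k1 hc (by rintro rfl; exact h0 (map_zero ι)), rfl⟩
    · rintro _ ⟨t, h1, rfl⟩ h2; exact ⟨t, MT.one ht h h1 (by rwa [hι] at h2), rfl⟩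
    · rintro _ ⟨a, ha, rfl⟩ h0
      obtain ⟨e, he⟩ := hv a ha (by rintro rfl; exact h0 (map_zero ι))
      refine ⟨_, ⟨_, ⟨1, one_mem _, one_ne_zero, e, rfl⟩, rfl⟩, ?_⟩
      change _ = ‖ι a‖
      rw [hι, hι, MT.norm ht (one_mem _) one_ne_zero, he]
    · rintro hp _ ⟨_, ⟨c, hc, hc0, e, rfl⟩, rfl⟩ h1
      rw [hι, MT.norm ht hc hc0] at h1
      obtain ⟨k, hk⟩ := zpow_dis h hp e h1
      refine ⟨k, ?_⟩
      rintro ⟨_, ⟨_, ⟨d, hd', hd0, f, rfl⟩, rfl⟩, h2⟩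
      rw [hι, hι, MT.norm ht hc hc0, MT.norm ht hd' hd0] at h2
      exact hk f h2
    · have := h.1 ⟨0, hρ⟩
      exact ⟨_, ⟨_, MT.inv (MT.pi ⟨0, hρ⟩), rfl⟩, by
        rw [hι, norm_inv]; exact (one_lt_inv₀ (norm_pos_iff.2 this.1)).2 this.2⟩
  haveI : ExpChar C p := expChar_of_injective_ringHom ι.injective p
  have h1 := hA.main (b := ι b) ⟨b, hb, rfl⟩ (by
    refine sep_map (b := b) ι (M := ad K1 (range π)) ?_ (mem_sc.1 (hs hb))
    intro a ha
    have : ad K1 (range π) ≤ (Subfield.closure (ι '' MT K1 π)).comap ι := by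
      rw [← MT.ad h, closure_le]; exact fun t ht => Subfield.subset_closure ⟨t, ht, rfl⟩
    exact this ha)
  obtain ⟨y, h2, h3⟩ := Metric.mem_closure_iff.1 h1 ε hε
  have h4 : (AddSubmonoid.closure (ι '' MT K1 π) : Set C) ⊆ (ad K1 (range π)).map ι := by
    have : AddSubmonoid.closure (ι '' MT K1 π) ≤ ((ad K1 (range π)).map ι).toAddSubgroup.toAddSubmonoid := by
      rw [AddSubmonoid.closure_le]; rintro _ ⟨t, ht, rfl⟩; exact ⟨t, MT.sub h ht, rfl⟩
    exact this
  obtain ⟨e, he, rfl⟩ := h4 h2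
  rw [dist_eq_norm] at h3
  change ‖ι b - ι e‖ < ε at h3
  rw [← map_sub, hι] at h3
  exact ⟨e, he, h3⟩

theorem base_step [IsAlgClosed U] (p : ℕ) [ExpChar U p] (hι : ∀ a, ‖ι a‖ = ‖a‖) (hd : ∀ c : C, ∀ ε > 0, ∃ a : U, ‖c - ι a‖ < ε)
    (k' : Subfield U) (hk' : acl k' ≤ sc k') (ht : ∀ c ∈ acl k', c ≠ 0 → ‖c‖ = 1) (res : ∀ a : U, ‖a‖ ≤ 1 → ∃ c ∈ acl k', ‖a - c‖ < 1)
    (hρ : 0 < ρ) {x : Fin ρ → U} (hx : Ind x) (X : Finset U) (hX : (X : Set U) = range x) : StepH (sc k') (ad k' (range x)) X ρ := by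
  classical
  intro S0 hS0 hXS
  have hka : sc k' = acl k' := le_antisymm (sc_le _) hk'
  rw [hka]
  set K1 := acl k'
  set N := ad K1 S0
  obtain ⟨π, hi, hπN, hv, hs⟩ := base_pi (K1 := K1) p ht hx S0 (hS0.trans (sc_mono (ad_mono (le_acl k') le_rfl)))
    (fun i => hXS (by rw [← mem_coe, hX]; exact ⟨i, rfl⟩))
  have hMN : ad K1 (range π) ≤ N := ad_le (le_ad _ _) (by rintro _ ⟨i, rfl⟩; exact hπN i)
  obtain ⟨R0, G0, hR, hG, he⟩ := Et.finM (B := S0.filter fun b => ‖b‖ ≤ 1) (R := {e | e ∈ ad K1 (range π) ∧ ‖e‖ ≤ 1}) (G := N) (fun b hb' => by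
    obtain ⟨hb, hb1⟩ := mem_filter.1 hb'
    have hbN : b ∈ N := sub_ad _ _ hb
    exact newton _ hMN (fun g hg e he c hc => div_mem (sub_mem hg (hMN he)) (hMN hc)) hbN hb1 (mem_sc.1 (hs hbN))
      (fun ε hε => base_lim ι p hι hd (acl_ac _) ht res hρ hi N (le_ad _ _) hπN hv hs hbN hε))
  have hR' : ∀ r ∈ R0, r ∈ ad K1 (range π) ∧ ‖r‖ ≤ 1 := fun r hr => by
    rcases hR hr with rfl | h
    · exact ⟨zero_mem _, by simp⟩
    · exact h
  choose! M hM hMe using fun r hr => MT.et ht hi (hR' r hr).1 (hR' r hr).2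
  have h1 : ∀ m ∈ R0.biUnion M, ∃ e : Fin ρ → ℤ, ∃ c ∈ K1, m = c * ∏ i, π i ^ e i ∧ ‖∏ i, π i ^ e i‖ ≤ 1 := by
    intro m hm
    obtain ⟨r, hr, hm⟩ := mem_biUnion.1 hm
    obtain ⟨⟨c, hc, hc0, e, rfl⟩, h2⟩ := hM r hr m hm
    exact ⟨e, c, hc, rfl, by rwa [norm_mul, ht c hc hc0, one_mul] at h2⟩
  choose! e c hc hm hn using h1
  obtain ⟨π', hi', h2, -, h3⟩ := perron hi ((R0.biUnion M).image fun m => ∏ i, π i ^ e m i) (by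
    intro m hm'
    obtain ⟨m, h, rfl⟩ := mem_image.1 hm'
    exact ⟨hn m h, _, rfl⟩)
  have hπ'N : ∀ i, π' i ∈ N := fun i => hMN (by
    have : Subfield.closure (range π) ≤ ad K1 (range π) := Subfield.closure_mono subset_union_right
    exact this (h2 i))
  have h1R : (1 : U) ∈ {l : U | l ∈ K1 ∧ ‖l‖ ≤ 1} := ⟨one_mem _, by simp⟩
  refine ⟨univ.image π', card_image_le.trans (by simp), ?_, fun b hb hb1 => ?_⟩
  · simp only [mem_image, mem_univ, true_and]
    rintro _ ⟨i, rfl⟩; exact ⟨(hi'.1 i).2.le, hπ'N i⟩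
  · have hk : ∀ a ∈ K1, ‖a‖ ≤ 1 := fun a ha => by
      by_cases h0 : a = 0
      · simp [h0]
      · exact (ht a ha h0).le
    refine Et.trans hG (fun r hr => hMe r hr _ N (fun a ha => Or.inl ⟨ha, hk a ha⟩) hMN fun m hm' => ?_) (he b (mem_filter.2 ⟨hb, hb1⟩))
    have hmb := mem_biUnion.2 ⟨r, hr, hm'⟩
    rw [hm m hmb]
    refine Et.mul (Et.base (Or.inl ⟨hc m hmb, hk _ (hc m hmb)⟩)) ?_
    have h4 : ∏ i, π i ^ e m i ∈ Submonoid.closure (range π') := h3 _ (mem_image_of_mem (fun m => ∏ i, π i ^ e m i) hmb)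
    generalize ∏ i, π i ^ e m i = z at h4 ⊢
    induction h4 using Submonoid.closure_induction with
    | mem x hx => obtain ⟨i, rfl⟩ := hx; exact Et.base (Or.inr (by simp))
    | one => exact Et.base (Or.inl h1R)
    | mul x y _ _ h1 h2 => exact Et.mul h1 h2
end Base

section Z
variable {U : Type*} [NormedField U] [IsUltrametricDist U] [IsAlgClosed U] {ρ : ℕ}
variable {C : Type*} [NontriviallyNormedField C] [CompleteSpace C] [IsUltrametricDist C] (ι : U →+* C)

theorem ad_ad (A : Subfield U) (S S' : Set U) : ad (ad A S) S' = ad A (S ∪ S') :=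
  le_antisymm (ad_le (ad_mono le_rfl subset_union_left) (subset_union_right.trans (sub_ad _ _)))
    (ad_le ((le_ad _ _).trans (le_ad _ _)) (union_subset ((sub_ad A S).trans (le_ad _ _)) (sub_ad _ _)))

theorem thmZ (p : ℕ) [ExpChar U p] (hι : ∀ a, ‖ι a‖ = ‖a‖) (hd : ∀ c : C, ∀ ε > 0, ∃ a : U, ‖c - ι a‖ < ε)
    (k' : Subfield U) (hk' : acl k' ≤ sc k') (ht : ∀ c ∈ acl k', c ≠ 0 → ‖c‖ = 1) (res : ∀ a : U, ‖a‖ ≤ 1 → ∃ c ∈ acl k', ‖a - c‖ < 1)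
    (hρ : 0 < ρ) {x : Fin ρ → U} (hx : Ind x) (hv : ∀ a : U, a ≠ 0 → ∃ n, 0 < n ∧ ∃ e : Fin ρ → ℤ, ‖a‖ ^ n = ∏ i, ‖x i‖ ^ e i)
    (X : Finset U) : (∀ z ∈ X, z ∉ acl (ad k' (range x ∪ ((X : Set U) \ {z})))) → Good k' (ad k' (range x ∪ X)) (ρ + X.card) := by
  classical
  induction X using induction_on with
  | empty =>
    intro _
    have := Good.step (X := univ.image x) le_rfl (le_ad k' (range x)) (by
      simpa using (sub_ad k' (range x)).trans (le_sc _)) (Good.start fun c hc => ht c (le_acl _ hc))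
      (base_step ι p hι hd k' hk' ht res hρ hx _ (by simp))
    simpa using this
  | insert z Y hz ih =>
    intro h
    have h1 := ih fun a ha hc => h a (mem_insert_of_mem ha) (acl_mono (ad_mono le_rfl
      (union_subset_union_right _ (show (↑Y \ {a} : Set U) ⊆ ↑(insert z Y) \ {a} from fun b hb => ⟨mem_coe.2 (mem_insert_of_mem hb.1), hb.2⟩))) hc)
    set E := ad k' (range x ∪ (Y : Set U))
    have hxE : ∀ i, x i ∈ E := fun i => sub_ad _ _ (Or.inl ⟨i, rfl⟩)
    have hzE : z ∉ acl E := fun hc => h z (mem_insert_self _ _) (acl_mono (ad_mono le_rfl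
      (union_subset_union_right _ (show (↑Y : Set U) ⊆ ↑(insert z Y) \ {z} from fun b hb => ⟨mem_coe.2 (mem_insert_of_mem hb), fun e => hz (by
        rw [Set.mem_singleton_iff] at e; exact e ▸ hb)⟩))) hc)
    have hs := imm_step ι p hι hd k' E (le_ad _ _) ht res ⟨x ⟨0, hρ⟩, hxE _, (hx.1 _).1, (hx.1 _).2⟩ (fun a => by
      rcases eq_or_ne a 0 with rfl | ha
      · exact ⟨0, zero_mem _, rfl⟩
      obtain ⟨n, hn, e, he⟩ := hv a ha
      obtain ⟨l, hl⟩ := IsAlgClosed.exists_pow_nat_eq (∏ i, x i ^ e i) hn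
      refine ⟨l, mem_acl.2 (IsAlgebraic.of_pow hn (mem_acl.1 (le_acl _ ?_))), ?_⟩
      · rw [hl]; exact prod_mem fun i _ => zpow_mem (hxE i) _
      · refine (pow_left_inj₀ (norm_nonneg _) (norm_nonneg _) hn.ne').1 ?_
        rw [he, ← norm_pow, hl, norm_prod]; simp only [norm_zpow]) z hzE
    have := Good.step (le_ad _ _) (le_ad E {z}) (by simpa using (le_sc _ (sub_ad E {z} rfl) : z ∈ _)) h1 hs
    rw [Finset.card_insert_of_notMem hz, ← add_assoc]
    convert this using 1
    rw [ad_ad, Set.union_assoc, coe_insert, Set.union_singleton]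
end Z

section T
variable {U : Type*} [Field U] {k : Subfield U}
theorem ad_iff (k : Subfield U) (S : Set U) (a : U) : a ∈ acl (ad k S) ↔ IsAlgebraic (Algebra.adjoin k S) a := by
  rw [← IntermediateField.isAlgebraic_adjoin_iff, mem_acl, ← adj_ad]; rfl
theorem td1 {d : ℕ} (hd : Algebra.trdeg k U = d) {n : ℕ} {z : Fin n → U} (hz : AlgebraicIndependent k z) : n ≤ d := by
  have := hz.lift_cardinalMk_le_trdeg
  rw [hd] at this; simpa using this
theorem td2 {d : ℕ} (hd : Algebra.trdeg k U = d) {S : Finset U} (hS : ∀ a, a ∈ acl (ad k S)) : d ≤ S.card := by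
  haveI : Algebra.IsAlgebraic (Algebra.adjoin k (S : Set U)) U := ⟨fun a => (ad_iff _ _ _).1 (hS a)⟩
  have := Algebra.IsAlgebraic.trdeg_le_cardinalMk k (S : Set U)
  rw [hd] at this; simpa using this
theorem td3 {d : ℕ} (hd : Algebra.trdeg k U = d) {n : ℕ} (hn : n ≤ d) {z : Fin n → U} (hz : ∀ a, a ∈ acl (ad k (range z))) :
    AlgebraicIndependent k z := by
  haveI : Algebra.IsAlgebraic (Algebra.adjoin k (range z)) U := ⟨fun a => (ad_iff _ _ _).1 (hz a)⟩
  exact (Algebra.IsAlgebraic.isTranscendenceBasis_of_lift_le_trdeg_of_finite k z (by rw [hd]; simpa using hn)).1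
end T
section RI
variable {U : Type*} [NormedField U] [IsUltrametricDist U] {k K1 : Subfield U}

theorem Ind.ai (ht : Tr K1) {ρ : ℕ} {x : Fin ρ → U} (h : Ind x) : AlgebraicIndependent K1 x := by
  classical
  rw [algebraicIndependent_iff]
  intro f hf
  by_contra h0
  let T : (Fin ρ →₀ ℕ) → U := fun m => ((MvPolynomial.coeff m f : K1) : U) * ∏ i, x i ^ (m i : ℤ)
  have hn : ∀ m ∈ f.support, ‖T m‖ = ∏ i, ‖x i‖ ^ (m i : ℤ) := fun m hm => by
    have : ((MvPolynomial.coeff m f : K1) : U) ≠ 0 := fun e => MvPolynomial.mem_support_iff.1 hm (Subtype.ext e)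
    exact MT.norm ht (f.coeff m).2 this _
  have hx0 : ∀ i, ‖x i‖ ≠ 0 := fun i => norm_ne_zero_iff.2 (h.1 i).1
  have hi : ∀ m ∈ f.support, ∀ m' ∈ f.support, ‖T m‖ = ‖T m'‖ → m = m' := fun m hm m' hm' e => by
    rw [hn m hm, hn m' hm'] at e
    have := h.2 (fun i => (m i : ℤ) - m' i) (by
      simp only [zpow_sub₀ (hx0 _), Finset.prod_div_distrib]
      rw [e, div_self (prod_ne_zero_iff.2 fun j _ => zpow_ne_zero _ (hx0 j))])
    ext i; have := congrFun this i; simp only [Pi.zero_apply] at this; omega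
  have hT0 : ∀ m ∈ f.support, T m ≠ 0 := fun m hm => by
    rw [← norm_ne_zero_iff, hn m hm]; exact prod_ne_zero_iff.2 fun j _ => zpow_ne_zero _ (hx0 j)
  obtain ⟨s, hs, e, -⟩ := sum_dom (f.support.image T) (by
    intro a ha b hb hab
    obtain ⟨m, hm, rfl⟩ := mem_image.1 ha
    obtain ⟨m', hm', rfl⟩ := mem_image.1 hb
    rw [hi m hm m' hm' hab]) (by
    intro a ha; obtain ⟨m, hm, rfl⟩ := mem_image.1 ha; exact hT0 m hm)
    ((MvPolynomial.support_nonempty.2 h0).image _)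
  rw [Finset.sum_image (fun m hm m' hm' e => hi m hm m' hm' (by rw [e]))] at e
  have : ∑ m ∈ f.support, T m = 0 := by
    rw [MvPolynomial.aeval_def, MvPolynomial.eval₂_eq'] at hf
    simp only [T, zpow_natCast]; exact hf
  rw [this, norm_zero] at e
  obtain ⟨m, hm, rfl⟩ := mem_image.1 hs
  exact hT0 m hm (norm_eq_zero.1 e.symm)

def RI (k : Subfield U) {τ : ℕ} (y : Fin τ → U) : Prop := ∀ g : MvPolynomial (Fin τ) k, g ≠ 0 → ‖MvPolynomial.aeval y g‖ = 1

variable {τ : ℕ} {y : Fin τ → U}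
theorem RI.ai (h : RI k y) : AlgebraicIndependent k y := by
  rw [algebraicIndependent_iff]
  intro g hg; by_contra h0; have := h g h0; rw [hg] at this; simp at this
theorem RI.le (h : RI k y) (g : MvPolynomial (Fin τ) k) : ‖MvPolynomial.aeval y g‖ ≤ 1 := by
  by_cases h0 : g = 0
  · simp [h0]
  · exact (h g h0).le
theorem RI.quot {c : U} (hc : c ∈ ad k (range y)) : ∃ g h : MvPolynomial (Fin τ) k, c = MvPolynomial.aeval y g / MvPolynomial.aeval y h := by
  rw [← adj_ad] at hc; exact (IntermediateField.mem_adjoin_range_iff k y c).1 hc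
theorem RI.triv (h : RI k y) : ∀ c ∈ ad k (range y), c ≠ 0 → ‖c‖ = 1 := by
  intro c hc h0
  obtain ⟨g, g', rfl⟩ := RI.quot hc
  rw [div_ne_zero_iff] at h0
  rw [norm_div, h g (by rintro rfl; simp at h0), h g' (by rintro rfl; simp at h0), div_one]
theorem RI.one (h : RI k y) (i) : ‖y i‖ = 1 := by simpa using h (MvPolynomial.X i) (MvPolynomial.X_ne_zero i)
theorem RI.pert (ht : Tr k) (h : RI k y) {y' : Fin τ → U} (hy : ∀ i, ‖y' i - y i‖ < 1) : RI k y' := by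
  have h1 : ∀ i, ‖y' i‖ = 1 := fun i => (um_eq_of_sub' (by rw [h.one i]; exact hy i)).trans (h.one i)
  have : ∀ g : MvPolynomial (Fin τ) k, ‖MvPolynomial.aeval y' g‖ ≤ 1 ∧ ‖MvPolynomial.aeval y' g - MvPolynomial.aeval y g‖ < 1 := by
    intro g
    induction g using MvPolynomial.induction_on with
    | C a =>
      have : ‖(a : U)‖ ≤ 1 := by
        by_cases h0 : (a : U) = 0
        · simp [h0]
        · exact (ht a a.2 h0).le
      exact ⟨by rw [MvPolynomial.aeval_C]; exact this, by simp⟩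
    | add a b ha hb =>
      simp only [map_add]
      exact ⟨um_le ha.1 hb.1, by rw [add_sub_add_comm]; exact um_lt ha.2 hb.2⟩
    | mul_X a i ha =>
      simp only [map_mul, MvPolynomial.aeval_X]
      refine ⟨by rw [norm_mul, h1, mul_one]; exact ha.1, ?_⟩
      rw [show ∀ a b c d : U, a * b - c * d = (a - c) * b + c * (b - d) by intros; ring]
      refine um_lt (by rw [norm_mul, h1, mul_one]; exact ha.2) ?_
      rw [norm_mul]
      exact (mul_le_of_le_one_left (norm_nonneg _) (h.le a)).trans_lt (hy i)
  intro g hg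
  have := (this g).2
  rw [← h g hg]
  exact um_eq_of_sub' (by rw [h g hg]; exact this)

theorem factor (hac : IsAlgClosed K1) (ht : Tr K1) {g : U[X]} (hg : ∀ i, g.coeff i ∈ K1) (h0 : g ≠ 0) {a : U}
    (ha : ∀ c ∈ K1, 1 ≤ ‖a - c‖) : 1 ≤ ‖g.eval a‖ := by
  haveI := hac
  obtain ⟨f, rfl⟩ : ∃ f : K1[X], f.map (algebraMap K1 U) = g := by
    have : g ∈ Polynomial.lifts (algebraMap K1 U) := (Polynomial.lifts_iff_coeff_lifts g).2 fun i => ⟨⟨_, hg i⟩, rfl⟩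
    exact (Polynomial.mem_lifts g).1 this
  have hf := (IsAlgClosed.splits f).eq_prod_roots
  rw [hf, Polynomial.map_mul, Polynomial.map_C, Polynomial.map_multiset_prod, Multiset.map_map, eval_mul, eval_C, eval_multiset_prod, Multiset.map_map,
    norm_mul]
  have hl : f.leadingCoeff ≠ 0 := leadingCoeff_ne_zero.2 (by rintro rfl; simp at h0)
  rw [show ‖algebraMap K1 U f.leadingCoeff‖ = 1 from ht _ f.leadingCoeff.2 fun e => hl (Subtype.ext e), one_mul]
  induction f.roots using Multiset.induction_on with
  | empty => simp
  | cons c s ih =>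
    rw [Multiset.map_cons, Multiset.prod_cons, norm_mul]
    refine one_le_mul_of_one_le_of_one_le ?_ ih
    have := ha c c.2
    simp only [Function.comp_apply, Polynomial.map_sub, map_X, map_C, eval_sub, eval_X, eval_C]; exact this

theorem RI.cons [IsAlgClosed U] (h : RI k y) {b : U} (hb : ‖b‖ ≤ 1) (hc : ∀ c ∈ acl (ad k (range y)), 1 ≤ ‖b - c‖) :
    RI k (Fin.cons b y : Fin (τ + 1) → U) := by
  intro g hg
  let φ : MvPolynomial (Fin τ) k →+* U := (MvPolynomial.aeval y : MvPolynomial (Fin τ) k →ₐ[k] U)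
  let G := (MvPolynomial.finSuccEquiv k τ g).map φ
  have e : ∀ g, MvPolynomial.aeval (Fin.cons b y : Fin (τ + 1) → U) g = ((MvPolynomial.finSuccEquiv k τ g).map φ).eval b := by
    intro g
    induction g using MvPolynomial.induction_on with
    | C a => simp [φ, MvPolynomial.finSuccEquiv_apply]
    | add a b ha hb => simp [ha, hb]
    | mul_X a i ha =>
      rw [map_mul, ha, map_mul, Polynomial.map_mul, eval_mul]
      congr 1
      refine Fin.cases ?_ (fun j => ?_) i <;> simp [MvPolynomial.finSuccEquiv_X_zero, MvPolynomial.finSuccEquiv_X_succ, φ]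
  have hG : ∀ i, G.coeff i ∈ ad k (range y) := fun i => by
    rw [coeff_map, ← adj_ad]
    exact IntermediateField.algebra_adjoin_le_adjoin _ _ ((Algebra.adjoin_range_eq_range_aeval k y) ▸ ⟨_, rfl⟩)
  have hG0 : G ≠ 0 := by
    intro e; exact hg ((map_eq_zero_iff _ (MvPolynomial.finSuccEquiv k τ).injective).1 ((Polynomial.map_eq_zero_iff (f := φ) h.ai).1 e))
  rw [e]
  refine le_antisymm (eval_le_one G (fun i => ?_) b hb) (factor (acl_ac _) (triv_alg h.triv) (fun i => le_acl _ (hG i)) hG0 hc)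
  rw [coeff_map]; exact h.le _
end RI

theorem nat_max (P : ℕ → Prop) (d : ℕ) (h0 : P 0) (hd : ∀ n, P n → n ≤ d) : ∃ n, P n ∧ ∀ m, P m → m ≤ n := by
  classical
  exact ⟨Nat.findGreatest P d, Nat.findGreatest_spec (Nat.zero_le d) h0, fun m hm => Nat.le_findGreatest (hd m hm) hm⟩
section SG
variable {U : Type*} [Field U] {k N : Subfield U}
theorem sepgen [PerfectField k] (S0 : Finset U) (hN : N = ad k S0) {d : ℕ} (hd : Algebra.trdeg k U = d) (hU : ∀ a, a ∈ acl N) :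
    ∃ s : Fin d → U, (∀ i, s i ∈ N) ∧ ∀ b ∈ N, IsSeparable (ad k (range s)) b := by
  classical
  let L := adjoin k (S0 : Set U)
  have hL : ∀ a, a ∈ L ↔ a ∈ N := fun a => by rw [hN, ← adj_ad]; rfl
  haveI : Algebra.EssFiniteType k L := by
    rw [← IntermediateField.fg_top_iff]
    exact (IntermediateField.fg_top_iff.2 (IntermediateField.essFiniteType_iff.2 ⟨S0, rfl⟩))
  obtain ⟨s, hs, hsep⟩ := exists_isTranscendenceBasis_and_isSeparable_of_perfectField k L
  have hS : ∀ b ∈ N, IsSeparable (ad k ((s.image Subtype.val : Finset U) : Set U)) b := fun b hb => by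
    have h1 : IsSeparable (adjoin k (s : Set L)).toSubfield (⟨b, (hL b).2 hb⟩ : L) := hsep.isSeparable (F := adjoin k (s : Set L)) ⟨b, (hL b).2 hb⟩
    refine sep_map L.val.toRingHom (b := (⟨b, (hL b).2 hb⟩ : L)) (fun a ha => ?_) h1
    rw [← adj_ad, coe_image]
    have : L.val a ∈ (adjoin k (s : Set L)).map L.val := ⟨a, ha, rfl⟩
    rwa [IntermediateField.adjoin_map] at this
  have hA : AlgebraicIndependent k (fun a : s => ((a : L) : U)) := hs.1.map' (f := L.val) Subtype.val_injective
  have c1 : s.card ≤ d := by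
    have := hA.comp s.equivFin.symm s.equivFin.symm.injective
    exact td1 hd this
  have c2 : d ≤ (s.image Subtype.val : Finset U).card := td2 hd fun a => acl_trans (fun b hb => sc_le _ (mem_sc.2 (hS b hb))) (hU a)
  rw [Finset.card_image_of_injective _ Subtype.val_injective] at c2
  let e := s.equivFinOfCardEq (le_antisymm c1 c2)
  refine ⟨fun i => ((e.symm i : L) : U), fun i => (hL _).1 (Subtype.mem _), fun b hb => ?_⟩
  have hR : (range fun i => ((e.symm i : L) : U)) = ((s.image Subtype.val : Finset U) : Set U) := by
    ext a; simp only [Set.mem_range, coe_image, Set.mem_image]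
    exact ⟨fun ⟨i, hi⟩ => ⟨_, (e.symm i).2, hi⟩, fun ⟨c, hc, h⟩ => ⟨e ⟨c, hc⟩, by simpa using h⟩⟩
  rw [hR]; exact hS b hb
end SG
section Fr
variable {U : Type*} [NormedField U] [IsUltrametricDist U] {k K1 N : Subfield U}

theorem res_up (hac : IsAlgClosed K1) (ht : Tr K1) (hN : ∀ b ∈ N, ‖b‖ ≤ 1 → ∃ c ∈ K1, ‖b - c‖ < 1) {a : U} (ha : a ∈ acl N)
    (h1 : ‖a‖ ≤ 1) : ∃ c ∈ K1, ‖a - c‖ < 1 := by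
  by_contra hcon
  push Not at hcon
  obtain ⟨f, hf, hfa⟩ := mem_acl.1 ha
  obtain ⟨i, hi, hm⟩ := exists_max_image f.support (fun i => ‖(f.coeff i : U)‖) (Polynomial.nonempty_support_iff.2 hf)
  have hi0 : (f.coeff i : U) ≠ 0 := fun e => mem_support_iff.1 hi (Subtype.ext e)
  have hb : ∀ j, ‖((f.coeff j / f.coeff i : N) : U)‖ ≤ 1 := fun j => by
    push_cast
    rw [norm_div, div_le_one (norm_pos_iff.2 hi0)]
    by_cases hj : j ∈ f.support
    · exact hm j hj
    · rw [notMem_support_iff.1 hj]; simp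
  choose c hc hcd using fun j => hN _ (f.coeff j / f.coeff i).2 (hb j)
  let g : U[X] := ∑ j ∈ f.support, monomial j (c j)
  have hg : ∀ j, g.coeff j = if j ∈ f.support then c j else 0 := fun j => by
    simp [g, finset_sum_coeff, coeff_monomial]
  have hci : c i ≠ 0 := fun e => by
    have := hcd i
    rw [e, div_self (mem_support_iff.1 hi)] at this; simp at this
  have := factor hac ht (g := g) (fun j => by rw [hg]; split_ifs; exacts [hc j, zero_mem _])
    (fun e => hci (by have := hg i; rw [e, if_pos hi] at this; simpa using this.symm)) hcon
  have h2 : ∑ j ∈ f.support, ((f.coeff j / f.coeff i : N) : U) * a ^ j = 0 := by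
    rw [aeval_eq_sum_range] at hfa
    have : ∑ j ∈ f.support, ((f.coeff j : N) : U) * a ^ j = 0 := by
      rw [← hfa]; refine Finset.sum_subset_zero_on_sdiff (fun j hj => ?_) (fun j hj => ?_) (fun j _ => rfl)
      · exact mem_range.2 (Nat.lt_succ_of_le (le_natDegree_of_mem_supp j hj))
      · rw [notMem_support_iff.1 (Finset.mem_sdiff.1 hj).2]; simp
    push_cast
    simp only [div_mul_eq_mul_div]
    rw [← Finset.sum_div, this, zero_div]
  refine absurd this (not_le.2 ?_)
  rw [show g.eval a = -∑ j ∈ f.support, (((f.coeff j / f.coeff i : N) : U) - c j) * a ^ j by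
    simp only [sub_mul, sum_sub_distrib, h2, zero_sub, neg_neg, g, eval_finset_sum, eval_monomial], norm_neg]
  refine um_sum_lt one_pos fun j _ => ?_
  rw [norm_mul, norm_pow]
  exact (mul_le_of_le_one_right (norm_nonneg _) (pow_le_one₀ (norm_nonneg _) h1)).trans_lt (hcd j)

theorem Ind.cons {ρ : ℕ} {x : Fin ρ → U} (h : Ind x) {a : U} (ha : a ≠ 0) (h1 : ‖a‖ < 1)
    (hn : ∀ n, 0 < n → ∀ e : Fin ρ → ℤ, ‖a‖ ^ n ≠ ∏ i, ‖x i‖ ^ e i) : Ind (Fin.cons a x : Fin (ρ + 1) → U) := by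
  have ha' : ‖a‖ ≠ 0 := norm_ne_zero_iff.2 ha
  refine ⟨fun i => Fin.cases ⟨ha, h1⟩ h.1 i, fun e he => ?_⟩
  simp only [Fin.prod_univ_succ, Fin.cons_zero, Fin.cons_succ] at he
  have h0 : e 0 = 0 := by
    by_contra h0
    rcases lt_or_gt_of_ne h0 with h' | h'
    · apply hn (-e 0).toNat (by omega) (fun i => e i.succ)
      rw [← zpow_natCast, Int.toNat_of_nonneg (by omega), zpow_neg]
      exact (eq_inv_of_mul_eq_one_right he).symm
    · apply hn (e 0).toNat (by omega) (fun i => -e i.succ)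
      rw [← zpow_natCast, Int.toNat_of_nonneg (by omega)]
      simp only [zpow_neg, Finset.prod_inv_distrib]
      exact eq_inv_of_mul_eq_one_left he
  rw [h0, zpow_zero, one_mul] at he
  have := h.2 _ he
  funext i; exact Fin.cases h0 (fun j => congrFun this j) i

theorem val_N {ρ : ℕ} {x : Fin ρ → U} (h : Ind x) (hxN : ∀ i, x i ∈ N) (hmax : ∀ x' : Fin (ρ + 1) → U, (∀ i, x' i ∈ N) → ¬ Ind x') :
    ∀ a ∈ N, a ≠ 0 → ∃ n, 0 < n ∧ ∃ e : Fin ρ → ℤ, ‖a‖ ^ n = ∏ i, ‖x i‖ ^ e i := by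
  have key : ∀ a ∈ N, a ≠ 0 → ‖a‖ < 1 → ∃ n, 0 < n ∧ ∃ e : Fin ρ → ℤ, ‖a‖ ^ n = ∏ i, ‖x i‖ ^ e i := by
    intro a ha h0 h1
    by_contra hcon
    push Not at hcon
    exact hmax _ (fun i => Fin.cases ha hxN i) (h.cons h0 h1 hcon)
  intro a ha h0
  rcases lt_trichotomy ‖a‖ 1 with h1 | h1 | h1
  · exact key a ha h0 h1
  · exact ⟨1, one_pos, 0, by simp [h1]⟩
  · obtain ⟨n, hn, e, he⟩ := key a⁻¹ (inv_mem ha) (inv_ne_zero h0) (by rw [norm_inv]; exact inv_lt_one_of_one_lt₀ h1)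
    refine ⟨n, hn, -e, ?_⟩
    rw [norm_inv, inv_pow, inv_eq_iff_eq_inv] at he
    rw [he]; simp
theorem val_up {ρ : ℕ} {x : Fin ρ → U} (h0 : ∀ i, x i ≠ 0) (hN : ∀ a ∈ N, a ≠ 0 → ∃ n, 0 < n ∧ ∃ e : Fin ρ → ℤ, ‖a‖ ^ n = ∏ i, ‖x i‖ ^ e i)
    {a : U} (ha : a ∈ acl N) (ha0 : a ≠ 0) : ∃ n, 0 < n ∧ ∃ e : Fin ρ → ℤ, ‖a‖ ^ n = ∏ i, ‖x i‖ ^ e i := by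
  obtain ⟨f, hf, hfa⟩ := mem_acl.1 ha
  obtain ⟨i, j, hij, -, hi0, hj0, e⟩ := two_terms (f.map (algebraMap N U)) (map_ne_zero hf) (a := a) (by rwa [eval_map_algebraMap]) ha0
  simp only [coeff_map] at hi0 hj0 e
  obtain ⟨n, hn, v, hv⟩ := hN _ (f.coeff i / f.coeff j).2 (by push_cast; exact div_ne_zero hi0 hj0)
  refine ⟨(j - i) * n, Nat.mul_pos (by omega) hn, v, ?_⟩
  rw [← hv, pow_mul]; congr 1
  push_cast
  rw [norm_div, eq_div_iff (norm_ne_zero_iff.2 (show ((f.coeff j : N) : U) ≠ 0 from hj0))]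
  apply mul_right_cancel₀ (pow_ne_zero i (norm_ne_zero_iff.2 ha0))
  have e' : ‖((f.coeff i : N) : U)‖ * ‖a‖ ^ i = ‖((f.coeff j : N) : U)‖ * ‖a‖ ^ j := e
  rw [e', show ‖a‖ ^ j = ‖a‖ ^ (j - i) * ‖a‖ ^ i by rw [← pow_add]; congr 1; omega]
  ring

def Fr (k N : Subfield U) {τ ρ : ℕ} (y : Fin τ → U) (x : Fin ρ → U) : Prop := (∀ i, y i ∈ N) ∧ (∀ i, x i ∈ N) ∧ RI k y ∧ Ind x ∧
  (∀ a : U, ‖a‖ ≤ 1 → ∃ c ∈ acl (ad k (range y)), ‖a - c‖ < 1) ∧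
  ∀ a : U, a ≠ 0 → ∃ n, 0 < n ∧ ∃ e : Fin ρ → ℤ, ‖a‖ ^ n = ∏ i, ‖x i‖ ^ e i

theorem fr_ai {τ ρ : ℕ} {y : Fin τ → U} {x : Fin ρ → U} (hy : RI k y) (hx : Ind x) : AlgebraicIndependent k (elim x y) := by
  have h2 := hx.ai hy.triv
  letI : Algebra k (ad k (range y)) := (inclusion (le_ad _ _)).toAlgebra
  haveI : IsScalarTower k (ad k (range y)) U := .of_algebraMap_eq fun x => rfl
  exact hy.ai.sumElim_of_tower (S := ad k (range y)) (by
    rintro _ ⟨i, rfl⟩; exact ⟨⟨_, sub_ad _ _ ⟨i, rfl⟩⟩, rfl⟩) h2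
theorem fr_count {d : ℕ} (hd : Algebra.trdeg k U = d) {τ ρ : ℕ} {y : Fin τ → U} {x : Fin ρ → U} (hy : RI k y) (hx : Ind x) : τ + ρ ≤ d := by
  have := (fr_ai hy hx).comp finSumFinEquiv.symm finSumFinEquiv.symm.injective
  have := td1 hd this; omega

theorem exists_fr [IsAlgClosed U] {d : ℕ} (hd : Algebra.trdeg k U = d) (ht : Tr k) (hU : ∀ a, a ∈ acl N) :
    ∃ τ ρ : ℕ, τ + ρ ≤ d ∧ (∃ (y : Fin τ → U) (x : Fin ρ → U), (∀ i, y i ∈ N) ∧ (∀ i, x i ∈ N) ∧ RI k y ∧ Ind x) ∧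
    ∀ (y : Fin τ → U) (x : Fin ρ → U), (∀ i, y i ∈ N) → (∀ i, x i ∈ N) → RI k y → Ind x → Fr k N y x := by
  have hx0 : Ind (Fin.elim0 : Fin 0 → U) := ⟨fun i => i.elim0, fun e _ => Subsingleton.elim _ _⟩
  have hy0 : RI k (Fin.elim0 : Fin 0 → U) := fun g hg => by
    obtain ⟨c, rfl⟩ := MvPolynomial.C_surjective _ g
    rw [MvPolynomial.aeval_C]; exact ht c c.2 fun e => hg (by rw [show c = 0 from Subtype.ext e, map_zero])
  obtain ⟨τ, ⟨y, hyN, hy⟩, hτ⟩ := nat_max (fun τ => ∃ y : Fin τ → U, (∀ i, y i ∈ N) ∧ RI k y) d ⟨_, fun i => i.elim0, hy0⟩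
    fun n ⟨y, _, hy⟩ => td1 hd hy.ai
  obtain ⟨ρ, ⟨x, hxN, hx⟩, hρ⟩ := nat_max (fun τ => ∃ y : Fin τ → U, (∀ i, y i ∈ N) ∧ Ind y) d ⟨_, fun i => i.elim0, hx0⟩
    fun n ⟨y, _, hy⟩ => td1 hd (hy.ai ht)
  refine ⟨τ, ρ, fr_count hd hy hx, ⟨y, x, hyN, hxN, hy, hx⟩, fun y x hyN hxN hy hx => ⟨hyN, hxN, hy, hx, fun a => ?_, fun a => ?_⟩⟩
  · refine res_up (acl_ac _) (triv_alg hy.triv) (fun b hb h1 => ?_) (hU a)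
    by_contra hcon
    push Not at hcon
    have := hτ _ ⟨_, fun i => Fin.cases hb hyN i, hy.cons h1 hcon⟩
    omega
  · exact val_up (fun i => (hx.1 i).1) (val_N hx hxN fun x' h' hi => by have := hρ _ ⟨_, h', hi⟩; omega) (hU a)
end Fr

section Fr
variable {U : Type*} [NormedField U] [IsUltrametricDist U] {k N : Subfield U}

def Frm (k N : Subfield U) (d : ℕ) {τ ρ : ℕ} (y : Fin τ → U) (x : Fin ρ → U) (X : Finset U) : Prop := Fr k N y x ∧ (X : Set U) ⊆ N ∧
  τ + ρ + X.card ≤ d ∧ N ≤ sc (ad k (range y ∪ (range x ∪ X)))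

theorem fr_indep {d : ℕ} (hd : Algebra.trdeg k U = d) {τ ρ : ℕ} {y : Fin τ → U} {x : Fin ρ → U} {X : Finset U} (hU : ∀ a, a ∈ acl N) (h : Frm k N d y x X)
    (k' : Subfield U) (hk' : k' ≤ acl (ad k (range y))) : ∀ z ∈ X, z ∉ acl (ad k' (range x ∪ ((X : Set U) \ {z}))) := by
  classical
  intro z hz hc
  let S : Finset U := univ.image y ∪ (univ.image x ∪ X.erase z)
  have hS : (S : Set U) = range y ∪ (range x ∪ ((X : Set U) \ {z})) := by simp [S]
  have h1 : ad k' (range x ∪ ((X : Set U) \ {z})) ≤ acl (ad k S) := ad_le (hk'.trans (acl_mono (ad_mono le_rfl (by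
    rw [hS]; exact subset_union_left)))) (Subset.trans (by rw [hS]; exact subset_union_right) ((sub_ad k (S : Set U)).trans (le_acl _)))
  have h2 : z ∈ acl (ad k S) := acl_trans h1 hc
  have h3 : N ≤ acl (ad k S) := (h.2.2.2.trans (sc_le _)).trans (acl_trans (ad_le ((le_ad _ _).trans (le_acl _)) (fun a ha => by
    by_cases e : a = z
    · exact e ▸ h2
    · refine le_acl _ (sub_ad _ _ ?_)
      rw [hS]
      exact ha.imp id (Or.imp id fun h => ⟨h, e⟩))))
  have := td2 hd fun a => acl_trans h3 (hU a)
  have h4 : S.card ≤ τ + (ρ + (X.card - 1)) := by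
    refine (card_union_le _ _).trans (Nat.add_le_add (card_image_le.trans (by simp)) ((card_union_le _ _).trans
      (Nat.add_le_add (card_image_le.trans (by simp)) (by rw [Finset.card_erase_of_mem hz]))))
  have := h.2.2.1
  have := Finset.card_pos.2 ⟨z, hz⟩
  omega

theorem frame_p [IsAlgClosed U] [PerfectField k] (S0 : Finset U) (hN : N = ad k S0) {d : ℕ} (hd : Algebra.trdeg k U = d) (ht : Tr k)
    (hU : ∀ a, a ∈ acl N) {p : ℕ} (hp0 : p ≠ 0) (hp : (p : U) = 0) {ϖ : U} (hϖ : ϖ ∈ N) (h0 : ϖ ≠ 0) (h1 : ‖ϖ‖ < 1) :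
    ∃ (τ ρ : ℕ) (y : Fin τ → U) (x : Fin ρ → U) (X : Finset U), Frm k N d y x X ∧ ∀ z ∈ X, ‖z‖ ≤ 1 := by
  classical
  obtain ⟨τ, ρ, hc, ⟨y, x, hyN, hxN, hy, hx⟩, hF⟩ := exists_fr hd ht hU
  obtain ⟨s, hsN, hs⟩ := sepgen S0 hN hd hU
  obtain ⟨r, rfl⟩ := Nat.exists_eq_add_of_le hc
  obtain ⟨δ, hδ0, hδ1, hδ⟩ : ∃ δ : ℝ, 0 < δ ∧ δ ≤ 1 ∧ ∀ i, δ ≤ ‖x i‖ := by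
    refine ⟨∏ i, ‖x i‖, Finset.prod_pos fun i _ => norm_pos_iff.2 (hx.1 i).1, Finset.prod_le_one (fun _ _ => norm_nonneg _) fun i _ => (hx.1 i).2.le, fun i => ?_⟩
    rw [← Finset.mul_prod_erase _ _ (mem_univ i)]
    exact mul_le_of_le_one_right (norm_nonneg _) (Finset.prod_le_one (fun _ _ => norm_nonneg _) fun i _ => (hx.1 i).2.le)
  obtain ⟨M, hM0, hM⟩ : ∃ M : ℝ, 0 < M ∧ ∀ j, ‖s j‖ ≤ M := ⟨∑ j, ‖s j‖ + 1, by positivity, fun j =>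
    (Finset.single_le_sum (fun i _ => norm_nonneg (s i)) (mem_univ j)).trans (by linarith)⟩
  obtain ⟨l, hl⟩ := exists_pow_lt_of_lt_one (div_pos hδ0 hM0) h1
  have hm : ∀ j, ‖(ϖ ^ l) ^ p * s j‖ < δ := fun j => by
    rw [norm_mul]
    refine (mul_le_mul_of_nonneg_left (hM j) (norm_nonneg _)).trans_lt ((lt_div_iff₀ hM0).1 (lt_of_le_of_lt ?_ hl))
    rw [norm_pow, norm_pow]
    exact pow_le_of_le_one (by positivity) (pow_le_one₀ (norm_nonneg _) h1.le) hp0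
  let e : (Fin τ ⊕ Fin ρ) ⊕ Fin r ≃ Fin (τ + ρ + r) := (Equiv.sumCongr finSumFinEquiv (Equiv.refl _)).trans finSumFinEquiv
  let w0 : (Fin τ ⊕ Fin ρ) ⊕ Fin r → U := elim (elim y x) 0
  obtain ⟨π, hπ, hπN, hsep⟩ := SEP k N (hN ▸ le_ad _ _) S0 hN s (fun i => w0 (e.symm i)) (fun _ => (ϖ ^ l) ^ p) hsN (fun i => by
    rcases e.symm i with (j | j) | j
    exacts [hyN j, hxN j, zero_mem _]) (fun _ => pow_ne_zero _ (pow_ne_zero _ h0)) (fun _ => Or.inr ⟨p, _, pow_mem hϖ l, hp, rfl⟩) hs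
  have hd' : ∀ i, ‖π (e i) - w0 i‖ < δ := fun i => by
    rcases hπ (e i) with h | ⟨j, h⟩
    · rw [h]; simpa using hδ0
    · rw [h]; simpa using hm j
  let y' := fun i => π (e (inl (inl i)))
  let x' := fun i => π (e (inl (inr i)))
  let X : Finset U := univ.image fun i => π (e (inr i))
  have hy' : RI k y' := hy.pert ht fun i => (hd' _).trans_le hδ1
  have hx' : Ind x' := hx.congr fun i => um_eq_of_sub' ((hd' (inl (inr i))).trans_le (hδ i))
  refine ⟨τ, ρ, y', x', X, ⟨hF y' x' (fun i => hπN _) (fun i => hπN _) hy' hx', fun z hz => ?_, ?_, fun b hb => mem_sc.2 ?_⟩, fun z hz => ?_⟩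
  · obtain ⟨i, -, rfl⟩ := mem_image.1 hz; exact hπN _
  · have : X.card ≤ r := card_image_le.trans (by simp)
    omega
  · convert hsep b hb using 4 <;>
    · change ad k _ = ad k _
      congr 1
      ext a
      simp only [Set.mem_union, Set.mem_range, X, coe_image, Finset.coe_univ, Set.image_univ]
      constructor
      · rintro (⟨i, rfl⟩ | ⟨i, rfl⟩ | ⟨i, rfl⟩) <;> exact ⟨_, rfl⟩
      · rintro ⟨i, rfl⟩
        obtain ⟨i, rfl⟩ := e.surjective i
        rcases i with (j | j) | j
        exacts [Or.inl ⟨j, rfl⟩, Or.inr (Or.inl ⟨j, rfl⟩), Or.inr (Or.inr ⟨j, rfl⟩)]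
  · obtain ⟨i, -, rfl⟩ := mem_image.1 hz
    have := hd' (inr i)
    simp only [w0, Sum.elim_inr, Pi.zero_apply, sub_zero] at this
    exact (this.trans_le hδ1).le

theorem frame_0 [IsAlgClosed U] [CharZero U] {d : ℕ} (hd : Algebra.trdeg k U = d) (ht : Tr k)
    (hU : ∀ a, a ∈ acl N) (hkN : k ≤ N) :
    ∃ (τ ρ : ℕ) (y : Fin τ → U) (x : Fin ρ → U) (X : Finset U), Frm k N d y x X := by
  classical
  obtain ⟨τ, ρ, hc, ⟨y, x, hyN, hxN, hy, hx⟩, hF⟩ := exists_fr hd ht hU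
  have hai := fr_ai hy hx
  haveI : Algebra.IsAlgebraic (Algebra.adjoin k (N : Set U)) U := ⟨fun a => (ad_iff _ _ _).1 (acl_mono (sub_ad k (N : Set U)) (hU a))⟩
  obtain ⟨u, hsu, hut, hu⟩ := exists_isTranscendenceBasis_between (R := k) (range (elim x y)) (N : Set U) (by
    rintro _ ⟨i | i, rfl⟩
    exacts [hxN i, hyN i]) hai.to_subtype_range
  have hcard := hu.cardinalMk_eq_trdeg
  rw [hd] at hcard
  have hfin : u.Finite := Cardinal.lt_aleph0_iff_set_finite.1 (hcard ▸ Cardinal.natCast_lt_aleph0)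
  lift u to Finset U using hfin
  have hcu : u.card = d := by simpa using hcard
  let Z : Finset U := univ.image (elim x y)
  have hZ : Z.card = τ + ρ := by
    rw [Finset.card_image_of_injective _ hai.injective]; simp [add_comm]
  have hZu : Z ⊆ u := fun a ha => by
    obtain ⟨i, -, rfl⟩ := mem_image.1 ha; exact hsu ⟨i, rfl⟩
  refine ⟨τ, ρ, y, x, u \ Z, hF y x hyN hxN hy hx, fun a ha => hut (Finset.mem_sdiff.1 ha).1, ?_, ?_⟩
  · rw [Finset.card_sdiff_of_subset hZu, hcu, hZ]; omega
  · have h1 : ∀ a : U, a ∈ acl (ad k u) := fun a => (ad_iff _ _ _).2 (by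
      have := hu.isAlgebraic
      rw [Subtype.range_coe_subtype] at this
      exact this.isAlgebraic a)
    intro b _
    refine alg_sc0 _ (acl_mono (ad_mono le_rfl fun a ha => ?_) (h1 b))
    by_cases hz : a ∈ Z
    · obtain ⟨i | i, -, rfl⟩ := mem_image.1 hz
      exacts [Or.inr (Or.inl ⟨i, rfl⟩), Or.inl ⟨i, rfl⟩]
    · exact Or.inr (Or.inr (mem_coe.2 (Finset.mem_sdiff.2 ⟨ha, hz⟩)))
end Fr

section Concl
variable {U : Type*} [NormedField U] [IsUltrametricDist U] {k N : Subfield U}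

def Concl (k N : Subfield U) (d : ℕ) (B : Finset U) : Prop := ∃ T G1 G2 B' : Finset U, B ⊆ B' ∧
  (G1 : Set U) ⊆ sc N ∧ (∀ σ : U ≃+* U, (∀ a ∈ N, σ a = a) → ∀ g ∈ G1, σ g ∈ G1) ∧
  (G2 : Set U) ⊆ sc (ad N G1) ∧ (∀ σ : U ≃+* U, (∀ a ∈ ad N G1, σ a = a) → ∀ g ∈ G2, σ g ∈ G2) ∧
  T.card ≤ d ∧ (∀ t ∈ T, ‖t‖ ≤ 1 ∧ t ∈ ad N ((G1 : Set U) ∪ G2)) ∧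
  (∀ b ∈ B', b ∈ ad N ((G1 : Set U) ∪ G2) ∧ Et ((k : Set U) ∪ T) (ad N ((G1 : Set U) ∪ G2)) b) ∧
  ∀ g, g ∈ G1 ∨ g ∈ G2 → g ∈ B' ∨ g⁻¹ ∈ B'

theorem et_triv {Y R G : Set U} (ht : ∀ c ∈ ad k Y, c ≠ 0 → ‖c‖ = 1) (hk : (k : Set U) ⊆ R) (hY : Y ⊆ R) (hG : (ad k Y : Set U) ⊆ G) :
    ∀ c ∈ ad k Y, Et R G c := by
  intro c hc
  refine Subfield.closure_induction (p := fun c _ => Et R G c) (fun x hx => .base (union_subset hk hY hx)) (.base (hk (one_mem k)))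
    (fun x y _ _ hx hy => hx.add hy) (fun x _ hx => ?_) (fun x hm hx => ?_) (fun x y _ _ hx hy => hx.mul hy) hc
  · rw [← neg_one_mul]; exact (Et.base (hk (neg_mem (one_mem k)))).mul hx
  · by_cases h0 : x = 0
    · rw [h0, inv_zero]; exact .base (hk (zero_mem k))
    · exact hx.inv (hk (zero_mem k)) (hk (neg_mem (one_mem k))) (ht x hm h0) (hG (inv_mem hm))

theorem concl_triv [PerfectField k] (S0 : Finset U) (hN : N = ad k S0) {d : ℕ} (hd : Algebra.trdeg k U = d) (ht : ∀ c : U, c ≠ 0 → ‖c‖ = 1)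
    (hU : ∀ a, a ∈ acl N) (B : Finset U) (hB : (B : Set U) ⊆ N) : Concl k N d B := by
  classical
  obtain ⟨s, hs, hsep⟩ := sepgen S0 hN hd hU
  have hN0 : N ≤ ad N (((∅ : Finset U) : Set U) ∪ (∅ : Finset U)) := le_ad _ _
  have h1 : ∀ c : U, ‖c‖ ≤ 1 := fun c => by
    by_cases h : c = 0
    · simp [h]
    · exact (ht c h).le
  have hkN : k ≤ N := hN ▸ le_ad _ _
  have hsN : ad k (range s) ≤ N := ad_le hkN (range_subset_iff.2 hs)
  refine ⟨univ.image s, ∅, ∅, B, subset_rfl, by simp, by simp, by simp, by simp, card_image_le.trans (by simp), fun t h => ⟨h1 t, ?_⟩,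
    fun b hb => ⟨hN0 (hB hb), ?_⟩, by simp⟩
  · obtain ⟨i, -, rfl⟩ := mem_image.1 h
    exact hN0 (hs i)
  · obtain ⟨f, hf, h0, hd⟩ := (sep_iff _ _).1 (hsep b (hB hb))
    exact .root f b (fun i => et_triv (fun c _ => ht c) subset_union_left (by simp) (hsN.trans hN0) _ (hf i)) (hN0 (hB hb)) (h1 b) h0 (ht _ hd)

theorem fr_pos {τ ρ : ℕ} {y : Fin τ → U} {x : Fin ρ → U} (h : Fr k N y x) {ϖ : U} (h0 : ϖ ≠ 0) (h1 : ‖ϖ‖ < 1) : 0 < ρ := by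
  rcases Nat.eq_zero_or_pos ρ with rfl | h2
  · obtain ⟨n, hn, e, he⟩ := h.2.2.2.2.2 ϖ h0
    simp only [Finset.univ_eq_empty, Finset.prod_empty] at he
    exact absurd he (pow_lt_one₀ (norm_nonneg _) h1 hn.ne').ne
  · exact h2

variable [IsAlgClosed U] {C : Type*} [NontriviallyNormedField C] [CompleteSpace C] [IsUltrametricDist C] {ι : U →+* C}

theorem concl_0 [CharZero U] (hι : ∀ a, ‖ι a‖ = ‖a‖) (hd : ∀ c : C, ∀ ε > 0, ∃ a : U, ‖c - ι a‖ < ε)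
    {d : ℕ} (hdd : Algebra.trdeg k U = d) (ht : Tr k) (hU : ∀ a, a ∈ acl N) (hkN : k ≤ N) {ϖ : U} (h0 : ϖ ≠ 0) (h1 : ‖ϖ‖ < 1)
    (B : Finset U) (hB : (B : Set U) ⊆ N) (hB1 : ∀ b ∈ B, ‖b‖ ≤ 1) : Concl k N d B := by
  classical
  obtain ⟨τ, ρ, y, x, X, h⟩ := frame_0 hdd ht hU hkN
  have hRI := h.1.2.2.1
  have hE : ad (ad k (range y)) (range x ∪ X) ≤ N := ad_le (ad_le hkN (range_subset_iff.2 h.1.1))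
    (union_subset (range_subset_iff.2 h.1.2.1) h.2.1)
  obtain ⟨S, T, hBS, hS, hst, hi, hc, hT, hE'⟩ := thmZ ι 1 hι hd (ad k (range y)) (alg_sc0 _) (triv_alg hRI.triv) h.1.2.2.2.2.1 (fr_pos h.1 h0 h1)
    h.1.2.2.2.1 h.1.2.2.2.2.2 X (fr_indep hdd hU h _ (le_acl _)) B (hB.trans (h.2.2.2.trans (sc_mono (by rw [ad_ad]))))
  have hk' : ad k (range y) ≤ ad N (((∅ : Finset U) : Set U) ∪ S) := (ad_le hkN (range_subset_iff.2 h.1.1)).trans (le_ad _ _)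
  have hG : ad (ad k (range y)) S ≤ ad N (((∅ : Finset U) : Set U) ∪ S) := ad_le hk' (subset_union_right.trans (sub_ad _ _))
  have e1 : ad N (((∅ : Finset U) : Set U)) = N := le_antisymm (ad_le le_rfl (by simp)) (le_ad _ _)
  refine ⟨univ.image y ∪ T, ∅, S, S.filter (‖·‖ ≤ 1), fun b hb => mem_filter.2 ⟨hBS hb, hB1 b hb⟩, by simp, by simp, ?_, ?_, ?_, ?_, ?_, ?_⟩
  · rw [e1]; exact hS.trans (sc_mono hE)
  · rw [e1]; exact fun σ hσ => hst σ fun a ha => hσ a (hE ha)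
  · have h5 := h.2.2.1
    have h6 : (univ.image y).card ≤ τ := card_image_le.trans (by simp)
    have h7 := card_union_le (univ.image y) T
    omega
  · intro t ht
    rcases mem_union.1 ht with ht | ht
    · obtain ⟨i, -, rfl⟩ := mem_image.1 ht
      exact ⟨(hRI.one i).le, le_ad _ _ (h.1.1 i)⟩
    · exact ⟨(hT t ht).1, hG (hT t ht).2⟩
  · intro b hb
    obtain ⟨hb, hb1⟩ := mem_filter.1 hb
    refine ⟨sub_ad _ _ (Or.inr hb), (hE' b hb hb1).trans hG fun r hr => ?_⟩
    rcases hr with hr | hr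
    · exact et_triv hRI.triv subset_union_left (by push_cast; simp [Set.subset_def]) hk' r hr
    · exact .base (Or.inr (by simp [show r ∈ T from hr]))
  · intro g hg
    have hg : g ∈ S := by simpa using hg
    rcases le_total ‖g‖ 1 with h | h
    · exact Or.inl (mem_filter.2 ⟨hg, h⟩)
    · exact Or.inr (mem_filter.2 ⟨hi g hg, by rw [norm_inv]; exact inv_le_one_of_one_le₀ h⟩)

end Concl

open Filter Topology
section Df
variable {U : Type*} [NormedField U] [IsUltrametricDist U] [IsAlgClosed U] {k : Subfield U}

theorem ext_aut {n : ℕ} {z w : Fin n → U} (hz : AlgebraicIndependent k z) (hw : AlgebraicIndependent k w)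
    (hz' : ∀ a, a ∈ acl (ad k (range z))) (hw' : ∀ a, a ∈ acl (ad k (range w))) :
    ∃ Ψ : U ≃+* U, (∀ c ∈ k, Ψ c = c) ∧ ∀ i, Ψ (z i) = w i := by
  haveI i1 : Algebra.IsAlgebraic (Algebra.adjoin k (range z)) U := ⟨fun a => (ad_iff _ _ _).1 (hz' a)⟩
  haveI i2 : Algebra.IsAlgebraic (Algebra.adjoin k (range w)) U := ⟨fun a => (ad_iff _ _ _).1 (hw' a)⟩
  haveI : IsAlgClosure (Algebra.adjoin k (range z)) U := ⟨inferInstance, i1⟩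
  haveI : IsAlgClosure (Algebra.adjoin k (range w)) U := ⟨inferInstance, i2⟩
  let e : Algebra.adjoin k (range z) ≃+* Algebra.adjoin k (range w) := (hz.aevalEquiv.symm.trans hw.aevalEquiv).toRingEquiv
  have key : ∀ q : MvPolynomial (Fin n) k, IsAlgClosure.equivOfEquiv U U e (MvPolynomial.aeval z q) = MvPolynomial.aeval w q := fun q => by
    rw [← hz.algebraMap_aevalEquiv, IsAlgClosure.equivOfEquiv_algebraMap, ← hw.algebraMap_aevalEquiv]
    congr 1
    simp [e]
  refine ⟨IsAlgClosure.equivOfEquiv U U e, fun c hc => ?_, fun i => ?_⟩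
  · have := key (MvPolynomial.C ⟨c, hc⟩)
    rw [MvPolynomial.aeval_C, MvPolynomial.aeval_C] at this
    exact this
  · simpa using key (MvPolynomial.X i)

theorem near_root {f : U[X]} (hf : f.Monic) (h0 : f.natDegree ≠ 0) (a : U) : ∃ r, f.eval r = 0 ∧ ‖a - r‖ ^ f.natDegree ≤ ‖f.eval a‖ := by
  classical
  have hs := IsAlgClosed.splits f
  have hc : f.natDegree = f.roots.card := hs.natDegree_eq_card_roots
  obtain ⟨r, hr, hmin⟩ := f.roots.toFinset.exists_min_image (fun r => ‖a - r‖) (by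
    rw [Multiset.toFinset_nonempty, ← Multiset.card_pos, ← hc]; omega)
  refine ⟨r, (mem_roots'.1 (Multiset.mem_toFinset.1 hr)).2, ?_⟩
  have key : ∀ s : Multiset U, (∀ b ∈ s, ‖a - r‖ ≤ ‖a - b‖) → ‖a - r‖ ^ s.card ≤ ‖(s.map fun b => X - Polynomial.C b).prod.eval a‖ := by
    intro s
    induction s using Multiset.induction with
    | empty => simp
    | cons b s ih =>
      intro h
      rw [Multiset.card_cons, Multiset.map_cons, Multiset.prod_cons, eval_mul, norm_mul, pow_succ']
      exact mul_le_mul (by simpa using h b (by simp)) (ih fun c hc => h c (by simp [hc])) (by positivity) (norm_nonneg _)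
  rw [hc]
  conv_rhs => rw [hs.eq_prod_roots_of_monic hf]
  exact key _ fun b hb => hmin b (Multiset.mem_toFinset.2 hb)

theorem conv_cl (Φ : ℕ → U ≃+* U) (Y : Set U) (h : ∀ a ∈ Y, Tendsto (fun J => Φ J a) atTop (𝓝 a)) {a : U} (ha : a ∈ Subfield.closure Y) :
    Tendsto (fun J => Φ J a) atTop (𝓝 a) := by
  induction ha using Subfield.closure_induction with
  | mem x hx => exact h x hx
  | one => simp
  | add x y _ _ hx hy => simpa using hx.add hy
  | mul x y _ _ hx hy => simpa using hx.mul hy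
  | neg x _ hx => simpa using hx.neg
  | inv x _ hx =>
    by_cases h0 : x = 0
    · simp [h0]
    · simpa using hx.inv₀ h0

theorem deform {n : ℕ} {z : Fin n → U} {w : ℕ → Fin n → U} (hz : AlgebraicIndependent k z) (hw : ∀ J, AlgebraicIndependent k (w J))
    (hz' : ∀ a, a ∈ acl (ad k (range z))) (hw' : ∀ J a, a ∈ acl (ad k (range (w J)))) (ht : ∀ i, Tendsto (fun J => w J i) atTop (𝓝 (z i)))
    (S : Finset U) (hS : (S : Set U) ⊆ sc (ad k (range z))) : ∃ Φ : ℕ → U ≃+* U, (∀ J, ∀ c ∈ k, Φ J c = c) ∧ (∀ J i, Φ J (z i) = w J i) ∧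
      ∀ a ∈ ad k (range z ∪ S), Tendsto (fun J => Φ J a) atTop (𝓝 a) := by
  choose Ψ hΨ1 hΨ2 using fun J => ext_aut hz (hw J) hz' (hw' J)
  set E := ad k (range z) with hE
  obtain ⟨α, hα, hαS⟩ := prim E S hS
  have cE : ∀ Φ : ℕ → U ≃+* U, (∀ J, ∀ c ∈ k, Φ J c = c) → (∀ J i, Φ J (z i) = w J i) → ∀ a ∈ E, Tendsto (fun J => Φ J a) atTop (𝓝 a) := by
    intro Φ h1 h2 a ha
    refine conv_cl Φ _ ?_ ha
    rintro b (hb | ⟨i, rfl⟩)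
    · simp only [h1 _ b hb]; exact tendsto_const_nhds
    · simp only [h2]; exact ht i
  haveI : IsAlgClosure E U := ⟨inferInstance, ⟨fun a => mem_acl.1 (hz' a)⟩⟩
  have hαi : IsAlgebraic E α := mem_acl.1 (hz' α)
  set m := minpoly E α with hm
  set f : U[X] := m.map (algebraMap E U) with hf
  have hfm : f.Monic := (minpoly.monic hαi.isIntegral).map _
  have hf0 : f.natDegree ≠ 0 := by rw [hf, natDegree_map]; exact (minpoly.natDegree_pos hαi.isIntegral).ne'
  have hfα : f.eval α = 0 := by rw [hf, eval_map_algebraMap]; exact minpoly.aeval _ _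
  have hfE : ∀ i, f.coeff i ∈ E := fun i => by rw [hf, coeff_map]; exact SetLike.coe_mem _
  have hex : ∀ J, ∃ r, (f.map (Ψ J).toRingHom).eval r = 0 ∧ ‖α - r‖ ^ f.natDegree ≤ ‖(f.map (Ψ J).toRingHom).eval α‖ := fun J => by
    have := near_root (hfm.map (Ψ J).toRingHom) (by rwa [natDegree_map]) α
    rwa [natDegree_map] at this
  choose r hr1 hr2 using hex
  have hσ : ∀ J, ∃ σ : U ≃ₐ[E] U, σ α = (Ψ J).symm (r J) := fun J => by
    haveI : Normal E U := IsAlgClosure.normal E U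
    refine minpoly.exists_algEquiv_of_root' hαi ?_
    rw [← eval_map_algebraMap]
    apply (Ψ J).injective
    have := hr1 J
    rw [eval_map, ← (Ψ J).apply_symm_apply (r J)] at this
    rw [map_zero, ← this]
    exact (hom_eval₂ f (RingHom.id U) (Ψ J).toRingHom _)
  choose σ hσ using hσ
  let Φ : ℕ → U ≃+* U := fun J => (σ J).toRingEquiv.trans (Ψ J)
  have hσE : ∀ J, ∀ c ∈ E, σ J c = c := fun J c hc => (σ J).commutes ⟨c, hc⟩
  have h1 : ∀ J, ∀ c ∈ k, Φ J c = c := fun J c hc => by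
    change Ψ J (σ J c) = c
    rw [hσE J c (le_ad _ _ hc), hΨ1 J c hc]
  have h2 : ∀ J i, Φ J (z i) = w J i := fun J i => by
    change Ψ J (σ J _) = _
    rw [hσE J _ (sub_ad _ _ ⟨i, rfl⟩), hΨ2]
  refine ⟨Φ, h1, h2, fun a ha => ?_⟩
  rw [← ad_ad, ← hE, hαS] at ha
  refine conv_cl Φ _ ?_ ha
  rintro b (hb | rfl)
  · exact cE Φ h1 h2 b hb
  · have e : ∀ J, Φ J b = r J := fun J => by
      change Ψ J (σ J b) = _
      rw [hσ, RingEquiv.apply_symm_apply]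
    simp only [e]
    have t1 : Tendsto (fun J => (f.map (Ψ J).toRingHom).eval b) atTop (𝓝 (f.eval b)) := by
      have : ∀ J, (f.map (Ψ J).toRingHom).eval b = ∑ i ∈ Finset.range (f.natDegree + 1), Ψ J (f.coeff i) * b ^ i := fun J => by
        rw [eval_eq_sum_range, natDegree_map]; simp
      simp only [this]
      rw [eval_eq_sum_range]
      exact tendsto_finsetSum _ fun i _ => (cE Ψ hΨ1 hΨ2 _ (hfE i)).mul_const _
    rw [hfα] at t1
    have t2 : Tendsto (fun J => ‖b - r J‖ ^ f.natDegree) atTop (𝓝 0) := squeeze_zero (fun _ => by positivity) hr2 (by simpa using t1.norm)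
    rw [tendsto_iff_norm_sub_tendsto_zero]
    rw [Metric.tendsto_atTop] at t2 ⊢
    intro ε hε
    obtain ⟨M, hM⟩ := t2 (ε ^ f.natDegree) (by positivity)
    refine ⟨M, fun J hJ => ?_⟩
    have := hM J hJ
    rw [dist_zero_right, norm_pow, norm_norm] at this
    rw [dist_zero_right, norm_norm, norm_sub_rev]
    exact lt_of_pow_lt_pow_left₀ _ hε.le this
end Df

section Pc
variable {U : Type*} [Field U] {k : Subfield U}

theorem fix_ad (σ : U ≃+* U) {A : Subfield U} {S : Set U} (h : ∀ a ∈ A, σ a = a) (h' : ∀ a ∈ S, σ a = a) : ∀ a ∈ ad A S, σ a = a := fun a ha =>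
  (ad_le (B := (σ : U →+* U).eqLocusField (RingHom.id U)) h h') ha

theorem sc_fin (L : Subfield U) (Y : Set U) (S : Finset U) (hS : (S : Set U) ⊆ sc (ad L Y)) :
    ∃ A : Finset U, (A : Set U) ⊆ L ∧ ∀ D : Subfield U, (A : Set U) ⊆ D → Y ⊆ D → (S : Set U) ⊆ sc D := by
  classical
  choose! f hf h0 hd using fun b (hb : b ∈ S) => (sep_iff _ _).1 (mem_sc.1 (hS hb))
  obtain ⟨A, hA, hG⟩ := ad_fin L Y (S.biUnion fun b => (f b).support.image (f b).coeff) (by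
    intro c hc
    simp only [coe_biUnion, Set.mem_iUnion, coe_image] at hc
    obtain ⟨b, hb, i, -, rfl⟩ := hc
    exact hf b hb i)
  refine ⟨A, hA, fun D hD hY b hb => mem_sc.2 ((sep_iff _ _).2 ⟨f b, fun i => ?_, h0 b hb, hd b hb⟩)⟩
  by_cases hi : i ∈ (f b).support
  · refine (closure_le.2 (union_subset hD hY)) (hG ?_)
    simp only [coe_biUnion, Set.mem_iUnion, coe_image]
    exact ⟨b, hb, i, hi, rfl⟩
  · rw [notMem_support_iff.1 hi]; exact zero_mem _

noncomputable def pc (A : Subfield U) : Subfield U := (perfectClosure A U).toSubfield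
variable (p : ℕ) [ExpChar U p]
theorem mem_pc {A : Subfield U} {a : U} : a ∈ pc A ↔ ∃ n, a ^ p ^ n ∈ A := by
  haveI := (algebraMap A U).expChar (algebraMap A U).injective p
  exact (mem_perfectClosure_iff_pow_mem p).trans (exists_congr fun n => ⟨fun ⟨c, hc⟩ => hc ▸ c.2, fun h => ⟨⟨_, h⟩, rfl⟩⟩)
theorem pc_sep [IsAlgClosed U] (A : Subfield U) : acl (pc A) ≤ sc (pc A) := fun a ha => by
  have h : IsAlgebraic (perfectClosure A U) a := mem_acl.1 ha
  have h2 : IsSeparable (perfectClosure A U) a := PerfectField.separable_of_irreducible (minpoly.irreducible h.isIntegral)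
  exact mem_sc.2 h2
theorem le_pc (A : Subfield U) : A ≤ pc A := fun a ha => (mem_pc (ringExpChar U)).2 ⟨0, by simpa using ha⟩
theorem pc_acl (A : Subfield U) : pc A ≤ acl A := fun a ha => by
  obtain ⟨n, hn⟩ := (mem_pc (ringExpChar U)).1 ha
  exact mem_acl.2 ((mem_acl.1 (le_acl _ hn)).of_pow (expChar_pow_pos U _ n))
theorem fix_pc (σ : U ≃+* U) {A : Subfield U} (h : ∀ a ∈ A, σ a = a) : ∀ a ∈ pc A, σ a = a := fun a ha => by
  obtain ⟨n, hn⟩ := (mem_pc (ringExpChar U)).1 ha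
  apply iterateFrobenius_inj U (ringExpChar U) n
  rw [iterateFrobenius_def, iterateFrobenius_def, ← map_pow, h _ hn]

variable {τ : ℕ} {y u : Fin τ → U} {l : ℕ}
theorem pc_root (hk : ∀ c ∈ k, ∃ c' ∈ k, c' ^ p = c) (hu : ∀ i, u i ^ p ^ l = y i) {a : U} (ha : a ^ p ^ l ∈ ad k (range y)) :
    a ∈ ad k (range u) := by
  have hk' : ∀ n, ∀ c ∈ k, ∃ c' ∈ k, c' ^ p ^ n = c := by
    intro n
    induction n with
    | zero => exact fun c hc => ⟨c, hc, by simp⟩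
    | succ n ih =>
      intro c hc
      obtain ⟨c1, h1, rfl⟩ := hk c hc
      obtain ⟨c2, h2, rfl⟩ := ih c1 h1
      exact ⟨c2, h2, by rw [pow_succ, pow_mul]⟩
  have h1 : a ^ p ^ l ∈ (ad k (range u)).map (iterateFrobenius U p l) := by
    rw [ad, map_field_closure]
    refine Subfield.closure_mono ?_ ha
    rintro b (hb | ⟨i, rfl⟩)
    · obtain ⟨c, hc, rfl⟩ := hk' l b hb
      exact ⟨c, Or.inl hc, rfl⟩
    · exact ⟨u i, Or.inr ⟨i, rfl⟩, hu i⟩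
  obtain ⟨b, hb, h⟩ := h1
  rwa [iterateFrobenius_inj U p l h] at hb

theorem pc_fin (A : Subfield U) (M : Finset U) (hM : (M : Set U) ⊆ pc A) : ∃ l, 0 < l ∧ ∀ a ∈ M, a ^ p ^ l ∈ A := by
  classical
  choose! n hn using fun a (ha : a ∈ M) => (mem_pc p).1 (hM ha)
  refine ⟨∑ a ∈ M, n a + 1, by omega, fun a ha => ?_⟩
  obtain ⟨j, hj⟩ := Nat.exists_eq_add_of_le ((Finset.single_le_sum (fun _ _ => Nat.zero_le _) ha).trans (Nat.le_succ (∑ a ∈ M, n a)))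
  rw [show ∑ a ∈ M, n a + 1 = n a + j from hj, pow_add, pow_mul]
  exact pow_mem (hn a ha) _
end Pc

section Et
variable {U : Type*} [NormedField U] [IsUltrametricDist U] {k : Subfield U}
theorem Et.desc (L : Subfield U) (T S' : Set U) (B : Finset U) (h : ∀ b ∈ B, Et ((L : Set U) ∪ T) (ad L S') b) :
    ∃ A : Finset U, (A : Set U) ⊆ L ∧ ∀ D : Subfield U, (A : Set U) ⊆ D → ∀ b ∈ B, Et ((D : Set U) ∪ T) (ad D S') b := by
  classical
  obtain ⟨R0, G0, hR, hG, hE⟩ := Et.finM h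
  obtain ⟨A, hA, hA'⟩ := ad_fin L S' G0 hG
  refine ⟨A ∪ R0.filter (· ∈ L), ?_, fun D hD b hb => (hE b hb).mono ?_ ?_⟩
  · intro a ha
    rcases mem_union.1 ha with h | h
    exacts [hA h, (mem_filter.1 h).2]
  · intro r hr
    by_cases hL : r ∈ L
    · exact Or.inl (hD (by simp [hL, show r ∈ R0 from hr]))
    · rcases hR hr with rfl | h | h
      exacts [absurd (zero_mem _) hL, absurd h hL, Or.inr h]
  · exact hA'.trans (Subfield.closure_mono (union_subset_union_left _ (Subset.trans (by simp) hD)))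

variable [IsAlgClosed U] (p : ℕ) [ExpChar U p] {τ : ℕ} {y u : Fin τ → U} {l : ℕ}
theorem RI.root (h : RI k y) (hu : ∀ i, u i ^ p ^ l = y i) : RI k u := by
  intro g hg
  haveI := (algebraMap k U).expChar (algebraMap k U).injective p
  have e : MvPolynomial.aeval u g ^ p ^ l = MvPolynomial.aeval y (MvPolynomial.map (iterateFrobenius k p l) g) := by
    rw [MvPolynomial.aeval_def, MvPolynomial.aeval_def, MvPolynomial.eval₂_map, ← iterateFrobenius_def, MvPolynomial.eval₂_comp_left]
    congr 1
    ext i; simp [iterateFrobenius_def, hu]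
  have h1 := h _ ((MvPolynomial.map_injective (σ := Fin τ) _ (iterateFrobenius_inj k p l)).ne hg |>.trans_eq (map_zero _))
  rw [← e, norm_pow] at h1
  exact (pow_eq_one_iff_of_nonneg (norm_nonneg _) (expChar_pow_pos U p l).ne').1 h1

theorem lvl (hk : ∀ c ∈ k, ∃ c' ∈ k, c' ^ p = c) (hy : RI k y) (Y : Set U) {m : ℕ} (hG : Good (pc (ad k (range y))) (ad (pc (ad k (range y))) Y) m)
    (A : Finset U) (hA : (A : Set U) ⊆ sc (ad (pc (ad k (range y))) Y)) : ∃ l, 0 < l ∧ ∀ u : Fin τ → U, (∀ i, u i ^ p ^ l = y i) →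
    ∃ S T : Finset U, A ⊆ S ∧ (S : Set U) ⊆ sc (ad k (range u ∪ Y)) ∧
      (∀ σ : U ≃+* U, (∀ a ∈ ad k (range u ∪ Y), σ a = a) → ∀ b ∈ S, σ b ∈ S) ∧ (∀ b ∈ S, b⁻¹ ∈ S) ∧ T.card ≤ m ∧
      (∀ t ∈ T, ‖t‖ ≤ 1 ∧ t ∈ ad k (range u ∪ S)) ∧ ∀ b ∈ S, ‖b‖ ≤ 1 → Et ((k : Set U) ∪ (range u ∪ T)) (ad k (range u ∪ S)) b := by
  classical
  obtain ⟨S, T, hAS, hS, hst, hi, hc, hT, hE⟩ := hG A hA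
  set k' := pc (ad k (range y))
  obtain ⟨A1, hA1, h1⟩ := sc_fin _ _ S hS
  obtain ⟨A2, hA2, h2⟩ := ad_fin k' S T fun t ht => (hT t ht).2
  obtain ⟨A3, hA3, h3⟩ := Et.desc k' T S (S.filter (‖·‖ ≤ 1)) fun b hb => hE b (mem_filter.1 hb).1 (mem_filter.1 hb).2
  obtain ⟨l, hl, hM⟩ := pc_fin p _ (A1 ∪ A2 ∪ A3) (by push_cast; exact union_subset (union_subset hA1 hA2) hA3)
  refine ⟨l, hl, fun u hu => ⟨S, T, hAS, ?_, fun σ hσ => hst σ (fix_ad σ (fix_pc σ (fix_ad σ ?_ ?_)) ?_), hi, hc, fun t ht => ⟨(hT t ht).1, ?_⟩, fun b hb hb1 => ?_⟩⟩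
  · refine h1 _ (fun a ha => ad_mono le_rfl subset_union_left (pc_root p hk hu (hM a ?_))) (subset_union_right.trans (sub_ad _ _))
    simp [show a ∈ A1 from ha]
  · exact fun a ha => hσ a (le_ad _ _ ha)
  · rintro _ ⟨i, rfl⟩
    exact hσ _ (hu i ▸ pow_mem (sub_ad k (range u ∪ Y) (Or.inl ⟨i, rfl⟩)) _)
  · exact fun a ha => hσ _ (sub_ad _ _ (Or.inr ha))
  · rw [← ad_ad]
    exact Subfield.closure_mono (union_subset_union_left _ fun a ha => pc_root p hk hu (hM a (by simp [show a ∈ A2 from ha]))) (h2 ht)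
  · have := h3 (ad k (range u)) (fun a ha => pc_root p hk hu (hM a (by simp [show a ∈ A3 from ha]))) b (mem_filter.2 ⟨hb, hb1⟩)
    rw [ad_ad] at this
    refine this.trans subset_rfl fun r hr => ?_
    rcases hr with hr | hr
    · exact et_triv (hy.root p hu).triv subset_union_left (fun a ha => Or.inr (Or.inl ha)) (ad_mono le_rfl subset_union_left) r hr
    · exact .base (Or.inr (Or.inr hr))
end Et

open Filter Topology
section Nw
variable {U : Type*} [NormedField U] [IsUltrametricDist U] {k : Subfield U}

def etR (k : Subfield U) (T G : Set U) : Subring U where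
  carrier := {a | Et ((k : Set U) ∪ T) G a}
  mul_mem' := Et.mul
  one_mem' := .base (Or.inl (one_mem k))
  add_mem' := Et.add
  zero_mem' := .base (Or.inl (zero_mem k))
  neg_mem' := fun {x} hx => by
    change Et _ _ (-x)
    rw [← neg_one_mul]; exact Et.mul (.base (Or.inl (neg_mem (one_mem k)))) hx

noncomputable def PW (W : Subring U) : Subsemiring U[X] := lifts W.subtype
variable {W : Subring U}
theorem mem_PW {f : U[X]} : f ∈ PW W ↔ ∀ i, f.coeff i ∈ W := by
  rw [PW, lifts_iff_coeff_lifts]; simp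
theorem PW.C {a : U} (h : a ∈ W) : Polynomial.C a ∈ PW W := C_mem_lifts W.subtype ⟨a, h⟩
theorem PW.X : (X : U[X]) ∈ PW W := X_mem_lifts _
theorem PW.comp {f g : U[X]} (hf : f ∈ PW W) (hg : g ∈ PW W) : f.comp g ∈ PW W := by
  rw [comp_eq_sum_left, sum_def]
  exact sum_mem fun i _ => mul_mem (PW.C (mem_PW.1 hf i)) (pow_mem hg i)
theorem PW.eval {f : U[X]} (hf : f ∈ PW W) {a : U} (ha : a ∈ W) : f.eval a ∈ W := by
  rw [eval_eq_sum_range]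
  exact sum_mem fun i _ => mul_mem (mem_PW.1 hf i) (pow_mem ha i)
theorem PW.der {f : U[X]} (hf : f ∈ PW W) : derivative f ∈ PW W := mem_PW.2 fun i => by
  rw [coeff_derivative]; exact mul_mem (mem_PW.1 hf _) (by exact_mod_cast natCast_mem W (i + 1))

theorem newt {T : Set U} {G : Subfield U} (hW : W = etR k T G) (h1 : ∀ a ∈ W, ‖a‖ ≤ 1) (hG : ∀ a ∈ W, a ∈ G)
    (φ : U ≃+* U) {ε b ω : U} {f : U[X]} (hf : ∀ i, φ (f.coeff i) ∈ W ∧ ∃ Q ∈ W, f.coeff i = φ (f.coeff i) + ε * Q) (hb0 : f.eval b = 0)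
    (hbW : φ b ∈ W) (hbG : b ∈ G) (hω : ω ∈ W) (hω1 : ‖ω‖ < 1) (hε : ε = ω * φ (f.derivative.eval b) ^ 2) (h0 : f.derivative.eval b ≠ 0)
    (hn : ‖b - φ b‖ < ‖φ (f.derivative.eval b)‖) : b ∈ W := by
  set g : U[X] := f.map (φ : U →+* U) with hg
  have hgc : ∀ i, g.coeff i = φ (f.coeff i) := fun i => by rw [hg, coeff_map]; rfl
  have hgW : g ∈ PW W := mem_PW.2 fun i => by rw [hgc]; exact (hf i).1
  set e := φ b with he
  have ge : g.eval e = 0 := by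
    rw [hg, he, show φ b = (φ : U →+* U) b from rfl, eval_map, eval₂_hom, hb0, map_zero]
  set c := φ (f.derivative.eval b) with hc
  have hcg : c = g.derivative.eval e := by
    rw [hg, he, hc, derivative_map, show φ b = (φ : U →+* U) b from rfl, eval_map, eval₂_hom]; rfl
  have hc0 : c ≠ 0 := by rw [hc]; simpa using h0
  have hcW : c ∈ W := hcg ▸ PW.eval (PW.der hgW) hbW
  choose! Q hQW hQ using fun i => (hf i).2
  set M0 : U[X] := ∑ i ∈ Finset.range (f.natDegree + 1), Polynomial.C (Q i) * X ^ i with hM0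
  have hM0W : M0 ∈ PW W := sum_mem fun i _ => mul_mem (PW.C (hQW i)) (pow_mem PW.X i)
  obtain ⟨r, hr⟩ : (X ^ 2 : U[X]) ∣ taylor e g - (Polynomial.C (g.eval e) + Polynomial.C c * X) := by
    rw [X_pow_dvd_iff]; intro d hd
    interval_cases d
    · simp
    · simp [hcg, taylor_coeff_one]
  have htW : taylor e g ∈ PW W := by
    rw [taylor_apply]; exact PW.comp hgW (add_mem PW.X (PW.C hbW))
  have hrW : r ∈ PW W := mem_PW.2 fun i => by
    have := congrArg (fun f => coeff f (i + 2)) hr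
    simp only [coeff_sub, coeff_add, coeff_C_succ, coeff_C_mul, coeff_X, coeff_X_pow_mul] at this
    rw [← this]; simpa using mem_PW.1 htW _
  set Z := (b - e) / c with hZ
  have hcZ : c * Z = b - e := by rw [hZ]; field_simp
  have hZ1 : ‖Z‖ < 1 := by rw [hZ, norm_div, div_lt_one (norm_pos_iff.2 hc0)]; exact hn
  set H := r.comp (Polynomial.C c * X) with hH
  have hHW : H ∈ PW W := PW.comp hrW (mul_mem (PW.C hcW) PW.X)
  set M := M0.comp (Polynomial.C e + Polynomial.C c * X) with hM
  have hMW : M ∈ PW W := PW.comp hM0W (add_mem (PW.C hbW) (mul_mem (PW.C hcW) PW.X))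
  set h : U[X] := X + X ^ 2 * H + Polynomial.C ω * M with hh
  have hhW : h ∈ PW W := add_mem (add_mem PW.X (mul_mem (pow_mem PW.X 2) hHW)) (mul_mem (PW.C hω) hMW)
  have e1 : g.eval b = c * c * Z + (c * Z) ^ 2 * r.eval (c * Z) := by
    have h2 : g.eval b = (taylor e g).eval (c * Z) := by rw [taylor_eval, hcZ, sub_add_cancel]
    have := congrArg (Polynomial.eval (c * Z)) hr
    simp only [eval_sub, eval_add, eval_C, eval_mul, eval_X, eval_pow, ge] at this
    rw [h2]; linear_combination this
  have e2 : f.eval b = g.eval b + ε * M0.eval b := by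
    rw [eval_eq_sum_range, eval_eq_sum_range, hM0, eval_finset_sum, mul_sum, hg, natDegree_map_eq_of_injective φ.injective, ← hg, ← sum_add_distrib]
    refine sum_congr rfl fun i _ => ?_
    rw [hgc, eval_mul, eval_pow, eval_X, eval_C]
    linear_combination (hQ i) * b ^ i
  have e3 : h.eval Z = 0 := by
    have : c ^ 2 * h.eval Z = 0 := by
      rw [hh, hH, hM]
      simp only [eval_add, eval_mul, eval_pow, eval_X, eval_C, eval_comp]
      rw [show e + c * Z = b by rw [hcZ]; ring]
      rw [hb0] at e2
      linear_combination -e2 - e1 + (-M0.eval b) * hε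
    exact (mul_eq_zero.1 this).resolve_left (pow_ne_zero _ hc0)
  have n1 : ∀ q ∈ PW W, ‖q.eval Z‖ ≤ 1 := fun q hq => eval_le_one q (fun i => h1 _ (mem_PW.1 hq i)) Z hZ1.le
  have n2 : ‖(2 : U)‖ ≤ 1 := by exact_mod_cast norm_natCast_le_one U 2
  have e4 : ‖h.derivative.eval Z‖ = 1 := by
    have : h.derivative.eval Z = 1 + (Z * (2 * H.eval Z + Z * H.derivative.eval Z) + ω * M.derivative.eval Z) := by
      rw [hh]; simp only [derivative_add, derivative_mul, derivative_X, derivative_X_pow, derivative_C, eval_add, eval_mul, eval_pow, eval_X, eval_C, eval_one, eval_zero]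
      push_cast; ring
    rw [this, um_eq, norm_one]
    rw [norm_one]
    refine um_lt ?_ ?_
    · rw [norm_mul]
      refine mul_lt_one_of_nonneg_of_lt_one_left (norm_nonneg _) hZ1 (um_le ?_ ?_) <;> rw [norm_mul]
      · exact mul_le_one₀ n2 (norm_nonneg _) (n1 _ hHW)
      · exact mul_le_one₀ hZ1.le (norm_nonneg _) (n1 _ (PW.der hHW))
    · rw [norm_mul]
      exact mul_lt_one_of_nonneg_of_lt_one_left (norm_nonneg _) hω1 (n1 _ (PW.der hMW))
  have hZW : Z ∈ W := by
    have : ∀ i, h.coeff i ∈ W := mem_PW.1 hhW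
    subst hW
    exact Et.root h Z this (div_mem (sub_mem hbG (hG _ hbW)) (hG _ hcW)) hZ1.le e3 e4
  rw [show b = e + c * Z by rw [hcZ]; ring]
  exact add_mem hbW (mul_mem hcW hZW)

theorem ev_eq {f : ℕ → U} {a : U} (h : Tendsto f atTop (𝓝 a)) {r : ℝ} (hr : 0 < r) : ∀ᶠ J in atTop, ‖a - f J‖ < r := by
  filter_upwards [Metric.tendsto_nhds.1 h r hr] with J hJ
  rwa [norm_sub_rev, ← dist_eq_norm]
theorem ev_le {f : ℕ → U} {a : U} (h : Tendsto f atTop (𝓝 a)) (ha : ‖a‖ ≤ 1) : ∀ᶠ J in atTop, ‖f J‖ ≤ 1 := by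
  filter_upwards [ev_eq h one_pos] with J hJ
  rw [show f J = a - (a - f J) by ring]; exact um_sub_le ha hJ.le

theorem Et.transp (Φ : ℕ → U ≃+* U) {R G : Set U} (D : Subfield U) (hR : R ⊆ D) (hG : G ⊆ D) (hD : ∀ a ∈ D, Tendsto (fun J => Φ J a) atTop (𝓝 a))
    {b : U} (hb : Et R G b) : ∀ᶠ J in atTop, Et (Φ J '' R) (Φ J '' G) (Φ J b) := by
  induction hb with
  | base hb => exact .of_forall fun J => .base ⟨_, hb, rfl⟩
  | add _ _ h1 h2 => filter_upwards [h1, h2] with J a b; rw [map_add]; exact a.add b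
  | mul _ _ h1 h2 => filter_upwards [h1, h2] with J a b; rw [map_mul]; exact a.mul b
  | root g η hg h2 h3 h4 h5 h6 =>
    have h7 : g.derivative.eval η ∈ D := by
      rw [eval_eq_sum_range]
      refine sum_mem fun i _ => mul_mem ?_ (pow_mem (hG h2) i)
      rw [coeff_derivative]; exact mul_mem ((hg _).mem D hR hG) (by exact_mod_cast natCast_mem D (i + 1))
    filter_upwards [(Filter.eventually_all_finset (Finset.range (g.natDegree + 2))).2 fun i _ => h6 i, ev_le (hD η (hG h2)) h3,
      ev_eq (hD _ h7) one_pos] with J a b c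
    refine .root (g.map (Φ J : U →+* U)) _ (fun i => ?_) ⟨η, h2, rfl⟩ b ?_ ?_
    · rw [coeff_map]
      rcases lt_or_ge i (g.natDegree + 2) with hi | hi
      · exact a i (mem_range.2 hi)
      · rw [coeff_eq_zero_of_natDegree_lt (by omega), ← coeff_eq_zero_of_natDegree_lt (lt_succ_self g.natDegree)]
        exact a (g.natDegree + 1) (by simp)
    · rw [show Φ J η = (Φ J : U →+* U) η from rfl, eval_map, eval₂_hom, h4, map_zero]
    · rw [derivative_map, show Φ J η = (Φ J : U →+* U) η from rfl, eval_map, eval₂_hom, ← h5]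
      exact um_eq_of_sub (by rw [h5]; exact c)
end Nw

open Filter Topology
section Cp
theorem den {U : Type*} [Field U] (s : Set U) {b : U} (hb : b ∈ sc (Subfield.closure s)) :
    ∃ f : U[X], (∀ i, f.coeff i ∈ Subring.closure s) ∧ f.eval b = 0 ∧ f.derivative.eval b ≠ 0 := by
  obtain ⟨f, hf, h0, h1⟩ := (sep_iff _ _).1 (mem_sc.1 hb)
  choose n hn e he hne using fun i => Subfield.mem_closure_iff.1 (hf i)
  have h2 : ∀ i, ∃ m ∈ Subring.closure s, m ≠ 0 ∧ m * f.coeff i ∈ Subring.closure s := fun i => by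
    by_cases h : e i = 0
    · exact ⟨1, one_mem _, one_ne_zero, by rw [← hne, h, div_zero, mul_zero]; exact zero_mem _⟩
    · exact ⟨e i, he i, h, by rw [← hne, mul_div_cancel₀ _ h]; exact hn i⟩
  choose m hm hm0 hm' using h2
  set D := ∏ i ∈ f.support, m i with hD
  have hD0 : D ≠ 0 := prod_ne_zero_iff.2 fun i _ => hm0 i
  refine ⟨Polynomial.C D * f, fun i => ?_, by simp [h0], by simp [hD0, h1]⟩
  rw [coeff_C_mul]
  by_cases hi : i ∈ f.support
  · rw [hD, ← Finset.prod_erase_mul _ _ hi, mul_assoc]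
    exact mul_mem (prod_mem fun i _ => hm i) (hm' i)
  · rw [notMem_support_iff.1 hi, mul_zero]; exact zero_mem _

variable {U : Type*} [NormedField U] [IsUltrametricDist U] {k N : Subfield U}

theorem as_le {q : ℕ} (hq : 2 ≤ q) {ε y v : U} (hy : ‖y‖ ≤ 1) (hε : ‖ε‖ ≤ 1) (h : v ^ q = ε * v + y) : ‖v‖ ≤ 1 := by
  by_contra hc
  push Not at hc
  have h1 : ‖v ^ q‖ ≤ ‖v‖ := by
    rw [h]; refine um_le ?_ (hy.trans hc.le)
    rw [norm_mul]; exact mul_le_of_le_one_left (norm_nonneg _) hε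
  rw [norm_pow] at h1
  exact absurd h1 (not_le.2 (lt_self_pow₀ hc (by omega)))

theorem fixJ (p : ℕ) [ExpChar U p] (hp : (p : U) = 0) {l q : ℕ} (hq : q = p ^ l) (hq2 : 2 ≤ q) {d m τ J : ℕ} {y u u' : Fin τ → U} {x0 ε : U} {Y : Set U}
    {S T : Finset U} (Φ : U ≃+* U) (ht : Tr k) (hkN : k ≤ N) (hyN : ∀ i, y i ∈ N) (hYN : Y ⊆ N) (hx0 : x0 ∈ Y) (h0 : x0 ≠ 0)
    (h1 : ‖x0‖ < 1) (hε : ε = x0 ^ (J * (q - 1))) (hy1 : ∀ i, ‖y i‖ ≤ 1) (hu : ∀ i, u i ^ q = y i) (hu' : ∀ i, u' i ^ q = ε * u' i + y i)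
    (Φk : ∀ c ∈ k, Φ c = c) (ΦY : ∀ a ∈ Y, Φ a = a) (Φu : ∀ i, Φ (u i) = u' i) (hYS : Y ⊆ S) (hY1 : ∀ a ∈ Y, ‖a‖ ≤ 1)
    (hS : (S : Set U) ⊆ sc (ad k (range u ∪ Y)))
    (hst : ∀ σ : U ≃+* U, (∀ a ∈ ad k (range u ∪ Y), σ a = a) → ∀ b ∈ S, σ b ∈ S) (hi : ∀ b ∈ S, b⁻¹ ∈ S) (hc : T.card ≤ m) (hd : τ + m ≤ d)
    (hT : ∀ t ∈ T, ‖Φ t‖ ≤ 1 ∧ t ∈ ad k (range u ∪ S))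
    (hE : ∀ b ∈ S, ‖b‖ ≤ 1 → Et (Φ '' ((k : Set U) ∪ (range u ∪ T))) (Φ '' (ad k (range u ∪ S))) (Φ b)) (B : Finset U)
    (hB : ∀ b ∈ B, b ∈ N ∧ b ∈ S ∧ ‖b‖ ≤ 1 ∧ ∃ (f : U[X]) (j : ℕ), (∀ i, f.coeff i ∈ Subring.closure ((k : Set U) ∪ (range y ∪ Y))) ∧ f.eval b = 0 ∧
      f.derivative.eval b ≠ 0 ∧ x0 ^ j / f.derivative.eval b ^ 2 ∈ S ∧ ‖x0 ^ j / f.derivative.eval b ^ 2‖ ≤ 1 ∧ j < J * (q - 1) ∧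
      ‖b - Φ b‖ < ‖Φ (f.derivative.eval b)‖) : Concl k N d B := by
  classical
  have hε1 : ‖ε‖ ≤ 1 := by rw [hε, norm_pow]; exact pow_le_one₀ (norm_nonneg _) h1.le
  have hε0 : ε ≠ 0 := by rw [hε]; exact pow_ne_zero _ h0
  have hεN : ε ∈ N := by rw [hε]; exact pow_mem (hYN hx0) _
  have hq0 : (q : U) = 0 := by
    rw [hq]; push_cast; rw [hp, zero_pow]; rintro rfl; simp at hq; omega
  let P : Fin τ → U[X] := fun i => X ^ q - (Polynomial.C ε * X + Polynomial.C (y i))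
  have hPd : ∀ i a, (P i).derivative.eval a = -ε := fun i a => by simp [P, derivative_X_pow, hq0]
  have hPe : ∀ i a, (P i).eval a = 0 ↔ a ^ q = ε * a + y i := fun i a => by simp [P, sub_eq_zero]
  have hP0 : ∀ i, P i ≠ 0 := fun i h => by have := hPd i 0; rw [h] at this; simp [hε0] at this
  have hPc : ∀ i j, (P i).coeff j ∈ N := fun i j => by
    simp only [P, coeff_sub, coeff_add, coeff_C_mul, coeff_X_pow, coeff_X, coeff_C]
    refine sub_mem ?_ (add_mem (mul_mem hεN ?_) ?_) <;> split_ifs <;> first | exact one_mem _ | exact zero_mem _ | exact hyN i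
  set G1 : Finset U := univ.biUnion fun i => (P i).roots.toFinset with hG1
  have m1 : ∀ g, g ∈ G1 ↔ ∃ i, g ^ q = ε * g + y i := fun g => by
    simp only [hG1, mem_biUnion, mem_univ, true_and, Multiset.mem_toFinset]
    exact exists_congr fun i => by rw [mem_roots (hP0 i), IsRoot, hPe]
  have hu1 : ∀ i, u' i ∈ G1 := fun i => (m1 _).2 ⟨i, hu' i⟩
  set G2 := S.image Φ with hG2
  set T' := univ.image u' ∪ T.image Φ with hT'
  set Gf := ad N ((G1 : Set U) ∪ G2) with hGf
  have hNG : N ≤ Gf := le_ad _ _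
  have hG1G : ∀ g ∈ G1, g ∈ Gf := fun g hg => sub_ad _ _ (Or.inl hg)
  have hΦS : ∀ a ∈ ad k (range u ∪ S), Φ a ∈ Gf := fun a ha => by
    refine (ad_le (B := Gf.comap (Φ : U →+* U)) (fun c hc => ?_) ?_) ha
    · rw [Subfield.mem_comap]; change Φ c ∈ _; rw [Φk c hc]; exact hNG (hkN hc)
    · rintro _ (⟨i, rfl⟩ | h)
      · rw [SetLike.mem_coe, Subfield.mem_comap]; change Φ _ ∈ _; rw [Φu]; exact hG1G _ (hu1 i)
      · rw [SetLike.mem_coe, Subfield.mem_comap]; exact sub_ad _ _ (Or.inr (mem_image_of_mem _ h))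
  have hΦY : ∀ a ∈ ad k (range u ∪ Y), Φ a ∈ ad N G1 := fun a ha => by
    refine (ad_le (B := (ad N G1).comap (Φ : U →+* U)) (fun c hc => ?_) ?_) ha
    · rw [Subfield.mem_comap]; change Φ c ∈ _; rw [Φk c hc]; exact le_ad _ _ (hkN hc)
    · rintro _ (⟨i, rfl⟩ | h)
      · rw [SetLike.mem_coe, Subfield.mem_comap]; change Φ _ ∈ _; rw [Φu]; exact sub_ad _ _ (hu1 i)
      · rw [SetLike.mem_coe, Subfield.mem_comap]; change Φ _ ∈ _; rw [ΦY _ h]; exact le_ad _ _ (hYN h)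
  have hTp : ∀ t ∈ T', ‖t‖ ≤ 1 ∧ t ∈ Gf := fun t h => by
    rcases mem_union.1 h with h | h
    · obtain ⟨i, -, rfl⟩ := mem_image.1 h
      exact ⟨as_le hq2 (hy1 i) hε1 (hu' i), hG1G _ (hu1 i)⟩
    · obtain ⟨t, h2, rfl⟩ := mem_image.1 h
      exact ⟨(hT t h2).1, hΦS _ (hT t h2).2⟩
  obtain ⟨W, hW⟩ : ∃ W, W = etR k (T' : Set U) Gf := ⟨_, rfl⟩
  have mW : ∀ a, a ∈ W ↔ Et ((k : Set U) ∪ T') Gf a := fun a => by rw [hW]; rfl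
  have hW1 : ∀ a ∈ W, ‖a‖ ≤ 1 := fun a ha => ((mW a).1 ha).le_one fun r hr => by
    rcases hr with hr | hr
    · by_cases h : r = 0
      · simp [h]
      · exact (ht r hr h).le
    · exact (hTp r hr).1
  have hWG : ∀ a ∈ W, a ∈ Gf := fun a ha => ((mW a).1 ha).mem Gf (union_subset (hkN.trans hNG) fun t h => (hTp t h).2) subset_rfl
  have hTW : ∀ t ∈ T', t ∈ W := fun t h => (mW t).2 (.base (Or.inr h))
  have huW : ∀ i, u' i ∈ W := fun i => hTW _ (mem_union_left _ (mem_image_of_mem _ (mem_univ i)))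
  have hSW : ∀ b ∈ S, ‖b‖ ≤ 1 → Φ b ∈ W := fun b hb hb1 => (mW _).2 ((hE b hb hb1).mono (by
      rintro _ ⟨a, h | ⟨i, rfl⟩ | h, rfl⟩
      · rw [Φk a h]; exact Or.inl h
      · rw [Φu]; exact Or.inr (mem_union_left _ (mem_image_of_mem _ (mem_univ i)))
      · exact Or.inr (mem_union_right _ (mem_image_of_mem _ h))) (by
      rintro _ ⟨a, h, rfl⟩; exact hΦS a h))
  have hYW : ∀ a ∈ Y, a ∈ W := fun a ha => by have := hSW a (hYS ha) (hY1 a ha); rwa [ΦY a ha] at this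
  have hxW := hYW _ hx0
  have hεW : ε ∈ W := by rw [hε]; exact pow_mem hxW _
  have hR : ∀ a ∈ Subring.closure ((k : Set U) ∪ (range y ∪ Y)), Φ a ∈ W ∧ ∃ Q ∈ W, a = Φ a + ε * Q := fun a ha => by
    induction ha using Subring.closure_induction with
    | mem a ha =>
      rcases ha with h | ⟨i, rfl⟩ | h
      · rw [Φk a h]; exact ⟨(mW a).2 (.base (Or.inl h)), 0, zero_mem _, by simp⟩
      · rw [← hu i, map_pow, Φu, hu]; exact ⟨pow_mem (huW i) _, -u' i, neg_mem (huW i), by rw [hu' i]; ring⟩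
      · rw [ΦY a h]; exact ⟨hYW a h, 0, zero_mem _, by simp⟩
    | zero => rw [map_zero]; exact ⟨zero_mem _, 0, zero_mem _, by simp⟩
    | one => rw [map_one]; exact ⟨one_mem _, 0, zero_mem _, by simp⟩
    | add a b _ _ h1 h2 =>
      obtain ⟨h1, Q1, h2, h3⟩ := h1
      obtain ⟨h4, Q2, h5, h6⟩ := ‹_ ∧ ∃ Q ∈ W, b = _›
      rw [map_add]; exact ⟨add_mem h1 h4, Q1 + Q2, add_mem h2 h5, by linear_combination h3 + h6⟩
    | neg a _ h =>
      obtain ⟨h1, Q1, h2, h3⟩ := h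
      rw [map_neg]; exact ⟨neg_mem h1, -Q1, neg_mem h2, by linear_combination -h3⟩
    | mul a b _ _ h1 h2 =>
      obtain ⟨h1, Q1, h2, h3⟩ := h1
      obtain ⟨h4, Q2, h5, h6⟩ := ‹_ ∧ ∃ Q ∈ W, b = _›
      rw [map_mul]
      exact ⟨mul_mem h1 h4, Φ a * Q2 + Q1 * Φ b + ε * Q1 * Q2, add_mem (add_mem (mul_mem h1 h5) (mul_mem h2 h4)) (mul_mem (mul_mem hεW h2) h5), by
        linear_combination b * h3 + (Φ a + ε * Q1) * h6⟩
  have hBW : ∀ b ∈ B, b ∈ W := fun b hb => by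
    obtain ⟨hbN, hbS, hb1, f, j, hf, hf0, hf1, hjS, hj1, hj, hn⟩ := hB b hb
    refine newt hW hW1 hWG Φ (ω := x0 ^ (J * (q - 1) - j) * Φ (x0 ^ j / f.derivative.eval b ^ 2)) (fun i => hR _ (hf i)) hf0 (hSW b hbS hb1) (hNG hbN)
      (mul_mem (pow_mem hxW _) (hSW _ hjS hj1)) ?_ ?_ hf1 hn
    · rw [norm_mul, norm_pow]
      exact mul_lt_one_of_nonneg_of_lt_one_left (pow_nonneg (norm_nonneg _) _) (pow_lt_one₀ (norm_nonneg _) h1 (by omega)) (hW1 _ (hSW _ hjS hj1))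
    · have : Φ (f.derivative.eval b) ≠ 0 := by simpa using hf1
      rw [map_div₀, map_pow, map_pow, ΦY _ hx0, mul_assoc, div_mul_cancel₀ _ (pow_ne_zero _ this), ← pow_add, Nat.sub_add_cancel hj.le, hε]
  have hG1W : ∀ g ∈ G1, g ∈ W := fun g hg => by
    obtain ⟨i, hg'⟩ := (m1 g).1 hg
    have hxJ : x0 ^ J ≠ 0 := pow_ne_zero _ h0
    set θ := (g - u' i) / x0 ^ J with hθ
    have e1 : (g - u' i) ^ q = ε * (g - u' i) := by
      rw [hq, sub_pow_expChar_pow, ← hq, hg', hu' i]; ring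
    have e2 : θ ^ q = θ := by
      rw [hθ, div_pow, e1, div_eq_div_iff (pow_ne_zero _ hxJ) hxJ, hε, ← pow_mul]
      rw [show J * q = J * (q - 1) + J by rw [← Nat.mul_succ]; congr 1; omega, pow_add]; ring
    have e3 : θ ∈ W := by
      rw [mW]
      refine .root (X ^ q - X) θ (fun i => ?_) (div_mem (sub_mem (hG1G _ hg) (hG1G _ (hu1 i))) (hNG (pow_mem (hYN hx0) _)))
        (as_le (y := 0) (ε := 1) hq2 (by simp) (by simp) (by simpa using e2)) (by simp [e2]) (by simp [derivative_X_pow, hq0])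
      rw [← mW, coeff_sub, coeff_X_pow, coeff_X]
      exact sub_mem (by split_ifs <;> first | exact one_mem _ | exact zero_mem _) (by split_ifs <;> first | exact one_mem _ | exact zero_mem _)
    rw [show g = u' i + x0 ^ J * θ by rw [hθ]; field_simp; ring]
    exact add_mem (huW i) (mul_mem (pow_mem hxW _) e3)
  refine ⟨T', G1, G2, B ∪ (G1 ∪ (S.filter (‖·‖ ≤ 1)).image Φ), Finset.subset_union_left, ?_, ?_, ?_, ?_, ?_, hTp, ?_, ?_⟩
  · intro g hg
    obtain ⟨i, hi⟩ := (m1 g).1 hg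
    exact mem_sc.2 ((sep_iff _ _).2 ⟨P i, hPc i, (hPe i g).2 hi, by rw [hPd]; simpa using hε0⟩)
  · intro σ hσ g hg
    obtain ⟨i, hi⟩ := (m1 g).1 hg
    exact (m1 _).2 ⟨i, by rw [← map_pow, hi, map_add, map_mul, hσ _ hεN, hσ _ (hyN i)]⟩
  · intro g hg
    obtain ⟨s, hs, rfl⟩ := mem_image.1 hg
    exact mem_sc.2 (sep_map (Φ : U →+* U) (b := s) hΦY (mem_sc.1 (hS hs)))
  · intro σ hσ g hg
    obtain ⟨s, hs, rfl⟩ := mem_image.1 hg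
    have := hst ((Φ.trans σ).trans Φ.symm) (fun a ha => by simp [hσ _ (hΦY a ha)]) s hs
    exact mem_image.2 ⟨_, this, by simp⟩
  · have h6 : (univ.image u').card ≤ τ := card_image_le.trans (by simp)
    have h7 : T'.card ≤ _ := card_union_le (univ.image u') (T.image Φ)
    have h8 : (T.image Φ).card ≤ T.card := card_image_le
    omega
  · intro b hb
    have : b ∈ W := by
      rcases mem_union.1 hb with h | h
      · exact hBW b h
      rcases mem_union.1 h with h | h
      · exact hG1W b h
      obtain ⟨s, hs, rfl⟩ := mem_image.1 h
      exact hSW s (mem_filter.1 hs).1 (mem_filter.1 hs).2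
    exact ⟨hWG b this, (mW b).1 this⟩
  · rintro g (hg | hg)
    · exact Or.inl (mem_union_right _ (mem_union_left _ hg))
    · obtain ⟨s, hs, rfl⟩ := mem_image.1 hg
      rcases le_total ‖s‖ 1 with h | h
      · exact Or.inl (mem_union_right _ (mem_union_right _ (mem_image_of_mem _ (mem_filter.2 ⟨hs, h⟩))))
      · exact Or.inr (mem_union_right _ (mem_union_right _ (mem_image.2 ⟨s⁻¹, mem_filter.2 ⟨hi s hs,
          by rw [norm_inv]; exact inv_le_one_of_one_le₀ h⟩, map_inv₀ Φ s⟩)))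
end Cp

open Filter Topology
section Cp
variable {U : Type*} [NormedField U] [IsUltrametricDist U] {k N : Subfield U}
variable [IsAlgClosed U] {C : Type*} [NontriviallyNormedField C] [CompleteSpace C] [IsUltrametricDist C] {ι : U →+* C}

theorem concl_p [PerfectField k] (p : ℕ) [ExpChar U p] (hp2 : 2 ≤ p) (hp : (p : U) = 0) (hι : ∀ a, ‖ι a‖ = ‖a‖) (hd : ∀ c : C, ∀ ε > 0, ∃ a : U, ‖c - ι a‖ < ε)
    (S0 : Finset U) (hN : N = ad k S0) {d : ℕ} (hdd : Algebra.trdeg k U = d) (ht : Tr k) (hU : ∀ a, a ∈ acl N) {ϖ : U} (hϖ : ϖ ∈ N)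
    (h0 : ϖ ≠ 0) (h1 : ‖ϖ‖ < 1) (B : Finset U) (hB : (B : Set U) ⊆ N) (hB1 : ∀ b ∈ B, ‖b‖ ≤ 1) : Concl k N d B := by
  classical
  have hkN : k ≤ N := hN ▸ le_ad _ _
  haveI := (algebraMap k U).expChar (algebraMap k U).injective p
  have hk : ∀ c ∈ k, ∃ c' ∈ k, c' ^ p = c := fun c hc => by
    haveI := PerfectField.toPerfectRing (K := k) p
    obtain ⟨c', h⟩ := (surjective_frobenius k p) ⟨c, hc⟩
    exact ⟨c', c'.2, by simpa [frobenius_def] using congrArg Subtype.val h⟩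
  obtain ⟨τ, ρ, y, x, X, h, hX1⟩ := frame_p S0 hN hdd ht hU (by omega) hp hϖ h0 h1
  obtain ⟨hyN, hxN, hRI, hx, hres, hval⟩ := h.1
  have hρ := fr_pos h.1 h0 h1
  set x0 := x ⟨0, hρ⟩ with hx0
  obtain ⟨hx00, hx01⟩ := hx.1 ⟨0, hρ⟩
  rw [← hx0] at hx00 hx01
  set Y : Set U := range x ∪ X with hY
  have hx0Y : x0 ∈ Y := Or.inl ⟨_, rfl⟩
  have hYN : Y ⊆ N := union_subset (range_subset_iff.2 hxN) h.2.1
  have hY1 : ∀ a ∈ Y, ‖a‖ ≤ 1 := by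
    rintro _ (⟨i, rfl⟩ | h)
    exacts [(hx.1 i).2.le, hX1 _ h]
  set E := ad k (range y) with hE
  have hG := thmZ ι p hι hd (pc E) (pc_sep E) (fun c hc => triv_alg hRI.triv c (acl_trans (pc_acl E) hc))
    (fun a ha => (hres a ha).imp fun c hc => ⟨acl_mono (le_pc E) hc.1, hc.2⟩) hρ hx hval X (fr_indep hdd hU h _ (pc_acl E))
  have hNs : N ≤ sc (ad (pc E) Y) := h.2.2.2.trans (sc_mono (by rw [← ad_ad]; exact ad_mono (le_pc E) subset_rfl))
  have hf : ∀ b ∈ B, ∃ (f : U[X]) (j : ℕ), (∀ i, f.coeff i ∈ Subring.closure ((k : Set U) ∪ (range y ∪ Y))) ∧ f.eval b = 0 ∧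
      f.derivative.eval b ≠ 0 ∧ ‖x0 ^ j / f.derivative.eval b ^ 2‖ ≤ 1 := fun b hb => by
    obtain ⟨f, hf, hf0, hf1⟩ := den _ (h.2.2.2 (hB hb))
    have h3 : 0 < ‖f.derivative.eval b ^ 2‖ := norm_pos_iff.2 (pow_ne_zero _ hf1)
    obtain ⟨j, hj⟩ := exists_pow_lt_of_lt_one h3 hx01
    exact ⟨f, j, hf, hf0, hf1, by rw [norm_div, norm_pow, div_le_one h3]; exact hj.le⟩
  choose! f j hf hf0 hf1 hj using hf
  have hfN : ∀ b ∈ B, (f b).derivative.eval b ∈ N := fun b hb => by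
    have hcN : ∀ i, (f b).coeff i ∈ N := fun i => by
      have : Subring.closure ((k : Set U) ∪ (range y ∪ Y)) ≤ N.toSubring :=
        Subring.closure_le.2 (union_subset hkN (union_subset (range_subset_iff.2 hyN) hYN))
      exact this (hf b hb i)
    rw [eval_eq_sum_range]
    refine sum_mem fun i _ => mul_mem ?_ (pow_mem (hB hb) i)
    rw [coeff_derivative]; exact mul_mem (hcN _) (by exact_mod_cast natCast_mem N (i + 1))
  set A : Finset U := (B ∪ (univ.image x ∪ X)) ∪ (B.image (fun b => (f b).derivative.eval b) ∪ B.image fun b => x0 ^ j b / (f b).derivative.eval b ^ 2) with hA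
  have hYA : Y ⊆ A := by
    rintro _ (⟨i, rfl⟩ | h)
    · simp [hA]
    · simp [hA, show _ ∈ X from h]
  have hAN : (A : Set U) ⊆ N := by
    intro a ha
    simp only [hA, coe_union, coe_image, Set.mem_union, Set.mem_image, mem_coe] at ha
    rcases ha with (h | ⟨i, -, rfl⟩ | h) | ⟨b, h, rfl⟩ | ⟨b, h, rfl⟩
    exacts [hB h, hxN i, hYN (Or.inr h), hfN b h, div_mem (pow_mem (hxN _) _) (pow_mem (hfN b h) _)]
  obtain ⟨l, hl, hlv⟩ := lvl p hk hRI Y hG A (hAN.trans hNs)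
  set q := p ^ l with hq
  have hq2 : 2 ≤ q := hp2.trans (Nat.le_self_pow hl.ne' p)
  choose u hu using fun i => IsAlgClosed.exists_pow_nat_eq (y i) (show 0 < q by omega)
  obtain ⟨S, T, hAS, hS, hst, hi, hc, hT, hEt⟩ := hlv u hu
  have hε1 : ∀ J, ‖x0 ^ (J * (q - 1))‖ ≤ 1 := fun J => by rw [norm_pow]; exact pow_le_one₀ (norm_nonneg _) hx01.le
  have hroot : ∀ (J : ℕ) (i : Fin τ), ∃ v : U, v ^ q = x0 ^ (J * (q - 1)) * v + y i := fun J i => by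
    obtain ⟨v, hv⟩ := IsAlgClosed.exists_root (Polynomial.X ^ q - (Polynomial.C (x0 ^ (J * (q - 1))) * Polynomial.X + Polynomial.C (y i))) (by
      rw [degree_sub_eq_left_of_degree_lt]
      · rw [degree_X_pow]; exact_mod_cast (by omega : q ≠ 0)
      · rw [degree_X_pow]; exact degree_linear_le.trans_lt (by exact_mod_cast hq2))
    exact ⟨v, by simpa [sub_eq_zero] using hv⟩
  choose u' hu' using hroot
  have hu't : ∀ i, Tendsto (fun J => u' J i) atTop (𝓝 (u i)) := fun i => by
    rw [Metric.tendsto_nhds]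
    intro δ hδ
    obtain ⟨J0, hJ0⟩ := exists_pow_lt_of_lt_one (pow_pos hδ q) hx01
    filter_upwards [eventually_ge_atTop J0] with J hJ
    rw [dist_eq_norm]
    refine lt_of_pow_lt_pow_left₀ q hδ.le ?_
    have e1 : (u' J i - u i) ^ q = x0 ^ (J * (q - 1)) * u' J i := by
      rw [hq, sub_pow_expChar_pow, ← hq, hu, hu']; ring
    rw [← norm_pow, e1, norm_mul]
    refine (mul_le_of_le_one_right (norm_nonneg _) (as_le hq2 (hRI.one i).le (hε1 J) (hu' J i))).trans_lt (lt_of_le_of_lt ?_ hJ0)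
    rw [norm_pow]
    exact pow_le_pow_of_le_one (norm_nonneg _) hx01.le (hJ.trans (Nat.le_mul_of_pos_right _ (by omega)))
  let e := (Fintype.equivFin (Fin τ ⊕ (Fin ρ ⊕ X))).symm
  have hcard : Fintype.card (Fin τ ⊕ (Fin ρ ⊕ X)) ≤ d := by
    simp only [Fintype.card_sum, Fintype.card_fin, Fintype.card_coe]; have := h.2.2.1; omega
  let Z : (Fin τ → U) → (Fin τ ⊕ (Fin ρ ⊕ X)) → U := fun v => elim v (elim x Subtype.val)
  have hr : ∀ v, range (Z v ∘ e) = range v ∪ Y := fun v => by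
    rw [e.surjective.range_comp]; simp only [Z, Set.Sum.elim_range]
    rw [hY]; congr 2; ext a; simp
  have hsp : ∀ (v : Fin τ → U), (∀ i, y i ∈ ad k (range v ∪ Y)) → ∀ a, a ∈ acl (ad k (range (Z v ∘ e))) := fun v hv a => by
    rw [hr]
    refine acl_trans (h.2.2.2.trans ((sc_le _).trans (acl_mono (ad_le (le_ad _ _) (union_subset (range_subset_iff.2 hv) ?_))))) (hU a)
    exact subset_union_right.trans (sub_ad _ _)
  have hz' := hsp u fun i => by
    have e1 : u i ∈ ad k (range u ∪ Y) := sub_ad _ _ (Or.inl ⟨i, rfl⟩)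
    rw [← hu i]; exact pow_mem e1 _
  have hw' : ∀ J a, a ∈ acl (ad k (range (Z (u' J) ∘ e))) := fun J => hsp (u' J) fun i => by
    have e1 : u' J i ∈ ad k (range (u' J) ∪ Y) := sub_ad _ _ (Or.inl ⟨i, rfl⟩)
    rw [show y i = u' J i ^ q - x0 ^ (J * (q - 1)) * u' J i by rw [hu']; ring]
    have e2 : x0 ∈ ad k (range (u' J) ∪ Y) := sub_ad _ _ (Or.inr hx0Y)
    exact sub_mem (pow_mem e1 _) (mul_mem (pow_mem e2 _) e1)
  obtain ⟨Φ, Φk, Φz, Φt⟩ := deform (td3 hdd hcard hz') (fun J => td3 hdd hcard (hw' J)) hz' hw' (fun i => by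
      simp only [Function.comp, Z]
      rcases e i with i | i | i
      exacts [hu't i, tendsto_const_nhds, tendsto_const_nhds]) S (by rw [hr]; exact hS)
  rw [hr] at Φt
  have Φu : ∀ J i, Φ J (u i) = u' J i := fun J i => by have := Φz J (e.symm (inl i)); simpa [Z] using this
  have ΦY : ∀ J, ∀ a ∈ Y, Φ J a = a := by
    rintro J _ (⟨i, rfl⟩ | h)
    · have := Φz J (e.symm (inr (inl i))); simpa [Z] using this
    · have := Φz J (e.symm (inr (inr ⟨_, h⟩))); simpa [Z] using this
  have Φt' : ∀ a ∈ ad k (range u ∪ S), Tendsto (fun J => Φ J a) atTop (𝓝 a) := fun a ha =>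
    Φt a (ad_mono le_rfl (union_subset_union_left _ subset_union_left) ha)
  have ΦS : ∀ a ∈ S, Tendsto (fun J => Φ J a) atTop (𝓝 a) := fun a ha => Φt' a (sub_ad _ _ (Or.inr ha))
  have v1 : ∀ᶠ J in atTop, ∀ t ∈ T, ‖Φ J t‖ ≤ 1 := (eventually_all_finset T).2 fun t h => ev_le (Φt' t (hT t h).2) (hT t h).1
  have v2 : ∀ᶠ J in atTop, ∀ b ∈ S, ‖b‖ ≤ 1 → Et (Φ J '' ((k : Set U) ∪ (range u ∪ T))) (Φ J '' (ad k (range u ∪ S))) (Φ J b) :=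
    (eventually_all_finset S).2 fun b hb => by
      by_cases hb1 : ‖b‖ ≤ 1
      · filter_upwards [(hEt b hb hb1).transp Φ (ad k (range u ∪ S)) (union_subset (le_ad _ _) (union_subset
          (subset_union_left.trans (sub_ad _ _)) fun t h => (hT t h).2)) subset_rfl Φt'] with J hJ _ using hJ
      · exact .of_forall fun J h => absurd h hb1
  have v3 : ∀ᶠ J in atTop, ∀ b ∈ B, ‖b - Φ J b‖ < ‖Φ J ((f b).derivative.eval b)‖ ∧ j b < J * (q - 1) := (eventually_all_finset B).2 fun b hb => by
    have h3 : 0 < ‖(f b).derivative.eval b‖ := norm_pos_iff.2 (hf1 b hb)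
    have h4 : (f b).derivative.eval b ∈ S := hAS (by simp only [hA, mem_union, mem_image]; exact Or.inr (Or.inl ⟨b, hb, rfl⟩))
    filter_upwards [ev_eq (ΦS b (hAS (by simp [hA, hb]))) h3, ev_eq (ΦS _ h4) h3, eventually_gt_atTop (j b)] with J a1 a2 a3
    rw [um_eq_of_sub a2]
    exact ⟨a1, a3.trans_le (Nat.le_mul_of_pos_right _ (by omega))⟩
  obtain ⟨J, v1, v2, v3⟩ := (v1.and (v2.and v3)).exists
  exact fixJ p hp hq hq2 (Φ J) ht hkN hyN hYN hx0Y hx00 hx01 rfl (fun i => (hRI.one i).le) hu (hu' J) (Φk J) (ΦY J) (Φu J) (hYA.trans hAS) hY1 hS hst hi hc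
    (by have := h.2.2.1; omega) (fun t h => ⟨v1 t h, (hT t h).2⟩) v2 B fun b hb => ⟨hB hb, hAS (by simp [hA, hb]), hB1 b hb, f b, j b, hf b hb, hf0 b hb, hf1 b hb,
      hAS (by simp only [hA, mem_union, mem_image]; exact Or.inr (Or.inr ⟨b, hb, rfl⟩)), hj b hb, (v3 b hb).2, (v3 b hb).1⟩
end Cp

section TD
variable {U : Type*} [NormedField U] [IsUltrametricDist U]

def Wc (R : Set U) (η : ℕ → U) (i : ℕ) : Subring U := Subring.closure (R ∪ η '' Iio i)
def TD (R : Set U) (G : Set U) (n : ℕ) (η : ℕ → U) : Prop := ∀ i < n, η i ∈ G ∧ ‖η i‖ ≤ 1 ∧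
  ∃ g : U[X], (∀ j, g.coeff j ∈ Wc R η i) ∧ g.eval (η i) = 0 ∧ ‖g.derivative.eval (η i)‖ = 1

variable {R G : Set U}
theorem Wc.congr {η η' : ℕ → U} {i : ℕ} (h : ∀ j < i, η' j = η j) : Wc R η' i = Wc R η i := by
  unfold Wc; congr 2; exact Set.image_congr h
theorem Wc.mono {η : ℕ → U} {i j : ℕ} (h : i ≤ j) : Wc R η i ≤ Wc R η j :=
  Subring.closure_mono (union_subset_union_right _ (Set.image_mono (Set.Iio_subset_Iio h)))

theorem TD.snoc {n : ℕ} {η : ℕ → U} (h : TD R G n η) {v : U} (hG : v ∈ G) (h1 : ‖v‖ ≤ 1) (g : U[X]) (hg : ∀ j, g.coeff j ∈ Wc R η n)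
    (h0 : g.eval v = 0) (hd : ‖g.derivative.eval v‖ = 1) : ∃ η', TD R G (n + 1) η' ∧ (∀ i < n, η' i = η i) ∧ η' n = v := by
  have e : ∀ i < n, update η n v i = η i := fun i hi => Function.update_of_ne hi.ne _ _
  refine ⟨update η n v, fun i hi => ?_, e, by simp⟩
  rcases (Nat.lt_succ_iff_lt_or_eq.1 hi) with hi | rfl
  · rw [e i hi, Wc.congr fun j hj => e j (hj.trans hi)]; exact h i hi
  · rw [Wc.congr e]; simp only [Function.update_self]; exact ⟨hG, h1, g, hg, h0, hd⟩

theorem TD.et {b : U} (hb : Et R G b) : ∀ {n : ℕ} {η : ℕ → U}, TD R G n η → ∃ n' η', n ≤ n' ∧ TD R G n' η' ∧ (∀ i < n, η' i = η i) ∧ b ∈ Wc R η' n' := by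
  induction hb with
  | base hb => exact fun {n η} h => ⟨n, η, le_rfl, h, fun _ _ => rfl, Subring.subset_closure (Or.inl hb)⟩
  | add _ _ h1 h2 =>
    intro n η h
    obtain ⟨n1, η1, hn1, t1, e1, b1⟩ := h1 h
    obtain ⟨n2, η2, hn2, t2, e2, b2⟩ := h2 t1
    refine ⟨n2, η2, hn1.trans hn2, t2, fun i hi => (e2 i (hi.trans_le hn1)).trans (e1 i hi), add_mem ?_ b2⟩
    exact Wc.mono hn2 (by rw [Wc.congr e2]; exact b1)
  | mul _ _ h1 h2 =>
    intro n η h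
    obtain ⟨n1, η1, hn1, t1, e1, b1⟩ := h1 h
    obtain ⟨n2, η2, hn2, t2, e2, b2⟩ := h2 t1
    refine ⟨n2, η2, hn1.trans hn2, t2, fun i hi => (e2 i (hi.trans_le hn1)).trans (e1 i hi), mul_mem ?_ b2⟩
    exact Wc.mono hn2 (by rw [Wc.congr e2]; exact b1)
  | root g v hg hG h1 h0 hd ih =>
    intro n η h
    have key : ∀ m, ∃ n' η', n ≤ n' ∧ TD R G n' η' ∧ (∀ i < n, η' i = η i) ∧ ∀ j < m, g.coeff j ∈ Wc R η' n' := fun m => by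
      induction m with
      | zero => exact ⟨n, η, le_rfl, h, fun _ _ => rfl, by simp⟩
      | succ m ihm =>
        obtain ⟨n1, η1, hn1, t1, e1, b1⟩ := ihm
        obtain ⟨n2, η2, hn2, t2, e2, b2⟩ := ih m t1
        refine ⟨n2, η2, hn1.trans hn2, t2, fun i hi => (e2 i (hi.trans_le hn1)).trans (e1 i hi), fun j hj => ?_⟩
        rcases Nat.lt_succ_iff_lt_or_eq.1 hj with hj | rfl
        · exact Wc.mono hn2 (by rw [Wc.congr e2]; exact b1 j hj)
        · exact b2
    obtain ⟨n1, η1, hn1, t1, e1, b1⟩ := key (g.natDegree + 1)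
    obtain ⟨η2, t2, e2, hv⟩ := t1.snoc hG h1 g (fun j => by
      rcases lt_or_ge j (g.natDegree + 1) with hj | hj
      · exact b1 j hj
      · rw [coeff_eq_zero_of_natDegree_lt (by omega)]; exact zero_mem _) h0 hd
    exact ⟨n1 + 1, η2, by omega, t2, fun i hi => (e2 i (hi.trans_le hn1)).trans (e1 i hi), Subring.subset_closure (Or.inr ⟨n1, by simp, hv⟩)⟩

theorem TD.all (B : Finset U) (hB : ∀ b ∈ B, b ∈ G ∧ ‖b‖ ≤ 1 ∧ Et R G b) : ∃ n η, TD R G n η ∧ ∀ b ∈ B, ∃ i < n, η i = b := by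
  classical
  induction B using induction_on with
  | empty => exact ⟨0, fun _ => 0, fun i hi => absurd hi (by omega), by simp⟩
  | insert a s _ ih =>
    obtain ⟨n, η, h, hs⟩ := ih fun b hb => hB b (mem_insert_of_mem hb)
    obtain ⟨h1, h2, h3⟩ := hB a (mem_insert_self _ _)
    obtain ⟨n1, η1, hn1, t1, e1, b1⟩ := TD.et h3 h
    obtain ⟨η2, t2, e2, hv⟩ := t1.snoc h1 h2 (X - Polynomial.C a) (fun j => by
      rw [coeff_sub, coeff_X, coeff_C]
      exact sub_mem (by split_ifs <;> first | exact one_mem _ | exact zero_mem _) (by split_ifs <;> first | exact b1 | exact zero_mem _)) (by simp) (by simp)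
    refine ⟨n1 + 1, η2, t2, fun b hb => ?_⟩
    rcases mem_insert.1 hb with rfl | hb
    · exact ⟨n1, by omega, hv⟩
    · obtain ⟨i, hi, rfl⟩ := hs b hb
      exact ⟨i, by omega, (e2 i (by omega)).trans (e1 i hi)⟩

theorem Et.sc (E : Subfield U) (hR : R ⊆ E) {b : U} (hb : Et R G b) : b ∈ sc E := by
  induction hb with
  | base hb => exact le_sc _ (hR hb)
  | add _ _ h1 h2 => exact add_mem h1 h2
  | mul _ _ h1 h2 => exact mul_mem h1 h2
  | root g v hg hG h1 h0 hd ih =>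
    refine sc_sc E (mem_sc.2 ((sep_iff _ _).2 ⟨g, ih, h0, fun h => ?_⟩))
    rw [h] at hd; simp at hd

def Fin2 (K0 : Subfield U) (S0 B : Finset U) : Prop := ∃ (A T G1 G2 : Finset U) (𝓚 M G : Subfield U) (n : ℕ) (η : ℕ → U),
  (A : Set U) ⊆ pc K0 ∧ 𝓚 = ad K0 A ∧ M = ad 𝓚 S0 ∧ G = ad (ad M G1) G2 ∧ (G1 : Set U) ⊆ sc M ∧ (∀ σ : U ≃+* U, (∀ a ∈ M, σ a = a) → ∀ g ∈ G1, σ g ∈ G1) ∧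
  (G2 : Set U) ⊆ sc (ad M G1) ∧ (∀ σ : U ≃+* U, (∀ a ∈ ad M G1, σ a = a) → ∀ g ∈ G2, σ g ∈ G2) ∧
  AlgebraicIndependent 𝓚 (fun i => (T.equivFin.symm i : U)) ∧ (∀ a, a ∈ acl (ad 𝓚 T)) ∧ (∀ t ∈ T, ‖t‖ ≤ 1 ∧ t ∈ G) ∧
  TD ((𝓚 : Set U) ∪ T) G n η ∧ (∀ b ∈ B, ∃ i < n, η i = b) ∧ Subfield.closure ((𝓚 : Set U) ∪ T ∪ η '' Iio n) = G

theorem trd {A B : Subfield U} (h : A ≤ B) (h' : B ≤ acl A) : Algebra.trdeg A U = Algebra.trdeg B U := by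
  letI : Algebra A B := (inclusion h).toAlgebra
  haveI : IsScalarTower A B U := .of_algebraMap_eq fun _ => rfl
  haveI : Algebra.IsAlgebraic A B := ⟨fun b => (isAlgebraic_algebraMap_iff (algebraMap B U).injective).1 (mem_acl.1 (h' b.2))⟩
  have := trdeg_add_eq (R := A) (S := B) (A := U)
  rw [← this, trdeg_eq_zero, zero_add]

theorem fin2 [IsAlgClosed U] {K0 : Subfield U} {S0 B : Finset U} {d : ℕ} (ht : Tr K0) (hU : ∀ a, a ∈ acl (ad K0 S0)) (hd : Algebra.trdeg K0 U = d)
    (hB1 : ∀ b ∈ B, ‖b‖ ≤ 1) (hSB : ∀ s ∈ S0, s ∈ B ∨ s⁻¹ ∈ B) (hC : Concl (pc K0) (ad (pc K0) S0) d B) : Fin2 K0 S0 B := by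
  classical
  obtain ⟨T, G1, G2, B', hBB, g1, g2, g3, g4, hTc, hT, hB', hg⟩ := hC
  set k := pc K0 with hk
  set N := ad k S0
  have eG : ad N ((G1 : Set U) ∪ G2) = ad k ((S0 : Set U) ∪ (G1 ∪ G2)) := ad_ad _ _ _
  rw [eG] at hB' hT
  obtain ⟨A1, a1, a1'⟩ := sc_fin k S0 G1 g1
  obtain ⟨A2, a2, a2'⟩ := sc_fin k ((S0 : Set U) ∪ G1) G2 (by rw [← ad_ad]; exact g3)
  obtain ⟨A3, a3, a3'⟩ := ad_fin k ((S0 : Set U) ∪ (G1 ∪ G2)) T fun t h => (hT t h).2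
  obtain ⟨A4, a4, a4'⟩ := Et.desc k T ((S0 : Set U) ∪ (G1 ∪ G2)) B' fun b hb => (hB' b hb).2
  obtain ⟨A5, a5, a5'⟩ := ad_fin k ((S0 : Set U) ∪ (G1 ∪ G2)) B' fun t h => (hB' t h).1
  set A := A1 ∪ A2 ∪ A3 ∪ A4 ∪ A5 with hA
  have hAk : (A : Set U) ⊆ k := by
    simp only [hA, coe_union, Set.union_subset_iff]; exact ⟨⟨⟨⟨a1, a2⟩, a3⟩, a4⟩, a5⟩
  set 𝓚 := ad K0 A with h𝓚
  have hA𝓚 : (A : Set U) ⊆ 𝓚 := sub_ad _ _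
  have hA' := hA𝓚
  simp only [hA, coe_union, Set.union_subset_iff] at hA'
  obtain ⟨⟨⟨⟨c1, c2⟩, c3⟩, c4⟩, c5⟩ := hA'
  have hK𝓚 : K0 ≤ 𝓚 := le_ad _ _
  have h𝓚k : 𝓚 ≤ k := ad_le (le_pc _) hAk
  have ht𝓚 : ∀ c ∈ 𝓚, c ≠ 0 → ‖c‖ = 1 := fun c hc => triv_alg ht c (pc_acl K0 (h𝓚k hc))
  set M := ad 𝓚 S0 with hM
  have hfixM : ∀ σ : U ≃+* U, (∀ a ∈ M, σ a = a) → ∀ a ∈ N, σ a = a := fun σ h =>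
    fix_ad σ (fix_pc σ fun a ha => h a (le_ad _ _ (hK𝓚 ha))) fun a ha => h a (sub_ad _ _ ha)
  set G := ad (ad M G1) (G2 : Set U) with hG
  have hGe : G = ad 𝓚 ((S0 : Set U) ∪ (G1 ∪ G2)) := by rw [hG, hM, ad_ad, ad_ad]
  have hE : ∀ b ∈ B', Et ((𝓚 : Set U) ∪ T) G b := fun b hb => by rw [hGe]; exact a4' 𝓚 c4 b hb
  have hTG : ∀ t ∈ T, t ∈ G := fun t h => by
    rw [hGe]; exact Subfield.closure_mono (union_subset_union_left _ c3) (a3' h)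
  have hBG : ∀ t ∈ B', t ∈ G := fun t h => by
    rw [hGe]; exact Subfield.closure_mono (union_subset_union_left _ c5) (a5' h)
  have hB1' : ∀ b ∈ B', ‖b‖ ≤ 1 := fun b hb => (hE b hb).le_one fun r hr => by
    rcases hr with hr | hr
    · by_cases h : r = 0
      · simp [h]
      · exact (ht𝓚 r hr h).le
    · exact (hT r hr).1
  obtain ⟨n, η, hTD, hη⟩ := TD.all (R := (𝓚 : Set U) ∪ T) (G := G) B' fun b hb => ⟨hBG b hb, hB1' b hb, hE b hb⟩
  have hclos : ∀ E : Subfield U, 𝓚 ≤ E → (∀ b ∈ B', b ∈ E) → G ≤ E := fun E h1 h2 => by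
    have h3 : ∀ a, a ∈ B' ∨ a⁻¹ ∈ B' → a ∈ E := by
      rintro a (h | h)
      exacts [h2 a h, inv_inv a ▸ inv_mem (h2 _ h)]
    rw [hGe]
    refine ad_le h1 ?_
    rintro a (h | h | h)
    · exact h3 a ((hSB a h).imp (fun h => hBB h) fun h => hBB h)
    exacts [h3 a (hg a (Or.inl h)), h3 a (hg a (Or.inr h))]
  have hsp : ∀ a, a ∈ acl (ad 𝓚 T) := fun a => by
    refine acl_trans (ad_le (hK𝓚.trans ((le_ad _ _).trans (le_acl _))) fun s hs => ?_) (hU a)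
    refine hclos (acl (ad 𝓚 T)) ((le_ad _ _).trans (le_acl _)) (fun b hb => sc_le _ ((hE b hb).sc _ (union_subset (le_ad _ _) (sub_ad _ _)))) ?_
    rw [hGe]; exact sub_ad _ _ (Or.inl hs)
  have hr : range (fun i => (T.equivFin.symm i : U)) = T := by
    rw [show (fun i => (T.equivFin.symm i : U)) = Subtype.val ∘ T.equivFin.symm from rfl, T.equivFin.symm.surjective.range_comp]; simp
  refine ⟨A, T, G1, G2, 𝓚, M, G, n, η, hAk, rfl, rfl, rfl, ?_, fun σ h => g2 σ (hfixM σ h), ?_, fun σ h => g4 σ (fix_ad σ (hfixM σ fun a ha => h a (le_ad _ _ ha))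
    fun a ha => h a (sub_ad _ _ ha)), ?_, hsp, fun t h => ⟨(hT t h).1, hTG t h⟩, hTD, fun b hb => hη b (hBB hb), ?_⟩
  · exact a1' M (c1.trans (le_ad _ _)) (sub_ad _ _)
  · exact a2' _ (c2.trans ((le_ad 𝓚 _).trans (le_ad M _))) (union_subset ((sub_ad _ _).trans (le_ad M _)) (sub_ad _ _))
  · exact td3 ((trd hK𝓚 (h𝓚k.trans (pc_acl K0))).symm.trans hd) hTc (by rw [hr]; exact hsp)
  · refine le_antisymm (closure_le.2 (union_subset (union_subset ?_ hTG) ?_)) (hclos _ (fun a h => Subfield.subset_closure (Or.inl (Or.inl h))) ?_)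
    · exact ((le_ad 𝓚 _).trans (le_ad M _)).trans (le_ad (ad M G1) _)
    · rintro _ ⟨i, hi, rfl⟩; exact (hTD i hi).1
    · intro b hb
      obtain ⟨i, hi, rfl⟩ := hη b hb
      exact Subfield.subset_closure (Or.inr ⟨i, hi, rfl⟩)
end TD

section UD
theorem poly_ex {U : Type*} [NormedField U] (A : Subring U) (η : ℕ → U) (n i : ℕ) (hi : i ≤ n) {w : U} (hw : w ∈ Wc (A : Set U) η i) :
    ∃ P ∈ MvPolynomial.supported A {j : Fin n | (j : ℕ) < i}, MvPolynomial.aeval (fun j : Fin n => η j) P = w := by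
  suffices h : Wc (A : Set U) η i ≤ ((MvPolynomial.supported A {j : Fin n | (j : ℕ) < i}).map (MvPolynomial.aeval (fun j : Fin n => η j))).toSubring from h hw
  refine Subring.closure_le.2 (union_subset (fun a ha => ?_) ?_)
  · exact Subalgebra.algebraMap_mem _ (⟨a, ha⟩ : A)
  · rintro _ ⟨j, hj, rfl⟩
    have hj : j < i := hj
    exact ⟨MvPolynomial.X ⟨j, hj.trans_le hi⟩, MvPolynomial.X_mem_supported.2 hj, by simp⟩

theorem poly_ex2 {U : Type*} [NormedField U] (A : Subring U) (η : ℕ → U) (n : ℕ) (i : Fin n) {g : U[X]} (hg : ∀ j, g.coeff j ∈ Wc (A : Set U) η i) :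
    ∃ f ∈ MvPolynomial.supported A {j : Fin n | j ≤ i}, MvPolynomial.aeval (fun j : Fin n => η j) f = g.eval (η i) ∧
      MvPolynomial.aeval (fun j : Fin n => η j) (MvPolynomial.pderiv i f) = g.derivative.eval (η i) := by
  choose P hP hP' using fun j => poly_ex A η n i i.2.le (hg j)
  refine ⟨∑ j ∈ Finset.range (g.natDegree + 1), P j * MvPolynomial.X i ^ j, sum_mem fun j _ => mul_mem ?_ (pow_mem (MvPolynomial.X_mem_supported.2 (show i ∈ {j : Fin n | j ≤ i} from le_refl i)) _), ?_, ?_⟩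
  · exact MvPolynomial.supported_mono (s := {j : Fin n | (j : ℕ) < i}) (fun a (h : (a : ℕ) < i) => (Fin.lt_def.2 h).le) (hP j)
  · rw [map_sum, eval_eq_sum_range]
    exact sum_congr rfl fun j _ => by rw [map_mul, hP', map_pow, MvPolynomial.aeval_X]
  · rw [map_sum, map_sum, derivative_eval, sum_over_range _ (by simp)]
    refine sum_congr rfl fun j _ => ?_
    have h0 : MvPolynomial.pderiv i (P j) = 0 := MvPolynomial.pderiv_eq_zero_of_notMem_vars fun h => by
      have : (i : ℕ) < i := MvPolynomial.mem_supported.1 (hP j) h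
      omega
    rw [MvPolynomial.pderiv_mul, h0, zero_mul, zero_add, MvPolynomial.pderiv_pow, MvPolynomial.pderiv_X_self, map_mul, hP']
    simp [mul_assoc]

theorem alg_e {E U : Type*} [Field E] [Field U] (e : E →+* U) (D : Subfield E) {z : E} (h : IsAlgebraic (D.map e) (e z)) : IsAlgebraic D z := by
  let f : D →+* D.map e := (e.comp D.subtype).codRestrict (D.map e) fun x => ⟨x.1, x.2, rfl⟩
  refine h.of_ringHom_of_comp_eq f e ?_ e.injective rfl
  rintro ⟨_, x, hx, rfl⟩
  exact ⟨⟨x, hx⟩, rfl⟩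

theorem ind_e {E U : Type*} [Field E] [Field U] (e : E →+* U) (D : Subfield E) {s : ℕ} {t : Fin s → E} (h : AlgebraicIndependent (D.map e) (fun i => e (t i))) :
    AlgebraicIndependent D t := by
  let f : D →+* D.map e := (e.comp D.subtype).codRestrict (D.map e) fun x => ⟨x.1, x.2, rfl⟩
  exact AlgebraicIndependent.of_ringHom_of_comp_eq (x := t) f e (by exact h) f.injective rfl

variable {U : Type*} [NormedField U] [IsUltrametricDist U] {E : Type*} [Field E]
open LocalUnif in
theorem unif_of (e : E →+* U) (Q : ValuationSubring E) (hQ : ∀ x, x ∈ Q ↔ ‖e x‖ ≤ 1) (𝓚' : Subfield E) {𝓚 G : Subfield U} (h𝓚 : 𝓚'.map e = 𝓚) (hG : ∀ a, a ∈ G ↔ ∃ x, e x = a)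
    (h𝓚1 : ∀ x ∈ 𝓚, ‖x‖ ≤ 1)
    (T : Finset U) (hT : AlgebraicIndependent 𝓚 (fun i => (T.equivFin.symm i : U))) (ha : ∀ a, a ∈ acl (ad 𝓚 T)) (hT1 : ∀ t ∈ T, ‖t‖ ≤ 1 ∧ t ∈ G)
    {n : ℕ} {η : ℕ → U} (hTD : TD ((𝓚 : Set U) ∪ T) G n η) (hcl : Subfield.closure ((𝓚 : Set U) ∪ T ∪ η '' Iio n) = G)
    {m : ℕ} (ζ : Fin m → E) (hζ : ∀ k, ∃ i < n, η i = e (ζ k)) : UnifWrt ⊤ 𝓚' Q ζ := by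
  subst h𝓚
  have hT2 : ∀ i, ∃ t : E, e t = (T.equivFin.symm i : U) := fun i => (hG _).1 (hT1 _ (T.equivFin.symm i).2).2
  choose t ht using hT2
  choose η' hη' using fun i : Fin n => (hG _).1 (hTD i i.2).1
  choose σ hσ hσ' using hζ
  have hrt : e '' range t = T := by
    ext a; constructor
    · rintro ⟨_, ⟨i, rfl⟩, rfl⟩; rw [ht]; exact (T.equivFin.symm i).2
    · exact fun h => ⟨_, ⟨T.equivFin ⟨a, h⟩, rfl⟩, by rw [ht]; simp⟩
  have hrη : e '' range η' = η '' Iio n := by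
    ext a; constructor
    · rintro ⟨_, ⟨i, rfl⟩, rfl⟩; exact ⟨i, i.2, (hη' i).symm⟩
    · rintro ⟨i, hi, rfl⟩; exact ⟨_, ⟨⟨i, hi⟩, rfl⟩, hη' _⟩
  have hkQ : ∀ x ∈ 𝓚', x ∈ Q := fun x hx => (hQ x).2 (h𝓚1 _ ⟨x, hx, rfl⟩)
  set R' : Subring E := Subring.closure ((↑(𝓚'.toSubring ⊓ Q.toSubring) : Set E) ∪ range t) with hR'
  have e1 : (↑(𝓚'.toSubring ⊓ Q.toSubring) : Set E) = 𝓚' := by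
    ext x; exact ⟨fun h => h.1, fun h => ⟨h, hkQ x h⟩⟩
  have hR : ∀ i, Wc (((𝓚'.map e : Subfield U) : Set U) ∪ T) η i ≤ Wc (R'.map e : Set U) η i := fun i =>
    Subring.closure_mono (union_subset_union_left _ (by
      rw [hR', e1, RingHom.map_closure, image_union, hrt]; exact Subring.subset_closure))
  have key : ∀ i : Fin n, ∃ f : MvPolynomial (Fin n) E, (∀ m, f.coeff m ∈ R') ∧ (∀ j : Fin n, i < j → j ∉ f.vars) ∧ MvPolynomial.eval η' f = 0 ∧
      ‖e (MvPolynomial.eval η' (MvPolynomial.pderiv i f))‖ = 1 := fun i => by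
    obtain ⟨-, -, g, hg, h0, hd⟩ := hTD i i.2
    obtain ⟨f, hf, hf0, hfd⟩ := poly_ex2 (R'.map e) η n i fun j => hR i (hg j)
    have hlift : ∀ a : R'.map e, ∃ b ∈ R', e b = a := fun a => a.2
    choose φ hφ hφ' using hlift
    let ψ : R'.map e →+* E :=
      { toFun := φ
        map_one' := e.injective (by rw [hφ', map_one]; rfl)
        map_zero' := e.injective (by rw [hφ', map_zero]; rfl)
        map_mul' := fun a b => e.injective (by rw [hφ', map_mul, hφ', hφ']; rfl)
        map_add' := fun a b => e.injective (by rw [hφ', map_add, hφ', hφ']; rfl) }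
    have hev : ∀ f, e (MvPolynomial.eval η' (MvPolynomial.map ψ f)) = MvPolynomial.aeval (fun j : Fin n => η j) f := fun f => by
      rw [MvPolynomial.eval_map, MvPolynomial.hom_eval₂, MvPolynomial.aeval_def]
      congr 1
      · ext a; exact hφ' a
      · ext j; exact hη' j
    refine ⟨MvPolynomial.map ψ f, fun m => ?_, fun j hj h => ?_, e.injective ?_, ?_⟩
    · rw [MvPolynomial.coeff_map]; exact hφ _
    · have := MvPolynomial.mem_supported.1 hf (MvPolynomial.vars_map f ψ h)
      exact absurd hj (not_lt.2 this)
    · rw [hev, hf0, h0, map_zero]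
    · rw [MvPolynomial.pderiv_map, hev, hfd, hd]
  choose f f1 f2 f3 f4 using key
  refine ⟨_, n, t, η', ⟨fun i => ⟨trivial, (hQ _).2 ?_⟩, fun i => ⟨trivial, (hQ _).2 ?_⟩, ind_e e 𝓚' ?_, fun z _ => ?_, ?_, f, f1, fun i j hij => ?_, f3, ?_⟩, fun k => ⟨σ k, hσ k⟩, fun k => e.injective ?_⟩
  · rw [ht]; exact (hT1 _ (T.equivFin.symm i).2).1
  · rw [hη']; exact (hTD i i.2).2.1
  · simp only [ht]; exact hT
  · have h2 : (ad 𝓚' (range t)).map e = ad (𝓚'.map e) T := by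
      rw [ad, map_field_closure, image_union, hrt]; rfl
    have h3 : IsAlgebraic (ad 𝓚' (range t)) z := alg_e e _ (by rw [h2]; exact mem_acl.1 (ha _))
    rw [← adj_ad] at h3; exact h3
  · refine top_unique fun z _ => ?_
    have hz : e z ∈ G := (hG _).2 ⟨z, rfl⟩
    rw [← hcl, ← hrt, ← hrη, Subfield.coe_map, ← image_union, ← image_union, ← map_field_closure] at hz
    obtain ⟨w, hw, hw'⟩ := hz
    exact e.injective hw' ▸ hw
  · classical
    rw [MvPolynomial.degreeOf_def, Multiset.count_eq_zero]
    intro h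
    exact f2 i j hij (by rw [MvPolynomial.vars_def]; exact Multiset.mem_toFinset.2 h)
  · rw [Matrix.det_of_lowerTriangular]
    swap
    · intro i j hij
      rw [Matrix.of_apply, MvPolynomial.pderiv_eq_zero_of_notMem_vars (f2 i j (by simpa using hij)), map_zero]
    have hn : ‖e (∏ i, MvPolynomial.eval η' (MvPolynomial.pderiv i (f i)))‖ = 1 := by
      rw [map_prod, norm_prod]; exact Finset.prod_eq_one fun i _ => f4 i
    refine ⟨fun h => ?_, (hQ _).2 hn.le, (hQ _).2 ?_⟩
    · have h' : (∏ i, MvPolynomial.eval η' (MvPolynomial.pderiv i (f i))) = 0 := h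
      rw [h', map_zero, norm_zero] at hn; exact zero_ne_one hn
    · rw [map_inv₀, norm_inv]; exact (inv_eq_one.2 hn).le
  · rw [hη']; exact hσ' k
end UD

section Nm

theorem ultra_compl {U : Type*} [NormedField U] [IsUltrametricDist U] : IsUltrametricDist (Completion U) :=
  IsUltrametricDist.isUltrametricDist_of_forall_norm_natCast_le_one fun n => by
    have h : ((n : U) : Completion U) = n := map_natCast Completion.coeRingHom n
    rw [← h, Completion.norm_coe]; exact norm_natCast_le_one U n

@[reducible] noncomputable def nnf {U : Type*} [i : NormedField U] {ϖ : U} (h0 : ϖ ≠ 0) (h1 : ‖ϖ‖ < 1) : NontriviallyNormedField U :=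
  { i with non_trivial := ⟨ϖ⁻¹, by rw [norm_inv]; exact (one_lt_inv₀ (norm_pos_iff.2 h0)).2 h1⟩ }

theorem ext_norm {F : Type*} [NormedField F] [IsUltrametricDist F] {ϖ : F} (h0 : ϖ ≠ 0) (h1 : ‖ϖ‖ < 1) :
    ∃ v : AbsoluteValue (AlgebraicClosure F) ℝ, IsNonarchimedean v ∧ ∀ x : F, v (algebraMap F _ x) = ‖x‖ := by
  let C := Completion F
  have hc : ∀ x : F, ‖(x : C)‖ = ‖x‖ := Completion.norm_coe
  have hu : IsUltrametricDist C := ultra_compl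
  letI : NontriviallyNormedField C := nnf (ϖ := (ϖ : C)) (by rw [← norm_pos_iff, hc, norm_pos_iff]; exact h0) (by rw [hc]; exact h1)
  haveI : IsUltrametricDist C := hu
  let φ : F →+* AlgebraicClosure C := (algebraMap C (AlgebraicClosure C)).comp Completion.coeRingHom
  letI : Algebra F (AlgebraicClosure C) := φ.toAlgebra
  let ψ : AlgebraicClosure F →ₐ[F] AlgebraicClosure C := IsAlgClosed.lift
  let w := spectralMulAlgNorm C (AlgebraicClosure C)
  have hw : IsNonarchimedean w := isNonarchimedean_spectralNorm
  refine ⟨{ toFun := fun x => w (ψ x), map_mul' := fun x y => by simp, nonneg' := fun x => apply_nonneg w _, eq_zero' := fun x => ?_, add_le' := fun x y => ?_ }, fun x y => ?_, fun x => ?_⟩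
  · rw [map_eq_zero_iff_eq_zero, map_eq_zero_iff ψ ψ.injective]
  · simp only [map_add]; exact map_add_le_add w _ _
  · change w (ψ (x + y)) ≤ _; rw [map_add]; exact hw _ _
  · change w (ψ (algebraMap F _ x)) = _
    rw [ψ.commutes]
    exact (spectralNorm_extends (x : C)).trans (hc x)

open LocalUnif in
theorem ex_norm {F : Type*} [Field F] (O : ValuationSubring F) (hO : RankOne O) :
    ∃ v : AbsoluteValue (AlgebraicClosure F) ℝ, IsNonarchimedean v ∧ (∀ x : F, v (algebraMap F _ x) ≤ 1 ↔ x ∈ O) ∧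
      ((∀ x, x ≠ 0 → v x = 1) ∨ ∃ ϖ : F, ϖ ≠ 0 ∧ v (algebraMap F _ ϖ) < 1) := by
  classical
  by_cases hT : ∀ x, x ∈ O
  · refine ⟨AbsoluteValue.trivial, fun x y => ?_, fun x => ⟨fun _ => hT x, fun _ => ?_⟩, Or.inl fun x hx => trivial_apply hx⟩
    · by_cases hx : x = 0
      · simp [hx]
      by_cases hxy : x + y = 0
      · rw [hxy, map_zero]; exact le_max_of_le_left (apply_nonneg _ _)
      · rw [trivial_apply hx, trivial_apply hxy]; exact le_max_left _ _
    · by_cases hx : algebraMap F (AlgebraicClosure F) x = 0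
      · rw [hx, map_zero]; exact zero_le_one
      · rw [trivial_apply hx]
  push Not at hT
  obtain ⟨b, hb⟩ := hT
  have hb0 : b ≠ 0 := fun h => hb (h ▸ zero_mem O)
  haveI : MulArchimedean O.ValueGroup := ⟨fun x {y} hy => by
    obtain ⟨a, rfl⟩ := O.valuation_surjective x
    obtain ⟨c, rfl⟩ := O.valuation_surjective y
    rcases le_or_gt (O.valuation a) 1 with h | h
    · exact ⟨0, by simpa using h⟩
    · have ha0 : a ≠ 0 := by rintro rfl; simp at h
      have hc0 : c ≠ 0 := by rintro rfl; simp at hy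
      obtain ⟨n, hn⟩ := hO c⁻¹ a⁻¹ (inv_ne_zero hc0) (Or.inr (by rw [inv_inv, ← O.valuation_le_one_iff]; exact not_le.2 hy)) (inv_ne_zero ha0)
        (Or.inr (by rw [inv_inv, ← O.valuation_le_one_iff]; exact not_le.2 h))
      refine ⟨n, ?_⟩
      rw [← O.valuation_le_one_iff, div_inv_eq_mul, inv_pow, map_mul, map_inv₀, map_pow, ← div_eq_inv_mul] at hn
      exact (div_le_one₀ (pow_pos (lt_trans zero_lt_one hy) n)).1 hn⟩
  haveI : O.valuation.IsNontrivial := ⟨b, by simpa using hb0, fun h => hb ((O.valuation_le_one_iff b).1 h.le)⟩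
  haveI : MulArchimedean (MonoidWithZeroHom.ValueGroup₀ (.ofClass O.valuation)) :=
    MulArchimedean.comap MonoidWithZeroHom.ValueGroup₀.embedding.toMonoidHom MonoidWithZeroHom.ValueGroup₀.embedding_strictMono
  obtain ⟨hR⟩ := (Valuation.nonempty_rankOne_iff_mulArchimedean (v := O.valuation)).2 inferInstance
  letI : Valued F O.ValueGroup := Valued.mk' O.valuation
  haveI : Valuation.RankOne (Valued.v : Valuation F O.ValueGroup) := hR
  letI : NormedField F := Valued.toNormedField F O.ValueGroup
  have h1 : ∀ x : F, ‖x‖ ≤ 1 ↔ x ∈ O := fun x => Valued.toNormedField.norm_le_one_iff.trans (O.valuation_le_one_iff x)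
  haveI : IsUltrametricDist F := IsUltrametricDist.isUltrametricDist_of_forall_norm_natCast_le_one fun n => (h1 _).2 (natCast_mem O n)
  have h2 : ‖b⁻¹‖ < 1 := by rw [norm_inv]; exact inv_lt_one_of_one_lt₀ (not_le.1 fun h => hb ((h1 b).1 h))
  obtain ⟨v, hv, hv'⟩ := ext_norm (inv_ne_zero hb0) h2
  exact ⟨v, hv, fun x => by rw [hv']; exact h1 x, Or.inr ⟨b⁻¹, inv_ne_zero hb0, by rw [hv']; exact h2⟩⟩

end Nm

section Asm
variable {F U : Type*} [Field F] [NormedField U] [IsUltrametricDist U] [IsAlgClosed U]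

theorem concl_all {K0 : Subfield U} {S0 B : Finset U} {d : ℕ} (ht : Tr K0) (hU : ∀ a, a ∈ acl (ad K0 S0))
    (hd : Algebra.trdeg K0 U = d) (hB1 : ∀ b ∈ B, ‖b‖ ≤ 1) (hB : (B : Set U) ⊆ ad K0 S0)
    (hc : (∀ x : U, x ≠ 0 → ‖x‖ = 1) ∨ ∃ ϖ ∈ ad K0 S0, ϖ ≠ 0 ∧ ‖ϖ‖ < 1) : Concl (pc K0) (ad (pc K0) S0) d B := by
  haveI : PerfectField (pc K0) := inferInstanceAs (PerfectField (perfectClosure K0 U))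
  have hm : ad K0 S0 ≤ ad (pc K0) S0 := ad_mono (le_pc _) subset_rfl
  have ht' : ∀ c ∈ pc K0, c ≠ 0 → ‖c‖ = 1 := fun c hc => triv_alg ht c (pc_acl _ hc)
  have hU' : ∀ a, a ∈ acl (ad (pc K0) (S0 : Set U)) := fun a => acl_mono hm (hU a)
  have hd' : Algebra.trdeg (pc K0) U = d := (trd (le_pc _) (pc_acl _)).symm.trans hd
  have hB' : (B : Set U) ⊆ ad (pc K0) S0 := hB.trans hm
  rcases hc with h | ⟨ϖ, hϖ, h0, h1⟩
  · exact concl_triv S0 rfl hd' h hU' B hB'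
  let C := Completion U
  have hι : ∀ x : U, ‖(x : C)‖ = ‖x‖ := Completion.norm_coe
  have hu : IsUltrametricDist C := ultra_compl
  have hcs : CompleteSpace C := inferInstance
  letI : NontriviallyNormedField C := nnf (ϖ := (ϖ : C)) (by rw [← norm_pos_iff, hι, norm_pos_iff]; exact h0) (by rw [hι]; exact h1)
  haveI : IsUltrametricDist C := hu
  haveI : CompleteSpace C := hcs
  let ι : U →+* C := Completion.coeRingHom
  have hdn : ∀ c : C, ∀ ε > 0, ∃ a : U, ‖c - ι a‖ < ε := fun c ε hε => by
    obtain ⟨a, ha⟩ := (Completion.denseRange_coe (α := U)).exists_dist_lt c hε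
    exact ⟨a, by rw [← dist_eq_norm]; exact ha⟩
  obtain ⟨p, hp⟩ := ExpChar.exists U
  rcases id hp with h | h
  · exact concl_0 (ι := ι) hι hdn hd' ht' hU' (le_ad _ _) h0 h1 B hB' hB1
  · exact concl_p (ι := ι) p (Nat.Prime.two_le ‹_›) (CharP.cast_eq_zero U p) hι hdn S0 rfl hd' ht' hU' (hm hϖ) h0 h1 B hB' hB1

variable [Algebra F U] [Algebra.IsAlgebraic F U]
theorem exFin2 (K : Subfield F) (S : Finset F) (hS : adjoin K (S : Set F) = ⊤) (hK : ∀ x ∈ K, x ≠ 0 → ‖algebraMap F U x‖ = 1)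
    (hc : (∀ x : U, x ≠ 0 → ‖x‖ = 1) ∨ ∃ ϖ : F, ϖ ≠ 0 ∧ ‖algebraMap F U ϖ‖ < 1) {m : ℕ} (ζ : Fin m → F) (hζ : ∀ k, ‖algebraMap F U (ζ k)‖ ≤ 1) :
    ∃ S0 B : Finset U, (∀ k, algebraMap F U (ζ k) ∈ B) ∧ (∀ a, a ∈ ad (K.map (algebraMap F U)) (S0 : Set U) ↔ ∃ x, algebraMap F U x = a) ∧
      (∀ a, a ∈ acl (ad (K.map (algebraMap F U)) (S0 : Set U))) ∧ (∀ c ∈ K.map (algebraMap F U), c ≠ 0 → ‖c‖ = 1) ∧ Fin2 (K.map (algebraMap F U)) S0 B := by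
  classical
  set φ := algebraMap F U
  have hr : ∀ a, a ∈ ad (K.map φ) ((S.image φ : Finset U) : Set U) ↔ ∃ x, φ x = a := by
    have e1 : Subfield.closure ((K : Set F) ∪ S) = ⊤ := by
      have := adj_ad K (S : Set F)
      rw [hS] at this; exact this.symm
    have e2 : ad (K.map φ) ((S.image φ : Finset U) : Set U) = φ.fieldRange := by
      rw [RingHom.fieldRange_eq_map, ← e1, map_field_closure, ad, image_union, coe_image]; rfl
    intro a; rw [e2]; rfl
  have ht : ∀ c ∈ K.map φ, c ≠ 0 → ‖c‖ = 1 := by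
    rintro _ ⟨x, hx, rfl⟩ h
    exact hK x hx fun h' => h (by rw [h']; exact map_zero φ)
  have hU : ∀ a, a ∈ acl (ad (K.map φ) ((S.image φ : Finset U) : Set U)) := fun a => by
    rw [mem_acl]
    let f : F →+* ad (K.map φ) ((S.image φ : Finset U) : Set U) := φ.codRestrict _ fun x => (hr _).2 ⟨x, rfl⟩
    exact (Algebra.IsAlgebraic.isAlgebraic (R := F) a).ringHom_of_comp_eq f (RingHom.id U) f.injective rfl
  have hd : Algebra.trdeg (K.map φ) U < Cardinal.aleph0 := by
    haveI : Algebra.IsAlgebraic (Algebra.adjoin (K.map φ) ((S.image φ : Finset U) : Set U)) U := ⟨fun a => (ad_iff _ _ a).1 (hU a)⟩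
    exact (Algebra.IsAlgebraic.trdeg_le_cardinalMk _ ((S.image φ : Finset U) : Set U)).trans_lt (Cardinal.lt_aleph0_of_finite _)
  obtain ⟨d, hd⟩ := Cardinal.lt_aleph0.1 hd
  set B : Finset U := univ.image (fun k => φ (ζ k)) ∪ (S.image φ).image fun s => if ‖s‖ ≤ 1 then s else s⁻¹ with hBd
  have hB : ∀ b ∈ B, ‖b‖ ≤ 1 ∧ b ∈ ad (K.map φ) ((S.image φ : Finset U) : Set U) := by
    intro b hb
    rcases mem_union.1 hb with h | h
    · obtain ⟨k, -, rfl⟩ := mem_image.1 h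
      exact ⟨hζ k, (hr _).2 ⟨_, rfl⟩⟩
    · obtain ⟨s, hs, rfl⟩ := mem_image.1 h
      have hs' : s ∈ ad (K.map φ) ((S.image φ : Finset U) : Set U) := sub_ad _ _ hs
      split_ifs with h1
      · exact ⟨h1, hs'⟩
      · exact ⟨by rw [norm_inv]; exact inv_le_one_of_one_le₀ (not_le.1 h1).le, inv_mem hs'⟩
  refine ⟨S.image φ, B, fun k => mem_union_left _ (mem_image.2 ⟨k, by simp, rfl⟩), hr, hU, ht, fin2 ht hU hd (fun b hb => (hB b hb).1) (fun s hs => ?_)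
    (concl_all ht hU hd (fun b hb => (hB b hb).1) (fun b hb => (hB b hb).2) (hc.imp_right ?_))⟩
  · have : (if ‖s‖ ≤ 1 then s else s⁻¹) ∈ B := mem_union_right _ (mem_image.2 ⟨s, hs, rfl⟩)
    split_ifs at this with h
    · exact Or.inl this
    · exact Or.inr this
  · rintro ⟨ϖ, h0, h1⟩
    exact ⟨φ ϖ, (hr _).2 ⟨_, rfl⟩, fun h => h0 (φ.injective (h.trans (map_zero φ).symm)), h1⟩
end Asm

section Gal
variable {D X U : Type*} [Field D] [Field X] [Algebra D X] [Field U] (e : X →+* U) {A : Subfield U} (hA : ∀ a, a ∈ A ↔ ∃ x : D, e (algebraMap D X x) = a)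
include hA
theorem alg_D [Algebra D U] (h : ∀ x, algebraMap D U x = e (algebraMap D X x)) {a : U} (ha : a ∈ acl A) : IsAlgebraic D a := by
  let f : D →+* A := (e.comp (algebraMap D X)).codRestrict A fun x => (hA _).2 ⟨x, rfl⟩
  refine (mem_acl.1 ha).of_ringHom_of_comp_eq f (RingHom.id U) ?_ (RingHom.id U).injective (RingHom.ext fun x => (h x).symm)
  rintro ⟨a, ha⟩
  obtain ⟨x, rfl⟩ := (hA a).1 ha
  exact ⟨x, rfl⟩
theorem sep_D [Algebra D U] (h : ∀ x, algebraMap D U x = e (algebraMap D X x)) {a : U} (ha : a ∈ sc A) : IsSeparable D a := by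
  let f : D →+* A := (e.comp (algebraMap D X)).codRestrict A fun x => (hA _).2 ⟨x, rfl⟩
  letI : Algebra D A := f.toAlgebra
  haveI : IsScalarTower D A U := .of_algebraMap_eq h
  haveI : Algebra.IsSeparable D A := ⟨fun a => by
    obtain ⟨x, hx⟩ := (hA a).1 a.2
    rw [show a = algebraMap D A x from Subtype.ext hx.symm]; exact isSeparable_algebraMap _⟩
  exact IsSeparable.of_algebra_isSeparable_of_isSeparable D (mem_sc.1 ha)
theorem adj_D [Algebra D U] (h : ∀ x, algebraMap D U x = e (algebraMap D X x)) (S : Set U) (a : U) : a ∈ adjoin D S ↔ a ∈ ad A S := by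
  rw [← IntermediateField.mem_toSubfield, IntermediateField.adjoin_toSubfield, ad]
  have : range (algebraMap D U) = A := by
    ext a; exact ⟨fun ⟨x, hx⟩ => (hA a).2 ⟨x, (h x).symm.trans hx⟩, fun ha => ((hA a).1 ha).imp fun x hx => (h x).trans hx⟩
  rw [this]

theorem fd_D (S : Finset U) (hS : ∀ s ∈ S, s ∈ acl A) (hX : ∀ x, e x ∈ ad A S) : FiniteDimensional D X := by
  letI : Algebra D U := (e.comp (algebraMap D X)).toAlgebra
  let E : X →ₐ[D] U := { e with commutes' := fun x => rfl }
  haveI : FiniteDimensional D (adjoin D (S : Set U)) :=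
    IntermediateField.finiteDimensional_adjoin fun s hs => (alg_D e hA (fun _ => rfl) (hS s hs)).isIntegral
  let g : X →ₗ[D] adjoin D (S : Set U) := E.toLinearMap.codRestrict (adjoin D (S : Set U)).toSubalgebra.toSubmodule
    fun x => (adj_D e hA (fun _ => rfl) _ _).2 (hX x)
  exact FiniteDimensional.of_injective g fun x y hxy => e.injective (congrArg Subtype.val hxy)

theorem gal_D [IsAlgClosed U] (hU : ∀ a, a ∈ acl A) (G : Finset U) (hG : (G : Set U) ⊆ sc A) (hs : ∀ σ : U ≃+* U, (∀ a ∈ A, σ a = a) → ∀ g ∈ G, σ g ∈ G)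
    (hX : ∀ a, a ∈ ad A G ↔ ∃ x, e x = a) : IsGalois D X := by
  letI : Algebra D U := (e.comp (algebraMap D X)).toAlgebra
  let E : X →ₐ[D] U := { e with commutes' := fun x => rfl }
  haveI : Algebra.IsAlgebraic D U := ⟨fun a => alg_D e hA (fun _ => rfl) (hU a)⟩
  haveI : IsAlgClosure D U := ⟨inferInstance, inferInstance⟩
  haveI : Normal D U := IsAlgClosure.normal D U
  let E' : X ≃ₐ[D] E.fieldRange := AlgEquiv.ofInjectiveField E
  have hr : E.fieldRange = adjoin D (G : Set U) := by
    ext a; rw [adj_D e hA (fun _ => rfl), hX]; rfl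
  haveI : Normal D E.fieldRange := by
    rw [IntermediateField.normal_iff_forall_map_le', hr]
    intro σ
    rw [IntermediateField.adjoin_map]
    refine adjoin.mono D _ _ ?_
    rintro _ ⟨g, hg, rfl⟩
    refine hs (σ : U ≃+* U) (fun a ha => ?_) g hg
    obtain ⟨x, rfl⟩ := (hA a).1 ha
    exact σ.commutes x
  haveI : Normal D X := Normal.of_algEquiv E'.symm
  haveI : Algebra.IsSeparable D E.fieldRange := by
    rw [hr, IntermediateField.isSeparable_adjoin_iff_isSeparable]
    exact fun g hg => sep_D e hA (fun _ => rfl) (hG hg)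
  haveI : Algebra.IsSeparable D X := Algebra.IsSeparable.of_equiv_equiv (RingEquiv.refl D) E'.symm.toRingEquiv (by
    ext x; simpa using (E'.symm.commutes x).symm)
  exact ⟨⟩
end Gal

section Fin
def vr (U : Type*) [NormedField U] [IsUltrametricDist U] : ValuationSubring U where
  carrier := {x | ‖x‖ ≤ 1}
  mul_mem' {x y} hx hy := show ‖x * y‖ ≤ 1 by rw [norm_mul]; exact mul_le_one₀ hx (norm_nonneg _) hy
  one_mem' := norm_one.le
  add_mem' hx hy := um_le hx hy
  zero_mem' := by simp
  neg_mem' {x} hx := by simpa using hx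
  mem_or_inv_mem' x := by
    rcases le_total ‖x‖ 1 with h | h
    · exact Or.inl h
    · right; change ‖x⁻¹‖ ≤ 1; rw [norm_inv]; exact inv_le_one_of_one_le₀ h

set_option synthInstance.maxHeartbeats 400000 in
set_option maxHeartbeats 1000000 in
open LocalUnif in
theorem asm {F U : Type*} [Field F] [NormedField U] [IsUltrametricDist U] [IsAlgClosed U] [Algebra F U] [Algebra.IsAlgebraic F U]
    (K : Subfield F) (O : ValuationSubring F) (S : Finset F) (hS : adjoin K (S : Set F) = ⊤) (htriv : TrivialOn O K)
    (hO : ∀ x : F, ‖algebraMap F U x‖ ≤ 1 ↔ x ∈ O)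
    (hc : (∀ x : U, x ≠ 0 → ‖x‖ = 1) ∨ ∃ ϖ : F, ϖ ≠ 0 ∧ ‖algebraMap F U ϖ‖ < 1) (m : ℕ) (ζ : Fin m → F) (hζ : ∀ k, ζ k ∈ O) :
    ∃ (𝓕 : IntermediateField F U) (Q : ValuationSubring ↥𝓕)
      (𝓚 : Subfield ↥𝓕),
      FiniteDimensional F ↥𝓕 ∧
      Q.comap (algebraMap F ↥𝓕) = O ∧
      (∃ hle : K.map (algebraMap F ↥𝓕) ≤ 𝓚,
        (letI : Algebra ↥(K.map (algebraMap F ↥𝓕)) ↥𝓚 := (inclusion hle).toAlgebra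
         FiniteDimensional ↥(K.map (algebraMap F ↥𝓕)) ↥𝓚) ∧
        ∀ x ∈ 𝓚, ∃ nn : ℕ, x ^ ringExpChar F ^ nn ∈ K.map (algebraMap F ↥𝓕)) ∧
      (∃ (L : Subfield ↥𝓕) (hle : (algebraMap F ↥𝓕).fieldRange ⊔ 𝓚 ≤ L),
        (letI : Algebra ↥((algebraMap F ↥𝓕).fieldRange ⊔ 𝓚) ↥L :=
          (inclusion hle).toAlgebra
         IsGalois ↥((algebraMap F ↥𝓕).fieldRange ⊔ 𝓚) ↥L) ∧
        IsGalois ↥L ↥𝓕) ∧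
      UnifWrt (F := ↥𝓕) ⊤ 𝓚 Q (fun k => algebraMap F ↥𝓕 (ζ k)) := by
  classical
  have hK : ∀ x ∈ K, x ≠ 0 → ‖algebraMap F U x‖ = 1 := fun x hx h0 => by
    refine le_antisymm ((hO x).2 (htriv x hx).1) ?_
    have := (hO x⁻¹).2 (htriv x hx).2
    rw [map_inv₀, norm_inv] at this
    exact (inv_le_one₀ (norm_pos_iff.2 ((_root_.map_ne_zero _).2 h0))).1 this
  obtain ⟨S0, B, hζB, hr, hU, ht, A, T, G1, G2, 𝓚, M, G, n, η, hA, h𝓚, hM, hG, g1, g2, g3, g4, hT, ha, hT1, hTD, hBη, hcl⟩ :=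
    exFin2 (U := U) K S hS hK hc ζ fun k => (hO _).2 (hζ k)
  set K0 := K.map (algebraMap F U) with hK0
  set N := ad K0 S0 with hN
  have hK𝓚 : K0 ≤ 𝓚 := h𝓚 ▸ le_ad _ _
  have h𝓚p : 𝓚 ≤ pc K0 := h𝓚 ▸ ad_le (le_pc _) hA
  have h𝓚M : 𝓚 ≤ M := hM ▸ le_ad _ _
  have hNM : N ≤ M := hM ▸ ad_mono hK𝓚 subset_rfl
  have hM1 : M ≤ ad M G1 := le_ad _ _
  have h1G : ad M G1 ≤ G := hG ▸ le_ad _ _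
  have hMG := hM1.trans h1G
  have hUM : ∀ a, a ∈ acl M := fun a => acl_mono hNM (hU a)
  have hφ : ∀ x, algebraMap F U x ∈ N := fun x => (hr _).2 ⟨x, rfl⟩
  let 𝓕 : IntermediateField F U := G.toIntermediateField fun x => hMG (hNM (hφ x))
  let e : 𝓕 →+* U := (𝓕.val : 𝓕 →ₐ[F] U).toRingHom
  have he : ∀ a, a ∈ G ↔ ∃ x : 𝓕, e x = a := fun a => ⟨fun h => ⟨⟨a, h⟩, rfl⟩, fun ⟨x, hx⟩ => hx ▸ x.2⟩
  have heφ : ∀ x : F, e (algebraMap F 𝓕 x) = algebraMap F U x := fun x => rfl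
  let V := vr U
  let 𝓚' : Subfield 𝓕 := 𝓚.comap e
  have hmap : 𝓚'.map e = 𝓚 := by
    ext a
    constructor
    · rintro ⟨x, hx, rfl⟩; exact hx
    · exact fun h => ⟨⟨a, hMG (h𝓚M h)⟩, h, rfl⟩
  have hle : K.map (algebraMap F 𝓕) ≤ 𝓚' := by
    rintro _ ⟨x, hx, rfl⟩; exact hK𝓚 ⟨x, hx, rfl⟩
  let L : Subfield 𝓕 := (ad M G1).comap e
  have hle2 : (algebraMap F 𝓕).fieldRange ⊔ 𝓚' ≤ L := by
    refine sup_le ?_ fun x hx => hM1 (h𝓚M hx)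
    rintro _ ⟨x, rfl⟩; exact hM1 (hNM (hφ x))
  have hK0m : ∀ a, a ∈ K0 ↔ ∃ x : K.map (algebraMap F 𝓕), e x = a := fun a =>
    ⟨fun ⟨x, hx, hxa⟩ => ⟨⟨algebraMap F 𝓕 x, x, hx, rfl⟩, hxa⟩, by rintro ⟨⟨_, x, hx, rfl⟩, rfl⟩; exact ⟨x, hx, rfl⟩⟩
  have hD : ((algebraMap F 𝓕).fieldRange ⊔ 𝓚').map e = M := by
    rw [Subfield.map_sup, hmap]
    refine le_antisymm (sup_le ?_ h𝓚M) ?_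
    · rintro _ ⟨_, ⟨x, rfl⟩, rfl⟩; exact hNM (hφ x)
    · rw [hM]
      refine ad_le le_sup_right fun s hs => le_sup_left (a := (algebraMap F 𝓕).fieldRange.map e) ?_
      have h : s ∈ N := sub_ad _ _ hs
      obtain ⟨x, rfl⟩ := (hr s).1 h
      exact ⟨_, ⟨x, rfl⟩, rfl⟩
  have hDm : ∀ a, a ∈ M ↔ ∃ x : ↥((algebraMap F 𝓕).fieldRange ⊔ 𝓚'), e x = a := fun a => by
    rw [← hD]
    constructor
    · rintro ⟨x, hx, rfl⟩; exact ⟨⟨x, hx⟩, rfl⟩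
    · rintro ⟨x, rfl⟩; exact ⟨x, x.2, rfl⟩
  have hLm : ∀ a, a ∈ ad M G1 ↔ ∃ x : L, e x = a := fun a =>
    ⟨fun h => ⟨⟨⟨a, h1G h⟩, h⟩, rfl⟩, fun ⟨x, hxa⟩ => hxa ▸ x.2⟩
  refine ⟨𝓕, V.comap e, 𝓚', ?_, ?_, ⟨hle, ?_, ?_⟩, ⟨L, hle2, ?_, ?_⟩, ?_⟩
  · refine fd_D e (A := N) hr (A ∪ S0 ∪ (G1 ∪ G2)) (fun s _ => hU s) fun x => ?_
    have hx : e x ∈ G := x.2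
    refine SetLike.le_def.1 ?_ hx
    rw [hG, hM, h𝓚]
    have hs : ((A ∪ S0 ∪ (G1 ∪ G2) : Finset U) : Set U) ⊆ ad N ((A ∪ S0 ∪ (G1 ∪ G2) : Finset U) : Set U) := sub_ad _ _
    simp only [coe_union, Set.union_subset_iff] at hs ⊢
    exact ad_le (ad_le (ad_le (ad_le ((le_ad _ _).trans (le_ad _ _)) hs.1.1) hs.1.2) hs.2.1) hs.2.2
  · ext x; exact hO x
  · letI : Algebra ↥(K.map (algebraMap F ↥𝓕)) ↥𝓚' := (inclusion hle).toAlgebra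
    exact fd_D (D := K.map (algebraMap F 𝓕)) (e.comp 𝓚'.subtype) hK0m A (fun s hs => pc_acl _ (hA hs)) fun x => h𝓚 ▸ x.2
  · intro x hx
    haveI : ExpChar U (ringExpChar F) := expChar_of_injective_algebraMap (algebraMap F U).injective _
    obtain ⟨j, y, hy, hyx⟩ := (mem_pc (ringExpChar F)).1 (h𝓚p hx)
    exact ⟨j, y, hy, e.injective (hyx.trans (map_pow e x _).symm)⟩
  · letI : Algebra ↥((algebraMap F ↥𝓕).fieldRange ⊔ 𝓚') ↥L := (inclusion hle2).toAlgebra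
    exact gal_D (D := ↥((algebraMap F ↥𝓕).fieldRange ⊔ 𝓚')) (e.comp L.subtype) hDm hUM G1 g1 g2 hLm
  · exact gal_D (D := L) e hLm (fun a => acl_mono hM1 (hUM a)) G2 g3 g4 fun a => by rw [← hG]; exact he a
  · refine unif_of e _ (fun x => Iff.rfl) 𝓚' hmap he (fun x hx => ?_) T hT ha hT1 hTD hcl _ fun k => hBη _ (hζB k)
    by_cases h : x = 0
    · simp [h]
    · exact (triv_alg ht x (pc_acl _ (h𝓚p hx)) h).le
end Fin
end LU

set_option synthInstance.maxHeartbeats 400000 in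
set_option maxHeartbeats 1000000 in
open LocalUnif in
theorem statement_4
    (F : Type*) [Field F] (K : Subfield F) (O : ValuationSubring F)
    (hff : IsFunctionField K) (htriv : TrivialOn O K)
    (hrk1 : RankOne O)
    (m : ℕ) (ζ : Fin m → F) (hζ : ∀ k, ζ k ∈ O) :
    ∃ (𝓕 : IntermediateField F (AlgebraicClosure F)) (Q : ValuationSubring ↥𝓕)
      (𝓚 : Subfield ↥𝓕),
      FiniteDimensional F ↥𝓕 ∧
      Q.comap (algebraMap F ↥𝓕) = O ∧
      (∃ hle : K.map (algebraMap F ↥𝓕) ≤ 𝓚,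
        (letI : Algebra ↥(K.map (algebraMap F ↥𝓕)) ↥𝓚 := (Subfield.inclusion hle).toAlgebra
         FiniteDimensional ↥(K.map (algebraMap F ↥𝓕)) ↥𝓚) ∧
        ∀ x ∈ 𝓚, ∃ nn : ℕ, x ^ ringExpChar F ^ nn ∈ K.map (algebraMap F ↥𝓕)) ∧
      (∃ (L : Subfield ↥𝓕) (hle : (algebraMap F ↥𝓕).fieldRange ⊔ 𝓚 ≤ L),
        (letI : Algebra ↥((algebraMap F ↥𝓕).fieldRange ⊔ 𝓚) ↥L :=
          (Subfield.inclusion hle).toAlgebra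
         IsGalois ↥((algebraMap F ↥𝓕).fieldRange ⊔ 𝓚) ↥L) ∧
        IsGalois ↥L ↥𝓕) ∧
      UnifWrt (F := ↥𝓕) ⊤ 𝓚 Q (fun k => algebraMap F ↥𝓕 (ζ k)) := by
  obtain ⟨⟨S, hS⟩, -⟩ := hff
  obtain ⟨v, hv, hO, hc⟩ := LU.ex_norm O hrk1
  letI : NormedField (AlgebraicClosure F) := v.toNormedField
  haveI : IsUltrametricDist (AlgebraicClosure F) := IsUltrametricDist.isUltrametricDist_of_isNonarchimedean_norm hv
  exact LU.asm (U := AlgebraicClosure F) K O S hS htriv hO hc m ζ hζ
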